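/- Let ζ > 2/5 and let r > 2/3 satisfy M̂(r) ≠ 0 and M̃_f(r) > 0. Then there exists ε₀ > 0 with the following property for every ε ∈ (0, ε₀) and every integer k ≥ 1. Write X₁ = (0,0,2), X₂ = (q_{b,+}(r,u_b(r)), 0, u_b(r)) and δ = ‖X₁ − X₂‖/3 (Euclidean norm on ℝ³). (i) There exist D > 0 and μ ∈ ℝ such that, with s = −ζ − μ, the traveling-wave system admits a solution converging to X₁ as ξ → −∞ and to X₂ as ξ → +∞, together with points ζ₁ < ξ₁ < ζ₂ < ξ₂ < ⋯ < ζ_k < ξ_k such that the solution lies within distance δ of X₂ at each ζ_i and within distance δ of X₁ at each ξ_i (a k-front, exhibiting k well-separated patches of turbulence). (ii) There exist D > 0 and μ such that the system admits a solution converging to X₂ as ξ → −∞ and to X₁ as ξ → +∞, together with points ξ₀ < ζ₁ < ξ₁ < ⋯ < ζ_k < ξ_k such that the solution lies within δ of X₁ at each ξ_i (i = 0,…,k) and within δ of X₂ at each ζ_i (i = 1,…,k) (a k-back). In particular, for all k ≥ 1 simultaneously, the system exhibits infinitely many distinct laminar-to-turbulent k-front and k-back traveling waves. -/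

import Mathlib

open Filter Topology MeasureTheory

noncomputable section

/-- The Nagumo front profile `φ(χ) = 1/(1 + exp(−χ/√2))`. -/
def phi (χ : ℝ) : ℝ := 1 / (1 + Real.exp (-χ / Real.sqrt 2))

/-- The cubic `K(u;r)`. -/
def Kc (u r : ℝ) : ℝ := 40*u^3 - (50*r + 169)*u^2 + (160*r + 224)*u - 120*r - 96

/-- `q_{f,+}(r) = 1 + √(r/(r + 1/10))`. -/
def qfp (r : ℝ) : ℝ := 1 + Real.sqrt (r / (r + 1/10))

/-- `q_{f,−}(r) = 1 − √(r/(r + 1/10))`. -/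
def qfm (r : ℝ) : ℝ := 1 - Real.sqrt (r / (r + 1/10))

/-- `q_{b,+}(r,u) = 1 + √((r + u − 2)/(r + 1/10))`. -/
def qbp (r u : ℝ) : ℝ := 1 + Real.sqrt ((r + u - 2) / (r + 1/10))

/-- `q_{b,−}(r,u) = 1 − √((r + u − 2)/(r + 1/10))`. -/
def qbm (r u : ℝ) : ℝ := 1 - Real.sqrt ((r + u - 2) / (r + 1/10))

/-- The singular wave-speed parameter `μ_0(r,u)`. -/
def mu0 (r u : ℝ) : ℝ :=
  (2*(2*qbm r u - qbp r u) + u*(2*qfm r - qfp r)) /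
    (qbp r u - 2*qbm r u + qfp r - 2*qfm r)

/-- The singular diffusion coefficient `D_0(r,u)`. -/
def D0 (r u : ℝ) : ℝ :=
  2*(2 - u)^2 / ((r + 1/10) * (2*qbm r u - qbp r u + 2*qfm r - qfp r)^2)

/-- Exponential rate along the front: `a_f = √2(1/2 − q_{f−}/q_{f+})`. -/
def af (r : ℝ) : ℝ := Real.sqrt 2 * (1/2 - qfm r / qfp r)

/-- Exponential rate along the back: `a_b = √2(1/2 − q_{b−}/q_{b+})`. -/
def ab (r u : ℝ) : ℝ := Real.sqrt 2 * (1/2 - qbm r u / qbp r u)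

/-- The basic Melnikov integral `∫ e^{−aχ} φ′(χ)² dχ`. -/
def Jsq (a : ℝ) : ℝ := ∫ χ : ℝ, Real.exp (-a * χ) * (deriv phi χ)^2

/-- The basic Melnikov integral `∫ e^{−aχ} φ′(χ) φ(χ)ⁿ dχ`. -/
def Jn (a : ℝ) (n : ℕ) : ℝ := ∫ χ : ℝ, Real.exp (-a * χ) * (deriv phi χ * (phi χ)^n)

/-- The Melnikov quantity `M_f(r)` (for `∂_D Q_f`). -/
def Mf (r : ℝ) : ℝ :=
  (qfp r / 2) * Real.sqrt 2 * (qfp r - 2 * qfm r) * Jsq (af r)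
    + (1 / (10 * (r + 1/10))) * Jn (af r) 1
    - 2 * qfp r * Jn (af r) 2
    + (qfp r)^2 * Jn (af r) 3

/-- The Melnikov quantity `M_b(r)` (for `∂_D Q_b`), with `u = u_b(r)`. -/
def Mb (r u : ℝ) : ℝ :=
  -(qbp r u / 2) * Real.sqrt 2 * (qbp r u - 2 * qbm r u) * Jsq (ab r u)
    + ((u - 21/10) / (r + 1/10)) * Jn (ab r u) 1
    + 2 * qbp r u * Jn (ab r u) 2
    - (qbp r u)^2 * Jn (ab r u) 3

/-- The Melnikov quantity `M̂_f(r)` (for `∂_μ Q_f`), with `u = u_b(r)`. -/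
def Mhf (r u : ℝ) : ℝ :=
  -(qfp r * D0 r u * Real.sqrt 2 * (qfp r - 2 * qfm r) / (2 * (mu0 r u + 2))) * Jsq (af r)

/-- The Melnikov quantity `M̂_b(r)` (for `∂_μ Q_b`), with `u = u_b(r)`. -/
def Mhb (r u : ℝ) : ℝ :=
  -(qbp r u * Real.sqrt 2 * (qbp r u - 2 * qbm r u) / (2 * (mu0 r u + u))) * Jsq (ab r u)

/-- The Melnikov quantity `M̃_f(r)` (for `∂_u 𝒬_f`), with `u = u_b(r)`. -/
def Mtf (r u : ℝ) : ℝ :=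
  -(qfp r) * Real.sqrt ((r + 1/10) / D0 r u) * Jsq (af r) + Jn (af r) 1

/-- The nondegeneracy quantity `M̂(r) = M_b/M̂_b − M_f/M̂_f`, with `u = u_b(r)`. -/
def Mhat (r u : ℝ) : ℝ := Mb r u / Mhb r u - Mf r / Mhf r u

/-- Reaction term `f(q,u;r)` of the pipe-flow model. -/
def fq (q u r : ℝ) : ℝ := q * (r + u - 2 - (r + 1/10) * (q - 1)^2)

/-- Reaction term `g(q,u)` of the pipe-flow model. -/
def gq (q u : ℝ) : ℝ := 2 - u + 2*q*(1 - u)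

/-- `(Q,P,U)` is a solution of the traveling-wave system
`q_ξ = p`, `p_ξ = D⁻¹((u + μ)p − f(q,u;r))`, `u_ξ = ε g(q,u)/(u − s)`. -/
def IsTWSol (D μ s ε r : ℝ) (Q P U : ℝ → ℝ) : Prop :=
  (∀ ξ : ℝ, U ξ ≠ s) ∧
  (∀ ξ : ℝ, HasDerivAt Q (P ξ) ξ) ∧
  (∀ ξ : ℝ, HasDerivAt P ((1/D) * ((U ξ + μ) * P ξ - fq (Q ξ) (U ξ) r)) ξ) ∧
  (∀ ξ : ℝ, HasDerivAt U (ε * gq (Q ξ) (U ξ) / (U ξ - s)) ξ)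

/-- Euclidean distance on ℝ³ (realized as ℝ × ℝ × ℝ). -/
def dist3 (a b : ℝ × ℝ × ℝ) : ℝ :=
  Real.sqrt ((a.1 - b.1)^2 + (a.2.1 - b.2.1)^2 + (a.2.2 - b.2.2)^2)

/-- Symbols of a point of the section under the return map: it escapes (`esc`), it comes back to the
section (`ret`), it fails to come back because it leaves on the other side (`out`), it hits
the tangency locus (`edge`), it is on the stable set of the saddle reached after half a turn (`sad`),
or on the stable set of the target (`tgt`). -/
inductive Symb
  | esc | out | ret | edge | sad | tgt

/-- The parameter `t` admits `k` successive returns. -/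
def Itin {X : Type*} (cl : X → Symb) (R : X → X) (σ : ℝ → X) (k : ℕ) (t : ℝ) : Prop :=
  ∀ j < k, cl (R^[j] (σ t)) = Symb.ret

theorem Itin.succ_iff {X : Type*} {cl : X → Symb} {R : X → X} {σ : ℝ → X} {k : ℕ} {t : ℝ} :
    Itin cl R σ (k+1) t ↔ Itin cl R σ k t ∧ cl (R^[k] (σ t)) = Symb.ret := by
  constructor
  · intro h
    exact ⟨fun j hj => h j (by omega), h k (by omega)⟩
  · rintro ⟨h1, h2⟩ j hj
    rcases Nat.lt_succ_iff_lt_or_eq.mp hj with h | h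
    · exact h1 j h
    · rw [h]; exact h2

section Shooting

variable {X : Type*} [TopologicalSpace X]

/-- The hypotheses of the topological shooting lemma. -/
structure ShootingData (S : Set X) (cl : X → Symb) (R : X → X) (th : X → ℝ) (σ : ℝ → X) : Prop where
  σ_mem : ∀ t ∈ Set.Icc (0:ℝ) 1, σ t ∈ S
  σ_cont : ContinuousOn σ (Set.Icc 0 1)
  th_σ : ∀ t ∈ Set.Icc (0:ℝ) 1, th (σ t) = t
  R_mem : ∀ x ∈ S, cl x = Symb.ret → R x ∈ S
  th_R : ∀ x ∈ S, cl x = Symb.ret → th (R x) = th x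
  esc_open : ∀ x ∈ S, cl x = Symb.esc → ∀ᶠ y in 𝓝[S] x, cl y = Symb.esc
  out_open : ∀ x ∈ S, cl x = Symb.out → ∀ᶠ y in 𝓝[S] x, cl y = Symb.out
  ret_open : ∀ x ∈ S, cl x = Symb.ret → ∀ᶠ y in 𝓝[S] x, cl y = Symb.ret
  R_cont : ∀ x ∈ S, cl x = Symb.ret → ContinuousWithinAt R S x
  near_edge : ∀ x ∈ S, cl x = Symb.edge → ∀ᶠ y in 𝓝[S] x,
    cl y = Symb.edge ∨ (cl y = Symb.ret ∧ cl (R y) = Symb.esc)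
  near_tgt : ∀ x ∈ S, cl x = Symb.tgt → ∀ᶠ y in 𝓝[S] x,
    cl y = Symb.esc ∨ cl y = Symb.tgt ∨ cl y = Symb.edge ∨ (cl y = Symb.ret ∧ cl (R y) = Symb.esc)
  near_sad : ∀ x ∈ S, cl x = Symb.sad → ∀ᶠ y in 𝓝[S] x,
    cl y = Symb.ret ∨ cl y = Symb.out ∨ cl y = Symb.sad
  R_sad : ∀ x ∈ S, cl x = Symb.sad →
    Tendsto R (𝓝[S ∩ {y | cl y = Symb.ret}] x) (𝓝 (σ (th x)))
  σ_zero : cl (σ 0) = Symb.out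
  σ_one : cl (σ 1) = Symb.esc

variable {S : Set X} {cl : X → Symb} {R : X → X} {th : X → ℝ} {σ : ℝ → X}

namespace ShootingData

theorem iter (H : ShootingData S cl R th σ) (k : ℕ) {t : ℝ} (ht : t ∈ Set.Icc (0:ℝ) 1)
    (hk : Itin cl R σ k t) :
    R^[k] (σ t) ∈ S ∧ th (R^[k] (σ t)) = t ∧
      Tendsto (fun s => R^[k] (σ s)) (𝓝[Set.Icc 0 1] t) (𝓝[S] (R^[k] (σ t))) ∧
      ∀ᶠ s in 𝓝[Set.Icc 0 1] t, Itin cl R σ k s := by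
  induction k with
  | zero =>
    refine ⟨H.σ_mem t ht, H.th_σ t ht, ?_, ?_⟩
    · refine tendsto_nhdsWithin_iff.mpr ⟨H.σ_cont t ht, ?_⟩
      filter_upwards [self_mem_nhdsWithin] with s hs using H.σ_mem s hs
    · exact Eventually.of_forall fun s j hj => by omega
  | succ k ih =>
    obtain ⟨hk1, hk2⟩ := Itin.succ_iff.mp hk
    obtain ⟨a, b, c, d⟩ := ih hk1
    simp only [Function.iterate_succ', Function.comp_apply]
    have e : ∀ᶠ s in 𝓝[Set.Icc 0 1] t, cl (R^[k] (σ s)) = Symb.ret :=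
      c.eventually (H.ret_open _ a hk2)
    have f : ∀ᶠ s in 𝓝[Set.Icc 0 1] t, R^[k] (σ s) ∈ S :=
      c.eventually self_mem_nhdsWithin
    refine ⟨H.R_mem _ a hk2, by rw [H.th_R _ a hk2, b], ?_, ?_⟩
    · refine tendsto_nhdsWithin_iff.mpr ⟨(H.R_cont _ a hk2).tendsto.comp c, ?_⟩
      filter_upwards [e, f] with s h1 h2 using H.R_mem _ h2 h1
    · filter_upwards [d, e] with s h1 h2 using Itin.succ_iff.mpr ⟨h1, h2⟩

/-- Behaviour at the left end point of the parameter interval: either the orbit is in the open set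
`out`, or the orbit shadows a homoclinic cycle `G`. -/
def LeftEnd (S : Set X) (cl : X → Symb) (R : X → X) (th : X → ℝ) (σ : ℝ → X) (k : ℕ) (α : ℝ) :
    Prop :=
  (∀ᶠ t in 𝓝[>] α, cl (R^[k] (σ t)) = Symb.out) ∨
  ∃ G : Set X, G ⊆ S ∧ σ α ∈ G ∧
    (∀ x ∈ G, th x = α ∧ ((cl x = Symb.ret ∧ R x ∈ G) ∨ cl x = Symb.sad)) ∧
    ∃ x ∈ G, Tendsto (fun t => R^[k] (σ t)) (𝓝[>] α) (𝓝[S] x)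

def Window (S : Set X) (cl : X → Symb) (R : X → X) (th : X → ℝ) (σ : ℝ → X) (k : ℕ) : Prop :=
  ∃ α β : ℝ, 0 ≤ α ∧ α < β ∧ β ≤ 1 ∧
    (∀ t ∈ Set.Ioo α β, Itin cl R σ k t ∧ cl (R^[k] (σ t)) ≠ Symb.esc ∧
      cl (R^[k] (σ t)) ≠ Symb.tgt) ∧
    Itin cl R σ k β ∧ cl (R^[k] (σ β)) = Symb.tgt ∧ LeftEnd S cl R th σ k α

/-- The set of points with a symbol `≠ esc, tgt` is relatively open. -/
theorem inner_open (H : ShootingData S cl R th σ) {x : X} (hx : x ∈ S) (h1 : cl x ≠ Symb.esc)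
    (h2 : cl x ≠ Symb.tgt) : ∀ᶠ y in 𝓝[S] x, cl y ≠ Symb.esc ∧ cl y ≠ Symb.tgt := by
  cases h : cl x with
  | esc => exact absurd h h1
  | tgt => exact absurd h h2
  | out => filter_upwards [H.out_open x hx h] with y hy; simp [hy]
  | ret => filter_upwards [H.ret_open x hx h] with y hy; simp [hy]
  | edge =>
    filter_upwards [H.near_edge x hx h] with y hy
    rcases hy with hy | ⟨hy, -⟩ <;> simp [hy]
  | sad =>
    filter_upwards [H.near_sad x hx h] with y hy
    rcases hy with hy | hy | hy <;> simp [hy]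

theorem right_le {α β : ℝ} (h0 : 0 ≤ α) (h : α < β) (h1 : β ≤ 1) :
    𝓝[>] α ≤ 𝓝[Set.Icc 0 1] α := by
  rw [← nhdsWithin_Ioo_eq_nhdsGT h]
  exact nhdsWithin_mono _ fun x hx => ⟨h0.trans hx.1.le, hx.2.le.trans h1⟩

theorem left_le {α β : ℝ} (h0 : 0 ≤ α) (h : α < β) (h1 : β ≤ 1) :
    𝓝[<] β ≤ 𝓝[Set.Icc 0 1] β := by
  rw [← nhdsWithin_Ioo_eq_nhdsLT h]
  exact nhdsWithin_mono _ fun x hx => ⟨h0.trans hx.1.le, hx.2.le.trans h1⟩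

/-- First exit from a property along an interval. -/
theorem first_exit {α γ : ℝ} {p : ℝ → Prop} (hαγ : α < γ) (hs : ∀ᶠ t in 𝓝[>] α, p t)
    (hγ : ¬ p γ) : ∃ b, α < b ∧ b ≤ γ ∧ (∀ t ∈ Set.Ioo α b, p t) ∧
      (p b → ∃ᶠ t in 𝓝[>] b, ¬ p t) ∧ (p b → b < γ) := by
  set B := {t | α < t ∧ t ≤ γ ∧ ¬ p t}
  have hne : B.Nonempty := ⟨γ, hαγ, le_rfl, hγ⟩
  have hbd : BddBelow B := ⟨α, fun t ht => ht.1.le⟩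
  have hbγ : sInf B ≤ γ := csInf_le hbd ⟨hαγ, le_rfl, hγ⟩
  obtain ⟨c, hc, hc'⟩ := (mem_nhdsGT_iff_exists_Ioo_subset' hαγ).mp hs
  have hαb : α < sInf B := by
    refine lt_of_lt_of_le (Set.mem_Ioi.mp hc) (le_csInf hne fun t ht => ?_)
    by_contra hlt
    push Not at hlt
    exact ht.2.2 (hc' ⟨ht.1, hlt⟩)
  refine ⟨sInf B, hαb, hbγ, ?_, ?_, ?_⟩
  · intro t ht
    by_contra hp
    have : sInf B ≤ t := csInf_le hbd ⟨ht.1, ht.2.le.trans hbγ, hp⟩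
    exact absurd ht.2 (not_lt.mpr this)
  · intro hpb hn
    have hn' : ∀ᶠ t in 𝓝[>] (sInf B), p t := by
      simpa [Filter.Frequently] using hn
    have hlt : sInf B < γ := lt_of_le_of_ne hbγ (fun h => hγ (h ▸ hpb))
    obtain ⟨c, hc, hc'⟩ := (mem_nhdsGT_iff_exists_Ioo_subset' hlt).mp hn'
    have : min c γ ≤ sInf B := by
      refine le_csInf hne fun t ht => ?_
      by_contra hlt2
      push Not at hlt2
      rcases (csInf_le hbd ht).lt_or_eq with h | h
      · exact ht.2.2 (hc' ⟨h, hlt2.trans_le (min_le_left _ _)⟩)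
      · exact ht.2.2 (h ▸ hpb)
    exact absurd (lt_min (Set.mem_Ioi.mp hc) hlt) (not_lt.mpr this)
  · intro hpb
    exact lt_of_le_of_ne hbγ (fun h => hγ (h ▸ hpb))

theorem window_zero (H : ShootingData S cl R th σ) : Window S cl R th σ 0 := by
  have i0 : (0:ℝ) ∈ Set.Icc (0:ℝ) 1 := by simp
  have hit : ∀ t, Itin cl R σ 0 t := fun t j hj => by omega
  have hs : ∀ᶠ t in 𝓝[>] (0:ℝ), cl (σ t) = Symb.out := by
    have := (H.iter 0 i0 (hit 0)).2.2.1.eventually (H.out_open _ (H.σ_mem 0 i0) H.σ_zero)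
    exact this.filter_mono (right_le le_rfl zero_lt_one le_rfl)
  obtain ⟨b, h1, h2, h3, h4, -⟩ := first_exit (p := fun t => cl (σ t) ≠ Symb.esc ∧ cl (σ t) ≠ Symb.tgt)
    zero_lt_one (hs.mono fun t ht => by simp [ht]) (by simp [H.σ_one])
  have ib : b ∈ Set.Icc (0:ℝ) 1 := ⟨h1.le, h2⟩
  have hc := (H.iter 0 ib (hit b)).2.2.1
  refine ⟨0, b, le_rfl, h1, h2, fun t ht => ⟨hit t, h3 t ht⟩, hit b, ?_, Or.inl hs⟩
  by_contra hb
  by_cases hb' : cl (σ b) = Symb.esc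
  · have e1 := (hc.eventually (H.esc_open _ (H.σ_mem b ib) hb')).filter_mono (left_le le_rfl h1 h2)
    have e2 : ∀ᶠ t in 𝓝[<] b, t ∈ Set.Ioo 0 b := Ioo_mem_nhdsLT h1
    obtain ⟨t, ht1, ht2⟩ := (e1.and e2).exists
    exact (h3 t ht2).1 ht1
  · have hlt : b < 1 := lt_of_le_of_ne h2 (fun h => hb' (h ▸ H.σ_one))
    have e1 := (hc.eventually (H.inner_open (H.σ_mem b ib) hb' hb)).filter_mono
      (right_le h1.le hlt le_rfl)
    exact h4 ⟨hb', hb⟩ (e1.mono fun t ht => not_not.mpr ht)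

theorem window_succ (H : ShootingData S cl R th σ) {k : ℕ} (hw : Window S cl R th σ k) :
    Window S cl R th σ (k+1) := by
  obtain ⟨α, β, hα, hαβ, hβ, hin, hitβ, htgt, hleft⟩ := hw
  have iβ : β ∈ Set.Icc (0:ℝ) 1 := ⟨hα.trans hαβ.le, hβ⟩
  have isub : ∀ t ∈ Set.Ioo α β, t ∈ Set.Icc (0:ℝ) 1 :=
    fun t ht => ⟨hα.trans ht.1.le, ht.2.le.trans hβ⟩
  obtain ⟨mβ, -, cβ, -⟩ := H.iter k iβ hitβ
  -- near `β`
  have nβ : ∀ᶠ t in 𝓝[<] β, cl (R^[k] (σ t)) = Symb.edge ∨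
      (cl (R^[k] (σ t)) = Symb.ret ∧ cl (R^[k+1] (σ t)) = Symb.esc) := by
    have e1 := (cβ.eventually (H.near_tgt _ mβ htgt)).filter_mono (left_le hα hαβ hβ)
    have e2 : ∀ᶠ t in 𝓝[<] β, t ∈ Set.Ioo α β := Ioo_mem_nhdsLT hαβ
    filter_upwards [e1, e2] with t h1 h2
    obtain ⟨-, h3, h4⟩ := hin t h2
    rw [Function.iterate_succ', Function.comp_apply]
    tauto
  set M := {m | m ∈ Set.Ioo α β ∧
    (cl (R^[k] (σ m)) = Symb.out ∨ cl (R^[k] (σ m)) = Symb.sad)} with hM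
  obtain ⟨c, hc, hc'⟩ := (mem_nhdsLT_iff_exists_Ioo_subset' hαβ).mp nβ
  have hMc : ∀ m ∈ M, m ≤ c := by
    intro m hm
    by_contra hlt
    push Not at hlt
    have := hc' ⟨hlt, hm.1.2⟩
    have h2 := hm.2
    simp only [Set.mem_ofPred_eq] at this
    rcases this with h | ⟨h, -⟩ <;> rw [h] at h2 <;> simp at h2
  -- the new left end point
  obtain ⟨α', h1, h2, h3, h4⟩ : ∃ α', α ≤ α' ∧ α' < β ∧
      (∀ t ∈ Set.Ioo α' β, cl (R^[k] (σ t)) = Symb.ret ∨ cl (R^[k] (σ t)) = Symb.edge) ∧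
      ((∀ᶠ t in 𝓝[>] α', cl (R^[k] (σ t)) = Symb.ret) ∧
        ∃ G : Set X, G ⊆ S ∧ σ α' ∈ G ∧
        (∀ x ∈ G, th x = α' ∧ ((cl x = Symb.ret ∧ R x ∈ G) ∨ cl x = Symb.sad)) ∧
        ∃ x ∈ G, Tendsto (fun t => R^[k] (σ t)) (𝓝[>] α') (𝓝[S] x)) := by
    have hre : ∀ γ, α ≤ γ → (∀ m ∈ M, m ≤ γ) → ∀ t ∈ Set.Ioo γ β,
        cl (R^[k] (σ t)) = Symb.ret ∨ cl (R^[k] (σ t)) = Symb.edge := by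
      intro γ hγ hMγ t ht
      have ht' : t ∈ Set.Ioo α β := ⟨hγ.trans_lt ht.1, ht.2⟩
      have hn : t ∉ M := fun hm => absurd ht.1 (not_lt.mpr (hMγ t hm))
      obtain ⟨-, h5, h6⟩ := hin t ht'
      simp only [hM, Set.mem_ofPred_eq, not_and, not_or] at hn
      obtain ⟨h7, h8⟩ := hn ht'
      cases h : cl (R^[k] (σ t)) <;> simp_all
    rcases M.eq_empty_or_nonempty with hemp | hne
    · have hre0 := hre α le_rfl (by simp [hemp])
      have hnear : ∀ᶠ t in 𝓝[>] α, t ∈ Set.Ioo α β := Ioo_mem_nhdsGT hαβ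
      rcases hleft with hl | ⟨G, g1, g2, g3, x, g4, g5⟩
      · obtain ⟨t, ht1, ht2⟩ := (hl.and hnear).exists
        have := hre0 t ht2
        simp [ht1] at this
      · refine ⟨α, le_rfl, hαβ, hre0, ?_, G, g1, g2, g3, x, g4, g5⟩
        have e : ∀ᶠ y in 𝓝[S] x, cl y = Symb.ret ∨ cl y = Symb.out ∨ cl y = Symb.sad := by
          rcases (g3 x g4).2 with ⟨h, -⟩ | h
          · exact (H.ret_open x (g1 g4) h).mono fun y hy => Or.inl hy
          · exact H.near_sad x (g1 g4) h
        filter_upwards [g5.eventually e, hnear] with t ht1 ht2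
        have := hre0 t ht2
        rcases this with h | h <;> simp_all
    · have hbd : BddAbove M := ⟨c, hMc⟩
      have hsc : sSup M ≤ c := csSup_le hne hMc
      have hsβ : sSup M < β := hsc.trans_lt hc
      obtain ⟨m0, hm0⟩ := hne
      have hαs : α < sSup M := hm0.1.1.trans_le (le_csSup hbd hm0)
      have hre0 := hre (sSup M) hαs.le (fun m hm => le_csSup hbd hm)
      have hs : sSup M ∈ Set.Ioo α β := ⟨hαs, hsβ⟩
      obtain ⟨t1, t2, t3⟩ := hin _ hs
      obtain ⟨u1, u2, u3, u4⟩ := H.iter k (isub _ hs) t1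
      have hnear : ∀ᶠ t in 𝓝[>] (sSup M), t ∈ Set.Ioo (sSup M) β := Ioo_mem_nhdsGT hsβ
      have hfr : ∃ᶠ t in 𝓝[Set.Icc 0 1] (sSup M), t ∈ M := by
        have : ∃ᶠ t in 𝓝[M] (sSup M), t ∈ M := by
          have hcl : sSup M ∈ closure M := csSup_mem_closure ⟨m0, hm0⟩ hbd
          have := mem_closure_iff_nhdsWithin_neBot.mp hcl
          exact (eventually_mem_nhdsWithin).frequently
        exact this.filter_mono (nhdsWithin_mono _ fun m hm => isub m hm.1)
      have hsad : cl (R^[k] (σ (sSup M))) = Symb.sad := by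
        cases h : cl (R^[k] (σ (sSup M))) with
        | esc => exact absurd h t2
        | tgt => exact absurd h t3
        | sad => rfl
        | out =>
          have e := (u3.eventually (H.out_open _ u1 h)).filter_mono
            (right_le (isub _ hs).1 hsβ hβ)
          obtain ⟨t, e1, e2⟩ := (e.and hnear).exists
          have := hre0 t e2
          simp [e1] at this
        | ret =>
          have e := u3.eventually (H.ret_open _ u1 h)
          obtain ⟨t, e1, e2⟩ := (hfr.and_eventually e).exists
          have := e1.2
          simp [e2] at this
        | edge =>
          have e := u3.eventually (H.near_edge _ u1 h)
          obtain ⟨t, e1, e2⟩ := (hfr.and_eventually e).exists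
          have := e1.2
          rcases e2 with h | ⟨h, -⟩ <;> simp [h] at this
      refine ⟨sSup M, hαs.le, hsβ, hre0, ?_, {x | ∃ j ≤ k, R^[j] (σ (sSup M)) = x}, ?_, ?_, ?_,
        R^[k] (σ (sSup M)), ⟨k, le_rfl, rfl⟩, ?_⟩
      · have e := (u3.eventually (H.near_sad _ u1 hsad)).filter_mono
          (right_le (isub _ hs).1 hsβ hβ)
        filter_upwards [e, hnear] with t e1 e2
        have := hre0 t e2
        rcases this with h | h <;> simp_all
      · rintro x ⟨j, hj, rfl⟩
        exact (H.iter j (isub _ hs) (fun i hi => t1 i (by omega))).1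
      · exact ⟨0, by omega, rfl⟩
      · rintro x ⟨j, hj, rfl⟩
        refine ⟨(H.iter j (isub _ hs) (fun i hi => t1 i (by omega))).2.1, ?_⟩
        rcases hj.lt_or_eq with hj | rfl
        · refine Or.inl ⟨t1 j hj, j+1, hj, ?_⟩
          rw [Function.iterate_succ', Function.comp_apply]
        · exact Or.inr hsad
      · exact u3.mono_left (right_le (isub _ hs).1 hsβ hβ)
  obtain ⟨hret, G, g1, g2, g3, x, g4, g5⟩ := h4
  have hα' : 0 ≤ α' := hα.trans h1
  -- the limit of the next iterate at the left end point
  obtain ⟨x', g6, g7⟩ : ∃ x' ∈ G, Tendsto (fun t => R^[k+1] (σ t)) (𝓝[>] α') (𝓝[S] x') := by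
    have hS : ∀ᶠ t in 𝓝[>] α', R^[k] (σ t) ∈ S := g5.eventually self_mem_nhdsWithin
    have hS' : ∀ᶠ t in 𝓝[>] α', R^[k+1] (σ t) ∈ S := by
      filter_upwards [hS, hret] with t e1 e2
      rw [Function.iterate_succ', Function.comp_apply]
      exact H.R_mem _ e1 e2
    simp only [Function.iterate_succ', Function.comp_apply] at hS' ⊢
    rcases (g3 x g4).2 with ⟨h, h'⟩ | h
    · exact ⟨R x, h', tendsto_nhdsWithin_iff.mpr
        ⟨(H.R_cont x (g1 g4) h).tendsto.comp g5, hS'⟩⟩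
    · refine ⟨σ α', g2, tendsto_nhdsWithin_iff.mpr ⟨?_, hS'⟩⟩
      have := H.R_sad x (g1 g4) h
      rw [(g3 x g4).1] at this
      refine this.comp (tendsto_nhdsWithin_iff.mpr ⟨(tendsto_nhdsWithin_iff.mp g5).1, ?_⟩)
      filter_upwards [hS, hret] with t e1 e2 using ⟨e1, e2⟩
  have hin' : ∀ t ∈ Set.Ioo α' β, t ∈ Set.Ioo α β := fun t ht => ⟨h1.trans_lt ht.1, ht.2⟩
  have hnear : ∀ᶠ t in 𝓝[>] α', t ∈ Set.Ioo α' β := Ioo_mem_nhdsGT h2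
  have hstart : ∀ᶠ t in 𝓝[>] α', Itin cl R σ (k+1) t ∧ cl (R^[k+1] (σ t)) ≠ Symb.esc ∧
      cl (R^[k+1] (σ t)) ≠ Symb.tgt := by
    have hx : cl x' ≠ Symb.esc ∧ cl x' ≠ Symb.tgt := by
      rcases (g3 x' g6).2 with ⟨h, -⟩ | h <;> simp [h]
    filter_upwards [g7.eventually (H.inner_open (g1 g6) hx.1 hx.2), hret, hnear] with t e1 e2 e3
    exact ⟨Itin.succ_iff.mpr ⟨(hin t (hin' t e3)).1, e2⟩, e1⟩
  obtain ⟨γ, hγ, hγ'⟩ : ∃ γ ∈ Set.Ioo α' β, ¬ (Itin cl R σ (k+1) γ ∧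
      cl (R^[k+1] (σ γ)) ≠ Symb.esc ∧ cl (R^[k+1] (σ γ)) ≠ Symb.tgt) := by
    have e2 : ∀ᶠ t in 𝓝[<] β, t ∈ Set.Ioo α' β := Ioo_mem_nhdsLT h2
    obtain ⟨t, ht1, ht2⟩ := (nβ.and e2).exists
    refine ⟨t, ht2, ?_⟩
    rintro ⟨h5, h6, -⟩
    rcases ht1 with h | ⟨-, h⟩
    · have := (Itin.succ_iff.mp h5).2
      simp [h] at this
    · exact h6 h
  obtain ⟨b, b1, b2, b3, b4, -⟩ := first_exit hγ.1 hstart hγ'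
  have hbβ : b < β := b2.trans_lt hγ.2
  have hb : b ∈ Set.Ioo α' β := ⟨b1, hbβ⟩
  have ib := isub b (hin' b hb)
  have hlb : 𝓝[<] b ≤ 𝓝[Set.Icc 0 1] b := left_le hα' b1 ib.2
  have hrb : 𝓝[>] b ≤ 𝓝[Set.Icc 0 1] b := right_le ib.1 hbβ hβ
  have enear : ∀ᶠ t in 𝓝[<] b, t ∈ Set.Ioo α' b := Ioo_mem_nhdsLT b1
  obtain ⟨u1, u2, u3, u4⟩ := H.iter k ib (hin b (hin' b hb)).1
  have hQ : cl (R^[k] (σ b)) = Symb.ret := by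
    rcases h3 b hb with h | h
    · exact h
    · exfalso
      have e := (u3.eventually (H.near_edge _ u1 h)).filter_mono hlb
      obtain ⟨t, e1, e2⟩ := (e.and enear).exists
      obtain ⟨v1, v2, -⟩ := b3 t e2
      rw [Function.iterate_succ', Function.comp_apply] at v2
      have := (Itin.succ_iff.mp v1).2
      rcases e1 with e1 | ⟨-, e1⟩
      · simp [e1] at this
      · exact v2 e1
  have hit : Itin cl R σ (k+1) b := Itin.succ_iff.mpr ⟨(hin b (hin' b hb)).1, hQ⟩
  obtain ⟨w1, w2, w3, w4⟩ := H.iter (k+1) ib hit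
  refine ⟨α', b, hα', b1, ib.2, b3, hit, ?_, Or.inr ⟨G, g1, g2, g3, x', g6, g7⟩⟩
  by_contra hb1
  by_cases hb2 : cl (R^[k+1] (σ b)) = Symb.esc
  · have e := (w3.eventually (H.esc_open _ w1 hb2)).filter_mono hlb
    obtain ⟨t, e1, e2⟩ := (e.and enear).exists
    exact (b3 t e2).2.1 e1
  · refine b4 ⟨hit, hb2, hb1⟩ ?_
    have e := ((w3.eventually (H.inner_open w1 hb2 hb1)).and w4).filter_mono hrb
    exact e.mono fun t ht => not_not.mpr ⟨ht.2, ht.1⟩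

/-- The topological shooting lemma. -/
theorem exists_itin (H : ShootingData S cl R th σ) (k : ℕ) : ∃ t ∈ Set.Icc (0:ℝ) 1,
    (∀ j < k, cl (R^[j] (σ t)) = Symb.ret) ∧ cl (R^[k] (σ t)) = Symb.tgt := by
  have h : Window S cl R th σ k := by
    induction k with
    | zero => exact H.window_zero
    | succ k ih => exact H.window_succ ih
  obtain ⟨α, β, h1, h2, h3, -, h4, h5, -⟩ := h
  exact ⟨β, ⟨h1.trans h2.le, h3⟩, h4, h5⟩

end ShootingData
end Shooting

section Flow
open Set

variable {E : Type*} [NormedAddCommGroup E] [NormedSpace ℝ E]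

/-- `φ` is the global flow of the autonomous vector field `V`. -/
structure IsFlow (V : E → E) (φ : E → ℝ → E) : Prop where
  zero : ∀ x, φ x 0 = x
  deriv : ∀ x t, HasDerivAt (φ x) (V (φ x t)) t
  cont : Continuous fun z : E × ℝ => φ z.1 z.2
  add : ∀ x s t, φ (φ x s) t = φ x (s + t)
  uniq : ∀ (γ : ℝ → E), (∀ t, HasDerivAt γ (V (γ t)) t) → ∀ t, γ t = φ (γ 0) t

theorem exists_global_solution [CompleteSpace E] {V : E → E} {K M : NNReal}
    (hV : LipschitzWith K V) (hM : ∀ x, ‖V x‖ ≤ M) (x : E) :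
    ∃ γ : ℝ → E, γ 0 = x ∧ ∀ t, HasDerivAt γ (V (γ t)) t := by
  have h1 : ∀ n : ℕ, ∃ α : ℝ → E, α 0 = x ∧
      ∀ t ∈ Ioo (-(n:ℝ)) n, HasDerivAt α (V (α t)) t := by
    intro n
    have h0 : (0:ℝ) ∈ Icc (-(n:ℝ)) n := by simp
    have hp : IsPicardLindelof (fun _ => V) (⟨0, h0⟩ : Icc (-(n:ℝ)) n) x (M * n) 0 M K := by
      refine IsPicardLindelof.of_time_independent (fun y _ => hM y) hV.lipschitzOnWith ?_
      simp
    obtain ⟨α, h2, h3⟩ := hp.exists_eq_forall_mem_Icc_hasDerivWithinAt₀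
    refine ⟨α, h2, fun t ht => (h3 t (Ioo_subset_Icc_self ht)).hasDerivAt (Icc_mem_nhds ht.1 ht.2)⟩
  choose α hα hα' using h1
  have h2 : ∀ n m : ℕ, n ≤ m → EqOn (α n) (α m) (Ioo (-(n:ℝ)) n) := by
    intro n m hnm
    rcases Nat.eq_zero_or_pos n with rfl | hn
    · intro t ht; simp at ht
    have hnm' : (n:ℝ) ≤ m := by exact_mod_cast hnm
    have hn' : (0:ℝ) < n := by exact_mod_cast hn
    refine ODE_solution_unique_of_mem_Ioo (v := fun _ => V) (s := fun _ => univ) (K := K) (t₀ := 0)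
      (fun t _ => hV.lipschitzOnWith) ⟨by linarith, hn'⟩
      (fun t ht => ⟨hα' n t ht, mem_univ _⟩)
      (fun t ht => ⟨hα' m t ⟨by linarith [ht.1], by linarith [ht.2]⟩, mem_univ _⟩) ?_
    rw [hα, hα]
  have h3 : ∀ n : ℕ, ∀ t ∈ Ioo (-(n:ℝ)) n, α (⌈|t|⌉₊ + 1) t = α n t := by
    intro n t ht
    have ht' : t ∈ Ioo (-((⌈|t|⌉₊ + 1 : ℕ):ℝ)) ((⌈|t|⌉₊ + 1 : ℕ):ℝ) := by
      have := Nat.le_ceil |t|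
      have h4 := abs_lt.mp (show |t| < ((⌈|t|⌉₊ + 1 : ℕ):ℝ) by push_cast; linarith)
      exact h4
    rcases le_total (⌈|t|⌉₊ + 1) n with h | h
    · exact h2 _ _ h ht'
    · exact (h2 _ _ h ht).symm
  refine ⟨fun t => α (⌈|t|⌉₊ + 1) t, hα _, fun t => ?_⟩
  obtain ⟨n, hn⟩ := exists_nat_gt |t|
  have ht := abs_lt.mp hn
  have he : (fun t => α (⌈|t|⌉₊ + 1) t) =ᶠ[𝓝 t] α n :=
    Filter.mem_of_superset (Ioo_mem_nhds ht.1 ht.2) (h3 n)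
  show HasDerivAt _ (V (α (⌈|t|⌉₊ + 1) t)) t
  rw [h3 n t ht]
  exact (hα' n t ht).congr_of_eventuallyEq he

theorem exists_isFlow [CompleteSpace E] {V : E → E} {K M : NNReal}
    (hV : LipschitzWith K V) (hM : ∀ x, ‖V x‖ ≤ M) : ∃ φ, IsFlow V φ := by
  choose φ h0 hd using exists_global_solution hV hM
  have huniq : ∀ (γ : ℝ → E), (∀ t, HasDerivAt γ (V (γ t)) t) → ∀ t, γ t = φ (γ 0) t := by
    intro γ hγ t
    exact congrFun (ODE_solution_unique_univ (v := fun _ => V) (s := fun _ => univ) (K := K)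
      (t₀ := 0) (fun t => hV.lipschitzOnWith) (fun t => ⟨hγ t, mem_univ _⟩)
      (fun t => ⟨hd _ t, mem_univ _⟩) (h0 _).symm) t
  have hpos : ∀ x y t, 0 ≤ t → dist (φ x t) (φ y t) ≤ dist x y * Real.exp (K * t) := by
    intro x y t ht
    have := dist_le_of_trajectories_ODE (v := fun _ => V) (K := K) (a := 0) (b := t)
      (f := φ x) (g := φ y) (δ := dist x y) (fun _ => hV)
      (fun s _ => (hd x s).continuousAt.continuousWithinAt)
      (fun s _ => (hd x s).hasDerivWithinAt)
      (fun s _ => (hd y s).continuousAt.continuousWithinAt)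
      (fun s _ => (hd y s).hasDerivWithinAt) (by rw [h0, h0]) t ⟨ht, le_rfl⟩
    simpa using this
  have hrev : ∀ x t, HasDerivAt (fun s => φ x (-s)) (-V (φ x (-t))) t := by
    intro x t
    have := (hd x (-t)).scomp t (hasDerivAt_neg t)
    simpa [Function.comp_def] using this
  have hneg : ∀ x y t, 0 ≤ t → dist (φ x (-t)) (φ y (-t)) ≤ dist x y * Real.exp (K * t) := by
    intro x y t ht
    have := dist_le_of_trajectories_ODE (v := fun _ z => -V z) (K := K) (a := 0) (b := t)
      (f := fun s => φ x (-s)) (g := fun s => φ y (-s)) (δ := dist x y) (fun _ => hV.neg)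
      (fun s _ => (hrev x s).continuousAt.continuousWithinAt)
      (fun s _ => (hrev x s).hasDerivWithinAt)
      (fun s _ => (hrev y s).continuousAt.continuousWithinAt)
      (fun s _ => (hrev y s).hasDerivWithinAt) (by simp [h0]) t ⟨ht, le_rfl⟩
    simpa using this
  have hall : ∀ x y t, dist (φ x t) (φ y t) ≤ dist x y * Real.exp (K * |t|) := by
    intro x y t
    rcases le_total 0 t with h | h
    · rw [abs_of_nonneg h]; exact hpos x y t h
    · have := hneg x y (-t) (by linarith)
      rw [abs_of_nonpos h]; simpa using this
  refine ⟨φ, h0, hd, ?_, ?_, huniq⟩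
  · rw [continuous_iff_continuousAt]
    rintro ⟨x, t⟩
    have h1 : Tendsto (fun z : E × ℝ => dist z.1 x * Real.exp (K * |z.2|)) (𝓝 (x, t)) (𝓝 0) := by
      have : ContinuousAt (fun z : E × ℝ => dist z.1 x * Real.exp (K * |z.2|)) (x, t) := by
        fun_prop
      simpa [ContinuousAt] using this
    have h2 : Tendsto (fun z : E × ℝ => dist (φ x z.2) (φ x t)) (𝓝 (x, t)) (𝓝 0) := by
      have h3 : Tendsto (fun z : E × ℝ => φ x z.2) (𝓝 (x, t)) (𝓝 (φ x t)) :=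
        (hd x t).continuousAt.tendsto.comp continuousAt_snd
      exact tendsto_iff_dist_tendsto_zero.mp h3
    refine tendsto_iff_dist_tendsto_zero.mpr (squeeze_zero (fun _ => dist_nonneg) (fun z => ?_)
      (by simpa using h1.add h2))
    exact (dist_triangle _ (φ x z.2) _).trans (by gcongr; exact hall _ _ _)
  · intro x s t
    have := huniq (fun t => φ x (s + t)) (fun t => (hd x (s + t)).comp_const_add s t) t
    simpa using this.symm

end Flow

section Entry
open Set

variable {X : Type*} [NormedAddCommGroup X] [NormedSpace ℝ X] {V : X → X} {φ : X → ℝ → X}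

theorem IsFlow.continuous_left (F : IsFlow V φ) (t : ℝ) : Continuous fun x => φ x t :=
  F.cont.comp (by fun_prop : Continuous fun x : X => (x, t))

theorem IsFlow.continuous_right (F : IsFlow V φ) (x : X) : Continuous (φ x) :=
  F.cont.comp (by fun_prop : Continuous fun t : ℝ => (x, t))

/-- Avoiding a closed set during a compact time interval is an open condition. -/
theorem IsFlow.eventually_avoid (F : IsFlow V φ) {C : Set X} (hC : IsClosed C) {x : X} {a b : ℝ}
    (h : ∀ s ∈ Icc a b, φ x s ∉ C) : ∀ᶠ y in 𝓝 x, ∀ s ∈ Icc a b, φ y s ∉ C := by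
  have h1 : ∀ s ∈ Icc a b, ∀ᶠ z : X × ℝ in 𝓝 (x, s), φ z.1 z.2 ∉ C := by
    intro s hs
    exact F.cont.continuousAt.eventually_mem
      (hC.isOpen_compl.mem_nhds (show φ (x, s).1 (x, s).2 ∈ Cᶜ from h s hs))
  exact (isCompact_Icc.eventually_forall_of_forall_eventually (fun s hs => h1 s hs))

/-- The orbit of `x` enters `O` at a positive time. -/
def Enters (φ : X → ℝ → X) (O : Set X) (x : X) : Prop := ∃ t, 0 < t ∧ φ x t ∈ O

/-- The first time the orbit of `x` enters `O`. -/
def entry (φ : X → ℝ → X) (O : Set X) (x : X) : ℝ := sInf {t | 0 < t ∧ φ x t ∈ O}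

/-- Whenever the orbit of `x` reaches `C` for the first time, it immediately enters `O`. -/
def RegularEntry (φ : X → ℝ → X) (O C : Set X) (x : X) : Prop :=
  ∀ t, 0 < t → φ x t ∈ C → (∀ s ∈ Ico 0 t, φ x s ∉ C) → ∃ᶠ s in 𝓝[>] t, φ x s ∈ O

variable {O C : Set X}

theorem bddBelow_entry {X : Type*} {φ : X → ℝ → X} {O : Set X} (x : X) : BddBelow {t | 0 < t ∧ φ x t ∈ O} :=
  ⟨0, fun _ ht => ht.1.le⟩

theorem enters_of_first_hit {X : Type*} {φ : X → ℝ → X} {O C : Set X} (hOC : O ⊆ C)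
    {x : X} (hR : RegularEntry φ O C x) {t : ℝ} (ht : 0 < t) (h : φ x t ∈ C)
    (h' : ∀ s ∈ Ico 0 t, φ x s ∉ C) : Enters φ O x ∧ entry φ O x = t := by
  have hf := hR t ht h h'
  have hlb : ∀ s ∈ {s | 0 < s ∧ φ x s ∈ O}, t ≤ s := by
    intro s hs
    by_contra hlt
    exact h' s ⟨hs.1.le, not_le.mp hlt⟩ (hOC hs.2)
  have hne : {s | 0 < s ∧ φ x s ∈ O}.Nonempty := by
    obtain ⟨s, hs, hs'⟩ := (hf.and_eventually self_mem_nhdsWithin).exists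
    exact ⟨s, ht.trans hs', hs⟩
  refine ⟨hne, le_antisymm ?_ (le_csInf hne hlb)⟩
  refine le_of_forall_gt_imp_ge_of_dense fun c hc => ?_
  obtain ⟨s, hs, hs'⟩ := (hf.and_eventually (Ioo_mem_nhdsGT hc)).exists
  exact (csInf_le (bddBelow_entry x) ⟨ht.trans hs'.1, hs⟩).trans hs'.2.le

/-- A first hitting time of `C` exists if `C` is hit. -/
theorem IsFlow.exists_first_hit (F : IsFlow V φ) (hC : IsClosed C) {x : X} (hx : x ∉ C)
    {T : ℝ} (hT : 0 ≤ T) (h : φ x T ∈ C) :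
    ∃ t, 0 < t ∧ t ≤ T ∧ φ x t ∈ C ∧ ∀ s ∈ Ico 0 t, φ x s ∉ C := by
  set B := {t | t ∈ Icc 0 T ∧ φ x t ∈ C}
  have hB : IsCompact B := by
    refine isCompact_Icc.of_isClosed_subset ?_ (fun t ht => ht.1)
    exact isClosed_Icc.inter (hC.preimage (F.continuous_right x))
  have hne : B.Nonempty := ⟨T, ⟨hT, le_rfl⟩, h⟩
  have hm := hB.sInf_mem hne
  have h0 : sInf B ≠ 0 := by
    intro h0
    have := hm.2
    rw [h0, F.zero] at this
    exact hx this
  refine ⟨sInf B, lt_of_le_of_ne hm.1.1 h0.symm, hm.1.2, hm.2, fun s hs hsC => ?_⟩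
  exact absurd (csInf_le hB.bddBelow ⟨⟨hs.1, hs.2.le.trans hm.1.2⟩, hsC⟩) (not_le.mpr hs.2)

/-- Basic properties of the entry time. -/
theorem IsFlow.entry_spec (F : IsFlow V φ) (hC : IsClosed C) (hOC : O ⊆ C)
    {x : X} (hx : x ∉ C) (hR : RegularEntry φ O C x) (h : Enters φ O x) :
    0 < entry φ O x ∧ φ x (entry φ O x) ∈ C ∧ ∀ s ∈ Ico 0 (entry φ O x), φ x s ∉ C := by
  obtain ⟨T, hT, hT'⟩ := h
  obtain ⟨t, h1, -, h2, h3⟩ := F.exists_first_hit hC hx hT.le (hOC hT')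
  rw [(enters_of_first_hit hOC hR h1 h2 h3).2]
  exact ⟨h1, h2, h3⟩

theorem IsFlow.avoid_of_not_enters (F : IsFlow V φ) (hC : IsClosed C) (hOC : O ⊆ C)
    {x : X} (hx : x ∉ C) (hR : RegularEntry φ O C x) (h : ¬ Enters φ O x) {t : ℝ} (ht : 0 ≤ t) :
    φ x t ∉ C := by
  intro hT'
  obtain ⟨t, h1, -, h2, h3⟩ := F.exists_first_hit hC hx ht hT'
  exact h (enters_of_first_hit hOC hR h1 h2 h3).1

theorem IsFlow.eventually_enters (F : IsFlow V φ) (hO : IsOpen O) {x : X} (h : Enters φ O x) :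
    ∀ᶠ y in 𝓝 x, Enters φ O y := by
  obtain ⟨t, ht, h⟩ := h
  filter_upwards [(F.continuous_left t).continuousAt.eventually_mem (hO.mem_nhds h)] with y hy
  exact ⟨t, ht, hy⟩

theorem IsFlow.continuousAt_entry (F : IsFlow V φ) (hO : IsOpen O) (hC : IsClosed C) (hOC : O ⊆ C)
    {x : X} (hx : x ∉ C) (hR : RegularEntry φ O C x) (h : Enters φ O x) :
    ContinuousAt (entry φ O) x := by
  obtain ⟨h1, h2, h3⟩ := F.entry_spec hC hOC hx hR h
  refine tendsto_order.mpr ⟨fun a ha => ?_, fun b hb => ?_⟩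
  · have hm : max 0 a < entry φ O x := max_lt h1 ha
    obtain ⟨c, hc1, hc2⟩ := exists_between hm
    filter_upwards [F.eventually_avoid hC (a := 0) (b := c)
      (fun s hs => h3 s ⟨hs.1, hs.2.trans_lt hc2⟩), F.eventually_enters hO h] with y hy hy'
    refine (le_max_right 0 a).trans_lt (hc1.trans_le (le_csInf hy' fun s hs => ?_))
    by_contra hlt
    exact hy s ⟨hs.1.le, (not_le.mp hlt).le⟩ (hOC hs.2)
  · obtain ⟨s, hs, hs'⟩ := ((hR _ h1 h2 h3).and_eventually (Ioo_mem_nhdsGT hb)).exists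
    filter_upwards [(F.continuous_left s).continuousAt.eventually_mem (hO.mem_nhds hs)] with y hy
    exact (csInf_le (bddBelow_entry y) ⟨h1.trans hs'.1, hy⟩).trans_lt hs'.2

theorem IsFlow.continuousAt_entry_point (F : IsFlow V φ) (hO : IsOpen O) (hC : IsClosed C)
    (hOC : O ⊆ C) {x : X} (hx : x ∉ C) (hR : RegularEntry φ O C x) (h : Enters φ O x) :
    ContinuousAt (fun y => φ y (entry φ O y)) x :=
  F.cont.continuousAt.comp (f := fun y => (y, entry φ O y))
    (continuousAt_id.prodMk (F.continuousAt_entry hO hC hOC hx hR h))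

/-- If the orbit of `x` never meets `C`, entry times of nearby points are large. -/
theorem IsFlow.eventually_entry_ge (F : IsFlow V φ) (hC : IsClosed C) (hOC : O ⊆ C)
    {x : X} (h : ∀ t, 0 ≤ t → φ x t ∉ C) (T : ℝ) :
    ∀ᶠ y in 𝓝 x, Enters φ O y → T ≤ entry φ O y := by
  filter_upwards [F.eventually_avoid hC (a := 0) (b := T) (fun s hs => h s hs.1)] with y hy hy'
  refine le_csInf hy' fun s hs => ?_
  by_contra hlt
  exact hy s ⟨hs.1.le, (not_le.mp hlt).le⟩ (hOC hs.2)

end Entry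

section Half
open Set

variable {X : Type*} [NormedAddCommGroup X] [NormedSpace ℝ X] {V : X → X} {φ : X → ℝ → X}

/-- The point where the orbit of `x` enters `O`. -/
def hit (φ : X → ℝ → X) (O : Set X) (x : X) : X := φ x (entry φ O x)

/-- Transition from the section `S` towards the section `S'`: orbits are followed until they enter
the open set `O`; `A` is the set of escaping points. -/
structure HalfMap (V : X → X) (φ : X → ℝ → X) (S S' O C A : Set X) : Prop where
  flow : IsFlow V φ
  isOpen : IsOpen O
  isClosed : IsClosed C
  subset : O ⊆ C
  disj : ∀ x ∈ S, x ∉ C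
  regular : ∀ x ∈ S, RegularEntry φ O C x
  esc_not_enters : ∀ x ∈ S, x ∈ A → ¬ Enters φ O x
  esc_open : ∀ x ∈ S, x ∈ A → ∀ᶠ y in 𝓝[S] x, y ∈ A
  good_open : ∀ x ∈ S, Enters φ O x → hit φ O x ∈ S' →
    ∀ᶠ y in 𝓝[S] x, hit φ O y ∈ S'

variable {S S' O C A O' C' A' : Set X}

namespace HalfMap

theorem hit_cont (H : HalfMap V φ S S' O C A) {x : X} (hx : x ∈ S) (h : Enters φ O x) :
    ContinuousAt (hit φ O) x :=
  H.flow.continuousAt_entry_point H.isOpen H.isClosed H.subset (H.disj x hx) (H.regular x hx) h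

theorem eventually_enters (H : HalfMap V φ S S' O C A) {x : X} (h : Enters φ O x) :
    ∀ᶠ y in 𝓝[S] x, Enters φ O y :=
  (H.flow.eventually_enters H.isOpen h).filter_mono nhdsWithin_le_nhds

theorem tendsto_hit (H : HalfMap V φ S S' O C A) {x : X} (hx : x ∈ S) (h : Enters φ O x)
    (h' : hit φ O x ∈ S') : Tendsto (hit φ O) (𝓝[S] x) (𝓝[S'] (hit φ O x)) :=
  tendsto_nhdsWithin_iff.mpr ⟨(H.hit_cont hx h).tendsto.mono_left nhdsWithin_le_nhds,
    H.good_open x hx h h'⟩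

end HalfMap

open Classical in
/-- The symbol of a point of `S`. -/
def symb (φ : X → ℝ → X) (S S' O A O' A' : Set X) (x : X) : Symb :=
  if x ∈ A then .esc
  else if ¬ Enters φ O x then .tgt
  else if hit φ O x ∉ S' then .out
  else if hit φ O x ∈ A' then .out
  else if ¬ Enters φ O' (hit φ O x) then .sad
  else if hit φ O' (hit φ O x) ∈ S then .ret
  else .edge

/-- The return map. -/
def retMap (φ : X → ℝ → X) (O O' : Set X) (x : X) : X := hit φ O' (hit φ O x)

theorem symb_ret {x : X} (h : symb φ S S' O A O' A' x = Symb.ret) :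
    x ∉ A ∧ Enters φ O x ∧ hit φ O x ∈ S' ∧ hit φ O x ∉ A' ∧ Enters φ O' (hit φ O x) ∧
      retMap φ O O' x ∈ S := by
  unfold symb at h; unfold retMap
  split_ifs at h <;> simp_all

theorem symb_edge {x : X} (h : symb φ S S' O A O' A' x = Symb.edge) :
    x ∉ A ∧ Enters φ O x ∧ hit φ O x ∈ S' ∧ hit φ O x ∉ A' ∧ Enters φ O' (hit φ O x) ∧
      retMap φ O O' x ∉ S := by
  unfold symb at h; unfold retMap
  split_ifs at h <;> simp_all

theorem symb_sad {x : X} (h : symb φ S S' O A O' A' x = Symb.sad) :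
    x ∉ A ∧ Enters φ O x ∧ hit φ O x ∈ S' ∧ hit φ O x ∉ A' ∧ ¬ Enters φ O' (hit φ O x) := by
  unfold symb at h
  split_ifs at h <;> simp_all

theorem symb_out {x : X} (h : symb φ S S' O A O' A' x = Symb.out) :
    x ∉ A ∧ Enters φ O x ∧ (hit φ O x ∉ S' ∨ (hit φ O x ∈ S' ∧ hit φ O x ∈ A')) := by
  unfold symb at h
  split_ifs at h <;> simp_all

theorem symb_tgt {x : X} (h : symb φ S S' O A O' A' x = Symb.tgt) :
    x ∉ A ∧ ¬ Enters φ O x := by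
  unfold symb at h
  split_ifs at h <;> simp_all

theorem symb_esc {x : X} (h : symb φ S S' O A O' A' x = Symb.esc) : x ∈ A := by
  unfold symb at h
  split_ifs at h <;> simp_all

/-- The hypotheses on the pair of half maps needed for shooting. -/
structure HalfPair (V : X → X) (φ : X → ℝ → X) (S S' O C A O' C' A' : Set X) (th : X → ℝ)
    (σ : ℝ → X) : Prop where
  fst : HalfMap V φ S S' O C A
  snd : HalfMap V φ S' S O' C' A'
  th_flow : ∀ x t, th (φ x t) = th x
  σ_mem : ∀ t ∈ Set.Icc (0:ℝ) 1, σ t ∈ S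
  σ_cont : ContinuousOn σ (Set.Icc 0 1)
  th_σ : ∀ t ∈ Set.Icc (0:ℝ) 1, th (σ t) = t
  edge_fst : ∀ x ∈ S, Enters φ O x → hit φ O x ∉ S' →
    ∀ᶠ y in 𝓝[S] x, hit φ O y ∈ S' → hit φ O y ∈ A'
  edge_snd : ∀ x ∈ S', Enters φ O' x → hit φ O' x ∉ S →
    ∀ᶠ y in 𝓝[S'] x, hit φ O' y ∈ S → hit φ O' y ∈ A
  near_tgt : ∀ x ∈ S, x ∉ A → ¬ Enters φ O x → ∀ᶠ y in 𝓝[S] x, Enters φ O y →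
    hit φ O y ∈ S' ∧ Enters φ O' (hit φ O y) ∧
      (hit φ O' (hit φ O y) ∈ S → hit φ O' (hit φ O y) ∈ A)
  near_sad : ∀ x ∈ S', x ∉ A' → ¬ Enters φ O' x → ∀ᶠ y in 𝓝[S'] x, Enters φ O' y →
    hit φ O' y ∈ S
  hit_sad : ∀ x ∈ S', x ∉ A' → ¬ Enters φ O' x →
    Tendsto (hit φ O') (𝓝[S' ∩ {y | Enters φ O' y}] x) (𝓝 (σ (th x)))
  σ_zero : σ 0 ∉ A ∧ Enters φ O (σ 0) ∧ (hit φ O (σ 0) ∈ S' → hit φ O (σ 0) ∈ A')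
  σ_one : σ 1 ∈ A

theorem HalfPair.shootingData {th : X → ℝ} {σ : ℝ → X}
    (H : HalfPair V φ S S' O C A O' C' A' th σ) :
    ShootingData S (symb φ S S' O A O' A') (retMap φ O O') th σ where
  σ_mem := H.σ_mem
  σ_cont := H.σ_cont
  th_σ := H.th_σ
  R_mem := fun x _ h => (symb_ret h).2.2.2.2.2
  th_R := fun x _ _ => by simp [retMap, hit, H.th_flow]
  esc_open := by
    intro x hx h
    filter_upwards [H.fst.esc_open x hx (symb_esc h)] with y hy
    simp [symb, hy]
  out_open := by
    intro x hx h
    obtain ⟨-, h2, h3⟩ := symb_out h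
    have e1 := H.fst.eventually_enters (S := S) h2
    rcases h3 with h3 | ⟨h3, h4⟩
    · filter_upwards [e1, H.edge_fst x hx h2 h3, self_mem_nhdsWithin] with y hy hy' hyS
      have hyA : y ∉ A := fun hA => H.fst.esc_not_enters y hyS hA hy
      simp only [symb, hyA, hy, if_false, not_true_eq_false]
      by_cases hyS' : hit φ O y ∈ S'
      · simp [hyS', hy' hyS']
      · simp [hyS']
    · have e2 := (H.fst.tendsto_hit hx h2 h3).eventually (H.snd.esc_open _ h3 h4)
      filter_upwards [e1, e2, H.fst.good_open x hx h2 h3, self_mem_nhdsWithin] with y hy hy' hy2 hyS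
      have hyA : y ∉ A := fun hA => H.fst.esc_not_enters y hyS hA hy
      simp [symb, hyA, hy, hy', hy2]
  ret_open := by
    intro x hx h
    obtain ⟨h1, h2, h3, h4, h5, h6⟩ := symb_ret h
    have ht := H.fst.tendsto_hit hx h2 h3
    filter_upwards [H.fst.eventually_enters (S := S) h2, H.fst.good_open x hx h2 h3,
      ht.eventually (H.snd.eventually_enters h5), ht.eventually (H.snd.good_open _ h3 h5 h6),
      self_mem_nhdsWithin] with y e1 e2 e3 e4 hyS
    have hyA : y ∉ A := fun hA => H.fst.esc_not_enters y hyS hA e1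
    have hyA' : hit φ O y ∉ A' := fun hA => H.snd.esc_not_enters _ e2 hA e3
    simp [symb, hyA, e1, e2, hyA', e3, e4]
  R_cont := by
    intro x hx h
    obtain ⟨h1, h2, h3, h4, h5, h6⟩ := symb_ret h
    have h7 : ContinuousAt (retMap φ O O') x :=
      (H.snd.hit_cont h3 h5).comp (f := hit φ O) (H.fst.hit_cont hx h2)
    exact h7.continuousWithinAt
  near_edge := by
    intro x hx h
    obtain ⟨h1, h2, h3, h4, h5, h6⟩ := symb_edge h
    have ht := H.fst.tendsto_hit hx h2 h3
    filter_upwards [H.fst.eventually_enters (S := S) h2, H.fst.good_open x hx h2 h3,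
      ht.eventually (H.snd.eventually_enters h5), ht.eventually (H.edge_snd _ h3 h5 h6),
      self_mem_nhdsWithin] with y e1 e2 e3 e4 hyS
    have hyA : y ∉ A := fun hA => H.fst.esc_not_enters y hyS hA e1
    have hyA' : hit φ O y ∉ A' := fun hA => H.snd.esc_not_enters _ e2 hA e3
    by_cases hy : hit φ O' (hit φ O y) ∈ S
    · right
      exact ⟨by simp [symb, hyA, e1, e2, hyA', e3, hy], by simp [symb, retMap, e4 hy]⟩
    · left; simp [symb, hyA, e1, e2, hyA', e3, hy]
  near_tgt := by
    intro x hx h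
    obtain ⟨h1, h2⟩ := symb_tgt h
    filter_upwards [H.near_tgt x hx h1 h2, self_mem_nhdsWithin] with y hy hyS
    by_cases hyA : y ∈ A
    · left; simp [symb, hyA]
    by_cases hyE : Enters φ O y
    · obtain ⟨h3, h4, h5⟩ := hy hyE
      have hyA' : hit φ O y ∉ A' := fun hA => H.snd.esc_not_enters _ h3 hA h4
      by_cases h6 : hit φ O' (hit φ O y) ∈ S
      · right; right; right
        exact ⟨by simp [symb, hyA, hyE, h3, h4, hyA', h6], by simp [symb, retMap, h5 h6]⟩
      · right; right; left
        simp [symb, hyA, hyE, h3, h4, hyA', h6]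
    · right; left; simp [symb, hyA, hyE]
  near_sad := by
    intro x hx h
    obtain ⟨h1, h2, h3, h4, h5⟩ := symb_sad h
    have ht := H.fst.tendsto_hit hx h2 h3
    filter_upwards [H.fst.eventually_enters (S := S) h2, H.fst.good_open x hx h2 h3,
      ht.eventually (H.near_sad _ h3 h4 h5), self_mem_nhdsWithin] with y e1 e2 e3 hyS
    have hyA : y ∉ A := fun hA => H.fst.esc_not_enters y hyS hA e1
    by_cases h6 : hit φ O y ∈ A'
    · right; left; simp [symb, hyA, e1, e2, h6]
    by_cases h7 : Enters φ O' (hit φ O y)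
    · left; simp [symb, hyA, e1, e2, h6, h7, e3 h7]
    · right; right; simp [symb, hyA, e1, e2, h6, h7]
  R_sad := by
    intro x hx h
    obtain ⟨h1, h2, h3, h4, h5⟩ := symb_sad h
    have ht := H.fst.tendsto_hit hx h2 h3
    have := H.hit_sad _ h3 h4 h5
    simp only [hit, H.th_flow] at this
    refine Tendsto.comp (g := hit φ O') (f := hit φ O) this (tendsto_nhdsWithin_iff.mpr ⟨?_, ?_⟩)
    · exact (H.fst.hit_cont hx h2).tendsto.mono_left nhdsWithin_le_nhds
    · filter_upwards [self_mem_nhdsWithin] with y hy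
      obtain ⟨-, -, g3, -, g5, -⟩ := symb_ret hy.2
      exact ⟨g3, g5⟩
  σ_zero := by
    obtain ⟨h1, h2, h3⟩ := H.σ_zero
    by_cases h4 : hit φ O (σ 0) ∈ S'
    · simp [symb, h1, h2, h4, h3 h4]
    · simp [symb, h1, h2, h4]
  σ_one := by simp [symb, H.σ_one]

/-- Orbits with a prescribed number of transitions. -/
theorem HalfPair.exists_orbit {th : X → ℝ} {σ : ℝ → X}
    (H : HalfPair V φ S S' O C A O' C' A' th σ) (k : ℕ) :
    ∃ t ∈ Set.Icc (0:ℝ) 1, ∃ τ η : ℕ → ℝ, τ 0 = 0 ∧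
      (∀ j < k, τ j < η j ∧ η j < τ (j+1)) ∧
      (∀ j < k, φ (σ t) (τ j) ∈ S ∧ φ (σ t) (τ j) ∉ A ∧ φ (σ t) (η j) ∈ S' ∧
        φ (σ t) (η j) ∉ A') ∧
      (∀ j < k, (∀ s ∈ Set.Ico (τ j) (η j), φ (σ t) s ∉ C) ∧
        ∀ s ∈ Set.Ico (η j) (τ (j+1)), φ (σ t) s ∉ C') ∧
      φ (σ t) (τ k) ∈ S ∧ φ (σ t) (τ k) ∉ A ∧ ¬ Enters φ O (φ (σ t) (τ k)) := by
  obtain ⟨t, ht, h1, h2⟩ := H.shootingData.exists_itin k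
  set R := retMap φ O O' with hR
  set s : ℕ → X := fun j => R^[j] (σ t) with hs
  set τ : ℕ → ℝ := fun j => ∑ i ∈ Finset.range j, (entry φ O (s i) + entry φ O' (hit φ O (s i)))
    with hτ
  have hsj : ∀ j, φ (σ t) (τ j) = s j := by
    intro j
    induction j with
    | zero => simp [hτ, hs, H.fst.flow.zero]
    | succ j ih =>
      have : τ (j+1) = τ j + (entry φ O (s j) + entry φ O' (hit φ O (s j))) := by
        simp [hτ, Finset.sum_range_succ]
      rw [this, ← H.fst.flow.add, ih, ← H.fst.flow.add]
      simp only [hs, Function.iterate_succ', Function.comp_apply]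
      rfl
  have hS : ∀ j ≤ k, s j ∈ S := by
    intro j hj
    exact (H.shootingData.iter j ht (fun i hi => h1 i (by omega))).1
  refine ⟨t, ht, τ, fun j => τ j + entry φ O (s j), by simp [hτ], ?_, ?_, ?_, ?_⟩
  · intro j hj
    obtain ⟨g1, g2, g3, g4, g5, g6⟩ := symb_ret (h1 j hj)
    have i1 := (H.fst.flow.entry_spec H.fst.isClosed H.fst.subset (H.fst.disj _ (hS j hj.le))
      (H.fst.regular _ (hS j hj.le)) g2).1
    have i2 := (H.snd.flow.entry_spec H.snd.isClosed H.snd.subset (H.snd.disj _ g3)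
      (H.snd.regular _ g3) g5).1
    have : τ (j+1) = τ j + (entry φ O (s j) + entry φ O' (hit φ O (s j))) := by
      simp [hτ, Finset.sum_range_succ]
    constructor
    · simpa using i1
    · rw [this]; linarith
  · intro j hj
    obtain ⟨g1, g2, g3, g4, g5, g6⟩ := symb_ret (h1 j hj)
    simp only
    rw [← H.fst.flow.add, hsj j]
    exact ⟨hS j hj.le, g1, g3, g4⟩
  · intro j hj
    obtain ⟨g1, g2, g3, g4, g5, g6⟩ := symb_ret (h1 j hj)
    have i1 := (H.fst.flow.entry_spec H.fst.isClosed H.fst.subset (H.fst.disj _ (hS j hj.le))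
      (H.fst.regular _ (hS j hj.le)) g2).2.2
    have i2 := (H.snd.flow.entry_spec H.snd.isClosed H.snd.subset (H.snd.disj _ g3)
      (H.snd.regular _ g3) g5).2.2
    have e1 : τ (j+1) = τ j + (entry φ O (s j) + entry φ O' (hit φ O (s j))) := by
      simp [hτ, Finset.sum_range_succ]
    refine ⟨fun v hv => ?_, fun v hv => ?_⟩
    · have := i1 (v - τ j) ⟨by linarith [hv.1], by linarith [hv.2]⟩
      rwa [← hsj j, H.fst.flow.add, add_sub_cancel] at this
    · simp only at hv
      have := i2 (v - (τ j + entry φ O (s j))) ⟨by linarith [hv.1], by linarith [hv.2]⟩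
      unfold hit at this
      have e2 : ∀ w, φ (s j) w = φ (σ t) (τ j + w) := fun w => by rw [← hsj, H.fst.flow.add]
      rwa [H.fst.flow.add, e2,
        show τ j + (entry φ O (s j) + (v - (τ j + entry φ O (s j)))) = v by ring] at this
  · rw [hsj k]
    exact ⟨hS k le_rfl, symb_tgt h2⟩

/-- Orbits with a prescribed number of transitions which stay in a region containing all pieces. -/
theorem HalfPair.exists_orbit_mem {th : X → ℝ} {σ : ℝ → X} {B : Set X}
    (H : HalfPair V φ S S' O C A O' C' A' th σ)
    (hB : ∀ x ∈ S, x ∉ A → ∀ T, 0 < T → (∀ s ∈ Set.Ico 0 T, φ x s ∉ C) → ∀ s ∈ Set.Icc 0 T, φ x s ∈ B)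
    (hB' : ∀ x ∈ S', x ∉ A' → ∀ T, 0 < T → (∀ s ∈ Set.Ico 0 T, φ x s ∉ C') →
      ∀ s ∈ Set.Icc 0 T, φ x s ∈ B)
    (hend : ∀ x ∈ S, x ∉ A → ¬ Enters φ O x → ∀ s, 0 ≤ s → φ x s ∈ B) (k : ℕ) :
    ∃ t ∈ Set.Icc (0:ℝ) 1, ∃ τ η : ℕ → ℝ,
      (∀ j < k, τ j < η j ∧ η j < τ (j+1)) ∧ (∀ j ≤ k, φ (σ t) (τ j) ∈ S ∧ φ (σ t) (τ j) ∉ A) ∧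
      (∀ j < k, φ (σ t) (η j) ∈ S' ∧ φ (σ t) (η j) ∉ A') ∧ ¬ Enters φ O (φ (σ t) (τ k)) ∧
      ∀ s, 0 ≤ s → φ (σ t) s ∈ B := by
  obtain ⟨t, ht, τ, η, h0, h1, h2, h3, h4, h5, h6⟩ := H.exists_orbit k
  refine ⟨t, ht, τ, η, h1, fun j hj => ?_, fun j hj => (h2 j hj).2.2, h6, ?_⟩
  · rcases hj.lt_or_eq with h | rfl
    exacts [⟨(h2 j h).1, (h2 j h).2.1⟩, ⟨h4, h5⟩]
  have Fl := H.fst.flow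
  have key : ∀ a b, a < b → ∀ C : Set X, (∀ s ∈ Set.Ico a b, φ (σ t) s ∉ C) →
      ∀ s ∈ Set.Ico 0 (b-a), φ (φ (σ t) a) s ∉ C := fun a b _ C h s hs => by
    rw [Fl.add]; exact h _ ⟨by linarith [hs.1], by linarith [hs.2]⟩
  have key' : ∀ a b, (∀ s ∈ Set.Icc 0 (b-a), φ (φ (σ t) a) s ∈ B) →
      ∀ s ∈ Set.Icc a b, φ (σ t) s ∈ B := fun a b h s hs => by
    have := h (s-a) ⟨by linarith [hs.1], by linarith [hs.2]⟩
    rwa [Fl.add, add_sub_cancel] at this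
  have hc : ∀ j ≤ k, ∀ s ∈ Set.Icc 0 (τ j), s < τ j → φ (σ t) s ∈ B := by
    intro j
    induction j with
    | zero => intro _ s hs hs'; rw [h0] at hs'; linarith [hs.1]
    | succ j ih =>
      intro hj s hs _
      obtain ⟨i1, i2, i3, i4⟩ := h2 j hj
      rcases lt_or_ge s (τ j) with h | h
      · exact ih (by omega) s ⟨hs.1, h.le⟩ h
      rcases le_total s (η j) with h' | h'
      · exact key' _ _ (hB _ i1 i2 _ (by linarith [(h1 j hj).1]) (key _ _ (h1 j hj).1 _ (h3 j hj).1)) s ⟨h, h'⟩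
      · exact key' _ _ (hB' _ i3 i4 _ (by linarith [(h1 j hj).2]) (key _ _ (h1 j hj).2 _ (h3 j hj).2)) s
          ⟨h', hs.2⟩
  intro s hs
  rcases lt_or_ge s (τ k) with h | h
  · exact hc k le_rfl s ⟨hs, h.le⟩ h
  · have := hend _ h4 h5 h6 (s - τ k) (by linarith)
    rwa [Fl.add, add_sub_cancel] at this

end Half

section Helper
open Set

/-- A barrier: a function which is nonnegative at the start and has positive derivative at
its zeros stays positive. -/
theorem barrier {h h' : ℝ → ℝ} {a b : ℝ} (hd : ∀ t ∈ Icc a b, HasDerivAt h (h' t) t)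
    (h0 : 0 ≤ h a)
    (key : ∀ t ∈ Icc a b, (∀ s ∈ Icc a t, 0 ≤ h s) → h t = 0 → 0 < h' t) :
    ∀ t ∈ Ioc a b, 0 < h t := by
  intro t₁ ht₁
  have hab : a ≤ b := ht₁.1.le.trans ht₁.2
  set B := {t | t ∈ Icc a b ∧ ∀ s ∈ Icc a t, 0 ≤ h s}
  have hcont : ContinuousOn h (Icc a b) := fun t ht => (hd t ht).continuousAt.continuousWithinAt
  have haB : a ∈ B := ⟨⟨le_rfl, hab⟩, fun s hs => by
    rw [le_antisymm hs.2 hs.1]; exact h0⟩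
  have hbd : BddAbove B := ⟨b, fun t ht => ht.1.2⟩
  set τ := sSup B
  have haτ : a ≤ τ := le_csSup hbd haB
  have hτb : τ ≤ b := csSup_le ⟨a, haB⟩ fun t ht => ht.1.2
  have hlt : ∀ s ∈ Ico a τ, 0 ≤ h s := by
    intro s hs
    obtain ⟨t, ht, hst⟩ := exists_lt_of_lt_csSup ⟨a, haB⟩ hs.2
    exact ht.2 s ⟨hs.1, hst.le⟩
  have hτ : 0 ≤ h τ := by
    rcases haτ.eq_or_lt with he | hl
    · rw [← he]; exact h0
    · have hc : ContinuousAt h τ := (hd τ ⟨haτ, hτb⟩).continuousAt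
      refine ge_of_tendsto (hc.tendsto.mono_left (nhdsWithin_le_nhds (s := Iio τ))) ?_
      filter_upwards [Ioo_mem_nhdsLT hl] with s hs using hlt s ⟨hs.1.le, hs.2⟩
  have hall : ∀ s ∈ Icc a τ, 0 ≤ h s := by
    intro s hs
    rcases hs.2.eq_or_lt with he | hl
    · rw [he]; exact hτ
    · exact hlt s ⟨hs.1, hl⟩
  have hτe : τ = b := by
    by_contra hne
    have hτb' : τ < b := lt_of_le_of_ne hτb hne
    have hd' := hd τ ⟨haτ, hτb⟩
    have hev : ∀ᶠ s in 𝓝[>] τ, 0 ≤ h s := by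
      rcases hτ.eq_or_lt with he | hl
      · have hp := key τ ⟨haτ, hτb⟩ hall he.symm
        have := (hasDerivAt_iff_tendsto_slope.mp hd').eventually (lt_mem_nhds hp)
        have h2 := this.filter_mono (nhdsWithin_mono (s := Ioi τ) τ (fun x hx => ne_of_gt hx))
        filter_upwards [h2, self_mem_nhdsWithin] with s hs hs'
        rw [slope_def_field, ← he, sub_zero] at hs
        have : 0 < s - τ := sub_pos.mpr hs'
        exact ((div_pos_iff_of_pos_right this).mp hs).le
      · exact ((hd'.continuousAt.eventually (lt_mem_nhds hl)).filter_mono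
          nhdsWithin_le_nhds).mono fun s hs => le_of_lt hs
    obtain ⟨c, hc, hc'⟩ := (mem_nhdsGT_iff_exists_Ioo_subset' hτb').mp hev
    obtain ⟨m, hm1, hm2⟩ := exists_between (lt_min (show τ < c from hc) hτb')
    have hmB : m ∈ B := by
      refine ⟨⟨haτ.trans hm1.le, (hm2.trans_le (min_le_right _ _)).le⟩, fun s hs => ?_⟩
      rcases le_or_gt s τ with h1 | h1
      · exact hall s ⟨hs.1, h1⟩
      · exact hc' ⟨h1, hs.2.trans_lt (hm2.trans_le (min_le_left _ _))⟩
    exact absurd (le_csSup hbd hmB) (not_le.mpr hm1)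
  rw [hτe] at hall
  have h1 := hall t₁ ⟨ht₁.1.le, ht₁.2⟩
  refine lt_of_le_of_ne h1 fun he => ?_
  have hp := key t₁ ⟨ht₁.1.le, ht₁.2⟩ (fun s hs => hall s ⟨hs.1, hs.2.trans ht₁.2⟩) he.symm
  have := (hasDerivAt_iff_tendsto_slope.mp (hd t₁ ⟨ht₁.1.le, ht₁.2⟩)).eventually (lt_mem_nhds hp)
  have h2 := this.filter_mono (nhdsWithin_mono (s := Iio t₁) t₁ (fun x hx => ne_of_lt hx))
  obtain ⟨s, hs, hs'⟩ := (h2.and (Ioo_mem_nhdsLT ht₁.1)).exists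
  rw [slope_def_field, ← he, sub_zero] at hs
  have h3 := hall s ⟨hs'.1.le, hs'.2.le.trans ht₁.2⟩
  have h4 : s - t₁ < 0 := sub_neg.mpr hs'.2
  have h5 : h s / (s - t₁) ≤ 0 := div_nonpos_of_nonneg_of_nonpos h3 h4.le
  linarith

theorem barrier_nonneg {h h' : ℝ → ℝ} {a b : ℝ} (hd : ∀ t ∈ Icc a b, HasDerivAt h (h' t) t)
    (h0 : 0 ≤ h a)
    (key : ∀ t ∈ Icc a b, (∀ s ∈ Icc a t, 0 ≤ h s) → h t = 0 → 0 < h' t) :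
    ∀ t ∈ Icc a b, 0 ≤ h t := by
  intro t ht
  rcases ht.1.eq_or_lt with he | hl
  · rw [← he]; exact h0
  · exact (barrier hd h0 key t ⟨hl, ht.2⟩).le

/-- Monotonicity from a lower bound on the derivative. -/
theorem le_of_deriv_ge {h h' : ℝ → ℝ} {a b C : ℝ} (hab : a ≤ b)
    (hd : ∀ t ∈ Icc a b, HasDerivAt h (h' t) t) (hC : ∀ t ∈ Icc a b, C ≤ h' t) :
    h a + C * (b - a) ≤ h b := by
  have := (convex_Icc a b).mul_sub_le_image_sub_of_le_deriv (f := h) (C := C)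
    (fun t ht => (hd t ht).continuousAt.continuousWithinAt)
    (fun t ht => (hd t (interior_subset ht)).differentiableAt.differentiableWithinAt)
    (fun t ht => by rw [(hd t (interior_subset ht)).deriv]; exact hC t (interior_subset ht))
    a ⟨le_rfl, hab⟩ b ⟨hab, le_rfl⟩ hab
  linarith

theorem ge_of_deriv_le {h h' : ℝ → ℝ} {a b C : ℝ} (hab : a ≤ b)
    (hd : ∀ t ∈ Icc a b, HasDerivAt h (h' t) t) (hC : ∀ t ∈ Icc a b, h' t ≤ C) :
    h b ≤ h a + C * (b - a) := by
  have := le_of_deriv_ge (h := fun t => -h t) (h' := fun t => -h' t) (C := -C) hab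
    (fun t ht => (hd t ht).neg) (fun t ht => neg_le_neg (hC t ht))
  linarith

/-- A positive function whose logarithmic derivative is bounded below stays positive. -/
theorem pos_of_deriv_ge {h h' : ℝ → ℝ} {a b K : ℝ}
    (hd : ∀ t ∈ Icc a b, HasDerivAt h (h' t) t) (h0 : 0 < h a)
    (key : ∀ t ∈ Icc a b, 0 < h t → - K * h t ≤ h' t) : ∀ t ∈ Icc a b, 0 < h t := by
  have hb := barrier_nonneg (h := fun t => h t * Real.exp ((K+1) * (t - a)) - h a / 2)
    (h' := fun t => (h' t + (K+1) * h t) * Real.exp ((K+1) * (t - a))) (a := a) (b := b)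
    (fun t ht => by
      have h1 : HasDerivAt (fun t => Real.exp ((K+1) * (t - a)))
          (Real.exp ((K+1) * (t - a)) * ((K+1) * 1)) t :=
        (((hasDerivAt_id t).sub_const a).const_mul (K+1)).exp
      exact (((hd t ht).mul h1).sub_const (h a / 2)).congr_deriv (by simp; ring)) (by simp; linarith) (by
      intro t ht _ he
      have hpos : 0 < h t := by
        have : 0 < h t * Real.exp ((K+1) * (t - a)) := by linarith
        exact (pos_iff_pos_of_mul_pos this).mpr (Real.exp_pos _)
      have := key t ht hpos
      exact mul_pos (by nlinarith) (Real.exp_pos _))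
  intro t ht
  have h1 := hb t ht
  have : 0 < h t * Real.exp ((K+1) * (t - a)) := by
    linarith
  exact (pos_iff_pos_of_mul_pos this).mpr (Real.exp_pos _)

/-- A function which can only decrease at a linear rate below zero stays nonnegative. -/
theorem nonneg_of_deriv_ge {h h' : ℝ → ℝ} {a b K : ℝ}
    (hd : ∀ t ∈ Icc a b, HasDerivAt h (h' t) t) (h0 : 0 ≤ h a)
    (key : ∀ t ∈ Icc a b, h t < 0 → K * h t ≤ h' t) : ∀ t ∈ Icc a b, 0 ≤ h t := by
  intro t₁ ht₁
  refine le_of_forall_pos_lt_add fun e he => ?_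
  set d := e / Real.exp ((K+1) * (t₁ - a)) / 2 with hd'
  have hdpos : 0 < d := by positivity
  have hb := barrier_nonneg (h := fun t => h t + d * Real.exp ((K+1) * (t - a)))
    (h' := fun t => h' t + d * ((K+1) * Real.exp ((K+1) * (t - a)))) (a := a) (b := b)
    (fun t ht => by
      have h1 : HasDerivAt (fun t => Real.exp ((K+1) * (t - a)))
          (Real.exp ((K+1) * (t - a)) * ((K+1) * 1)) t :=
        (((hasDerivAt_id t).sub_const a).const_mul (K+1)).exp
      exact ((hd t ht).add (h1.const_mul d)).congr_deriv (by ring)) (by simp; linarith) (by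
      intro t ht _ he
      have hE : 0 < d * Real.exp ((K+1) * (t - a)) := by positivity
      have := key t ht (by linarith)
      rw [eq_neg_of_add_eq_zero_left he] at this
      linarith)
  have h1 := hb t₁ ht₁
  have h2 : d * Real.exp ((K+1) * (t₁ - a)) = e / 2 := by
    rw [hd']; field_simp
  simp only [h2] at h1
  linarith

theorem eventually_neg_right {f : ℝ → ℝ} {f' t : ℝ} (hf : HasDerivAt f f' t) (h : f t ≤ 0)
    (hf' : f' < 0) : ∀ᶠ s in 𝓝[>] t, f s < 0 := by
  have := (hasDerivAt_iff_tendsto_slope.mp hf).eventually (gt_mem_nhds hf')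
  have h2 := this.filter_mono (nhdsWithin_mono (s := Ioi t) t (fun x hx => ne_of_gt hx))
  filter_upwards [h2, self_mem_nhdsWithin] with s hs hs'
  rw [slope_def_field] at hs
  have h3 : 0 < s - t := sub_pos.mpr hs'
  have := (div_neg_iff.mp hs).resolve_left (fun h => by linarith [h.2])
  linarith [this.1]

theorem eventually_pos_right {f : ℝ → ℝ} {f' t : ℝ} (hf : HasDerivAt f f' t) (h : 0 ≤ f t)
    (hf' : 0 < f') : ∀ᶠ s in 𝓝[>] t, 0 < f s := by
  filter_upwards [eventually_neg_right hf.neg (by simpa using h) (by simpa using hf')] with s hs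
  simpa using hs

theorem eventually_lt_right {f f' : ℝ → ℝ} {t : ℝ} (hf : ∀ s, HasDerivAt f (f' s) s)
    (h : ∀ᶠ s in 𝓝[>] t, f' s < 0) : ∀ᶠ s in 𝓝[>] t, f s < f t := by
  obtain ⟨b, hb, hb'⟩ := mem_nhdsGT_iff_exists_Ioo_subset.mp h
  filter_upwards [Ioo_mem_nhdsGT (show t < b from hb)] with s hs
  refine strictAntiOn_of_deriv_neg (convex_Icc t s) (fun x _ => (hf x).continuousAt.continuousWithinAt)
    (fun x hx => ?_) ⟨le_rfl, hs.1.le⟩ ⟨hs.1.le, le_rfl⟩ hs.1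
  rw [interior_Icc] at hx
  rw [(hf x).deriv]; exact hb' ⟨hx.1, hx.2.trans hs.2⟩

theorem eventually_gt_right {f f' : ℝ → ℝ} {t : ℝ} (hf : ∀ s, HasDerivAt f (f' s) s)
    (h : ∀ᶠ s in 𝓝[>] t, 0 < f' s) : ∀ᶠ s in 𝓝[>] t, f t < f s := by
  filter_upwards [eventually_lt_right (f := fun s => -f s) (f' := fun s => -f' s)
    (fun s => (hf s).neg) (by simpa using h)] with s hs
  simpa using hs

/-- The derivative at the first time a positive function reaches zero. -/
theorem deriv_nonpos_of_first {f : ℝ → ℝ} {f' a t : ℝ} (hf : HasDerivAt f f' t) (hat : a < t)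
    (h : ∀ s ∈ Ico a t, 0 ≤ f s) (h0 : f t ≤ 0) : f' ≤ 0 := by
  by_contra hneg
  have := (hasDerivAt_iff_tendsto_slope.mp hf).eventually (lt_mem_nhds (not_le.mp hneg))
  have h2 := this.filter_mono (nhdsWithin_mono (s := Iio t) t (fun x hx => ne_of_lt hx))
  obtain ⟨s, hs, hs'⟩ := (h2.and (Ioo_mem_nhdsLT hat)).exists
  rw [slope_def_field] at hs
  have h3 := h s ⟨hs'.1.le, hs'.2⟩
  have h4 : s - t < 0 := sub_neg.mpr hs'.2
  have h5 := div_nonpos_of_nonneg_of_nonpos (show 0 ≤ f s - f t by linarith) h4.le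
  linarith

/-- The first time a continuous function reaches zero. -/
theorem exists_first_zero {f : ℝ → ℝ} {a b : ℝ} (hab : a ≤ b) (hf : ContinuousOn f (Icc a b))
    (ha : 0 < f a) (hb : f b ≤ 0) : ∃ t ∈ Ioc a b, f t = 0 ∧ ∀ s ∈ Ico a t, 0 < f s := by
  set B := {t | t ∈ Icc a b ∧ f t ∈ Iic 0}
  have hB : IsCompact B := isCompact_Icc.of_isClosed_subset
    (hf.preimage_isClosed_of_isClosed isClosed_Icc isClosed_Iic) (fun t ht => ht.1)
  obtain ⟨t, ht, hmin⟩ := hB.exists_isLeast ⟨b, ⟨hab, le_rfl⟩, hb⟩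
  have hpos : ∀ s ∈ Ico a t, 0 < f s := by
    intro s hs
    by_contra h
    exact absurd (hmin ⟨⟨hs.1, hs.2.le.trans ht.1.2⟩, not_lt.mp h⟩) (not_le.mpr hs.2)
  have hat : a < t := lt_of_le_of_ne ht.1.1 (fun h => by
    have : f t ≤ 0 := ht.2
    rw [← h] at this; linarith)
  refine ⟨t, ⟨hat, ht.1.2⟩, le_antisymm ht.2 ?_, hpos⟩
  have hc : Tendsto f (𝓝[<] t) (𝓝 (f t)) :=
    (hf t ht.1).tendsto.mono_left (nhdsWithin_le_iff.mpr
      (mem_of_superset (Ioo_mem_nhdsLT hat) (fun s hs => ⟨hs.1.le, hs.2.le.trans ht.1.2⟩)))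
  exact ge_of_tendsto hc (by
    filter_upwards [Ioo_mem_nhdsLT hat] with s hs using (hpos s ⟨hs.1.le, hs.2⟩).le)

/-- A Barbalat type lemma. -/
theorem tendsto_zero_of_lyapunov {L L' w w' : ℝ → ℝ} {t₀ m C : ℝ}
    (hL : ∀ t, t₀ ≤ t → HasDerivAt L (L' t) t) (hm : ∀ t, t₀ ≤ t → m ≤ L t)
    (hw : ∀ t, t₀ ≤ t → 0 ≤ w t) (hLw : ∀ t, t₀ ≤ t → L' t ≤ - w t)
    (hd : ∀ t, t₀ ≤ t → HasDerivAt w (w' t) t) (hC : ∀ t, t₀ ≤ t → |w' t| ≤ C) :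
    Tendsto w atTop (𝓝 0) := by
  have hC0 : 0 ≤ C := (abs_nonneg _).trans (hC t₀ le_rfl)
  have hanti : ∀ s t, t₀ ≤ s → s ≤ t → L t ≤ L s := by
    intro s t hs hst
    have := ge_of_deriv_le (C := 0) hst (fun τ hτ => hL τ (hs.trans hτ.1))
      (fun τ hτ => (hLw τ (hs.trans hτ.1)).trans (by linarith [hw τ (hs.trans hτ.1)]))
    linarith
  have hlim : ∃ l, Tendsto L atTop (𝓝 l) := by
    have hA : Antitone fun t => L (max t t₀) := fun s t hst =>
      hanti _ _ (le_max_right _ _) (max_le_max_right _ hst)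
    have := tendsto_atTop_ciInf hA ⟨m, by rintro _ ⟨t, rfl⟩; exact hm _ (le_max_right _ _)⟩
    refine ⟨_, this.congr' ?_⟩
    filter_upwards [eventually_ge_atTop t₀] with t ht
    rw [max_eq_left ht]
  obtain ⟨l, hl⟩ := hlim
  refine Metric.tendsto_atTop.mpr fun e he => ?_
  set δ := e / (2 * (C + 1)) with hδ
  have hδ0 : 0 < δ := by positivity
  obtain ⟨T, hT⟩ := Metric.tendsto_atTop.mp hl (e * δ / 8) (by positivity)
  refine ⟨max T t₀, fun t ht => ?_⟩
  have ht0 : t₀ ≤ t := (le_max_right _ _).trans ht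
  have htT : T ≤ t := (le_max_left _ _).trans ht
  rw [Real.dist_eq, sub_zero, abs_of_nonneg (hw t ht0)]
  by_contra hge
  push Not at hge
  have hbd : ∀ s ∈ Icc t (t + δ), e / 2 ≤ w s := by
    intro s hs
    have := le_of_deriv_ge (C := -C) hs.1 (fun τ hτ => hd τ (ht0.trans hτ.1))
      (fun τ hτ => (abs_le.mp (hC τ (ht0.trans hτ.1))).1)
    have h2 : C * (s - t) ≤ e / 2 := by
      have : C * (s - t) ≤ (C + 1) * δ := by
        have : s - t ≤ δ := by linarith [hs.2]
        have : 0 ≤ s - t := by linarith [hs.1]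
        nlinarith
      have h3 : (C + 1) * δ = e / 2 := by rw [hδ]; field_simp
      linarith
    linarith
  have h1 := ge_of_deriv_le (C := -(e/2)) (show t ≤ t + δ by linarith)
    (fun τ hτ => hL τ (ht0.trans hτ.1))
    (fun τ hτ => (hLw τ (ht0.trans hτ.1)).trans (by linarith [hbd τ hτ]))
  have h2 := hT t htT
  have h3 := hT (t + δ) (by linarith)
  rw [Real.dist_eq] at h2 h3
  have h4 := abs_lt.mp h2
  have h5 := abs_lt.mp h3
  nlinarith

end Helper

/-- Static parameters of the rescaled travelling wave system, together with an affine
one-parameter family of wave speed functions. -/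
structure Par where
  (ζ ub y x κ qL qH ulo um ρ cb0 cb1 c20 c21 : ℝ)
  hζ : 2/5 < ζ
  hub : 9/7 < ub
  hub' : ub < 4/3
  hκ : 0 < κ
  hR : 23/30 < 2*κ^2
  hR' : 2*κ^2 < 87/100
  hx0 : 0 < x
  hx : 2*κ^2*x^2 = 2*κ^2 - 1/10
  hy0 : 0 < y
  hy1 : y < 1/4
  hy : 2*κ^2*y^2 = 2*κ^2 + ub - 21/10
  hyub : 2*(1+y)*(ub-1) = 2 - ub
  hqL : 0 < qL
  hqL' : qL ≤ 1/1000
  hqH : 1 < qH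
  hqH' : qH < 1 + y
  hulo : 5/4 < ulo
  hum : ulo < um
  hum' : um < ub
  hFH : 0 < ulo - 21/10 + 2*κ^2*qH*(2-qH)
  hρ : 0 < ρ
  hρy : ρ ≤ y/1000
  hρω : 40*(1+y-qH) ≤ y*ρ
  adm_a : ∀ θ ∈ Set.Icc (0:ℝ) 1, 0 < ((c20 + c21*θ) - (cb0 + cb1*θ))/(2-ub) ∧
    ((c20 + c21*θ) - (cb0 + cb1*θ))/(2-ub) ≤ 2
  adm_lo : ∀ θ ∈ Set.Icc (0:ℝ) 1, 1/10 ≤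
    (cb0 + cb1*θ) + ((c20 + c21*θ) - (cb0 + cb1*θ))/(2-ub) * (ulo-ub)
  adm_hi : ∀ θ ∈ Set.Icc (0:ℝ) 1, c20 + c21*θ ≤ 2

namespace Par
open Set
variable (P : Par)

/-- The reaction term divided by `q`. -/
def F (q u : ℝ) : ℝ := u - 21/10 + 2*P.κ^2*q*(2-q)
def cb (θ : ℝ) : ℝ := P.cb0 + P.cb1*θ
def c2 (θ : ℝ) : ℝ := P.c20 + P.c21*θ
def a (θ : ℝ) : ℝ := (P.c2 θ - P.cb θ)/(2-P.ub)
/-- The rescaled wave speed at height `u`. -/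
def c (θ u : ℝ) : ℝ := P.cb θ + P.a θ * (u - P.ub)
/-- Cut-off switching off the slow drift below `um`. -/
def m (u : ℝ) : ℝ := max 0 (min 1 ((u - P.ulo)/(P.um - P.ulo)))
/-- The slow drift. -/
def du (ε θ q u : ℝ) : ℝ := ε * P.m u * gq q u / (P.c θ u + P.a θ * P.ζ)

theorem c_two (θ : ℝ) : P.c θ 2 = P.c2 θ := by
  have := P.hub'
  unfold c a
  have h : 2 - P.ub ≠ 0 := by linarith
  field_simp; ring

theorem c_ub (θ : ℝ) : P.c θ P.ub = P.cb θ := by unfold c; ring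

variable {P} {θ : ℝ} (hθ : θ ∈ Icc (0:ℝ) 1)
include hθ

theorem a_pos : 0 < P.a θ := (P.adm_a θ hθ).1
theorem a_le : P.a θ ≤ 2 := (P.adm_a θ hθ).2

theorem c_mono {u v : ℝ} (h : u ≤ v) : P.c θ u ≤ P.c θ v := by
  have := P.a_pos hθ
  unfold c; nlinarith

theorem le_c {u : ℝ} (h : P.ulo ≤ u) : 1/10 ≤ P.c θ u :=
  le_trans (P.adm_lo θ hθ) (P.c_mono hθ h)

theorem c_le {u : ℝ} (h : u ≤ 2) : P.c θ u ≤ 2 :=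
  (P.c_mono hθ h).trans ((P.c_two θ).trans_le (P.adm_hi θ hθ))

theorem le_den {u : ℝ} (h : P.ulo ≤ u) : 1/10 ≤ P.c θ u + P.a θ * P.ζ := by
  have := P.le_c hθ h
  have := P.a_pos hθ
  have := P.hζ
  nlinarith

omit hθ in
theorem m_nonneg (u : ℝ) : 0 ≤ P.m u := le_max_left _ _
omit hθ in
theorem m_le (u : ℝ) : P.m u ≤ 1 := max_le zero_le_one (min_le_left _ _)
omit hθ in
theorem m_eq {u : ℝ} (h : P.um ≤ u) : P.m u = 1 := by
  have := P.hum
  have h1 : 1 ≤ (u - P.ulo)/(P.um - P.ulo) := by rw [le_div_iff₀ (by linarith)]; linarith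
  unfold m; rw [min_eq_left h1]; simp
omit hθ in
theorem m_zero {u : ℝ} (h : u ≤ P.ulo) : P.m u = 0 := by
  have := P.hum
  have h1 : (u - P.ulo)/(P.um - P.ulo) ≤ 0 := div_nonpos_of_nonpos_of_nonneg (by linarith) (by linarith)
  unfold m; exact max_eq_left ((min_le_right _ _).trans h1)

theorem abs_du_le {ε q u : ℝ} (hε : 0 ≤ ε) (hq : q ∈ Icc (0:ℝ) 2) (hu : u ∈ Icc P.ulo 2) :
    |P.du ε θ q u| ≤ 40 * ε := by
  have h1 := P.le_den hθ hu.1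
  have h2 : |gq q u| ≤ 4 := by
    have := P.hulo
    have := hu.1; have := hu.2; have := hq.1; have := hq.2
    unfold gq; rw [abs_le]; constructor <;> nlinarith
  unfold du
  rw [abs_div, abs_mul, abs_mul, abs_of_nonneg hε, abs_of_nonneg (P.m_nonneg u),
    abs_of_pos (show 0 < P.c θ u + P.a θ * P.ζ by linarith), div_le_iff₀ (by linarith)]
  have h3 := P.m_nonneg u
  have h4 := P.m_le u
  have h5 : ε * P.m u ≤ ε := by nlinarith
  calc ε * P.m u * |gq q u| ≤ ε * 4 := by gcongr
    _ ≤ _ := by nlinarith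

end Par

namespace Par
open Set

/-- Truncation to an interval. -/
def clamp (l h x : ℝ) : ℝ := max l (min h x)

theorem clamp_mem {l h : ℝ} (hl : l ≤ h) (x : ℝ) : clamp l h x ∈ Icc l h :=
  ⟨le_max_left _ _, max_le hl (min_le_left _ _)⟩

theorem clamp_eq {l h x : ℝ} (hx : x ∈ Icc l h) : clamp l h x = x := by
  unfold clamp; rw [min_eq_right hx.2, max_eq_right hx.1]

theorem clamp_low {l h x : ℝ} (hx : x ≤ l) : clamp l h x = l := by
  unfold clamp; exact max_eq_left ((min_le_right _ _).trans hx)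

theorem clamp_high {l h x : ℝ} (hl : l ≤ h) (hx : h ≤ x) : clamp l h x = h := by
  unfold clamp; rw [min_eq_left hx, max_eq_right hl]

theorem exists_lip_clamp {α : Type*} [PseudoEMetricSpace α] {f : α → ℝ} (l h : ℝ)
    (hf : ∃ K, LipschitzWith K f) : ∃ K, LipschitzWith K fun x => clamp l h (f x) :=
  hf.imp fun _ hf => (hf.const_min h).const_max l

variable (P : Par)

/-- The extended vector field before truncation; the last variable is the cut-off factor. -/
def rawField (ε : ℝ) (z : ℝ × ℝ × ℝ × ℝ × ℝ) : ℝ × ℝ × ℝ × ℝ :=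
  (0, z.2.2.1, P.c z.1 z.2.2.2.1 * z.2.2.1 - z.2.1 * P.F z.2.1 z.2.2.2.1,
    ε * z.2.2.2.2 * gq z.2.1 z.2.2.2.1 / (P.c z.1 z.2.2.2.1 + P.a z.1 * P.ζ))

def trunc (z : ℝ × ℝ × ℝ × ℝ) : ℝ × ℝ × ℝ × ℝ × ℝ :=
  (clamp 0 1 z.1, clamp 0 2 z.2.1, clamp (-16) 7 z.2.2.1, clamp P.ulo 2 z.2.2.2, P.m z.2.2.2)

/-- The truncated vector field on `(θ, q, p, u)`-space. -/
def field (ε : ℝ) (z : ℝ × ℝ × ℝ × ℝ) : ℝ × ℝ × ℝ × ℝ := P.rawField ε (P.trunc z)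

theorem exists_lip_prod {α : Type*} [PseudoEMetricSpace α] {β γ : Type*} [PseudoEMetricSpace β]
    [PseudoEMetricSpace γ] {f : α → β} {g : α → γ} (hf : ∃ K, LipschitzWith K f)
    (hg : ∃ K, LipschitzWith K g) : ∃ K, LipschitzWith K fun x => (f x, g x) := by
  obtain ⟨K, hK⟩ := hf
  obtain ⟨K', hK'⟩ := hg
  exact ⟨_, hK.prodMk hK'⟩

def truncBox : Set (ℝ × ℝ × ℝ × ℝ × ℝ) :=
  Icc 0 1 ×ˢ Icc 0 2 ×ˢ Icc (-16) 7 ×ˢ Icc P.ulo 2 ×ˢ Icc 0 1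

theorem ulo_lt : P.ulo < 2 := by have := P.hum; have := P.hum'; have := P.hub'; linarith

theorem trunc_mem (z : ℝ × ℝ × ℝ × ℝ) : P.trunc z ∈ P.truncBox := by
  simp only [truncBox, mem_prod]
  exact ⟨clamp_mem (by norm_num) _, clamp_mem (by norm_num) _, clamp_mem (by norm_num) _,
    clamp_mem P.ulo_lt.le _, P.m_nonneg _, P.m_le _⟩

theorem isCompact_truncBox : IsCompact P.truncBox :=
  isCompact_Icc.prod (isCompact_Icc.prod (isCompact_Icc.prod (isCompact_Icc.prod isCompact_Icc)))

theorem convex_truncBox : Convex ℝ P.truncBox :=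
  (convex_Icc _ _).prod ((convex_Icc _ _).prod ((convex_Icc _ _).prod
    ((convex_Icc _ _).prod (convex_Icc _ _))))

theorem contDiffOn_rawField (ε : ℝ) : ContDiffOn ℝ 1 (P.rawField ε) P.truncBox := by
  have h0 : ∀ z ∈ P.truncBox, P.c z.1 z.2.2.2.1 + P.a z.1 * P.ζ ≠ 0 := by
    intro z hz
    simp only [truncBox, mem_prod] at hz
    exact (lt_of_lt_of_le (by norm_num) (P.le_den hz.1 hz.2.2.2.1.1)).ne'
  have h1 : ContDiff ℝ 1 fun z : ℝ × ℝ × ℝ × ℝ × ℝ => P.c z.1 z.2.2.2.1 := by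
    unfold c a cb c2; fun_prop
  have h2 : ContDiff ℝ 1 fun z : ℝ × ℝ × ℝ × ℝ × ℝ => P.c z.1 z.2.2.2.1 + P.a z.1 * P.ζ := by
    unfold c a cb c2; fun_prop
  have h3 : ContDiff ℝ 1 fun z : ℝ × ℝ × ℝ × ℝ × ℝ => P.F z.2.1 z.2.2.2.1 := by
    unfold F; fun_prop
  have h4 : ContDiff ℝ 1 fun z : ℝ × ℝ × ℝ × ℝ × ℝ => ε * z.2.2.2.2 * gq z.2.1 z.2.2.2.1 := by
    unfold gq; fun_prop
  unfold rawField
  refine ContDiffOn.prodMk contDiffOn_const (ContDiffOn.prodMk (by fun_prop)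
    (ContDiffOn.prodMk ?_ ?_))
  · exact (ContDiff.sub (h1.mul (by fun_prop)) (ContDiff.mul (by fun_prop) h3)).contDiffOn
  · exact h4.contDiffOn.div h2.contDiffOn h0

theorem exists_flow (ε : ℝ) : ∃ φ, IsFlow (P.field ε) φ := by
  obtain ⟨K, hK⟩ := (P.contDiffOn_rawField ε).exists_lipschitzOnWith one_ne_zero
    P.convex_truncBox P.isCompact_truncBox
  have hfst : ∃ K, LipschitzWith K fun z : ℝ × ℝ × ℝ × ℝ => z.1 := ⟨_, LipschitzWith.prod_fst⟩
  have hq : ∃ K, LipschitzWith K fun z : ℝ × ℝ × ℝ × ℝ => z.2.1 :=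
    ⟨_, LipschitzWith.prod_fst.comp LipschitzWith.prod_snd⟩
  have hp : ∃ K, LipschitzWith K fun z : ℝ × ℝ × ℝ × ℝ => z.2.2.1 :=
    ⟨_, LipschitzWith.prod_fst.comp (LipschitzWith.prod_snd.comp LipschitzWith.prod_snd)⟩
  have hu : ∃ K, LipschitzWith K fun z : ℝ × ℝ × ℝ × ℝ => z.2.2.2 :=
    ⟨_, LipschitzWith.prod_snd.comp (LipschitzWith.prod_snd.comp LipschitzWith.prod_snd)⟩
  have hm : ∃ K, LipschitzWith K fun z : ℝ × ℝ × ℝ × ℝ => P.m z.2.2.2 := by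
    have h1 : ∃ K, LipschitzWith K fun u : ℝ => (u - P.ulo)/(P.um - P.ulo) := by
      refine ⟨Real.toNNReal (1/(P.um - P.ulo)), LipschitzWith.of_dist_le_mul fun u v => ?_⟩
      have h : 0 < P.um - P.ulo := by have := P.hum; linarith
      rw [Real.coe_toNNReal _ (by positivity), Real.dist_eq, Real.dist_eq, ← sub_div, abs_div,
        abs_of_pos h]
      apply le_of_eq; rw [sub_sub_sub_cancel_right]; ring
    obtain ⟨K, hK⟩ := exists_lip_clamp 0 1 h1
    obtain ⟨K', hK'⟩ := hu
    exact ⟨_, hK.comp hK'⟩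
  obtain ⟨K', hK'⟩ : ∃ K, LipschitzWith K P.trunc :=
    exists_lip_prod (exists_lip_clamp _ _ hfst) (exists_lip_prod (exists_lip_clamp _ _ hq)
      (exists_lip_prod (exists_lip_clamp _ _ hp) (exists_lip_prod (exists_lip_clamp _ _ hu) hm)))
  have hlip : LipschitzWith (K * K') (P.field ε) :=
    lipschitzOnWith_univ.mp (hK.comp hK'.lipschitzOnWith (fun z _ => P.trunc_mem z))
  obtain ⟨M, hM⟩ := P.isCompact_truncBox.exists_bound_of_continuousOn
    (P.contDiffOn_rawField ε).continuousOn
  exact exists_isFlow (M := Real.toNNReal M) hlip fun x =>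
    (hM _ (P.trunc_mem x)).trans (Real.le_coe_toNNReal M)

/-- `(q,p,u)` solves the rescaled system on `I` and stays in the box. -/
structure Orb (ε θ : ℝ) (q p u : ℝ → ℝ) (I : Set ℝ) : Prop where
  dq : ∀ t ∈ I, HasDerivAt q (p t) t
  dp : ∀ t ∈ I, HasDerivAt p (P.c θ (u t) * p t - q t * P.F (q t) (u t)) t
  du : ∀ t ∈ I, HasDerivAt u (P.du ε θ (q t) (u t)) t
  hq : ∀ t ∈ I, q t ∈ Icc (0:ℝ) 2
  hp : ∀ t ∈ I, p t ∈ Icc (-16:ℝ) 7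
  hu : ∀ t ∈ I, u t ∈ Icc P.ulo 2

variable {P} {ε : ℝ} {φ : ℝ × ℝ × ℝ × ℝ → ℝ → ℝ × ℝ × ℝ × ℝ}

theorem Orb.mono {θ : ℝ} {q p u : ℝ → ℝ} {I J : Set ℝ} (h : P.Orb ε θ q p u I) (hJ : J ⊆ I) :
    P.Orb ε θ q p u J :=
  ⟨fun t ht => h.dq t (hJ ht), fun t ht => h.dp t (hJ ht), fun t ht => h.du t (hJ ht),
    fun t ht => h.hq t (hJ ht), fun t ht => h.hp t (hJ ht), fun t ht => h.hu t (hJ ht)⟩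

section flow
variable (Fl : IsFlow (P.field ε) φ)
include Fl

theorem flow_deriv (x : ℝ × ℝ × ℝ × ℝ) (t : ℝ) :
    HasDerivAt (fun t => (φ x t).1) 0 t ∧
    HasDerivAt (fun t => (φ x t).2.1) (P.field ε (φ x t)).2.1 t ∧
    HasDerivAt (fun t => (φ x t).2.2.1) (P.field ε (φ x t)).2.2.1 t ∧
    HasDerivAt (fun t => (φ x t).2.2.2) (P.field ε (φ x t)).2.2.2 t := by
  have h := Fl.deriv x t
  have h1 := HasFDerivAt.comp_hasDerivAt t
    (hasFDerivAt_fst (𝕜 := ℝ) (E := ℝ) (F := ℝ × ℝ × ℝ) (p := φ x t)) h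
  have h2 := HasFDerivAt.comp_hasDerivAt t
    (hasFDerivAt_snd (𝕜 := ℝ) (E := ℝ) (F := ℝ × ℝ × ℝ) (p := φ x t)) h
  have h3 := HasFDerivAt.comp_hasDerivAt t
    (hasFDerivAt_fst (𝕜 := ℝ) (E := ℝ) (F := ℝ × ℝ) (p := (φ x t).2)) h2
  have h4 := HasFDerivAt.comp_hasDerivAt t
    (hasFDerivAt_snd (𝕜 := ℝ) (E := ℝ) (F := ℝ × ℝ) (p := (φ x t).2)) h2
  have h5 := HasFDerivAt.comp_hasDerivAt t
    (hasFDerivAt_fst (𝕜 := ℝ) (E := ℝ) (F := ℝ) (p := (φ x t).2.2)) h4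
  have h6 := HasFDerivAt.comp_hasDerivAt t
    (hasFDerivAt_snd (𝕜 := ℝ) (E := ℝ) (F := ℝ) (p := (φ x t).2.2)) h4
  exact ⟨h1, h3, h5, h6⟩

theorem flow_fst (x : ℝ × ℝ × ℝ × ℝ) (t : ℝ) : (φ x t).1 = x.1 := by
  have := is_const_of_deriv_eq_zero (f := fun t => (φ x t).1)
    (fun t => (flow_deriv Fl x t).1.differentiableAt) (fun t => (flow_deriv Fl x t).1.deriv) t 0
  simpa [Fl.zero] using this

theorem flow_u_mem {x : ℝ × ℝ × ℝ × ℝ} (hθ : x.1 ∈ Icc (0:ℝ) 1) (hu : x.2.2.2 ∈ Icc P.ulo 2) (hε : 0 < ε) {t : ℝ} (ht : 0 ≤ t) :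
    (φ x t).2.2.2 ∈ Icc P.ulo 2 := by
  have hc : ∀ z : ℝ × ℝ × ℝ × ℝ, z.1 ∈ Icc (0:ℝ) 1 →
      0 < P.c (clamp 0 1 z.1) (clamp P.ulo 2 z.2.2.2) + P.a (clamp 0 1 z.1) * P.ζ := fun z hz =>
    lt_of_lt_of_le (by norm_num) (P.le_den (clamp_mem (by norm_num) _) (clamp_mem P.ulo_lt.le _).1)
  constructor
  · refine le_of_forall_pos_lt_add fun e he => ?_
    have := barrier_nonneg (h := fun s => (φ x s).2.2.2 - P.ulo + e / (1 + t) / 2 * (1 + s)) (a := 0) (b := t)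
      (fun s _ => ((flow_deriv Fl x s).2.2.2.sub_const P.ulo).add
        (((hasDerivAt_id s).const_add 1).const_mul _)) (by
          simp only [Fl.zero]; have := hu.1; have : 0 < e / (1+t) := by positivity
          linarith)
      (by
        intro s hs _ h0
        have hpos : 0 < e / (1 + t) / 2 := by positivity
        have h1 : (φ x s).2.2.2 ≤ P.ulo := by
          have := mul_pos hpos (show 0 < 1 + s by linarith [hs.1])
          linarith
        simp only [field, rawField, trunc, P.m_zero h1]
        simpa using hpos) t ⟨ht, le_rfl⟩
    have h2 : e / (1 + t) / 2 * (1 + t) = e / 2 := by field_simp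
    rw [h2] at this
    linarith
  · refine le_of_forall_pos_lt_add fun e he => ?_
    have := barrier_nonneg (h := fun s => 2 - (φ x s).2.2.2 + e / (1 + t) / 2 * (1 + s)) (a := 0) (b := t)
      (fun s _ => ((flow_deriv Fl x s).2.2.2.const_sub 2).add
        (((hasDerivAt_id s).const_add 1).const_mul _)) (by
          simp only [Fl.zero]; have := hu.2; have : 0 < e / (1+t) := by positivity
          linarith)
      (by
        intro s hs _ h0
        have hpos : 0 < e / (1 + t) / 2 := by positivity
        have h1 : 2 ≤ (φ x s).2.2.2 := by
          have := mul_pos hpos (show 0 < 1 + s by linarith [hs.1])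
          linarith
        have h3 := hc (φ x s) (by rw [flow_fst Fl]; exact hθ)
        simp only [field, rawField, trunc]
        rw [clamp_high P.ulo_lt.le h1] at h3 ⊢
        have h4 : ε * P.m (φ x s).2.2.2 * gq (clamp 0 2 (φ x s).2.1) 2 ≤ 0 := by
          have h5 := (clamp_mem (l := 0) (h := 2) (by norm_num) (φ x s).2.1).1
          have h6 := P.m_nonneg (φ x s).2.2.2
          refine mul_nonpos_of_nonneg_of_nonpos (by positivity) ?_
          unfold gq; linarith
        have h7 := div_nonpos_of_nonpos_of_nonneg h4 h3.le
        linarith) t ⟨ht, le_rfl⟩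
    have h2 : e / (1 + t) / 2 * (1 + t) = e / 2 := by field_simp
    rw [h2] at this
    linarith

theorem flow_orb {x : ℝ × ℝ × ℝ × ℝ} (hθ : x.1 ∈ Icc (0:ℝ) 1) {I : Set ℝ}
    (hq : ∀ t ∈ I, (φ x t).2.1 ∈ Icc (0:ℝ) 2) (hp : ∀ t ∈ I, (φ x t).2.2.1 ∈ Icc (-16:ℝ) 7)
    (hu : ∀ t ∈ I, (φ x t).2.2.2 ∈ Icc P.ulo 2) :
    P.Orb ε x.1 (fun t => (φ x t).2.1) (fun t => (φ x t).2.2.1) (fun t => (φ x t).2.2.2) I := by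
  have key : ∀ t ∈ I, P.field ε (φ x t) = (0, (φ x t).2.2.1,
      P.c x.1 (φ x t).2.2.2 * (φ x t).2.2.1 - (φ x t).2.1 * P.F (φ x t).2.1 (φ x t).2.2.2,
      P.du ε x.1 (φ x t).2.1 (φ x t).2.2.2) := by
    intro t ht
    simp only [field, rawField, trunc, clamp_eq (hq t ht), clamp_eq (hp t ht), clamp_eq (hu t ht),
      flow_fst Fl, clamp_eq hθ, du]
  refine ⟨fun t ht => ?_, fun t ht => ?_, fun t ht => ?_, hq, hp, hu⟩
  · have := (flow_deriv Fl x t).2.1; rwa [key t ht] at this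
  · have := (flow_deriv Fl x t).2.2.1; rwa [key t ht] at this
  · have := (flow_deriv Fl x t).2.2.2; rwa [key t ht] at this

end flow
end Par

namespace Par
open Set
variable (P : Par)

/-- The section `q = qL`, crossed upwards. -/
def S : Set (ℝ × ℝ × ℝ × ℝ) := {z | z.1 ∈ Icc (0:ℝ) 1 ∧ z.2.1 = P.qL ∧
  (0 < z.2.2.1 ∧ z.2.2.1 ≤ 3*P.qL) ∧ z.2.2.2 ∈ Icc P.ulo 2}
/-- The section `q = qH`, crossed downwards. -/
def S' : Set (ℝ × ℝ × ℝ × ℝ) := {z | z.1 ∈ Icc (0:ℝ) 1 ∧ z.2.1 = P.qH ∧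
  (-5*(3-P.qH) ≤ z.2.2.1 ∧ z.2.2.1 < 0) ∧ z.2.2.2 ∈ Icc P.ulo 2}
def Dn : Set (ℝ × ℝ × ℝ × ℝ) := {z | z.2.2.1 < 0 ∧ z.2.1 < P.qH}
def Dnc : Set (ℝ × ℝ × ℝ × ℝ) := {z | z.2.2.1 ≤ 0 ∧ z.2.1 ≤ P.qH}
def Up : Set (ℝ × ℝ × ℝ × ℝ) := {z | 0 < z.2.2.1 ∧ P.qL < z.2.1}
def Upc : Set (ℝ × ℝ × ℝ × ℝ) := {z | 0 ≤ z.2.2.1 ∧ P.qL ≤ z.2.1}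
/-- Points escaping to large `q`. -/
def A (φ : ℝ × ℝ × ℝ × ℝ → ℝ → ℝ × ℝ × ℝ × ℝ) : Set (ℝ × ℝ × ℝ × ℝ) :=
  {x | ∃ t, 0 ≤ t ∧ 2 < (φ x t).2.1 ∧ 0 < (φ x t).2.2.1 ∧ ∀ s ∈ Icc 0 t, φ x s ∉ P.Dnc}
/-- Points escaping to negative `q`. -/
def C (φ : ℝ × ℝ × ℝ × ℝ → ℝ → ℝ × ℝ × ℝ × ℝ) : Set (ℝ × ℝ × ℝ × ℝ) :=
  {x | ∃ t, 0 ≤ t ∧ 0 < (φ x t).2.1 ∧ (φ x t).2.2.1 < -(9/10) * (φ x t).2.1 ∧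
    ∀ s ∈ Icc 0 t, φ x s ∉ P.Upc}

theorem isOpen_Dn : IsOpen P.Dn := by
  simp only [Dn, ofPred_and]
  exact (isOpen_lt (by fun_prop) (by fun_prop)).inter (isOpen_lt (by fun_prop) (by fun_prop))
theorem isOpen_Up : IsOpen P.Up := by
  simp only [Up, ofPred_and]
  exact (isOpen_lt (by fun_prop) (by fun_prop)).inter (isOpen_lt (by fun_prop) (by fun_prop))
theorem isClosed_Dnc : IsClosed P.Dnc := by
  simp only [Dnc, ofPred_and]
  exact (isClosed_le (by fun_prop) (by fun_prop)).inter (isClosed_le (by fun_prop) (by fun_prop))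
theorem isClosed_Upc : IsClosed P.Upc := by
  simp only [Upc, ofPred_and]
  exact (isClosed_le (by fun_prop) (by fun_prop)).inter (isClosed_le (by fun_prop) (by fun_prop))
theorem Dn_subset : P.Dn ⊆ P.Dnc := fun _ h => ⟨h.1.le, h.2.le⟩
theorem Up_subset : P.Up ⊆ P.Upc := fun _ h => ⟨h.1.le, h.2.le⟩

theorem qL_lt_qH : P.qL < P.qH := by have := P.hqL'; have := P.hqH; linarith
theorem qH_lt_two : P.qH < 2 := by have := P.hqH'; have := P.hy1; linarith

theorem F_mem {q u : ℝ} (hq : q ∈ Icc (0:ℝ) 2) (hu : u ∈ Icc P.ulo 2) :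
    P.F q u ∈ Icc (-(17/20)) (77/100) := by
  have h1 := P.hulo; have h2 := P.hR'; have h3 := P.hκ
  have := hu.1; have := hu.2
  have h4 : 0 ≤ q*(2-q) := mul_nonneg hq.1 (by linarith [hq.2])
  have h5 : q*(2-q) ≤ 1 := by nlinarith [sq_nonneg (q-1)]
  have h6 : 0 ≤ 2*P.κ^2 := by positivity
  unfold F
  constructor <;> nlinarith [mul_nonneg h6 h4, mul_le_mul_of_nonneg_left h5 h6]

theorem field_p {ε : ℝ} (z : ℝ × ℝ × ℝ × ℝ) : ∃ cv ∈ Icc (1/10:ℝ) 2,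
    ∃ Fv ∈ Icc (-(17/20):ℝ) (77/100), (P.field ε z).2.2.1 =
      cv * clamp (-16) 7 z.2.2.1 - clamp 0 2 z.2.1 * Fv ∧ (2 ≤ z.2.1 → Fv ≤ -(1/10)) := by
  have hθ := clamp_mem (l := 0) (h := 1) (by norm_num) z.1
  have hu := clamp_mem P.ulo_lt.le z.2.2.2
  refine ⟨_, ⟨P.le_c hθ hu.1, P.c_le hθ hu.2⟩, _,
    P.F_mem (clamp_mem (l := 0) (h := 2) (by norm_num) z.2.1) hu, rfl, fun h => ?_⟩
  rw [clamp_high (by norm_num) h]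
  unfold F; linarith [hu.2]

theorem clamp_pos {x : ℝ} : 0 < clamp (-16) 7 x ↔ 0 < x := by
  unfold clamp; rw [lt_max_iff, lt_min_iff]; constructor
  · rintro (h | h); · norm_num at h
    exact h.2
  · intro h; right; exact ⟨by norm_num, h⟩
theorem clamp_neg {x : ℝ} : clamp (-16) 7 x < 0 ↔ x < 0 := by
  unfold clamp; rw [max_lt_iff, min_lt_iff]; constructor
  · rintro ⟨-, h | h⟩; · norm_num at h
    exact h
  · intro h; exact ⟨by norm_num, Or.inr h⟩
theorem clamp_le_of_nonneg {h x : ℝ} (l : ℝ) (hl : l ≤ 0) (hx : 0 ≤ x) : clamp l h x ≤ x := by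
  unfold clamp; exact max_le (hl.trans hx) (min_le_right _ _)
theorem le_clamp_of_nonpos {l x : ℝ} (h : ℝ) (hh : 0 ≤ h) (hx : x ≤ 0) : x ≤ clamp l h x := by
  unfold clamp; exact le_max_of_le_right (le_min (hx.trans hh) le_rfl)
theorem clamp_zero : clamp (-16) 7 0 = 0 := clamp_eq ⟨by norm_num, by norm_num⟩
theorem clamp_le_zero {x : ℝ} : clamp (-16) 7 x ≤ 0 ↔ x ≤ 0 := by
  rw [← not_lt, clamp_pos, not_lt]
theorem clamp_ge_zero {x : ℝ} : 0 ≤ clamp (-16) 7 x ↔ 0 ≤ x := by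
  rw [← not_lt, clamp_neg, not_lt]

variable {P} {ε : ℝ} {φ : ℝ × ℝ × ℝ × ℝ → ℝ → ℝ × ℝ × ℝ × ℝ} (Fl : IsFlow (P.field ε) φ)
include Fl

theorem flow_dq (x : ℝ × ℝ × ℝ × ℝ) (t : ℝ) :
    HasDerivAt (fun t => (φ x t).2.1) (clamp (-16) 7 (φ x t).2.2.1) t := (flow_deriv Fl x t).2.1

theorem flow_dp (x : ℝ × ℝ × ℝ × ℝ) (t : ℝ) :
    HasDerivAt (fun t => (φ x t).2.2.1) (P.field ε (φ x t)).2.2.1 t := (flow_deriv Fl x t).2.2.1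

/-- Once `q ≥ 2` and `p ≥ 0`, the orbit runs off. -/
theorem run_off {x : ℝ × ℝ × ℝ × ℝ} {t₀ : ℝ} (hq : 2 ≤ (φ x t₀).2.1) (hp : 0 ≤ (φ x t₀).2.2.1) :
    ∀ t, t₀ < t → 2 < (φ x t).2.1 ∧ 0 < (φ x t).2.2.1 := by
  intro t ht
  have hq2 : ∀ s ∈ Icc t₀ t, (∀ τ ∈ Icc t₀ s, 0 ≤ (φ x τ).2.2.1) → 2 ≤ (φ x s).2.1 := by
    intro s hs h
    have := le_of_deriv_ge (C := 0) hs.1 (fun τ _ => flow_dq Fl x τ)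
      (fun τ hτ => clamp_ge_zero.mpr (h τ hτ))
    linarith
  have hpp := barrier (fun s (_ : s ∈ Icc t₀ t) => flow_dp Fl x s) hp (by
    intro s hs h h0
    obtain ⟨cv, -, Fv, -, h1, h2⟩ := P.field_p (ε := ε) (φ x s)
    have h3 := hq2 s hs h
    rw [h1, h0, clamp_zero, clamp_high (by norm_num) h3]
    linarith [h2 h3])
  have hpp' : ∀ τ ∈ Icc t₀ t, 0 ≤ (φ x τ).2.2.1 := fun τ hτ => by
    rcases hτ.1.eq_or_lt with h | h
    · rw [← h]; exact hp
    · exact (hpp τ ⟨h, hτ.2⟩).le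
  refine ⟨?_, hpp t ⟨ht, le_rfl⟩⟩
  have := strictMonoOn_of_deriv_pos (convex_Icc t₀ t)
    (fun s _ => (flow_dq Fl x s).continuousAt.continuousWithinAt) (fun s hs => by
      rw [interior_Icc] at hs
      rw [(flow_dq Fl x s).deriv]
      exact clamp_pos.mpr (hpp s ⟨hs.1, hs.2.le⟩)) ⟨le_rfl, ht.le⟩ ⟨ht.le, le_rfl⟩ ht
  simp only at this
  linarith

theorem A_not_Dnc {x : ℝ × ℝ × ℝ × ℝ} (hA : x ∈ P.A φ) {t : ℝ} (ht : 0 ≤ t) : φ x t ∉ P.Dnc := by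
  obtain ⟨t₀, h0, h1, h2, h3⟩ := hA
  rcases le_or_gt t t₀ with h | h
  · exact h3 t ⟨ht, h⟩
  · intro hD
    have := (run_off Fl h1.le h2.le t h).1
    have := hD.2
    have := P.qH_lt_two
    linarith

theorem neg_forever {x : ℝ × ℝ × ℝ × ℝ} {t₀ : ℝ} (hq : 0 < (φ x t₀).2.1)
    (hp : (φ x t₀).2.2.1 < -(9/10) * (φ x t₀).2.1) : ∀ t, t₀ ≤ t → (φ x t).2.2.1 < 0 := by
  by_contra hcon
  push Not at hcon
  obtain ⟨t, ht, hpt⟩ := hcon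
  have hc : ∀ I, ContinuousOn (fun s => -(φ x s).2.2.1) I := fun I s _ =>
    (flow_dp Fl x s).neg.continuousAt.continuousWithinAt
  obtain ⟨t₁, ht₁, hz, hbef⟩ := exists_first_zero ht (hc _) (by simp; linarith)
    (by simp; linarith)
  have hneg : ∀ s ∈ Icc t₀ t₁, (φ x s).2.2.1 ≤ 0 := by
    intro s hs
    rcases hs.2.eq_or_lt with h | h
    · rw [h]; linarith
    · linarith [hbef s ⟨hs.1, h⟩]
  have hh := nonneg_of_deriv_ge (h := fun s => -(φ x s).2.2.1 - 9/10 * (φ x s).2.1) (K := 3)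
    (a := t₀) (b := t₁)
    (fun s _ => (flow_dp Fl x s).neg.sub ((flow_dq Fl x s).const_mul (9/10))) (by linarith)
    (by
      intro s hs h
      obtain ⟨cv, hcv, Fv, hFv, h1, -⟩ := P.field_p (ε := ε) (φ x s)
      rw [h1]
      have hp0 := hneg s hs
      have hq0 : 0 < (φ x s).2.1 := by linarith
      have hq2 : 0 ≤ clamp 0 2 (φ x s).2.1 ∧ clamp 0 2 (φ x s).2.1 ≤ (φ x s).2.1 :=
        ⟨(clamp_mem (by norm_num) _).1, clamp_le_of_nonneg _ le_rfl hq0.le⟩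
      have hp2 := clamp_le_zero.mpr hp0
      have hcc : clamp (-16) 7 (φ x s).2.2.1 = (φ x s).2.2.1 ∨ (clamp (-16) 7 (φ x s).2.2.1 = -16) := by
        rcases le_or_gt (-16) (φ x s).2.2.1 with h | h
        · exact Or.inl (clamp_eq ⟨h, by linarith⟩)
        · exact Or.inr (clamp_low h.le)
      have hFq : -(17/20) * clamp 0 2 (φ x s).2.1 ≤ clamp 0 2 (φ x s).2.1 * Fv := by
        nlinarith [hFv.1, hq2.1]
      rcases hcc with h4 | h4
      · rw [h4]; nlinarith [hcv.1, hcv.2, hq2.2]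
      · rw [h4]
        have := (clamp_mem (l := 0) (h := 2) (by norm_num) (φ x s).2.1).2
        nlinarith [hcv.1, hcv.2, hq2.2])
  have hpos := pos_of_deriv_ge (h := fun s => -(φ x s).2.2.1) (K := 2) (a := t₀) (b := t₁)
    (fun s _ => (flow_dp Fl x s).neg) (by linarith) (by
      intro s hs h
      obtain ⟨cv, hcv, Fv, hFv, h1, -⟩ := P.field_p (ε := ε) (φ x s)
      rw [h1]
      have h2 := hh s hs
      have hp2 := clamp_le_zero.mpr (show (φ x s).2.2.1 ≤ 0 by linarith)
      have hq2 : 0 ≤ clamp 0 2 (φ x s).2.1 := (clamp_mem (by norm_num) _).1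
      have hq3 : clamp 0 2 (φ x s).2.1 ≤ 10/9 * (-(φ x s).2.2.1) := by
        unfold clamp; exact max_le (by linarith) ((min_le_right _ _).trans (by linarith))
      nlinarith [hFv.1, hcv.1, mul_nonneg (show 0 ≤ cv by linarith [hcv.1]) (show 0 ≤ -clamp (-16) 7 (φ x s).2.2.1 by linarith)])
  have := hpos t₁ ⟨ht₁.1.le, le_rfl⟩
  linarith

theorem C_not_Upc {x : ℝ × ℝ × ℝ × ℝ} (hC : x ∈ P.C φ) {t : ℝ} (ht : 0 ≤ t) : φ x t ∉ P.Upc := by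
  obtain ⟨t₀, h0, h1, h2, h3⟩ := hC
  rcases le_or_gt t t₀ with h | h
  · exact h3 t ⟨ht, h⟩
  · intro hD
    have := neg_forever Fl h1 h2 t h.le
    have := hD.1
    linarith

theorem isOpen_A : IsOpen (P.A φ) := by
  rw [isOpen_iff_mem_nhds]
  rintro x ⟨t, h0, h1, h2, h3⟩
  have hc := Fl.continuous_left t
  filter_upwards [Fl.eventually_avoid P.isClosed_Dnc h3,
    ((by fun_prop : Continuous fun y => (φ y t).2.1).tendsto x).eventually (lt_mem_nhds h1),
    ((by fun_prop : Continuous fun y => (φ y t).2.2.1).tendsto x).eventually (lt_mem_nhds h2)]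
    with y h4 h5 h6 using ⟨t, h0, h5, h6, h4⟩

theorem isOpen_C : IsOpen (P.C φ) := by
  rw [isOpen_iff_mem_nhds]
  rintro x ⟨t, h0, h1, h2, h3⟩
  have hc := Fl.continuous_left t
  filter_upwards [Fl.eventually_avoid P.isClosed_Upc h3,
    ((by fun_prop : Continuous fun y => (φ y t).2.1).tendsto x).eventually (lt_mem_nhds h1),
    ((by fun_prop : Continuous fun y => -(9/10)*(φ y t).2.1 - (φ y t).2.2.1).tendsto x).eventually
      (lt_mem_nhds (show 0 < -(9/10)*(φ x t).2.1 - (φ x t).2.2.1 by linarith))]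
    with y h4 h5 h6 using ⟨t, h0, h5, by linarith, h4⟩

end Par

namespace Par
open Set

theorem nonneg_at_end {h : ℝ → ℝ} {a b : ℝ} (hab : a < b) (hc : ContinuousAt h b)
    (hh : ∀ t ∈ Ico a b, 0 ≤ h t) : ∀ t ∈ Icc a b, 0 ≤ h t := by
  intro t ht
  rcases ht.2.eq_or_lt with rfl | hlt
  · refine ge_of_tendsto (hc.tendsto.mono_left (nhdsWithin_le_nhds (s := Iio t))) ?_
    filter_upwards [Ioo_mem_nhdsLT hab] with s hs using hh s ⟨hs.1.le, hs.2⟩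
  · exact hh t ⟨ht.1, hlt⟩

variable {P : Par} {ε : ℝ} {φ : ℝ × ℝ × ℝ × ℝ → ℝ → ℝ × ℝ × ℝ × ℝ} (Fl : IsFlow (P.field ε) φ)
include Fl

theorem p_le_of_q_mem {x : ℝ × ℝ × ℝ × ℝ} {T : ℝ} (hq : ∀ t ∈ Icc 0 T, (φ x t).2.1 ∈ Icc 0 2)
    (h0 : x.2.2.1 ≤ 3 * x.2.1) : ∀ t ∈ Icc 0 T, (φ x t).2.2.1 ≤ 3 * (φ x t).2.1 := by
  have := nonneg_of_deriv_ge (h := fun s => 3 * (φ x s).2.1 - (φ x s).2.2.1) (K := 0)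
    (a := 0) (b := T) (fun s _ => ((flow_dq Fl x s).const_mul 3).sub (flow_dp Fl x s))
    (by simp only [Fl.zero]; linarith) (by
      intro s hs h
      obtain ⟨cv, hcv, Fv, hFv, h1, -⟩ := P.field_p (ε := ε) (φ x s)
      have hqs := hq s hs
      rw [h1, clamp_eq hqs]
      have h2 : 3 * (φ x s).2.1 ≤ clamp (-16) 7 (φ x s).2.2.1 :=
        le_max_of_le_right (le_min (by linarith [hqs.2]) (by linarith))
      nlinarith [hcv.1, hcv.2, hqs.1, hFv.1])
  intro t ht
  linarith [this t ht]

theorem le_p_of_q_mem {x : ℝ × ℝ × ℝ × ℝ} {T : ℝ} (hq : ∀ t ∈ Icc 0 T, (φ x t).2.1 ∈ Icc 0 2)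
    (h0 : -5 * (3 - x.2.1) ≤ x.2.2.1) : ∀ t ∈ Icc 0 T, -5 * (3 - (φ x t).2.1) ≤ (φ x t).2.2.1 := by
  have := nonneg_of_deriv_ge (h := fun s => (φ x s).2.2.1 + 15 - 5 * (φ x s).2.1) (K := 0)
    (a := 0) (b := T)
    (fun s _ => ((flow_dp Fl x s).add_const 15).sub ((flow_dq Fl x s).const_mul 5))
    (by simp only [Fl.zero]; linarith) (by
      intro s hs h
      obtain ⟨cv, hcv, Fv, hFv, h1, -⟩ := P.field_p (ε := ε) (φ x s)
      have hqs := hq s hs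
      rw [h1, clamp_eq hqs]
      have h2 : clamp (-16) 7 (φ x s).2.2.1 ≤ -15 + 5 * (φ x s).2.1 :=
        max_le (by linarith [hqs.1]) ((min_le_right _ _).trans (by linarith))
      nlinarith [hcv.1, hcv.2, hqs.1, hqs.2, hFv.1, hFv.2])
  intro t ht
  linarith [this t ht]

theorem S_orb_of_le (hε : 0 < ε) {x : ℝ × ℝ × ℝ × ℝ} (hx : x ∈ P.S) {T : ℝ}
    (hT : 0 < T) (hD : ∀ t ∈ Ico 0 T, φ x t ∉ P.Dnc) (hq2 : ∀ t ∈ Icc 0 T, (φ x t).2.1 ≤ 2) :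
    P.Orb ε x.1 (fun t => (φ x t).2.1) (fun t => (φ x t).2.2.1) (fun t => (φ x t).2.2.2) (Icc 0 T) ∧
    (∀ t ∈ Icc 0 T, P.qL ≤ (φ x t).2.1) ∧ (∀ t ∈ Icc 0 T, (φ x t).2.2.1 ≤ 3 * (φ x t).2.1) ∧
    (∀ t ∈ Icc 0 T, -5 * (3 - (φ x t).2.1) ≤ (φ x t).2.2.1) := by
  obtain ⟨hθ, hxq, hxp, hxu⟩ := hx
  have hpp : ∀ t ∈ Ico 0 T, (φ x t).2.1 ≤ P.qH → 0 < (φ x t).2.2.1 := by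
    intro t ht hq
    by_contra h
    exact hD t ht ⟨not_lt.mp h, hq⟩
  have hqL := P.hqL
  have hqLH := P.qL_lt_qH
  have hq1 : ∀ t ∈ Icc 0 T, P.qL ≤ (φ x t).2.1 := by
    have := nonneg_at_end (h := fun s => (φ x s).2.1 - P.qL) hT
      ((flow_dq Fl x T).sub_const _).continuousAt (by
        intro t ht
        refine nonneg_of_deriv_ge (h := fun s => (φ x s).2.1 - P.qL) (K := 0) (a := 0) (b := t)
          (fun s _ => (flow_dq Fl x s).sub_const _) (by simp [Fl.zero, hxq]) (by
            intro s hs h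
            have := hpp s ⟨hs.1, hs.2.trans_lt ht.2⟩ (by linarith)
            have := clamp_ge_zero.mpr this.le
            linarith) t ⟨ht.1, le_rfl⟩)
    intro t ht; linarith [this t ht]
  have hq : ∀ t ∈ Icc 0 T, (φ x t).2.1 ∈ Icc (0:ℝ) 2 := fun t ht =>
    ⟨hqL.le.trans (hq1 t ht), hq2 t ht⟩
  have h3 := p_le_of_q_mem Fl hq (by rw [hxq]; exact hxp.2)
  have h5 := le_p_of_q_mem Fl hq (by rw [hxq]; have := P.hqL'; linarith [hxp.1])
  refine ⟨flow_orb Fl hθ hq (fun t ht => ⟨?_, ?_⟩) (fun t ht => flow_u_mem Fl hθ hxu hε ht.1),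
    hq1, h3, h5⟩
  · linarith [h5 t ht, hq1 t ht]
  · linarith [h3 t ht, hq2 t ht]

/-- Orbits from `S` that have not escaped stay in the box until they reach `Dnc`. -/
theorem S_orb (hε : 0 < ε) {x : ℝ × ℝ × ℝ × ℝ} (hx : x ∈ P.S) (hA : x ∉ P.A φ) {T : ℝ}
    (hT : 0 < T) (hD : ∀ t ∈ Ico 0 T, φ x t ∉ P.Dnc) :
    P.Orb ε x.1 (fun t => (φ x t).2.1) (fun t => (φ x t).2.2.1) (fun t => (φ x t).2.2.2) (Icc 0 T) ∧
    (∀ t ∈ Icc 0 T, P.qL ≤ (φ x t).2.1) ∧ (∀ t ∈ Icc 0 T, (φ x t).2.2.1 ≤ 3 * (φ x t).2.1) ∧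
    (∀ t ∈ Icc 0 T, -5 * (3 - (φ x t).2.1) ≤ (φ x t).2.2.1) := by
  refine S_orb_of_le Fl hε hx hT hD ?_
  obtain ⟨hθ, hxq, hxp, hxu⟩ := hx
  intro t ht
  by_contra hcon
  push Not at hcon
  obtain ⟨t₁, ht₁, hz, hbef⟩ := exists_first_zero (f := fun s => 2 - (φ x s).2.1) ht.1
    (fun s _ => ((flow_dq Fl x s).const_sub 2).continuousAt.continuousWithinAt)
    (by simp only [Fl.zero, hxq]; have := P.hqL'; linarith) (by linarith)
  have h1 := deriv_nonpos_of_first ((flow_dq Fl x t₁).const_sub 2) ht₁.1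
    (fun s hs => (hbef s hs).le) hz.le
  have h2 : 0 ≤ (φ x t₁).2.2.1 := clamp_ge_zero.mp (by linarith)
  have h3 := run_off Fl (show 2 ≤ (φ x t₁).2.1 by linarith) h2
  refine hA ⟨t₁ + 1, by linarith [ht₁.1], (h3 _ (by linarith)).1, (h3 _ (by linarith)).2, ?_⟩
  intro s hs hsD
  have := P.qH_lt_two
  rcases lt_trichotomy s t₁ with h | h | h
  · exact hD s ⟨hs.1, h.trans_le (ht₁.2.trans ht.2)⟩ hsD
  · have := hsD.2; rw [h] at this; linarith
  · have := hsD.2; linarith [(h3 s h).1]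

theorem S'_orb_of_le (hε : 0 < ε) {x : ℝ × ℝ × ℝ × ℝ} (hx : x ∈ P.S') {T : ℝ}
    (hT : 0 < T) (hD : ∀ t ∈ Ico 0 T, φ x t ∉ P.Upc)
    (hCb : ∀ t ∈ Ico 0 T, 0 < (φ x t).2.1 → -(9/10) * (φ x t).2.1 ≤ (φ x t).2.2.1) :
    P.Orb ε x.1 (fun t => (φ x t).2.1) (fun t => (φ x t).2.2.1) (fun t => (φ x t).2.2.2) (Icc 0 T) ∧
    (∀ t ∈ Icc 0 T, 0 < (φ x t).2.1) ∧ (∀ t ∈ Icc 0 T, (φ x t).2.1 ≤ P.qH) ∧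
    (∀ t ∈ Icc 0 T, (φ x t).2.2.1 ≤ 3 * (φ x t).2.1) ∧
    (∀ t ∈ Icc 0 T, -(9/10) * (φ x t).2.1 ≤ (φ x t).2.2.1) := by
  obtain ⟨hθ, hxq, hxp, hxu⟩ := hx
  have hqL := P.hqL
  have hqLH := P.qL_lt_qH
  have hq2 : ∀ t ∈ Icc 0 T, (φ x t).2.1 ≤ P.qH := by
    have := nonneg_at_end (h := fun s => P.qH - (φ x s).2.1) hT
      ((flow_dq Fl x T).const_sub _).continuousAt (by
        intro t ht
        refine nonneg_of_deriv_ge (h := fun s => P.qH - (φ x s).2.1) (K := 0) (a := 0) (b := t)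
          (fun s _ => (flow_dq Fl x s).const_sub _) (by simp [Fl.zero, hxq]) (by
            intro s hs h
            have : (φ x s).2.2.1 ≤ 0 := by
              by_contra hh
              exact hD s ⟨hs.1, hs.2.trans_lt ht.2⟩ ⟨(not_le.mp hh).le, by linarith⟩
            have := clamp_le_zero.mpr this
            linarith) t ⟨ht.1, le_rfl⟩)
    intro t ht; linarith [this t ht]
  have key : ∀ s, 0 < (φ x s).2.1 → -(9/10) * (φ x s).2.1 ≤ (φ x s).2.2.1 →
      -(9/10) * (φ x s).2.1 ≤ clamp (-16) 7 (φ x s).2.2.1 := by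
    intro s h1 h2
    rcases le_or_gt 0 (φ x s).2.2.1 with h | h
    · have := clamp_ge_zero.mpr h; linarith
    · exact h2.trans (le_clamp_of_nonpos _ (by norm_num) h.le)
  have hpos0 : 0 < (φ x 0).2.1 := by simp only [Fl.zero, hxq]; linarith
  have hq0 : ∀ t ∈ Ico 0 T, 0 < (φ x t).2.1 := by
    intro t ht
    exact pos_of_deriv_ge (K := 9/10) (a := 0) (b := t) (fun s _ => flow_dq Fl x s) hpos0
      (fun s hs h => by
        have := key s h (hCb s ⟨hs.1, hs.2.trans_lt ht.2⟩ h)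
        linarith) t ⟨ht.1, le_rfl⟩
  have hC1 : ∀ t ∈ Icc 0 T, 0 ≤ (φ x t).2.2.1 + 9/10 * (φ x t).2.1 :=
    nonneg_at_end (h := fun s => (φ x s).2.2.1 + 9/10 * (φ x s).2.1) hT
      ((flow_dp Fl x T).add ((flow_dq Fl x T).const_mul _)).continuousAt
      (fun t ht => by linarith [hCb t ht (hq0 t ht)])
  have hq1 : ∀ t ∈ Icc 0 T, 0 < (φ x t).2.1 :=
    pos_of_deriv_ge (K := 9/10) (fun s _ => flow_dq Fl x s) hpos0
      (fun s hs h => by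
        have := key s h (by linarith [hC1 s hs])
        linarith)
  have hqH := P.qH_lt_two
  have hq : ∀ t ∈ Icc 0 T, (φ x t).2.1 ∈ Icc (0:ℝ) 2 := fun t ht =>
    ⟨(hq1 t ht).le, (hq2 t ht).trans hqH.le⟩
  have h3 := p_le_of_q_mem Fl hq (by rw [hxq]; linarith [hxp.2])
  refine ⟨flow_orb Fl hθ hq (fun t ht => ⟨?_, ?_⟩) (fun t ht => flow_u_mem Fl hθ hxu hε ht.1),
    hq1, hq2, h3, fun t ht => by linarith [hC1 t ht]⟩
  · linarith [hC1 t ht, hq2 t ht]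
  · linarith [h3 t ht, hq2 t ht]

/-- Orbits from `S'` that have not escaped stay in the box until they reach `Upc`. -/
theorem S'_orb (hε : 0 < ε) {x : ℝ × ℝ × ℝ × ℝ} (hx : x ∈ P.S') (hC : x ∉ P.C φ) {T : ℝ}
    (hT : 0 < T) (hD : ∀ t ∈ Ico 0 T, φ x t ∉ P.Upc) :
    P.Orb ε x.1 (fun t => (φ x t).2.1) (fun t => (φ x t).2.2.1) (fun t => (φ x t).2.2.2) (Icc 0 T) ∧
    (∀ t ∈ Icc 0 T, 0 < (φ x t).2.1) ∧ (∀ t ∈ Icc 0 T, (φ x t).2.1 ≤ P.qH) ∧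
    (∀ t ∈ Icc 0 T, (φ x t).2.2.1 ≤ 3 * (φ x t).2.1) ∧
    (∀ t ∈ Icc 0 T, -(9/10) * (φ x t).2.1 ≤ (φ x t).2.2.1) :=
  S'_orb_of_le Fl hε hx hT hD fun t ht hq => by
    by_contra h
    exact hC ⟨t, ht.1, hq, not_le.mp h, fun s hs => hD s ⟨hs.1, hs.2.trans_lt ht.2⟩⟩

end Par

namespace Par
open Set

theorem exists_margin {X : Type*} [TopologicalSpace X] {K : Set X} (hK : IsCompact K) {f g : X → ℝ}
    (hf : Continuous f) (hg : Continuous g) (h : ∀ z ∈ K, 0 ≤ g z → 0 < f z) :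
    ∃ η > 0, ∀ z ∈ K, -η ≤ g z → η ≤ f z := by
  rcases K.eq_empty_or_nonempty with rfl | hne
  · exact ⟨1, one_pos, by simp⟩
  obtain ⟨z, hz, hmin⟩ := hK.exists_isMinOn hne ((hf.max hg.neg).continuousOn)
  have hpos : 0 < max (f z) (-g z) := by
    rcases le_or_gt 0 (g z) with h1 | h1
    · exact lt_max_of_lt_left (h z hz h1)
    · exact lt_max_of_lt_right (by linarith)
  refine ⟨max (f z) (-g z) / 2, by positivity, fun w hw hgw => ?_⟩
  have h1 : max (f z) (-g z) ≤ max (f w) (-g w) := hmin hw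
  rcases le_max_iff.mp h1 with h2 | h2 <;> linarith

variable (P : Par)

/-- The potential: `∂Phi/∂q = q F`. -/
def Phi (q u : ℝ) : ℝ := (u - 21/10)*q^2/2 + 2*P.κ^2*(2*q^3/3 - q^4/4)

def box : Set (ℝ × ℝ × ℝ) := Icc 0 2 ×ˢ Icc (-16) 7 ×ˢ Icc P.ulo 2

theorem isCompact_box : IsCompact P.box :=
  isCompact_Icc.prod (isCompact_Icc.prod isCompact_Icc)

variable {P} {ε θ : ℝ} {q p u : ℝ → ℝ}

theorem Orb.mem_box {I : Set ℝ} (h : P.Orb ε θ q p u I) {t : ℝ} (ht : t ∈ I) :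
    (q t, p t, u t) ∈ P.box := ⟨h.hq t ht, h.hp t ht, h.hu t ht⟩

theorem Orb.dPhi {I : Set ℝ} (h : P.Orb ε θ q p u I) {t : ℝ} (ht : t ∈ I) :
    HasDerivAt (fun t => P.Phi (q t) (u t))
      (q t * P.F (q t) (u t) * p t + q t^2/2 * P.du ε θ (q t) (u t)) t := by
  unfold Phi
  have hq := h.dq t ht
  have hu := h.du t ht
  refine (((((hu.sub_const (21/10)).mul (hq.pow 2)).div_const 2).add
    ((((hq.pow 3).const_mul 2).div_const 3).sub ((hq.pow 4).div_const 4) |>.const_mul (2*P.κ^2)))).congr_deriv ?_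
  simp only [Pi.pow_apply]
  unfold F; push_cast; ring

theorem Orb.dE {I : Set ℝ} (h : P.Orb ε θ q p u I) {t : ℝ} (ht : t ∈ I) :
    HasDerivAt (fun t => p t^2/2 + P.Phi (q t) (u t))
      (P.c θ (u t) * p t^2 + q t^2/2 * P.du ε θ (q t) (u t)) t := by
  refine ((((h.dp t ht).pow 2).div_const 2).add (h.dPhi ht)).congr_deriv ?_
  push_cast; ring

theorem Orb.dF {I : Set ℝ} (h : P.Orb ε θ q p u I) {t : ℝ} (ht : t ∈ I) :
    HasDerivAt (fun t => P.F (q t) (u t))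
      (P.du ε θ (q t) (u t) + 4*P.κ^2*(1-q t)*p t) t := by
  unfold F
  refine (((h.du t ht).sub_const (21/10)).add
    (((h.dq t ht).const_mul (2*P.κ^2)).mul ((h.dq t ht).const_sub 2))).congr_deriv ?_
  ring

theorem abs_Phi_le {q u : ℝ} (hq : q ∈ Icc (0:ℝ) 2) (hu : u ∈ Icc P.ulo 2) : |P.Phi q u| ≤ 8 := by
  have h1 := P.hulo; have h2 := P.hR'; have h3 := P.hκ
  have hu1 := hu.1; have hu2 := hu.2
  have hq1 := hq.1; have hq2 := hq.2
  have h4 : 0 ≤ 2*q^3/3 - q^4/4 ∧ 2*q^3/3 - q^4/4 ≤ 6 := by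
    have : q^3 ≤ 2^3 := by gcongr
    have : 0 ≤ q^3 := by positivity
    constructor <;> nlinarith
  have h5 : 0 ≤ q^2 ∧ q^2 ≤ 4 := ⟨by positivity, by nlinarith⟩
  have h6 : 0 ≤ 2*P.κ^2 := by positivity
  unfold Phi
  rw [abs_le]; constructor <;> nlinarith [mul_nonneg h6 h4.1, mul_le_mul_of_nonneg_left h4.2 h6]

/-- Away from the rest points of the fast system an orbit spends a bounded time. -/
theorem time_bound (P : Par) {η : ℝ} (hη : 0 < η) : ∃ T > 0, ∀ᶠ ε in 𝓝[>] (0:ℝ),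
    ∀ θ ∈ Icc (0:ℝ) 1, ∀ (q p u : ℝ → ℝ) (a b : ℝ), a ≤ b → P.Orb ε θ q p u (Icc a b) →
    (∀ t ∈ Icc a b, t - a ≤ T + 1 → η ≤ p t^2 + (q t * P.F (q t) (u t))^2) → b - a ≤ T := by
  refine ⟨400*640/η, by positivity, ?_⟩
  filter_upwards [Ioo_mem_nhdsGT (show 0 < η/64000 by positivity)] with ε hε θ hθ q p u a b hab ho hw
  set T := 400*640/η with hT
  have hT0 : 0 < T := by positivity
  by_contra hcon
  push Not at hcon
  set b' := min b (a + T + 1)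
  have hb1 : b' ≤ b := min_le_left _ _
  have hb2 : a + T < b' := lt_min (by linarith) (by linarith)
  have hab' : a ≤ b' := by linarith
  have hb3 : b' ≤ a + T + 1 := min_le_right _ _
  replace ho := ho.mono (Icc_subset_Icc_right hb1)
  have hN : ∀ t ∈ Icc a b', |p t^2/2 + P.Phi (q t) (u t) - 1/160 * (p t * (q t * P.F (q t) (u t)))| ≤ 199 := by
    intro t ht
    have h1 := abs_le.mp (abs_Phi_le (ho.hq t ht) (ho.hu t ht))
    have h2 := ho.hp t ht
    have h3 := ho.hq t ht
    have h4 := P.F_mem h3 (ho.hu t ht)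
    have h5 : |q t * P.F (q t) (u t)| ≤ 2 := by
      rw [abs_mul, abs_of_nonneg h3.1]
      have : |P.F (q t) (u t)| ≤ 1 := abs_le.mpr ⟨by linarith [h4.1], by linarith [h4.2]⟩
      nlinarith [h3.1, h3.2, abs_nonneg (P.F (q t) (u t))]
    have h6 : |p t * (q t * P.F (q t) (u t))| ≤ 16 * 2 := by
      rw [abs_mul]
      exact mul_le_mul (abs_le.mpr ⟨h2.1, by linarith [h2.2]⟩) h5 (abs_nonneg _) (by norm_num)
    have h7 : p t^2 ≤ 256 := by nlinarith [h2.1, h2.2]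
    have h8 := abs_le.mp h6
    rw [abs_le]; constructor
    · nlinarith [sq_nonneg (p t)]
    · linarith
  have hder : ∀ t (ht : t ∈ Icc a b'), HasDerivAt
      (fun t => p t^2/2 + P.Phi (q t) (u t) - 1/160 * (p t * (q t * P.F (q t) (u t)))) _ t :=
    fun t ht => (ho.dE ht).sub ((((ho.dp t ht).mul ((ho.dq t ht).mul (ho.dF ht)))).const_mul (1/160))
  have := le_of_deriv_ge (C := η/640) hab' hder (by
    intro t ht
    have h1 := P.le_c hθ (ho.hu t ht).1
    have h1' := P.c_le hθ (ho.hu t ht).2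
    have h2 := ho.hp t ht
    have h3 := ho.hq t ht
    have hu := ho.hu t ht
    have h4 := P.F_mem h3 (ho.hu t ht)
    have h5 := abs_le.mp (P.abs_du_le hθ hε.1.le h3 (ho.hu t ht))
    have h6 := hw t ⟨ht.1, ht.2.trans hb1⟩ (by linarith [ht.2])
    set f := q t * P.F (q t) (u t) with hf
    set cv := P.c θ (u t)
    set dv := P.du ε θ (q t) (u t)
    have hfq : P.F (q t) (u t) + q t * (4*P.κ^2*(1-q t)) ≤ 11/10 := by
      have h7 := P.hR'; have := P.hκ
      unfold F
      nlinarith [sq_nonneg (q t - 2/3), mul_nonneg (show 0 ≤ 2*P.κ^2 by positivity) (sq_nonneg (3*q t - 2)), hu.2]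
    have e1 : -(80*ε) ≤ q t^2/2*dv := by
      have : 0 ≤ q t^2 ∧ q t^2 ≤ 4 := ⟨by positivity, by nlinarith [h3.1, h3.2]⟩
      nlinarith [hε.1]
    have hqd : |p t * q t * dv| ≤ 16*2*(40*ε) := by
      rw [abs_mul, abs_mul]
      refine mul_le_mul (mul_le_mul (abs_le.mpr ⟨h2.1, by linarith [h2.2]⟩) (abs_le.mpr ⟨by linarith [h3.1], h3.2⟩) (abs_nonneg _) (by norm_num)) (abs_le.mpr h5) (abs_nonneg _) (by norm_num)
    have e2 := (abs_le.mp hqd).2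
    have e3 : (P.F (q t) (u t) + q t * (4*P.κ^2*(1-q t))) * p t^2 ≤ 11/10 * p t^2 :=
      mul_le_mul_of_nonneg_right hfq (sq_nonneg _)
    have e4 : cv * (p t * f) ≤ 2 * p t^2 + f^2/2 := by
      have h8 : p t * f ≤ p t^2 + f^2/4 := by nlinarith [sq_nonneg (p t - f/2)]
      have : 0 ≤ p t^2 + f^2/4 := by positivity
      nlinarith
    have e5 : 1/10 * p t^2 ≤ cv * p t^2 := mul_le_mul_of_nonneg_right h1 (sq_nonneg _)
    have hε2 := hε.2
    simp only [Pi.mul_apply, ← hf]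
    have : ε * 64000 < η := by rwa [lt_div_iff₀ (by norm_num)] at hε2
    nlinarith [sq_nonneg (p t), sq_nonneg f])
  have h1 := abs_le.mp (hN a ⟨le_rfl, hab'⟩)
  have h2 := abs_le.mp (hN b' ⟨hab', le_rfl⟩)
  have h3 : η/640 * T ≤ η/640 * (b' - a) := by gcongr; linarith
  have h4 : η/640 * T = 400 := by rw [hT]; field_simp
  linarith

theorem Orb.u_sub_le {a b : ℝ} (hθ : θ ∈ Icc (0:ℝ) 1) (hε : 0 < ε) (h : P.Orb ε θ q p u (Icc a b))
    {t : ℝ} (ht : t ∈ Icc a b) : |u t - u a| ≤ 40 * ε * (t - a) := by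
  have h1 : ∀ s ∈ Icc a t, s ∈ Icc a b := fun s hs => ⟨hs.1, hs.2.trans ht.2⟩
  have hd : ∀ s ∈ Icc a t, |P.du ε θ (q s) (u s)| ≤ 40*ε := fun s hs =>
    P.abs_du_le hθ hε.le (h.hq s (h1 s hs)) (h.hu s (h1 s hs))
  have h2 := le_of_deriv_ge (C := -(40*ε)) ht.1 (fun s hs => h.du s (h1 s hs))
    (fun s hs => (abs_le.mp (hd s hs)).1)
  have h3 := ge_of_deriv_le (C := 40*ε) ht.1 (fun s hs => h.du s (h1 s hs))
    (fun s hs => (abs_le.mp (hd s hs)).2)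
  rw [abs_le]; constructor <;> linarith

/-- The energy relative to a reference level `q₀` does not decrease much. -/
theorem Orb.energy_ge {a b : ℝ} (hθ : θ ∈ Icc (0:ℝ) 1) (hε : 0 < ε)
    (h : P.Orb ε θ q p u (Icc a b)) {q₀ : ℝ} (hq₀ : q₀ ∈ Icc (0:ℝ) 2) {t : ℝ} (ht : t ∈ Icc a b) :
    p a^2/2 + P.Phi (q a) (u a) - P.Phi q₀ (u a) - 80*ε*(t - a) ≤
      p t^2/2 + P.Phi (q t) (u t) - P.Phi q₀ (u t) := by
  have h1 : ∀ s ∈ Icc a t, s ∈ Icc a b := fun s hs => ⟨hs.1, hs.2.trans ht.2⟩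
  have hd : ∀ s ∈ Icc a t, HasDerivAt (fun t => P.Phi q₀ (u t))
      (q₀^2/2 * P.du ε θ (q s) (u s)) s := by
    intro s hs
    unfold Phi
    refine ((((h.du s (h1 s hs)).sub_const (21/10)).mul_const (q₀^2)).div_const 2 |>.add_const
      (2*P.κ^2*(2*q₀^3/3 - q₀^4/4))).congr_deriv ?_
    ring
  have h2 := le_of_deriv_ge (C := -(80*ε)) ht.1 (fun s hs => (h.dE (h1 s hs)).sub (hd s hs))
    (by
      intro s hs
      have h3 := abs_le.mp (P.abs_du_le hθ hε.le (h.hq s (h1 s hs)) (h.hu s (h1 s hs)))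
      have h4 := P.le_c hθ (h.hu s (h1 s hs)).1
      have h5 := h.hq s (h1 s hs)
      have h6 : q s^2 ≤ 4 := by nlinarith [h5.1, h5.2]
      have h7 : q₀^2 ≤ 4 := by nlinarith [hq₀.1, hq₀.2]
      have h8 : |(q s^2 - q₀^2)/2| ≤ 2 := abs_le.mpr ⟨by nlinarith [sq_nonneg (q s)], by nlinarith [sq_nonneg q₀]⟩
      have h9 : |(q s^2 - q₀^2)/2 * P.du ε θ (q s) (u s)| ≤ 2 * (40*ε) := by
        rw [abs_mul]
        exact mul_le_mul h8 (abs_le.mpr h3) (abs_nonneg _) (by norm_num)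
      have h10 := (abs_le.mp h9).1
      nlinarith [sq_nonneg (p s)])
  simp only [Pi.sub_apply] at h2
  linarith

theorem F_qL_neg {u : ℝ} (hu : u ≤ 2) : P.F P.qL u < 0 := by
  have h1 := P.hR'; have h2 := P.hκ; have h3 := P.hqL; have h4 := P.hqL'
  have h6 : 0 ≤ 2*P.κ^2 := by positivity
  unfold F
  nlinarith [mul_nonneg h6 h3.le]

theorem F_qH_pos {u : ℝ} (hu : P.ulo ≤ u) : 0 < P.F P.qH u := by
  have := P.hFH; unfold F; linarith

/-- Zeros of `F` have lower potential than both sections. -/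
theorem Phi_lt_of_F_eq_zero {q u : ℝ} (hq : q ∈ Icc P.qL P.qH) (hu : u ∈ Icc P.ulo 2)
    (hF : P.F q u = 0) : P.Phi q u < P.Phi P.qL u ∧ P.Phi q u < P.Phi P.qH u := by
  have h1 := P.F_qL_neg hu.2
  have h2 := P.F_qH_pos hu.1
  have h3 := P.hqL; have h5 := P.hκ
  have hqL : P.qL < q := lt_of_le_of_ne hq.1 (by rintro rfl; linarith)
  have hqH : q < P.qH := lt_of_le_of_ne hq.2 (by rintro rfl; linarith)
  have hid : ∀ v, P.Phi v u - P.Phi q u = 2*P.κ^2 * (v - q)^2 * ((1 - q) * q - ((v-q)^2/4 + (v - q)*(q - 2/3))) + P.F q u * (v^2-q^2)/2 := by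
    intro v; unfold Phi F; ring
  have hq1 : q < 1 := by
    by_contra hcon
    unfold F at hF h2
    nlinarith [mul_nonneg (show 0 ≤ 2*P.κ^2 by positivity) (mul_nonneg (show 0 ≤ P.qH - q by linarith) (show 0 ≤ P.qH + q - 2 by linarith))]
  have hm : P.qH < 2 - q := by
    by_contra hcon
    unfold F at hF h2
    nlinarith [mul_nonneg (show 0 ≤ 2*P.κ^2 by positivity) (mul_nonneg (show 0 ≤ P.qH - q by linarith) (show 0 ≤ P.qH + q - 2 by linarith))]
  have hpos : ∀ v, 0 < v → v ≠ q → v < 2 - q → 0 < P.Phi v u - P.Phi q u := by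
    intro v hv hvq hv2
    rw [hid, hF]
    have : 0 < (v-q)^2 := by positivity [sub_ne_zero.mpr hvq]
    have h7 : 0 < (1 - q) * q - ((v-q)^2/4 + (v - q)*(q - 2/3)) := by
      have hq0 : 0 < q := by linarith
      nlinarith [mul_pos hv (show 0 < 2 - q - v by linarith), mul_pos hv (show 0 < 1 - q by linarith),
        mul_pos hq0 (show 0 < 2 - q - v by linarith), mul_pos hq0 (show 0 < 1 - q by linarith)]
    have : 0 < 2*P.κ^2 * (v - q)^2 * ((1 - q) * q - ((v-q)^2/4 + (v - q)*(q - 2/3))) := by positivity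
    linarith
  exact ⟨by linarith [hpos P.qL h3 hqL.ne (by linarith [P.hqL', P.hqH])],
    by linarith [hpos P.qH (by linarith [P.hqH]) hqH.ne' hm]⟩

end Par

namespace Par
open Set

/-- Passage between the sections takes a bounded time and avoids rest points of the fast system. -/
theorem transit (P : Par) : ∃ T > 0, ∀ᶠ ε in 𝓝[>] (0:ℝ),
    ∀ θ ∈ Icc (0:ℝ) 1, ∀ (q p u : ℝ → ℝ) (a b : ℝ), a ≤ b → P.Orb ε θ q p u (Icc a b) →
    (∀ t ∈ Icc a b, q t ∈ Icc P.qL P.qH) → (q a = P.qL ∨ q a = P.qH) →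
    b - a ≤ T ∧ ∀ t ∈ Icc a b, F P (q t) (u t) = 0 → p t ≠ 0 := by
  obtain ⟨η, hη, hm⟩ := exists_margin (K := P.box ∩ {z | z.1 ∈ Icc P.qL P.qH})
    (f := fun z => z.2.1^2 + (z.1 * P.F z.1 z.2.2)^2)
    (g := fun z => z.2.1^2/2 + P.Phi z.1 z.2.2 - min (P.Phi P.qL z.2.2) (P.Phi P.qH z.2.2))
    (P.isCompact_box.inter_right (isClosed_Icc.preimage continuous_fst))
    (by unfold F; fun_prop) (by unfold Phi; fun_prop) (by
      rintro ⟨q, p, u⟩ ⟨hb, hq⟩ hg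
      simp only [box, mem_prod, mem_ofPred_eq] at hb hq hg ⊢
      have hq0 : 0 < q := P.hqL.trans_le hq.1
      by_contra hcon
      have h1 : p^2 + (q*P.F q u)^2 = 0 := le_antisymm (not_lt.mp hcon) (by positivity)
      have hp : p = 0 := by nlinarith [sq_nonneg p, sq_nonneg (q*P.F q u)]
      have hF : P.F q u = 0 := by
        have : q * P.F q u = 0 := by nlinarith [sq_nonneg p, sq_nonneg (q*P.F q u)]
        exact (mul_eq_zero.mp this).resolve_left hq0.ne'
      have := P.Phi_lt_of_F_eq_zero hq hb.2.2 hF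
      rw [hp] at hg
      have := lt_min this.1 this.2
      linarith)
  obtain ⟨T, hT, hbd⟩ := P.time_bound hη
  refine ⟨T, hT, ?_⟩
  filter_upwards [hbd, Ioo_mem_nhdsGT (show 0 < η/(80*(T+1)) by positivity)] with ε hbd hε
    θ hθ q p u a b hab ho hq hqa
  have key : ∀ t ∈ Icc a b, t - a ≤ T + 1 → η ≤ p t^2 + (q t * P.F (q t) (u t))^2 := by
    intro t ht htT
    refine hm (q t, p t, u t) ⟨ho.mem_box ht, hq t ht⟩ ?_
    have h0 : 80*ε*(t-a) ≤ η := by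
      have := hε.2
      rw [lt_div_iff₀ (by positivity)] at this
      have := hε.1
      nlinarith [ht.1]
    simp only
    rcases hqa with h | h
    · have := ho.energy_ge hθ hε.1 (q₀ := P.qL) ⟨P.hqL.le, by linarith [P.hqL']⟩ ht
      have h2 := min_le_left (P.Phi P.qL (u t)) (P.Phi P.qH (u t))
      rw [h] at this
      nlinarith [sq_nonneg (p a)]
    · have := ho.energy_ge hθ hε.1 (q₀ := P.qH) ⟨by linarith [P.hqH], P.qH_lt_two.le⟩ ht
      have h2 := min_le_right (P.Phi P.qL (u t)) (P.Phi P.qH (u t))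
      rw [h] at this
      nlinarith [sq_nonneg (p a)]
  have hT' := hbd θ hθ q p u a b hab ho key
  refine ⟨hT', fun t ht hF hp => ?_⟩
  have := key t ht (by linarith [ht.2])
  rw [hF, hp] at this
  simp at this
  linarith

variable {P : Par} {ε : ℝ} {φ : ℝ × ℝ × ℝ × ℝ → ℝ → ℝ × ℝ × ℝ × ℝ} (Fl : IsFlow (P.field ε) φ)
include Fl

theorem S_first_hit (hε : 0 < ε) {x : ℝ × ℝ × ℝ × ℝ} (hx : x ∈ P.S) {T : ℝ}
    (hT : 0 < T) (hTD : φ x T ∈ P.Dnc) (hD : ∀ t ∈ Ico 0 T, φ x t ∉ P.Dnc) :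
    (φ x T ∈ P.S') ∨ ((φ x T).2.2.1 = 0 ∧ ∀ t ∈ Icc 0 T, (φ x t).2.1 ≤ P.qH) := by
  have hA : x ∉ P.A φ := fun h => A_not_Dnc Fl h hT.le hTD
  obtain ⟨ho, hq1, hp1, hp2⟩ := S_orb Fl hε hx hA hT hD
  have hTT : T ∈ Icc 0 T := ⟨hT.le, le_rfl⟩
  have hstay : (φ x T).2.2.1 = 0 → ∀ t ∈ Icc 0 T, (φ x t).2.1 ≤ P.qH := by
    intro hp0
    by_contra hcon
    push Not at hcon
    obtain ⟨s, hs, hqs⟩ := hcon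
    obtain ⟨t₁, ht₁, hz, hbef⟩ := exists_first_zero (f := fun s => (φ x s).2.1 - P.qH) hs.2
      (fun s _ => ((flow_dq Fl x s).sub_const _).continuousAt.continuousWithinAt) (by linarith)
      (by linarith [hTD.2])
    have h1 := deriv_nonpos_of_first ((flow_dq Fl x t₁).sub_const P.qH) ht₁.1
      (fun s hs => (hbef s hs).le) hz.le
    have h2 : (φ x t₁).2.2.1 ≤ 0 := clamp_le_zero.mp h1
    have h3 : t₁ = T := by
      by_contra hne
      exact hD t₁ ⟨hs.1.trans ht₁.1.le, lt_of_le_of_ne ht₁.2 hne⟩ ⟨h2, by linarith⟩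
    subst h3
    have h4 := ho.dp t₁ hTT
    have h5 := P.F_qH_pos (ho.hu t₁ hTT).1
    have hqe : (φ x t₁).2.1 = P.qH := by linarith
    simp only [hp0, hqe] at h4
    have h6 : 0 < P.qH * P.F P.qH (φ x t₁).2.2.2 := mul_pos (by linarith [P.hqH]) h5
    have h7 := (hasDerivAt_iff_tendsto_slope.mp h4).eventually (gt_mem_nhds (show _ < (0:ℝ) by linarith))
    have h8 := h7.filter_mono (nhdsWithin_mono (s := Iio t₁) t₁ (fun x hx => ne_of_lt hx))
    obtain ⟨b, hb, hb'⟩ := mem_nhdsLT_iff_exists_Ioo_subset.mp h8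
    have hm : max s b < t₁ := max_lt ht₁.1 hb
    have h9 := strictMonoOn_of_deriv_pos (convex_Icc (max s b) t₁) (f := fun t => (φ x t).2.1)
      (fun s _ => (flow_dq Fl x s).continuousAt.continuousWithinAt) (fun s' hs' => by
        rw [interior_Icc] at hs'
        rw [(flow_dq Fl x s').deriv, clamp_pos]
        have := hb' ⟨(le_max_right _ _).trans_lt hs'.1, hs'.2⟩
        simp only [mem_ofPred_eq, slope_def_field, hp0] at this
        have h10 := (div_neg_iff.mp this).resolve_right (fun h => by linarith [h.2, hs'.2])
        linarith [h10.1]) ⟨le_rfl, hm.le⟩ ⟨hm.le, le_rfl⟩ hm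
    have h11 := hbef (max s b) ⟨le_max_left _ _, hm⟩
    simp only at h9 h11
    linarith
  have hle := hTD.1
  rcases hle.eq_or_lt with h | h
  · exact Or.inr ⟨h, hstay h⟩
  · have hqe : (φ x T).2.1 = P.qH := by
      refine le_antisymm hTD.2 ?_
      by_contra hlt
      push Not at hlt
      have e1 : ∀ᶠ s in 𝓝[<] T, (φ x s).2.1 < P.qH ∧ (φ x s).2.2.1 < 0 ∧ s ∈ Ioo 0 T :=
        ((((flow_dq Fl x T).continuousAt.eventually (gt_mem_nhds hlt)).and
          ((flow_dp Fl x T).continuousAt.eventually (gt_mem_nhds h))).filter_mono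
            nhdsWithin_le_nhds).and (Ioo_mem_nhdsLT hT) |>.mono fun s hs => ⟨hs.1.1, hs.1.2, hs.2⟩
      obtain ⟨s, h1, h2, h3⟩ := e1.exists
      exact hD s ⟨h3.1.le, h3.2⟩ ⟨h2.le, h1.le⟩
    refine Or.inl ⟨by rw [flow_fst Fl]; exact hx.1, hqe, ⟨?_, h⟩, ho.hu T hTT⟩
    have := hp2 T hTT
    rw [hqe] at this; exact this

theorem S'_first_hit (hε : 0 < ε) {x : ℝ × ℝ × ℝ × ℝ} (hx : x ∈ P.S') {T : ℝ}
    (hT : 0 < T) (hTD : φ x T ∈ P.Upc) (hD : ∀ t ∈ Ico 0 T, φ x t ∉ P.Upc) :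
    (φ x T ∈ P.S) ∨ ((φ x T).2.2.1 = 0 ∧ ∀ t ∈ Icc 0 T, P.qL ≤ (φ x t).2.1) := by
  have hA : x ∉ P.C φ := fun h => C_not_Upc Fl h hT.le hTD
  obtain ⟨ho, hq1, hq2, hp1, hp2⟩ := S'_orb Fl hε hx hA hT hD
  have hTT : T ∈ Icc 0 T := ⟨hT.le, le_rfl⟩
  have hstay : (φ x T).2.2.1 = 0 → ∀ t ∈ Icc 0 T, P.qL ≤ (φ x t).2.1 := by
    intro hp0
    by_contra hcon
    push Not at hcon
    obtain ⟨s, hs, hqs⟩ := hcon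
    obtain ⟨t₁, ht₁, hz, hbef⟩ := exists_first_zero (f := fun s => P.qL - (φ x s).2.1) hs.2
      (fun s _ => ((flow_dq Fl x s).const_sub _).continuousAt.continuousWithinAt) (by linarith)
      (by linarith [hTD.2])
    have h1 := deriv_nonpos_of_first ((flow_dq Fl x t₁).const_sub P.qL) ht₁.1
      (fun s hs => (hbef s hs).le) hz.le
    have h2 : 0 ≤ (φ x t₁).2.2.1 := clamp_ge_zero.mp (by linarith)
    have h3 : t₁ = T := by
      by_contra hne
      exact hD t₁ ⟨hs.1.trans ht₁.1.le, lt_of_le_of_ne ht₁.2 hne⟩ ⟨h2, by linarith⟩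
    subst h3
    have h4 := ho.dp t₁ hTT
    have h5 := P.F_qL_neg (ho.hu t₁ hTT).2
    have hqe : (φ x t₁).2.1 = P.qL := by linarith
    simp only [hp0, hqe] at h4
    have h6 : P.qL * P.F P.qL (φ x t₁).2.2.2 < 0 := mul_neg_of_pos_of_neg P.hqL h5
    have h7 := (hasDerivAt_iff_tendsto_slope.mp h4).eventually (lt_mem_nhds (show (0:ℝ) < _ by linarith))
    have h8 := h7.filter_mono (nhdsWithin_mono (s := Iio t₁) t₁ (fun x hx => ne_of_lt hx))
    obtain ⟨b, hb, hb'⟩ := mem_nhdsLT_iff_exists_Ioo_subset.mp h8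
    have hm : max s b < t₁ := max_lt ht₁.1 hb
    have h9 := strictAntiOn_of_deriv_neg (convex_Icc (max s b) t₁) (f := fun t => (φ x t).2.1)
      (fun s _ => (flow_dq Fl x s).continuousAt.continuousWithinAt) (fun s' hs' => by
        rw [interior_Icc] at hs'
        rw [(flow_dq Fl x s').deriv, clamp_neg]
        have := hb' ⟨(le_max_right _ _).trans_lt hs'.1, hs'.2⟩
        simp only [mem_ofPred_eq, slope_def_field, hp0] at this
        have h10 := (div_pos_iff.mp this).resolve_left (fun h => by linarith [h.2, hs'.2])
        linarith [h10.1]) ⟨le_rfl, hm.le⟩ ⟨hm.le, le_rfl⟩ hm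
    have h11 := hbef (max s b) ⟨le_max_left _ _, hm⟩
    simp only at h9 h11
    linarith
  rcases hTD.1.eq_or_lt with h | h
  · exact Or.inr ⟨h.symm, hstay h.symm⟩
  · have hqe : (φ x T).2.1 = P.qL := by
      refine le_antisymm ?_ hTD.2
      by_contra hlt
      push Not at hlt
      have e1 : ∀ᶠ s in 𝓝[<] T, P.qL < (φ x s).2.1 ∧ 0 < (φ x s).2.2.1 ∧ s ∈ Ioo 0 T :=
        ((((flow_dq Fl x T).continuousAt.eventually (lt_mem_nhds hlt)).and
          ((flow_dp Fl x T).continuousAt.eventually (lt_mem_nhds h))).filter_mono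
            nhdsWithin_le_nhds).and (Ioo_mem_nhdsLT hT) |>.mono fun s hs => ⟨hs.1.1, hs.1.2, hs.2⟩
      obtain ⟨s, h1, h2, h3⟩ := e1.exists
      exact hD s ⟨h3.1.le, h3.2⟩ ⟨h2.le, h1.le⟩
    refine Or.inl ⟨by rw [flow_fst Fl]; exact hx.1, hqe, ⟨h, ?_⟩, ho.hu T hTT⟩
    have := hp1 T hTT
    rw [hqe] at this; exact this

omit Fl in
theorem regular_S (P : Par) : ∀ᶠ ε in 𝓝[>] (0:ℝ), ∀ φ, IsFlow (P.field ε) φ →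
    ∀ x ∈ P.S, RegularEntry φ P.Dn P.Dnc x := by
  obtain ⟨T₀, -, htr⟩ := P.transit
  filter_upwards [htr, self_mem_nhdsWithin] with ε htr hε φ Fl x hx T hT hTD hD
  have hA : x ∉ P.A φ := fun h => A_not_Dnc Fl h hT.le hTD
  obtain ⟨ho, hq1, hp1, hp2⟩ := S_orb Fl hε hx hA hT hD
  have hTT : T ∈ Icc 0 T := ⟨hT.le, le_rfl⟩
  apply Eventually.frequently
  have hpneg : (φ x T).2.2.1 = 0 → ∀ᶠ s in 𝓝[>] T, (φ x s).2.2.1 < 0 := by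
    intro h
    have h4 := ho.dp T hTT
    have hle : ∀ t ∈ Icc 0 T, (φ x t).2.1 ≤ P.qH := by
      rcases S_first_hit Fl hε hx hT hTD hD with h' | h'
      · exact absurd h h'.2.2.1.2.ne
      · exact h'.2
    have hF := (htr x.1 hx.1 _ _ _ 0 T hT.le ho (fun t ht => ⟨hq1 t ht, hle t ht⟩)
      (Or.inl (by simp only [Fl.zero]; exact hx.2.1))).2 T hTT
    have hqpos : 0 < (φ x T).2.1 := P.hqL.trans_le (hq1 T hTT)
    refine eventually_neg_right h4 h.le (lt_of_le_of_ne ?_ ?_)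
    · refine deriv_nonpos_of_first h4 hT (fun s hs => ?_) h.le
      by_contra hneg
      exact hD s hs ⟨(not_le.mp hneg).le, hle s ⟨hs.1, hs.2.le⟩⟩
    · intro h0
      simp only [h, mul_zero, zero_sub, neg_eq_zero, mul_eq_zero, hqpos.ne', false_or] at h0
      exact hF h0 h
  rcases hTD.2.eq_or_lt with hqe | hqlt
  · have hn : ∀ᶠ s in 𝓝[>] T, (φ x s).2.2.1 < 0 := by
      rcases hTD.1.eq_or_lt with h | h
      · exact hpneg h
      · exact ((flow_dp Fl x T).continuousAt.eventually (gt_mem_nhds h)).filter_mono nhdsWithin_le_nhds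
    have := eventually_lt_right (flow_dq Fl x) (hn.mono fun s hs => clamp_neg.mpr hs)
    filter_upwards [hn, this] with s h1 h2 using ⟨h1, by rwa [hqe] at h2⟩
  · have hn : (φ x T).2.2.1 = 0 := by
      rcases S_first_hit Fl hε hx hT hTD hD with h' | h'
      · exact absurd h'.2.1 hqlt.ne
      · exact h'.1
    filter_upwards [hpneg hn, ((flow_dq Fl x T).continuousAt.eventually (gt_mem_nhds hqlt)).filter_mono
      nhdsWithin_le_nhds] with s h1 h2 using ⟨h1, h2⟩

omit Fl in
theorem regular_S' (P : Par) : ∀ᶠ ε in 𝓝[>] (0:ℝ), ∀ φ, IsFlow (P.field ε) φ →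
    ∀ x ∈ P.S', RegularEntry φ P.Up P.Upc x := by
  obtain ⟨T₀, -, htr⟩ := P.transit
  filter_upwards [htr, self_mem_nhdsWithin] with ε htr hε φ Fl x hx T hT hTD hD
  have hA : x ∉ P.C φ := fun h => C_not_Upc Fl h hT.le hTD
  obtain ⟨ho, hq1, hq2, hp1, hp2⟩ := S'_orb Fl hε hx hA hT hD
  have hTT : T ∈ Icc 0 T := ⟨hT.le, le_rfl⟩
  apply Eventually.frequently
  have hppos : (φ x T).2.2.1 = 0 → ∀ᶠ s in 𝓝[>] T, 0 < (φ x s).2.2.1 := by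
    intro h
    have h4 := ho.dp T hTT
    have hle : ∀ t ∈ Icc 0 T, P.qL ≤ (φ x t).2.1 := by
      rcases S'_first_hit Fl hε hx hT hTD hD with h' | h'
      · exact absurd h h'.2.2.1.1.ne'
      · exact h'.2
    have hF := (htr x.1 hx.1 _ _ _ 0 T hT.le ho (fun t ht => ⟨hle t ht, hq2 t ht⟩)
      (Or.inr (by simp only [Fl.zero]; exact hx.2.1))).2 T hTT
    have hqpos : 0 < (φ x T).2.1 := hq1 T hTT
    refine eventually_pos_right h4 h.ge (lt_of_le_of_ne ?_ ?_)
    · have := deriv_nonpos_of_first h4.neg hT (fun s hs => ?_) (by simp [h])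
      · linarith
      · by_contra hneg
        exact hD s hs ⟨by simp only [Pi.neg_apply] at hneg; linarith, hle s ⟨hs.1, hs.2.le⟩⟩
    · intro h0
      rw [eq_comm] at h0
      simp only [h, mul_zero, zero_sub, neg_eq_zero, mul_eq_zero, hqpos.ne', false_or] at h0
      exact hF h0 h
  rcases hTD.2.eq_or_lt with hqe | hqlt
  · have hn : ∀ᶠ s in 𝓝[>] T, 0 < (φ x s).2.2.1 := by
      rcases hTD.1.eq_or_lt with h | h
      · exact hppos h.symm
      · exact ((flow_dp Fl x T).continuousAt.eventually (lt_mem_nhds h)).filter_mono nhdsWithin_le_nhds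
    have := eventually_gt_right (flow_dq Fl x) (hn.mono fun s hs => clamp_pos.mpr hs)
    filter_upwards [hn, this] with s h1 h2 using ⟨h1, by rwa [← hqe] at h2⟩
  · have hn : (φ x T).2.2.1 = 0 := by
      rcases S'_first_hit Fl hε hx hT hTD hD with h' | h'
      · exact absurd h'.2.1 hqlt.ne'
      · exact h'.1
    filter_upwards [hppos hn, ((flow_dq Fl x T).continuousAt.eventually (lt_mem_nhds hqlt)).filter_mono
      nhdsWithin_le_nhds] with s h1 h2 using ⟨h1, h2⟩

end Par

namespace Par
open Set

variable {P : Par} {ε θ : ℝ} {q p u : ℝ → ℝ}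

/-- The vector field crosses the parabola `p = k (q-α) (β-q)` upwards. -/
theorem cross_up {k α β c q u : ℝ} (hk : k^2 = P.κ^2) (hαβ : α < β) (hα : 0 < α)
    (hA : 3*P.κ^2*(α+β) - 4*P.κ^2 - k*c ≤ 0) (hFα : P.F α u < 0) (hFβ : P.F β u < 0)
    (hq : q ∈ Icc α β) :
    0 < c*(k*(q-α)*(β-q)) - q * P.F q u - k*(α+β-2*q)*(k*(q-α)*(β-q)) := by
  have hid : (c*(k*(q-α)*(β-q)) - q * P.F q u - k*(α+β-2*q)*(k*(q-α)*(β-q))) * (β-α) =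
      (β-q)*(-(α*P.F α u)) + (q-α)*(-(β*P.F β u)) +
      (-(3*P.κ^2*(α+β) - 4*P.κ^2 - k*c))*((q-α)*(β-q)*(β-α)) := by
    unfold F
    have e : k*(α+β-2*q)*(k*(q-α)*(β-q)) = P.κ^2*((α+β-2*q)*((q-α)*(β-q))) := by rw [← hk]; ring
    rw [e]; ring
  have h1 : 0 ≤ q - α := by linarith [hq.1]
  have h2 : 0 ≤ β - q := by linarith [hq.2]
  have h3 : 0 < β - α := by linarith
  have h4 : 0 < -(α*P.F α u) := by nlinarith
  have h5 : 0 < -(β*P.F β u) := by nlinarith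
  have h6 : 0 < (β-q)*(-(α*P.F α u)) + (q-α)*(-(β*P.F β u)) := by
    rcases h1.eq_or_lt with h | h
    · rw [← h]; have : 0 < β - q := by linarith
      simpa using mul_pos this h4
    · have := mul_pos h h5
      have := mul_nonneg h2 h4.le
      linarith
  have h7 : 0 ≤ (-(3*P.κ^2*(α+β) - 4*P.κ^2 - k*c))*((q-α)*(β-q)*(β-α)) :=
    mul_nonneg (by linarith) (by positivity)
  exact pos_of_mul_pos_left (by rw [hid]; linarith) h3.le

theorem hasDerivAt_parabola {k α β : ℝ} {I : Set ℝ} (h : P.Orb ε θ q p u I) {t : ℝ} (ht : t ∈ I) :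
    HasDerivAt (fun t => k*(q t-α)*(β-q t)) (k*(α+β-2*q t)*p t) t := by
  refine ((((h.dq t ht).sub_const α).const_mul k).mul ((h.dq t ht).const_sub β)).congr_deriv ?_
  ring

/-- Orbits stay above an upward crossed parabola. -/
theorem Orb.ge_parabola {k α β a b : ℝ} (ho : P.Orb ε θ q p u (Icc a b)) (hk : k^2 = P.κ^2)
    (hαβ : α < β) (hα : 0 < α)
    (hA : ∀ t ∈ Icc a b, 3*P.κ^2*(α+β) - 4*P.κ^2 - k*P.c θ (u t) ≤ 0)
    (hFα : ∀ t ∈ Icc a b, P.F α (u t) < 0) (hFβ : ∀ t ∈ Icc a b, P.F β (u t) < 0)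
    (hq : ∀ t ∈ Icc a b, q t ∈ Icc α β) (h0 : k*(q a-α)*(β-q a) ≤ p a) :
    ∀ t ∈ Ioc a b, k*(q t-α)*(β-q t) < p t := by
  have := barrier (h := fun t => p t - k*(q t-α)*(β-q t)) (a := a) (b := b)
    (fun t ht => (ho.dp t ht).sub (hasDerivAt_parabola ho ht)) (by linarith)
    (by
      intro t ht _ h
      have hp : p t = k*(q t-α)*(β-q t) := by linarith
      have := cross_up (c := P.c θ (u t)) hk hαβ hα (hA t ht) (hFα t ht) (hFβ t ht) (hq t ht)
      rw [hp]; linarith)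
  intro t ht
  linarith [this t ht]

theorem F_anti {q q' u : ℝ} (h : 1 ≤ q) (h' : q ≤ q') : P.F q' u ≤ P.F q u := by
  unfold F
  nlinarith [mul_nonneg (show 0 ≤ 2*P.κ^2 by positivity) (mul_nonneg (show 0 ≤ q' - q by linarith) (show 0 ≤ q' + q - 2 by linarith))]

theorem F_mono_u {q u v : ℝ} (h : u ≤ v) : P.F q u ≤ P.F q v := by unfold F; linarith

theorem over_aux {b T : ℝ} (ho : P.Orb ε θ q p u (Icc 0 T)) (hb : 1 ≤ b)
    (hA : ∀ t ∈ Icc 0 T, P.κ*(3*(b+P.qL) - 4) ≤ P.c θ (u t))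
    (hF : ∀ t ∈ Icc 0 T, P.F b (u t) < 0)
    (hq : ∀ t ∈ Icc 0 T, P.qL ≤ q t) (hq0 : q 0 = P.qL) (hp0 : 0 < p 0) :
    ∀ t ∈ Icc 0 T, 0 < p t ∧ (q t ≤ b → P.κ*(q t-P.qL)*(b-q t) ≤ p t) := by
  have hκ := P.hκ
  have hqL := P.hqL'
  have phase1 : ∀ s ∈ Icc 0 T, (∀ t ∈ Icc 0 s, q t ≤ b) → ∀ t ∈ Icc 0 s,
      0 < p t ∧ P.κ*(q t-P.qL)*(b-q t) ≤ p t := by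
    intro s hs hqb t ht
    have hsub : Icc 0 s ⊆ Icc 0 T := Icc_subset_Icc_right hs.2
    rcases ht.1.eq_or_lt with h | h
    · rw [← h, hq0]; exact ⟨hp0, by simpa using hp0.le⟩
    have := (ho.mono hsub).ge_parabola (k := P.κ) (α := P.qL) (β := b) rfl (by linarith) P.hqL
      (fun t ht => by nlinarith [hA t (hsub ht)])
      (fun t ht => P.F_qL_neg (ho.hu t (hsub ht)).2) (fun t ht => hF t (hsub ht))
      (fun t ht => ⟨hq t (hsub ht), hqb t ht⟩) (by rw [hq0]; simpa using hp0.le) t ⟨h, ht.2⟩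
    have h2 : 0 ≤ P.κ*(q t-P.qL)*(b-q t) :=
      mul_nonneg (mul_nonneg hκ.le (by linarith [hq t (hsub ht)])) (by linarith [hqb t ht])
    exact ⟨by linarith, this.le⟩
  intro t ht
  by_cases hall : ∀ s ∈ Icc 0 t, q s ≤ b
  · have := phase1 t ht hall t ⟨ht.1, le_rfl⟩
    exact ⟨this.1, fun _ => this.2⟩
  · push Not at hall
    obtain ⟨s, hs, hsb⟩ := hall
    have hsT : s ∈ Icc 0 T := ⟨hs.1, hs.2.trans ht.2⟩
    obtain ⟨t₁, ht₁, hz, hbef⟩ := exists_first_zero (f := fun s => b - q s) hs.1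
      (fun r hr => ((ho.dq r ⟨hr.1, hr.2.trans hsT.2⟩).const_sub b).continuousAt.continuousWithinAt)
      (by rw [hq0]; linarith) (by linarith)
    have h1T : t₁ ∈ Icc 0 T := ⟨ht₁.1.le, ht₁.2.trans hsT.2⟩
    have hp1 := (phase1 t₁ h1T (fun r hr => by
      rcases hr.2.eq_or_lt with h | h
      · rw [h]; linarith
      · linarith [hbef r ⟨hr.1, h⟩]) t₁ ⟨ht₁.1.le, le_rfl⟩).1
    have hsub : Icc t₁ T ⊆ Icc 0 T := Icc_subset_Icc_left ht₁.1.le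
    have hqb : ∀ r ∈ Icc t₁ T, (∀ τ ∈ Icc t₁ r, 0 ≤ p τ) → b ≤ q r := by
      intro r hr h
      have := le_of_deriv_ge (C := 0) hr.1 (fun τ hτ => ho.dq τ (hsub ⟨hτ.1, hτ.2.trans hr.2⟩)) h
      linarith
    have hpp := barrier (h := p) (a := t₁) (b := T) (fun τ hτ => ho.dp τ (hsub hτ)) hp1.le (by
      intro τ hτ hist h0
      have h3 := hqb τ hτ hist
      have h4 := (P.F_anti (u := u τ) hb h3).trans_lt (hF τ (hsub hτ))
      rw [h0]
      have : q τ * P.F (q τ) (u τ) < 0 := mul_neg_of_pos_of_neg (by linarith) h4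
      linarith)
    have hpp' : ∀ τ ∈ Icc t₁ T, 0 < p τ := fun τ hτ => by
      rcases hτ.1.eq_or_lt with h | h
      · rw [← h]; exact hp1
      · exact hpp τ ⟨h, hτ.2⟩
    have htt : t₁ ≤ t := ht₁.2.trans hs.2
    have h5 := hpp' t ⟨htt, ht.2⟩
    refine ⟨h5, fun hle => ?_⟩
    have h6 := hqb t ⟨htt, ht.2⟩ (fun τ hτ => (hpp' τ ⟨hτ.1, hτ.2.trans ht.2⟩).le)
    have : b - q t = 0 := by linarith
    rw [this]; simpa using h5.le

/-- Starting points over the barrier escape. -/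
theorem mem_A_of_over (P : Par) {Θ V : Set ℝ} {ω μ : ℝ} (hω : 0 < ω) (hμ : 0 < μ)
    (h : ∀ θ ∈ Θ, ∀ v ∈ V, ∃ b ∈ Icc (1:ℝ) 2, ∀ u ∈ Icc P.ulo 2, |u - v| ≤ ω →
      P.κ*(3*(b+P.qL) - 4) ≤ P.c θ u ∧ P.F b u ≤ -μ) :
    ∀ᶠ ε in 𝓝[>] (0:ℝ), ∀ φ, IsFlow (P.field ε) φ → ∀ x ∈ P.S, x.1 ∈ Θ → x.2.2.2 ∈ V →
      x ∈ P.A φ := by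
  obtain ⟨η, hη, hm⟩ := exists_margin
    (K := (Icc (1:ℝ) 2 ×ˢ P.box) ∩ {z | P.qL ≤ z.2.1 ∧ P.F z.1 z.2.2.2 ≤ -μ ∧ 0 ≤ z.2.2.1})
    (f := fun z => z.2.2.1^2 + (z.2.1 * P.F z.2.1 z.2.2.2)^2)
    (g := fun z => z.2.2.1 - P.κ*(z.2.1-P.qL)*max 0 (z.1-z.2.1))
    (by
      refine (isCompact_Icc.prod P.isCompact_box).inter_right ?_
      simp only [ofPred_and]
      refine (isClosed_le (by fun_prop) (by fun_prop)).inter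
        ((isClosed_le (by unfold F; fun_prop) (by fun_prop)).inter
          (isClosed_le (by fun_prop) (by fun_prop))))
    (by unfold F; fun_prop) (by fun_prop) (by
      rintro ⟨b, q, p, u⟩ ⟨⟨hb, hbox⟩, h1, h2, h3⟩ hg
      simp only [box, mem_prod] at hbox h1 h2 h3 hg ⊢
      simp only at hb
      have hq0 : 0 < q := P.hqL.trans_le h1
      rcases eq_or_ne p 0 with hp | hp
      · have hF : P.F q u < 0 := by
          rcases le_or_gt b q with hbq | hbq
          · have := P.F_anti (u := u) hb.1 hbq; linarith
          · rw [max_eq_right (by linarith), hp] at hg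
            have : q = P.qL := by
              by_contra hne
              have := mul_pos (mul_pos P.hκ (sub_pos.mpr (lt_of_le_of_ne h1 (Ne.symm hne)))) (sub_pos.mpr hbq)
              linarith
            rw [this]; exact P.F_qL_neg hbox.2.2.2
        have : q * P.F q u ≠ 0 := mul_ne_zero hq0.ne' hF.ne
        positivity
      · positivity)
  obtain ⟨T, hT, hbd⟩ := P.time_bound hη
  filter_upwards [hbd, Ioo_mem_nhdsGT (show 0 < ω/(40*(T+1)) by positivity)] with ε hbd hε φ Fl x hx hΘ hV
  by_contra hA
  obtain ⟨b, hb, hbu⟩ := h _ hΘ _ hV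
  have key : ∀ T', 0 < T' → T' ≤ T + 1 → (∀ t ∈ Ico 0 T', φ x t ∉ P.Dnc) →
      ∀ t ∈ Icc 0 T', 0 < (φ x t).2.2.1 ∧ ((φ x t).2.1 ≤ b →
        P.κ*((φ x t).2.1-P.qL)*(b-(φ x t).2.1) ≤ (φ x t).2.2.1) ∧ P.F b (φ x t).2.2.2 ≤ -μ := by
    intro T' h1 h2 h3
    obtain ⟨ho, hq1, -, -⟩ := S_orb Fl hε.1 hx hA h1 h3
    have hu : ∀ t ∈ Icc 0 T', |(φ x t).2.2.2 - x.2.2.2| ≤ ω := by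
      intro t ht
      have h4 := ho.u_sub_le hx.1 hε.1 ht
      simp only [Fl.zero] at h4
      have h5 := hε.2
      rw [lt_div_iff₀ (by positivity)] at h5
      refine h4.trans ?_
      have := hε.1
      nlinarith [ht.1, ht.2]
    have := over_aux ho hb.1 (fun t ht => (hbu _ (ho.hu t ht) (hu t ht)).1)
      (fun t ht => by linarith [(hbu _ (ho.hu t ht) (hu t ht)).2]) hq1
      (by simp only [Fl.zero]; exact hx.2.1) (by simp only [Fl.zero]; exact hx.2.2.1.1)
    exact fun t ht => ⟨(this t ht).1, (this t ht).2, (hbu _ (ho.hu t ht) (hu t ht)).2⟩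
  have hno : ∀ t ∈ Ico 0 (T+1), φ x t ∉ P.Dnc := by
    intro t ht hD
    obtain ⟨t', h1, h2, h3, h4⟩ := Fl.exists_first_hit P.isClosed_Dnc
      (x := x) (fun h => by linarith [h.1, hx.2.2.1.1]) ht.1 hD
    have := (key t' h1 (by linarith [ht.2]) h4 t' ⟨h1.le, le_rfl⟩).1
    linarith [h3.1]
  obtain ⟨ho, hq1, -, -⟩ := S_orb Fl hε.1 hx hA (show 0 < T + 1 by linarith) hno
  have h1 := hbd x.1 hx.1 _ _ _ 0 (T+1) (by linarith) ho (by
    intro t ht _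
    obtain ⟨k1, k2, k3⟩ := key (T+1) (by linarith) le_rfl hno t ht
    refine hm (b, (φ x t).2.1, (φ x t).2.2.1, (φ x t).2.2.2)
      ⟨⟨hb, ho.mem_box ht⟩, hq1 t ht, k3, k1.le⟩ ?_
    simp only
    rcases le_or_gt (φ x t).2.1 b with hle | hlt
    · rw [max_eq_right (by linarith)]; linarith [k2 hle]
    · rw [max_eq_left (by linarith)]; simp; linarith)
  linarith

end Par

namespace Par
open Set

variable {P : Par} {ε : ℝ} {φ : ℝ × ℝ × ℝ × ℝ → ℝ → ℝ × ℝ × ℝ × ℝ}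

theorem S_not_Dnc {x : ℝ × ℝ × ℝ × ℝ} (hx : x ∈ P.S) : x ∉ P.Dnc := fun h => by
  linarith [hx.2.2.1.1, h.1]

theorem S'_not_Upc {x : ℝ × ℝ × ℝ × ℝ} (hx : x ∈ P.S') : x ∉ P.Upc := fun h => by
  linarith [hx.2.2.1.2, h.1]

/-- Description of the entry point into `Dn` of an orbit from `S`. -/
theorem hit_Dn (Fl : IsFlow (P.field ε) φ) (hε : 0 < ε) (hR : ∀ x ∈ P.S, RegularEntry φ P.Dn P.Dnc x)
    {x : ℝ × ℝ × ℝ × ℝ} (hx : x ∈ P.S) (h : Enters φ P.Dn x) :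
    0 < entry φ P.Dn x ∧ hit φ P.Dn x ∈ P.Dnc ∧ (∀ t ∈ Ico 0 (entry φ P.Dn x), φ x t ∉ P.Dnc) ∧
    x ∉ P.A φ ∧ (hit φ P.Dn x ∈ P.S' ∨ ((hit φ P.Dn x).2.2.1 = 0 ∧
      ∀ t ∈ Icc 0 (entry φ P.Dn x), (φ x t).2.1 ≤ P.qH)) := by
  obtain ⟨h1, h2, h3⟩ := Fl.entry_spec P.isClosed_Dnc P.Dn_subset (S_not_Dnc hx) (hR x hx) h
  exact ⟨h1, h2, h3, fun hA => A_not_Dnc Fl hA h1.le h2, S_first_hit Fl hε hx h1 h2 h3⟩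

/-- Description of the entry point into `Up` of an orbit from `S'`. -/
theorem hit_Up (Fl : IsFlow (P.field ε) φ) (hε : 0 < ε) (hR : ∀ x ∈ P.S', RegularEntry φ P.Up P.Upc x)
    {x : ℝ × ℝ × ℝ × ℝ} (hx : x ∈ P.S') (h : Enters φ P.Up x) :
    0 < entry φ P.Up x ∧ hit φ P.Up x ∈ P.Upc ∧ (∀ t ∈ Ico 0 (entry φ P.Up x), φ x t ∉ P.Upc) ∧
    x ∉ P.C φ ∧ (hit φ P.Up x ∈ P.S ∨ ((hit φ P.Up x).2.2.1 = 0 ∧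
      ∀ t ∈ Icc 0 (entry φ P.Up x), P.qL ≤ (φ x t).2.1)) := by
  obtain ⟨h1, h2, h3⟩ := Fl.entry_spec P.isClosed_Upc P.Up_subset (S'_not_Upc hx) (hR x hx) h
  exact ⟨h1, h2, h3, fun hA => C_not_Upc Fl hA h1.le h2, S'_first_hit Fl hε hx h1 h2 h3⟩

theorem halfMap_S (Fl : IsFlow (P.field ε) φ) (hε : 0 < ε)
    (hR : ∀ x ∈ P.S, RegularEntry φ P.Dn P.Dnc x) :
    HalfMap (P.field ε) φ P.S P.S' P.Dn P.Dnc (P.A φ) where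
  flow := Fl
  isOpen := P.isOpen_Dn
  isClosed := P.isClosed_Dnc
  subset := P.Dn_subset
  disj := fun x hx => S_not_Dnc hx
  regular := hR
  esc_not_enters := fun x _ hA ⟨_, ht, h⟩ => A_not_Dnc Fl hA ht.le (P.Dn_subset h)
  esc_open := fun x _ hA => ((isOpen_A Fl).mem_nhds hA |> Filter.Eventually.filter_mono nhdsWithin_le_nhds :)
  good_open := by
    intro x hx he hh
    have hc := Fl.continuousAt_entry_point P.isOpen_Dn P.isClosed_Dnc P.Dn_subset (S_not_Dnc hx)
      (hR x hx) he
    have h1 : ∀ᶠ y in 𝓝 x, (φ y (entry φ P.Dn y)).2.2.1 < 0 :=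
      ((continuous_fst.comp (continuous_snd.comp continuous_snd)).continuousAt.comp hc).eventually
        (gt_mem_nhds hh.2.2.1.2)
    filter_upwards [h1.filter_mono nhdsWithin_le_nhds, self_mem_nhdsWithin,
      (Fl.eventually_enters P.isOpen_Dn he).filter_mono nhdsWithin_le_nhds] with y h2 hy h3
    exact (hit_Dn Fl hε hR hy h3).2.2.2.2.resolve_right fun h => by
      have := h.1; unfold hit at this; linarith

theorem halfMap_S' (Fl : IsFlow (P.field ε) φ) (hε : 0 < ε)
    (hR : ∀ x ∈ P.S', RegularEntry φ P.Up P.Upc x) :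
    HalfMap (P.field ε) φ P.S' P.S P.Up P.Upc (P.C φ) where
  flow := Fl
  isOpen := P.isOpen_Up
  isClosed := P.isClosed_Upc
  subset := P.Up_subset
  disj := fun x hx => S'_not_Upc hx
  regular := hR
  esc_not_enters := fun x _ hA ⟨_, ht, h⟩ => C_not_Upc Fl hA ht.le (P.Up_subset h)
  esc_open := fun x _ hA => ((isOpen_C Fl).mem_nhds hA |> Filter.Eventually.filter_mono nhdsWithin_le_nhds :)
  good_open := by
    intro x hx he hh
    have hc := Fl.continuousAt_entry_point P.isOpen_Up P.isClosed_Upc P.Up_subset (S'_not_Upc hx)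
      (hR x hx) he
    have h1 : ∀ᶠ y in 𝓝 x, 0 < (φ y (entry φ P.Up y)).2.2.1 :=
      ((continuous_fst.comp (continuous_snd.comp continuous_snd)).continuousAt.comp hc).eventually
        (lt_mem_nhds hh.2.2.1.1)
    filter_upwards [h1.filter_mono nhdsWithin_le_nhds, self_mem_nhdsWithin,
      (Fl.eventually_enters P.isOpen_Up he).filter_mono nhdsWithin_le_nhds] with y h2 hy h3
    exact (hit_Up Fl hε hR hy h3).2.2.2.2.resolve_right fun h => by
      have := h.1; unfold hit at this; linarith

end Par

namespace Par
open Set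

/-- The energy divided by `q²`. -/
def Rt (P : Par) (q p u : ℝ) : ℝ := (p/q)^2/2 + (u-21/10)/2 + 2*P.κ^2*(2*q/3-q^2/4)

variable {P : Par} {ε θ : ℝ} {q p u : ℝ → ℝ}

theorem Orb.Rt_ge {T η : ℝ} (ho : P.Orb ε θ q p u (Icc 0 T)) (hθ : θ ∈ Icc (0:ℝ) 1) (hε : 0 ≤ ε)
    (hη : 0 < η) (hεη : 400*ε ≤ η^2)
    (hq : ∀ t ∈ Icc 0 T, 0 < q t) (hq' : ∀ t ∈ Icc 0 T, q t ≤ 4/3)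
    (hw : ∀ t ∈ Icc 0 T, -(9/10) * q t ≤ p t) (hp : ∀ t ∈ Icc 0 T, p t ≤ 0)
    (h0 : η ≤ P.Rt (q 0) (p 0) (u 0)) :
    ∀ t ∈ Icc 0 T, 11/20*η ≤ P.Rt (q t) (p t) (u t) ∧
      η + η^2/2*t ≤ P.Rt (q t) (p t) (u t) - η/2*(p t/q t) := by
  intro t ht
  have hT : 0 ≤ T := ht.1.trans ht.2
  have hw0 : ∀ t ∈ Icc 0 T, p t/q t ≤ 0 ∧ -(9/10) ≤ p t/q t := fun t ht =>
    ⟨div_nonpos_of_nonpos_of_nonneg (hp t ht) (hq t ht).le, (le_div_iff₀ (hq t ht)).mpr (hw t ht)⟩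
  have hd : ∀ t ∈ Icc 0 T, HasDerivAt (fun t => P.Rt (q t) (p t) (u t) - η/2*(p t/q t))
      (P.c θ (u t)*(p t/q t)^2 - (p t/q t)*(2*P.Rt (q t) (p t) (u t) + η/2*P.c θ (u t)) +
        η/2*(P.κ^2*q t*(4/3-q t)) + η*P.Rt (q t) (p t) (u t) + P.du ε θ (q t) (u t)/2) t := by
    intro t ht
    have hq0 := (hq t ht).ne'
    have h1 := (ho.dp t ht).div (ho.dq t ht) hq0
    have h2 := ((((h1.pow 2).div_const 2).add (((ho.du t ht).sub_const (21/10)).div_const 2)).add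
      (((((ho.dq t ht).const_mul 2).div_const 3).sub (((ho.dq t ht).pow 2).div_const 4)).const_mul
        (2*P.κ^2))).sub (h1.const_mul (η/2))
    refine h2.congr_deriv ?_
    simp only [Pi.div_apply, Rt, F, show 2 - 1 = 1 from rfl, pow_one, Nat.cast_ofNat]
    field_simp
    ring
  have hd' : ∀ t ∈ Icc 0 T, η ≤ P.Rt (q t) (p t) (u t) - η/2*(p t/q t) → η^2/2 ≤ 
      (P.c θ (u t)*(p t/q t)^2 - (p t/q t)*(2*P.Rt (q t) (p t) (u t) + η/2*P.c θ (u t)) +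
        η/2*(P.κ^2*q t*(4/3-q t)) + η*P.Rt (q t) (p t) (u t) + P.du ε θ (q t) (u t)/2) := by
    intro t ht h
    have hR : 11/20*η ≤ P.Rt (q t) (p t) (u t) := by nlinarith [(hw0 t ht).2]
    have hc := P.le_c hθ (ho.hu t ht).1
    have hu := (abs_le.mp (P.abs_du_le hθ hε (ho.hq t ht) (ho.hu t ht))).1
    have h1 : 0 ≤ P.κ^2*q t*(4/3-q t) := mul_nonneg (mul_nonneg (sq_nonneg _) (hq t ht).le)
      (by linarith [hq' t ht])
    have h2 : 0 ≤ -(p t/q t)*(2*P.Rt (q t) (p t) (u t) + η/2*P.c θ (u t)) :=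
      mul_nonneg (by linarith [(hw0 t ht).1]) (by
        have : 0 ≤ η/2*P.c θ (u t) := by positivity
        linarith)
    have h3 : 0 ≤ P.c θ (u t)*(p t/q t)^2 := by positivity
    nlinarith
  have hb := barrier (h := fun t => P.Rt (q t) (p t) (u t) - η/2*(p t/q t) - η) (a := 0) (b := T)
    (fun t ht => (hd t ht).sub_const η)
    (by have := (hw0 0 ⟨le_rfl, hT⟩).1; nlinarith)
    (fun t ht _ h => by have := hd' t ht (by linarith); have : 0 < η^2 := by positivity
                        linarith)
  have hb' : ∀ t ∈ Icc 0 T, η ≤ P.Rt (q t) (p t) (u t) - η/2*(p t/q t) := by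
    intro t ht
    rcases ht.1.eq_or_lt with h | h
    · rw [← h]; have := (hw0 0 ⟨le_rfl, hT⟩).1; nlinarith
    · linarith [hb t ⟨h, ht.2⟩]
  refine ⟨by nlinarith [(hw0 t ht).2, hb' t ht], ?_⟩
  have := le_of_deriv_ge (C := η^2/2) ht.1 (fun s hs => hd s ⟨hs.1, hs.2.trans ht.2⟩)
    (fun s hs => hd' s ⟨hs.1, hs.2.trans ht.2⟩ (hb' s ⟨hs.1, hs.2.trans ht.2⟩))
  have h1 := hb' 0 ⟨le_rfl, hT⟩
  simp only [sub_zero] at this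
  linarith

variable {φ : ℝ × ℝ × ℝ × ℝ → ℝ → ℝ × ℝ × ℝ × ℝ}

/-- Points of `S'` of positive energy escape. -/
theorem mem_C_of_energy (Fl : IsFlow (P.field ε) φ) (hε : 0 < ε) {η : ℝ} (hη : 0 < η)
    (hεη : 400*ε ≤ η^2) {x : ℝ × ℝ × ℝ × ℝ} (hx : x ∈ P.S')
    (h0 : η ≤ P.Rt x.2.1 x.2.2.1 x.2.2.2) : x ∈ P.C φ := by
  by_contra hC
  have hy1 := P.hy1
  have hqH' := P.hqH'
  have aux : ∀ T, 0 < T → (∀ t ∈ Ico 0 T, (φ x t).2.2.1 < 0) →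
      P.Orb ε x.1 (fun t => (φ x t).2.1) (fun t => (φ x t).2.2.1) (fun t => (φ x t).2.2.2) (Icc 0 T) ∧
      (∀ t ∈ Icc 0 T, 0 < (φ x t).2.1 ∧ (φ x t).2.1 ≤ P.qH ∧ -(9/10) * (φ x t).2.1 ≤ (φ x t).2.2.1 ∧
        (φ x t).2.2.1 ≤ 0) ∧
      ∀ t ∈ Icc 0 T, 11/20*η ≤ P.Rt (φ x t).2.1 (φ x t).2.2.1 (φ x t).2.2.2 ∧
      η + η^2/2*t ≤ P.Rt (φ x t).2.1 (φ x t).2.2.1 (φ x t).2.2.2 -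
        η/2*((φ x t).2.2.1/(φ x t).2.1) := by
    intro T hT h
    obtain ⟨ho, h1, h2, -, h4⟩ := S'_orb Fl hε hx hC hT (fun t ht hU => by linarith [h t ht, hU.1])
    have h5 : ∀ t ∈ Icc 0 T, 0 ≤ -(φ x t).2.2.1 :=
      nonneg_at_end hT (flow_dp Fl x T).neg.continuousAt (fun t ht => by linarith [h t ht])
    exact ⟨ho, fun t ht => ⟨h1 t ht, h2 t ht, h4 t ht, by linarith [h5 t ht]⟩,
      ho.Rt_ge hx.1 hε.le hη hεη h1 (fun t ht => by linarith [h2 t ht]) h4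
        (fun t ht => by linarith [h5 t ht]) (by simpa only [Fl.zero] using h0)⟩
  by_cases hall : ∀ t ∈ Icc 0 (4/η^2), (φ x t).2.2.1 < 0
  · have hT : 0 < 4/η^2 := by positivity
    obtain ⟨ho, h1, h2⟩ := aux _ hT (fun t ht => hall t ⟨ht.1, ht.2.le⟩)
    have h3 := (h2 _ ⟨hT.le, le_rfl⟩).2
    obtain ⟨k1, k2, k3, k4⟩ := h1 _ ⟨hT.le, le_rfl⟩
    have k5 := ho.hu _ ⟨hT.le, le_rfl⟩
    generalize φ x (4/η^2) = z at *
    have k6 : z.2.2.1/z.2.1 ≤ 0 ∧ -(9/10) ≤ z.2.2.1/z.2.1 :=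
      ⟨div_nonpos_of_nonpos_of_nonneg k4 k1.le, (le_div_iff₀ k1).mpr k3⟩
    have k7 : η^2/2*(4/η^2) = 2 := by field_simp; norm_num
    rw [k7] at h3
    unfold Rt at h3
    have k8 : 2*z.2.1/3-z.2.1^2/4 ≤ 4/9 := by nlinarith [sq_nonneg (z.2.1-4/3)]
    have k9 : 2*P.κ^2*(2*z.2.1/3-z.2.1^2/4) ≤ 87/100*(4/9) := by
      have := P.hR'
      nlinarith [sq_nonneg P.κ]
    have k10 : (z.2.2.1/z.2.1)^2 ≤ 1 := by nlinarith
    nlinarith [k5.2]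
  · push Not at hall
    obtain ⟨t, ht, hpt⟩ := hall
    obtain ⟨t₁, ht₁, hz, hbef⟩ := exists_first_zero (f := fun s => -(φ x s).2.2.1) ht.1
      (fun s _ => (flow_dp Fl x s).neg.continuousAt.continuousWithinAt)
      (by simp only [Fl.zero]; linarith [hx.2.2.1.2]) (by linarith)
    obtain ⟨ho, h1, h2⟩ := aux _ ht₁.1 (fun s hs => by linarith [hbef s hs])
    have hm : t₁ ∈ Icc 0 t₁ := ⟨ht₁.1.le, le_rfl⟩
    have h3 := deriv_nonpos_of_first (ho.dp t₁ hm).neg ht₁.1 (fun s hs => (hbef s hs).le) hz.le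
    have h4 := (h2 t₁ hm).1
    obtain ⟨k1, k2, -, -⟩ := h1 t₁ hm
    have hp0 : (φ x t₁).2.2.1 = 0 := by linarith
    rw [hp0] at h3 h4
    unfold Rt at h4; unfold F at h3
    generalize φ x t₁ = z at *
    have h5 : 0 ≤ P.κ^2*(z.2.1*(4/3-z.2.1)) :=
      mul_nonneg (sq_nonneg _) (mul_nonneg k1.le (by linarith))
    have h6 : 0 < z.2.2.2 - 21/10 + 2*P.κ^2*z.2.1*(2-z.2.1) := by
      norm_num at h4
      nlinarith
    have := mul_pos k1 h6
    linarith

end Par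

namespace Par
open Set

variable {P : Par} {ε θ : ℝ} {φ : ℝ × ℝ × ℝ × ℝ → ℝ → ℝ × ℝ × ℝ × ℝ}

theorem F_q2 (P : Par) (u : ℝ) : P.F (1+P.y) u = u - P.ub := by
  have := P.hy
  unfold F; linear_combination -this

theorem gq_nonneg {q u : ℝ} (hq0 : 0 ≤ q) (hq : q ≤ 1 + P.y) (hu : u ≤ P.ub) : 0 ≤ gq q u := by
  have := P.hyub
  have := P.hub
  unfold gq
  nlinarith

/-- Orbits to the right of a zero of the reaction term with `p ≥ 0` escape. -/
theorem mem_A_of_trap (P : Par) {b v ν : ℝ} (hb : P.qH < b) (hν : 0 < ν) (hF : P.F b v ≤ -(2*ν)) :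
    ∀ᶠ ε in 𝓝[>] (0:ℝ), ∀ φ, IsFlow (P.field ε) φ → ∀ x ∈ P.S, ∀ t₀, 0 ≤ t₀ →
      (∀ t ∈ Ico 0 t₀, φ x t ∉ P.Dnc) → b ≤ (φ x t₀).2.1 → 0 ≤ (φ x t₀).2.2.1 →
      (φ x t₀).2.2.2 ≤ v → x ∈ P.A φ := by
  set T := 2 + 2/ν with hT
  have hT0 : 0 < T := by positivity
  filter_upwards [Ioo_mem_nhdsGT (show 0 < ν/(40*T) by positivity)] with ε hε φ Fl x hx t₀ ht₀ hD₀ hq0 hp0 hu0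
  by_contra hA
  have hb1 : 1 < b := P.hqH.trans hb
  have hεT : 40*ε*T < ν := by
    have := hε.2; rw [lt_div_iff₀ (by positivity)] at this; linarith
  have key : ∀ T', t₀ < T' → T' ≤ t₀ + T → (∀ t ∈ Ico 0 T', φ x t ∉ P.Dnc) →
      P.Orb ε x.1 (fun t => (φ x t).2.1) (fun t => (φ x t).2.2.1) (fun t => (φ x t).2.2.2) (Icc t₀ T') ∧
      (∀ t ∈ Icc t₀ T', b ≤ (φ x t).2.1 ∧ 0 ≤ (φ x t).2.2.1 ∧ P.F (φ x t).2.1 (φ x t).2.2.2 ≤ -ν) := by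
    intro T' h1 h2 h3
    have ho := (S_orb Fl hε.1 hx hA (ht₀.trans_lt h1) h3).1.mono (Icc_subset_Icc_left ht₀)
    have hqb : ∀ r ∈ Icc t₀ T', (∀ τ ∈ Icc t₀ r, 0 ≤ (φ x τ).2.2.1) → b ≤ (φ x r).2.1 := by
      intro r hr h
      have := le_of_deriv_ge (C := 0) hr.1 (fun τ hτ => ho.dq τ ⟨hτ.1, hτ.2.trans hr.2⟩) h
      linarith
    have hFb : ∀ r ∈ Icc t₀ T', b ≤ (φ x r).2.1 → P.F (φ x r).2.1 (φ x r).2.2.2 ≤ -ν := by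
      intro r hr h
      have h4 := (abs_le.mp (ho.u_sub_le hx.1 hε.1 hr)).2
      have h5 : (φ x r).2.2.2 ≤ v + ν := by
        have : ε*(r-t₀) ≤ ε*T := mul_le_mul_of_nonneg_left (by linarith [hr.2]) hε.1.le
        linarith
      have h6 := P.F_anti (u := (φ x r).2.2.2) hb1.le h
      have h7 := P.F_mono_u (q := b) h5
      have h8 : P.F b (v+ν) = P.F b v + ν := by unfold F; ring
      linarith
    have hpp := barrier_nonneg (fun τ hτ => ho.dp τ hτ) hp0 (by
      intro τ hτ hist h0
      have h3 := hqb τ hτ hist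
      have h4 := hFb τ hτ h3
      rw [h0]
      have : (φ x τ).2.1 * P.F (φ x τ).2.1 (φ x τ).2.2.2 < 0 := mul_neg_of_pos_of_neg (by linarith) (by linarith)
      linarith)
    refine ⟨ho, fun t ht => ?_⟩
    have := hqb t ht (fun τ hτ => hpp τ ⟨hτ.1, hτ.2.trans ht.2⟩)
    exact ⟨this, hpp t ht, hFb t ht this⟩
  have hno : ∀ t ∈ Ico 0 (t₀ + T), φ x t ∉ P.Dnc := by
    intro t ht hD
    obtain ⟨t', h1, h2, h3, h4⟩ := Fl.exists_first_hit P.isClosed_Dnc (S_not_Dnc hx) ht.1 hD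
    have h5 : t₀ ≤ t' := by
      by_contra h
      exact hD₀ t' ⟨h1.le, not_le.mp h⟩ h3
    have h6 : b ≤ (φ x t').2.1 := by
      rcases h5.eq_or_lt with h | h
      · rw [← h]; exact hq0
      · exact ((key t' h (by linarith [ht.2]) h4).2 t' ⟨h.le, le_rfl⟩).1
    linarith [h3.2]
  obtain ⟨ho, hk⟩ := key (t₀ + T) (by linarith) le_rfl hno
  have hdp : ∀ t ∈ Icc t₀ (t₀+T), ν ≤ P.c x.1 (φ x t).2.2.2 * (φ x t).2.2.1 - (φ x t).2.1 *
      P.F (φ x t).2.1 (φ x t).2.2.2 := by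
    intro t ht
    obtain ⟨k1, k2, k3⟩ := hk t ht
    have := P.le_c hx.1 (ho.hu t ht).1
    have h1 : 0 ≤ P.c x.1 (φ x t).2.2.2 * (φ x t).2.2.1 := mul_nonneg (by linarith) k2
    nlinarith
  have h0T : t₀ + 1 ≤ t₀ + T := by
    have : 0 < 2/ν := by positivity
    rw [hT]; linarith
  have hp1 : ∀ t ∈ Icc (t₀+1) (t₀+T), ν ≤ (φ x t).2.2.1 := by
    intro t ht
    have := le_of_deriv_ge (C := ν) (show t₀ ≤ t by linarith [ht.1])
      (fun τ hτ => ho.dp τ ⟨hτ.1, hτ.2.trans ht.2⟩) (fun τ hτ => hdp τ ⟨hτ.1, hτ.2.trans ht.2⟩)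
    nlinarith [ht.1]
  have := le_of_deriv_ge (C := ν) h0T (fun τ hτ => ho.dq τ ⟨by linarith [hτ.1], hτ.2⟩) hp1
  have h2 := (ho.hq (t₀+T) ⟨by linarith, le_rfl⟩).2
  have h3 := (hk (t₀+1) ⟨by linarith, h0T⟩).1
  have h4 : ν*(t₀ + T - (t₀+1)) = ν + 2 := by rw [hT]; field_simp; ring
  rw [h4] at this
  linarith

/-- Orbits from high points of `S` that have not escaped stay above `um`. -/
theorem um_le (P : Par) : ∀ᶠ ε in 𝓝[>] (0:ℝ), ∀ φ, IsFlow (P.field ε) φ → ∀ x ∈ P.S, x ∉ P.A φ →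
    P.ub ≤ x.2.2.2 → ∀ T, 0 < T → (∀ t ∈ Ico 0 T, φ x t ∉ P.Dnc) →
    ∀ t ∈ Icc 0 T, P.um ≤ (φ x t).2.2.2 := by
  have hum := P.hum'
  have hy0 := P.hy0
  set ν := (P.ub - P.um)/4 with hν
  have hν0 : 0 < ν := by rw [hν]; linarith
  obtain ⟨T₀, hT₀, hbd⟩ := P.time_bound (η := (2*ν)^2) (by positivity)
  filter_upwards [hbd, P.mem_A_of_trap (b := 1+P.y) (v := P.ub - 2*ν) P.hqH' hν0 (by rw [F_q2]; linarith),
    Ioo_mem_nhdsGT (show 0 < 2*ν/(40*T₀) by positivity)]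
    with ε hbd htr hε φ Fl x hx hA hu0 T hT hD t₂ ht₂
  by_contra hlt
  push Not at hlt
  obtain ⟨ho, -⟩ := S_orb Fl hε.1 hx hA hT hD
  have hcu : ∀ s ∈ Icc 0 T, ContinuousAt (fun t => (φ x t).2.2.2) s := fun s hs => (ho.du s hs).continuousAt
  have hεT : 40*ε*T₀ < 2*ν := by
    have := hε.2; rw [lt_div_iff₀ (by positivity)] at this; linarith
  obtain ⟨s, hs, hz, hbef⟩ := exists_first_zero (f := fun s => (P.ub-2*ν) - (φ x (t₂ - s)).2.2.2)
    (a := 0) (b := t₂) ht₂.1 (fun s hs => by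
      have h1 : t₂ - s ∈ Icc 0 T := ⟨by linarith [hs.2], by linarith [hs.1, ht₂.2]⟩
      exact (continuousAt_const.sub (ContinuousAt.comp' (g := fun t => (φ x t).2.2.2) (f := fun s => t₂ - s)
        (hcu _ h1) (by fun_prop))).continuousWithinAt) (by simp only [sub_zero]; linarith)
    (by simp only [sub_self, Fl.zero]; linarith)
  set t₁ := t₂ - s with ht₁
  have h0t₁ : 0 ≤ t₁ := by linarith [hs.2]
  have h12 : t₁ < t₂ := by linarith [hs.1]
  have hmem : ∀ t ∈ Icc t₁ t₂, t ∈ Icc 0 T := fun t ht => ⟨h0t₁.trans ht.1, ht.2.trans ht₂.2⟩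
  have hum1 : ∀ t ∈ Icc t₁ t₂, (φ x t).2.2.2 ≤ P.ub - 2*ν := by
    intro t ht
    rcases ht.1.eq_or_lt with h | h
    · rw [← h]; linarith
    · have := hbef (t₂ - t) ⟨by linarith [ht.2], by linarith⟩
      rw [sub_sub_cancel] at this; linarith
  have hneg : ∀ t ∈ Icc t₁ t₂, 1 + P.y ≤ (φ x t).2.1 → (φ x t).2.2.1 < 0 := by
    intro t ht hq
    by_contra hp
    exact hA (htr φ Fl x hx t (hmem t ht).1 (fun τ hτ => hD τ ⟨hτ.1, hτ.2.trans_le (hmem t ht).2⟩) hq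
      (not_lt.mp hp) (hum1 t ht))
  have hlate : ∀ t ∈ Icc t₁ t₂, (φ x t).2.1 ≤ 1 + P.y → (φ x t).2.2.2 ≤ (φ x t₂).2.2.2 := by
    intro t ht hq
    have hq' := barrier_nonneg (h := fun s => 1 + P.y - (φ x s).2.1) (a := t) (b := t₂)
      (fun τ hτ => (ho.dq τ (hmem τ ⟨ht.1.trans hτ.1, hτ.2⟩)).const_sub _) (by linarith)
      (fun τ hτ _ h => by
        have := hneg τ ⟨ht.1.trans hτ.1, hτ.2⟩ (by linarith)
        linarith)
    have := le_of_deriv_ge (C := 0) ht.2 (fun τ hτ => ho.du τ (hmem τ ⟨ht.1.trans hτ.1, hτ.2⟩))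
      (fun τ hτ => by
        have hm := hmem τ ⟨ht.1.trans hτ.1, hτ.2⟩
        have h1 := P.le_den hx.1 (ho.hu τ hm).1
        have h2 := P.gq_nonneg (ho.hq τ hm).1 (by linarith [hq' τ hτ])
          (show (φ x τ).2.2.2 ≤ P.ub by linarith [hum1 τ ⟨ht.1.trans hτ.1, hτ.2⟩])
        unfold du
        exact div_nonneg (mul_nonneg (mul_nonneg hε.1.le (P.m_nonneg _)) h2) (by linarith))
    linarith
  have hshort : ∀ s ∈ Icc t₁ t₂, (∀ t ∈ Icc t₁ s, 1 + P.y ≤ (φ x t).2.1) →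
      P.um < (φ x s).2.2.2 := by
    intro s hs hq
    have hsub : Icc t₁ s ⊆ Icc 0 T := fun t ht => hmem t ⟨ht.1, ht.2.trans hs.2⟩
    have h1 := hbd x.1 hx.1 _ _ _ t₁ s hs.1 (ho.mono hsub) (by
      intro t ht _
      have h2 := P.F_anti (u := (φ x t).2.2.2) (by linarith) (hq t ht)
      rw [F_q2] at h2
      have h3 := hum1 t ⟨ht.1, ht.2.trans hs.2⟩
      have h4 : (φ x t).2.1 * P.F (φ x t).2.1 (φ x t).2.2.2 ≤ -(2*ν) := by
        have := hq t ht; nlinarith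
      nlinarith [sq_nonneg ((φ x t).2.2.1)])
    have h2 := (abs_le.mp ((ho.mono hsub).u_sub_le hx.1 hε.1 ⟨hs.1, le_rfl⟩)).1
    have h3 : ε*(s - t₁) ≤ ε*T₀ := mul_le_mul_of_nonneg_left h1 hε.1.le
    have h4 : (φ x t₁).2.2.2 = P.ub - 2*ν := by linarith
    rw [h4] at h2
    have : P.um = P.ub - 4*ν := by rw [hν]; ring
    linarith
  rcases le_or_gt (φ x t₁).2.1 (1+P.y) with hc | hc
  · have := hlate t₁ ⟨le_rfl, h12.le⟩ hc
    linarith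
  · by_cases hall : ∀ t ∈ Icc t₁ t₂, 1 + P.y ≤ (φ x t).2.1
    · linarith [hshort t₂ ⟨h12.le, le_rfl⟩ hall]
    · push Not at hall
      obtain ⟨s, hs, hsq⟩ := hall
      obtain ⟨r, hr, hrz, hrb⟩ := exists_first_zero (f := fun t => (φ x t).2.1 - (1 + P.y)) hs.1
        (fun t _ => ((flow_dq Fl x t).sub_const _).continuousAt.continuousWithinAt) (by linarith) (by linarith)
      have hrm : r ∈ Icc t₁ t₂ := ⟨hr.1.le, hr.2.trans hs.2⟩
      have h1 := hshort r hrm (fun t ht => by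
        rcases ht.2.eq_or_lt with h | h
        · rw [h]; linarith
        · linarith [hrb t ⟨ht.1, h⟩])
      have h2 := hlate r hrm (by linarith)
      linarith

end Par

namespace Par
open Set

variable {P : Par} {ε θ : ℝ} {φ : ℝ × ℝ × ℝ × ℝ → ℝ → ℝ × ℝ × ℝ × ℝ}

theorem Rt_qH_ge (P : Par) (p u : ℝ) (hu : 3/2 ≤ u) : 1/100 ≤ P.Rt P.qH p u := by
  have h1 := P.hqH
  have h2 := P.hqH'
  have h3 := P.hy1
  have h4 : 5/12 ≤ 2*P.qH/3 - P.qH^2/4 := by nlinarith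
  have h5 : 23/30*(5/12) ≤ 2*P.κ^2*(2*P.qH/3 - P.qH^2/4) := by
    have := P.hR
    nlinarith
  have := sq_nonneg (p/P.qH)
  unfold Rt; linarith

/-- Points of `S'` that do not escape are low. -/
theorem lt_of_not_mem_C (Fl : IsFlow (P.field ε) φ) (hε : 0 < ε) (hε' : ε ≤ 1/4000000)
    {x : ℝ × ℝ × ℝ × ℝ} (hx : x ∈ P.S') (hC : x ∉ P.C φ) : x.2.2.2 < 3/2 := by
  by_contra h
  refine hC (mem_C_of_energy Fl hε (η := 1/100) (by norm_num) (by linarith) hx ?_)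
  rw [hx.2.1]
  exact P.Rt_qH_ge _ _ (not_lt.mp h)

theorem edge_fst (P : Par) : ∀ᶠ ε in 𝓝[>] (0:ℝ), ∀ φ, IsFlow (P.field ε) φ →
    (∀ x ∈ P.S, x.2.2.2 ≤ 8/5 → x ∈ P.A φ) →
    ∀ x ∈ P.S, Enters φ P.Dn x → hit φ P.Dn x ∉ P.S' →
    ∀ᶠ y in 𝓝[P.S] x, hit φ P.Dn y ∈ P.S' → hit φ P.Dn y ∈ P.C φ := by
  obtain ⟨T, hT, htr⟩ := P.transit
  filter_upwards [htr, P.regular_S, Ioo_mem_nhdsGT (show 0 < 1/(1000*T) by positivity),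
    Ioo_mem_nhdsGT (show (0:ℝ) < 1/4000000 by positivity)] with ε htr hR hεT hε φ Fl hFA x hx he hh
  obtain ⟨h1, h2, h3, h4, h5⟩ := hit_Dn Fl hε.1 (hR φ Fl) hx he
  obtain ⟨-, h5⟩ := h5.resolve_left hh
  have hu0 : 8/5 < x.2.2.2 := by
    by_contra h
    exact h4 (hFA x hx (not_lt.mp h))
  obtain ⟨ho, hq1, -⟩ := S_orb Fl hε.1 hx h4 h1 h3
  have h6 := (htr x.1 hx.1 _ _ _ 0 _ h1.le ho (fun t ht => ⟨hq1 t ht, h5 t ht⟩)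
    (Or.inl (by simp only [Fl.zero]; exact hx.2.1))).1
  have h7 := (abs_le.mp (ho.u_sub_le hx.1 hε.1 ⟨h1.le, le_rfl⟩)).1
  simp only [Fl.zero] at h7
  have h8 : 3/2 < (hit φ P.Dn x).2.2.2 := by
    have := hεT.2
    rw [lt_div_iff₀ (by positivity)] at this
    have h9 : ε * (entry φ P.Dn x - 0) ≤ ε*T := mul_le_mul_of_nonneg_left h6 hε.1.le
    unfold hit
    linarith
  have hc := (halfMap_S Fl hε.1 (hR φ Fl)).hit_cont hx he
  have h9 : ∀ᶠ y in 𝓝 x, 3/2 < (hit φ P.Dn y).2.2.2 :=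
    ((continuous_snd.comp (continuous_snd.comp continuous_snd)).continuousAt.comp hc).eventually
      (lt_mem_nhds h8)
  filter_upwards [h9.filter_mono nhdsWithin_le_nhds] with y hy hyS
  by_contra hC
  linarith [lt_of_not_mem_C Fl hε.1 hε.2.le hyS hC]

theorem edge_snd (P : Par) : ∀ᶠ ε in 𝓝[>] (0:ℝ), ∀ φ, IsFlow (P.field ε) φ →
    (∀ x ∈ P.S, x.2.2.2 ≤ 8/5 → x ∈ P.A φ) →
    ∀ x ∈ P.S', Enters φ P.Up x → hit φ P.Up x ∉ P.S →
    ∀ᶠ y in 𝓝[P.S'] x, hit φ P.Up y ∈ P.S → hit φ P.Up y ∈ P.A φ := by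
  obtain ⟨T, hT, htr⟩ := P.transit
  filter_upwards [htr, P.regular_S', Ioo_mem_nhdsGT (show 0 < 1/(1000*T) by positivity),
    Ioo_mem_nhdsGT (show (0:ℝ) < 1/4000000 by positivity)] with ε htr hR hεT hε φ Fl hFA x hx he hh
  obtain ⟨h1, h2, h3, h4, h5⟩ := hit_Up Fl hε.1 (hR φ Fl) hx he
  obtain ⟨-, h5⟩ := h5.resolve_left hh
  have hu0 := lt_of_not_mem_C Fl hε.1 hε.2.le hx h4
  obtain ⟨ho, -, hq1, -⟩ := S'_orb Fl hε.1 hx h4 h1 h3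
  have h6 := (htr x.1 hx.1 _ _ _ 0 _ h1.le ho (fun t ht => ⟨h5 t ht, hq1 t ht⟩)
    (Or.inr (by simp only [Fl.zero]; exact hx.2.1))).1
  have h7 := (abs_le.mp (ho.u_sub_le hx.1 hε.1 ⟨h1.le, le_rfl⟩)).2
  simp only [Fl.zero] at h7
  have h8 : (hit φ P.Up x).2.2.2 < 8/5 := by
    have := hεT.2
    rw [lt_div_iff₀ (by positivity)] at this
    have h9 : ε * (entry φ P.Up x - 0) ≤ ε*T := mul_le_mul_of_nonneg_left h6 hε.1.le
    unfold hit
    linarith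
  have hc := (halfMap_S' Fl hε.1 (hR φ Fl)).hit_cont hx he
  have h9 : ∀ᶠ y in 𝓝 x, (hit φ P.Up y).2.2.2 < 8/5 :=
    ((continuous_snd.comp (continuous_snd.comp continuous_snd)).continuousAt.comp hc).eventually
      (gt_mem_nhds h8)
  filter_upwards [h9.filter_mono nhdsWithin_le_nhds] with y hy hyS
  exact hFA _ hyS hy.le

end Par

theorem IsFlow.hit_or_avoid {X : Type*} [NormedAddCommGroup X] [NormedSpace ℝ X]
    {V : X → X} {φ : X → ℝ → X} {C : Set X} (Fl : IsFlow V φ) (hC : IsClosed C) {x : X}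
    (hx : x ∉ C) (T : ℝ) : (∃ t, 0 < t ∧ t ≤ T ∧ φ x t ∈ C ∧ ∀ s ∈ Set.Ico 0 t, φ x s ∉ C) ∨
      ∀ s ∈ Set.Icc 0 T, φ x s ∉ C := by
  by_cases h : ∀ s ∈ Set.Icc 0 T, φ x s ∉ C
  · exact Or.inr h
  · push Not at h
    obtain ⟨s, hs, hsC⟩ := h
    obtain ⟨t, h1, h2, h3, h4⟩ := Fl.exists_first_hit hC hx hs.1 hsC
    exact Or.inl ⟨t, h1, h2.trans hs.2, h3, h4⟩

namespace Par
open Set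

/-- Orbits from `S'` above a downward facing parabola turn around strictly above `S`. -/
theorem turn_above (P : Par) {Θ : Set ℝ} {b ω : ℝ} (hb : P.qH < b) (hb' : b ≤ 13/10) (hω : 0 < ω)
    (hc : ∀ θ ∈ Θ, P.c θ (P.ub + ω) ≤ P.κ*(4 - 3*(b + P.qL))) (hF : P.F b (P.ub + ω) < 0) :
    ∀ᶠ ε in 𝓝[>] (0:ℝ), ∀ φ, IsFlow (P.field ε) φ → ∀ x ∈ P.S', x.1 ∈ Θ →
      x.2.2.2 ≤ P.ub + ω/2 → -(P.κ*(P.qH - P.qL)*(b - P.qH)) ≤ x.2.2.1 →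
      x ∉ P.C φ ∧ Enters φ P.Up x ∧ hit φ P.Up x ∉ P.S := by
  obtain ⟨T, hT, htr⟩ := P.transit
  filter_upwards [htr, P.regular_S', Ioo_mem_nhdsGT (show 0 < ω/(80*(T+1)) by positivity)] with ε htr
    hreg hε φ Fl x hx hΘ hxu hxp
  have hε0 := hε.1
  have hκ := P.hκ
  have hκ2 : P.κ < 33/50 := by have := P.hR'; nlinarith
  have hqL := P.hqL; have hqL' := P.hqL'; have hqH := P.hqH; have hLH := P.qL_lt_qH
  have hθ := hx.1
  set Cl : Set (ℝ × ℝ × ℝ × ℝ) := P.Upc ∪ {z | z.2.2.1 + 87/100*z.2.1 ≤ 0} with hCl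
  have hClc : IsClosed Cl := P.isClosed_Upc.union (isClosed_le (by fun_prop) (by fun_prop))
  have hεT : 40*ε*(T+1) < ω/2 := by
    have := hε.2; rw [lt_div_iff₀ (by positivity)] at this; linarith
  have main : ∀ T' ∈ Ioc 0 (T+1), (∀ s ∈ Ico 0 T', φ x s ∉ Cl) →
      P.Orb ε x.1 (fun t => (φ x t).2.1) (fun t => (φ x t).2.2.1) (fun t => (φ x t).2.2.2) (Icc 0 T') ∧
      (∀ t ∈ Icc 0 T', (φ x t).2.1 ∈ Ioc P.qL P.qH) ∧
      0 < (φ x T').2.2.1 + 87/100*(φ x T').2.1 := by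
    intro T' hT' hav
    obtain ⟨ho, h0, h1, -, -⟩ := S'_orb_of_le Fl hε0 hx hT'.1 (fun t ht h => hav t ht (Or.inl h))
      (fun t ht hq => by
        by_contra h
        exact hav t ht (Or.inr (by simp only [mem_ofPred_eq]; linarith)))
    have hu : ∀ t ∈ Icc 0 T', (φ x t).2.2.2 ≤ P.ub + ω := by
      intro t ht
      have := ho.u_sub_le hθ hε0 ht
      rw [abs_le] at this
      have h2 := this.2
      simp only [Fl.zero] at h2
      nlinarith [ht.1, ht.2, hT'.2]
    have par : ∀ s ∈ Ioc 0 T', (∀ t ∈ Icc 0 s, P.qL ≤ (φ x t).2.1) →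
        -(P.κ*((φ x s).2.1-P.qL)*(b-(φ x s).2.1)) < (φ x s).2.2.1 := by
      intro s hs hq
      have hsub : Icc 0 s ⊆ Icc 0 T' := Icc_subset_Icc_right hs.2
      have := (ho.mono hsub).ge_parabola (k := -P.κ) (α := P.qL) (β := b) (by ring) (by linarith)
        hqL (fun t ht => by
          have h5 := P.c_mono hθ (hu t (hsub ht))
          have h6 := hc x.1 hΘ
          nlinarith) (fun t ht => P.F_qL_neg (ho.hu t (hsub ht)).2)
        (fun t ht => (F_mono_u (hu t (hsub ht))).trans_lt hF)
        (fun t ht => ⟨hq t ht, (h1 t (hsub ht)).trans hb.le⟩)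
        (by simp only [Fl.zero, hx.2.1]; linarith) s ⟨hs.1, le_rfl⟩
      linarith
    have hq : ∀ t ∈ Icc 0 T', P.qL < (φ x t).2.1 := by
      by_contra hcon
      push Not at hcon
      obtain ⟨t, ht, hqt⟩ := hcon
      obtain ⟨t₁, ht₁, hz, hbef⟩ := exists_first_zero (f := fun s => (φ x s).2.1 - P.qL) ht.1
        (fun s _ => ((flow_dq Fl x s).sub_const _).continuousAt.continuousWithinAt)
        (by simp only [Fl.zero, hx.2.1]; linarith) (by linarith)
      have h2 := deriv_nonpos_of_first ((flow_dq Fl x t₁).sub_const P.qL) ht₁.1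
        (fun s hs => (hbef s hs).le) hz.le
      have h3 := par t₁ ⟨ht₁.1, ht₁.2.trans ht.2⟩ (fun s hs => by
        rcases hs.2.eq_or_lt with h | h
        · rw [h]; linarith
        · linarith [hbef s ⟨hs.1, h⟩])
      rw [show (φ x t₁).2.1 - P.qL = 0 from hz] at h3
      have := clamp_le_zero.mp h2
      linarith
    refine ⟨ho, fun t ht => ⟨hq t ht, h1 t ht⟩, ?_⟩
    have hTT : T' ∈ Icc 0 T' := ⟨hT'.1.le, le_rfl⟩
    have h3 := par T' ⟨hT'.1, le_rfl⟩ fun t ht => (hq t ht).le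
    have h4 := hq T' hTT
    have h5 := h1 T' hTT
    have h8 := h0 T' hTT
    have h6 : P.κ*((φ x T').2.1-P.qL)*(b-(φ x T').2.1) ≤ P.κ*(φ x T').2.1*b :=
      mul_le_mul (mul_le_mul_of_nonneg_left (by linarith) hκ.le) (by linarith) (by linarith)
        (by positivity)
    have h7 : P.κ*b ≤ 858/1000 := by nlinarith
    nlinarith
  have hx0 : x ∉ Cl := by
    rintro (h | h)
    · exact S'_not_Upc hx h
    · simp only [mem_ofPred_eq, hx.2.1] at h
      have : P.κ*(P.qH - P.qL)*(b - P.qH) ≤ P.κ*P.qH*(3/10) := by gcongr <;> linarith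
      nlinarith
  rcases Fl.hit_or_avoid hClc hx0 (T+1) with ⟨t, h1, h2, h3, h4⟩ | h
  · obtain ⟨ho, hq, hp⟩ := main t ⟨h1, h2⟩ h4
    have h5 : φ x t ∈ P.Upc := h3.resolve_right fun h => by
      simp only [mem_ofPred_eq] at h; linarith
    obtain ⟨h6, h7⟩ := enters_of_first_hit P.Up_subset (hreg φ Fl x hx) h1 h5
      (fun s hs h => h4 s hs (Or.inl h))
    refine ⟨fun h => C_not_Upc Fl h h1.le h5, h6, fun h => ?_⟩
    unfold hit at h
    rw [h7] at h
    have := (hq t ⟨h1.le, le_rfl⟩).1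
    rw [h.2.1] at this
    exact lt_irrefl _ this
  · obtain ⟨ho, hq, -⟩ := main (T+1) ⟨by linarith, le_rfl⟩ (fun s hs => h s ⟨hs.1, hs.2.le⟩)
    have := (htr x.1 hθ _ _ _ 0 (T+1) (by linarith) ho (fun t ht => ⟨(hq t ht).1.le, (hq t ht).2⟩)
      (Or.inr (by simp only [Fl.zero]; exact hx.2.1))).1
    linarith

end Par

namespace Par
open Set

/-- The vector field crosses the parabola `p = κ q (b-q)` downwards. -/
theorem cross_down (P : Par) {b c q u : ℝ} (hc : P.κ*b*(c - P.κ*b) + 21/10 - u < 0)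
    (hF : 0 < P.F b u) (hb : 0 < b) (hq : q ∈ Ioc 0 b) :
    0 < P.κ*(b-2*q)*(P.κ*q*(b-q)) - (c*(P.κ*q*(b-q)) - q*P.F q u) := by
  have hid : (P.κ*(b-2*q)*(P.κ*q*(b-q)) - (c*(P.κ*q*(b-q)) - q*P.F q u)) * b =
      q*((b-q)*(-(P.κ*b*(c - P.κ*b) + 21/10 - u)) + q*P.F b u) := by
    unfold F; ring
  have h1 : 0 ≤ (b-q)*(-(P.κ*b*(c - P.κ*b) + 21/10 - u)) :=
    mul_nonneg (by linarith [hq.2]) (by linarith)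
  have h2 := mul_pos hq.1 hF
  refine pos_of_mul_pos_left ?_ hb.le
  rw [hid]
  exact mul_pos hq.1 (by linarith)

/-- Orbits from `S` below a downward crossed parabola come back below `b`, and never reach a point
of `S'` from which the next excursion returns. -/
theorem turn_below (P : Par) {Θ : Set ℝ} {b ω : ℝ} (hb : P.qH < b) (hb' : b < 2) (hω : 0 < ω)
    (hω' : ω ≤ 1/4) (hc : ∀ θ ∈ Θ, P.κ*b*(P.c2 θ - P.κ*b) + 1/10 + ω < 0)
    (hF : 0 < P.F b (2 - ω)) :
    ∀ᶠ ε in 𝓝[>] (0:ℝ), ∀ φ, IsFlow (P.field ε) φ → ∀ x ∈ P.S, x.1 ∈ Θ →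
      2 - ω/2 ≤ x.2.2.2 → x.2.2.1 ≤ P.κ*P.qL*(b - P.qL) →
      x ∉ P.A φ ∧ Enters φ P.Dn x ∧ (hit φ P.Dn x ∈ P.S' → hit φ P.Dn x ∈ P.C φ) := by
  obtain ⟨η, hη, hm⟩ := exists_margin (K := P.box ∩ {z | z.1 ∈ Icc P.qL b ∧ z.2.2 ∈ Ici (2 - ω)})
    (f := fun z => z.2.1^2 + (z.1 * P.F z.1 z.2.2)^2)
    (g := fun z => z.2.1^2/2 + P.Phi z.1 z.2.2 - P.Phi P.qL z.2.2)
    (P.isCompact_box.inter_right ((isClosed_Icc.preimage continuous_fst).inter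
      ((isClosed_Ici (a := 2 - ω)).preimage (continuous_snd.comp continuous_snd))))
    (by unfold F; fun_prop) (by unfold Phi; fun_prop) (by
      rintro ⟨q, p, u⟩ ⟨hb1, hq, hu⟩ hg
      simp only [box, mem_prod, mem_Ici] at hb1 hq hg hu ⊢
      have hq0 : 0 < q := P.hqL.trans_le hq.1
      by_contra hcon
      have h1 : p^2 + (q*P.F q u)^2 = 0 := le_antisymm (not_lt.mp hcon) (by positivity)
      have hp : p = 0 := by nlinarith [sq_nonneg p, sq_nonneg (q*P.F q u)]
      have hF0 : P.F q u = 0 := by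
        have : q * P.F q u = 0 := by nlinarith [sq_nonneg p, sq_nonneg (q*P.F q u)]
        exact (mul_eq_zero.mp this).resolve_left hq0.ne'
      have hq1 : q ≤ P.qH := by
        by_contra hlt
        have h2 := F_anti (P := P) (u := u) (show 1 ≤ q by linarith [P.hqH]) hq.2
        have h3 := F_mono_u (P := P) (q := b) hu
        linarith
      have := P.Phi_lt_of_F_eq_zero ⟨hq.1, hq1⟩ hb1.2.2 hF0
      rw [hp] at hg
      linarith)
  obtain ⟨T, hT, hbd⟩ := P.time_bound hη
  filter_upwards [hbd, P.regular_S, Ioo_mem_nhdsGT (show 0 < ω/(80*(T+1)) by positivity),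
    Ioo_mem_nhdsGT (show 0 < η/(80*(T+1)) by positivity),
    Ioo_mem_nhdsGT (show (0:ℝ) < 1/4000000 by norm_num)] with ε hbd hreg hε hεη hε1 φ Fl x hx hΘ hxu hxp
  have hε0 := hε.1
  have hκ := P.hκ
  have hκ2 : P.κ < 33/50 := by have := P.hR'; nlinarith
  have hqL := P.hqL; have hqL' := P.hqL'; have hqH := P.hqH; have hLH := P.qL_lt_qH
  have hθ := hx.1
  set Cl : Set (ℝ × ℝ × ℝ × ℝ) := P.Dnc ∪ {z | b ≤ z.2.1} with hCl
  have hClc : IsClosed Cl := P.isClosed_Dnc.union (isClosed_le (by fun_prop) (by fun_prop))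
  have hεT : 40*ε*(T+1) < ω/2 := by
    have := hε.2; rw [lt_div_iff₀ (by positivity)] at this; linarith
  have main : ∀ T' ∈ Ioc 0 (T+1), (∀ s ∈ Ico 0 T', φ x s ∉ Cl) →
      P.Orb ε x.1 (fun t => (φ x t).2.1) (fun t => (φ x t).2.2.1) (fun t => (φ x t).2.2.2) (Icc 0 T') ∧
      (∀ t ∈ Icc 0 T', (φ x t).2.1 ∈ Ico P.qL b) ∧ (∀ t ∈ Icc 0 T', 2 - ω ≤ (φ x t).2.2.2) := by
    intro T' hT' hav
    have hqb : ∀ t ∈ Icc 0 T', 0 ≤ b - (φ x t).2.1 :=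
      nonneg_at_end (h := fun t => b - (φ x t).2.1) hT'.1
        ((flow_dq Fl x T').const_sub b).continuousAt (fun t ht => by
          by_contra h
          exact hav t ht (Or.inr (by simp only [mem_ofPred_eq]; linarith)))
    obtain ⟨ho, h1, -, -⟩ := S_orb_of_le Fl hε0 hx hT'.1 (fun t ht h => hav t ht (Or.inl h))
      (fun t ht => by linarith [hqb t ht])
    have hu : ∀ t ∈ Icc 0 T', 2 - ω ≤ (φ x t).2.2.2 := by
      intro t ht
      have := ho.u_sub_le hθ hε0 ht
      rw [abs_le] at this
      have h2 := this.1
      simp only [Fl.zero] at h2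
      nlinarith [ht.1, ht.2, hT'.2]
    have hpar := barrier_nonneg (h := fun t => P.κ*(φ x t).2.1*(b-(φ x t).2.1) - (φ x t).2.2.1)
      (a := 0) (b := T')
      (fun t ht => ((((ho.dq t ht).const_mul P.κ).mul ((ho.dq t ht).const_sub b)).sub
        (ho.dp t ht)))
      (by simp only [Fl.zero, hx.2.1]; linarith) (by
        intro t ht _ h
        have hp : (φ x t).2.2.1 = P.κ*(φ x t).2.1*(b-(φ x t).2.1) := by linarith
        have h5 := P.c_mono hθ (ho.hu t ht).2
        rw [P.c_two] at h5
        have h6 := hc x.1 hΘ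
        have h7 : P.κ*b*(P.c x.1 (φ x t).2.2.2 - P.κ*b) ≤ P.κ*b*(P.c2 x.1 - P.κ*b) :=
          mul_le_mul_of_nonneg_left (by simpa using h5) (by nlinarith)
        have := P.cross_down (b := b) (c := P.c x.1 (φ x t).2.2.2) (q := (φ x t).2.1)
          (u := (φ x t).2.2.2) (by linarith [hu t ht])
          (hF.trans_le (F_mono_u (hu t ht))) (by linarith) ⟨hqL.trans_le (h1 t ht), by linarith [hqb t ht]⟩
        simp only [hp]
        linarith)
    have hlt := pos_of_deriv_ge (h := fun t => b - (φ x t).2.1) (K := 2) (a := 0) (b := T')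
      (fun t ht => (ho.dq t ht).const_sub b) (by simp only [Fl.zero, hx.2.1]; linarith) (by
        intro t ht h
        have h2 := hpar t ht
        have h3 := (ho.hq t ht).2
        have h4 := h1 t ht
        have : P.κ*(φ x t).2.1*(b-(φ x t).2.1) ≤ 2*(b-(φ x t).2.1) :=
          mul_le_mul_of_nonneg_right (by nlinarith) h.le
        linarith)
    exact ⟨ho, fun t ht => ⟨h1 t ht, by linarith [hlt t ht]⟩, hu⟩
  have hx0 : x ∉ Cl := by
    rintro (h | h)
    · exact S_not_Dnc hx h
    · simp only [mem_ofPred_eq, hx.2.1] at h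
      linarith
  rcases Fl.hit_or_avoid hClc hx0 (T+1) with ⟨t, h1, h2, h3, h4⟩ | h
  · obtain ⟨ho, hq, hu⟩ := main t ⟨h1, h2⟩ h4
    have htt : t ∈ Icc 0 t := ⟨h1.le, le_rfl⟩
    have h5 : φ x t ∈ P.Dnc := h3.resolve_right fun h => by
      simp only [mem_ofPred_eq] at h; linarith [(hq t htt).2]
    obtain ⟨h6, h7⟩ := enters_of_first_hit P.Dn_subset (hreg φ Fl x hx) h1 h5
      (fun s hs h => h4 s hs (Or.inl h))
    refine ⟨fun h => A_not_Dnc Fl h h1.le h5, h6, fun h => ?_⟩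
    by_contra hC
    have := lt_of_not_mem_C Fl hε0 hε1.2.le h hC
    unfold hit at this
    rw [h7] at this
    linarith [hu t htt]
  · obtain ⟨ho, hq, hu⟩ := main (T+1) ⟨by linarith, le_rfl⟩ (fun s hs => h s ⟨hs.1, hs.2.le⟩)
    have := hbd x.1 hθ _ _ _ 0 (T+1) (by linarith) ho (fun t ht htT => by
      refine hm ((φ x t).2.1, (φ x t).2.2.1, (φ x t).2.2.2) ⟨ho.mem_box ht, ⟨(hq t ht).1, (hq t ht).2.le⟩, hu t ht⟩ ?_
      have h1 := ho.energy_ge hθ hε0 (q₀ := P.qL) ⟨hqL.le, by linarith⟩ ht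
      have h2 : 80*ε*(t-0) ≤ η := by
        have := hεη.2
        rw [lt_div_iff₀ (by positivity)] at this
        nlinarith [ht.1]
      simp only [Fl.zero, hx.2.1] at h1
      simp only
      nlinarith [sq_nonneg x.2.2.1])
    linarith

end Par

namespace Par
open Set

/-- If the wave speed is large enough, every orbit from `S'` escapes to negative `q`. -/
theorem mem_C_of_speed (P : Par) {Θ : Set ℝ} (hulo : 128/100 ≤ P.ulo) (hLH : P.qL < P.qH - 1)
    (hc : ∀ θ ∈ Θ, 96/100 ≤ P.c θ P.ulo) :
    ∀ᶠ ε in 𝓝[>] (0:ℝ), ∀ φ, IsFlow (P.field ε) φ → ∀ x ∈ P.S', x.1 ∈ Θ → x ∈ P.C φ := by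
  obtain ⟨T, hT, htr⟩ := P.transit
  filter_upwards [htr, self_mem_nhdsWithin] with ε htr hε0 φ Fl x hx hΘ
  by_contra hC
  have hqL := P.hqL; have hqH := P.hqH; have hθ := hx.1
  have hq5 : P.qH < 5/4 := by have := P.hqH'; have := P.hy1; linarith
  have main : ∀ T' > 0, (∀ s ∈ Ico 0 T', φ x s ∉ P.Upc) →
      P.Orb ε x.1 (fun t => (φ x t).2.1) (fun t => (φ x t).2.2.1) (fun t => (φ x t).2.2.2) (Icc 0 T') ∧
      (∀ t ∈ Icc 0 T', 0 < (φ x t).2.1 ∧ (φ x t).2.1 ≤ P.qH) ∧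
      ∀ t ∈ Ioc 0 T', (φ x t).2.2.1 < -(9/10*(φ x t).2.1*(P.qH - (φ x t).2.1)) := by
    intro T' hT' hav
    obtain ⟨ho, h0, h1, -, -⟩ := S'_orb Fl hε0 hx hC hT' hav
    refine ⟨ho, fun t ht => ⟨h0 t ht, h1 t ht⟩, fun t ht => ?_⟩
    have := barrier (h := fun t => -(9/10*(φ x t).2.1*(P.qH-(φ x t).2.1)) - (φ x t).2.2.1)
      (a := 0) (b := T')
      (fun t ht => ((((ho.dq t ht).const_mul (9/10)).mul ((ho.dq t ht).const_sub P.qH)).neg.sub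
        (ho.dp t ht)))
      (by simp only [Fl.zero, hx.2.1]; linarith [hx.2.2.1.2]) (by
        intro t ht _ h
        have hp : (φ x t).2.2.1 = -(9/10*(φ x t).2.1*(P.qH-(φ x t).2.1)) := by linarith
        simp only [hp]
        have h5 := P.c_mono hθ (ho.hu t ht).1
        have h6 := hc x.1 hΘ
        have h7 := P.F_qH_pos (ho.hu t ht).1
        have h8 := (ho.hu t ht).1
        have hq0 := h0 t ht
        have hq1 := h1 t ht
        generalize (φ x t).2.1 = q at hq0 hq1 ⊢
        generalize (φ x t).2.2.2 = u at h5 h7 h8 ⊢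
        generalize P.c x.1 u = c at h5 ⊢
        have hR := P.hR
        have hid : P.F q u * P.qH = q * P.F P.qH u + (P.qH - q)*(u - 21/10 + 2*P.κ^2*P.qH*q) := by
          unfold F; ring
        have hbr : 0 < (81/100*(P.qH - 2*q) + 9/10*c + 2*P.κ^2*q)*P.qH - (21/10 - u) := by
          nlinarith [mul_nonneg hq0.le (show 0 ≤ 2*P.κ^2 - 23/30 by linarith),
            mul_nonneg (mul_nonneg hq0.le (show 0 ≤ 2*P.κ^2 - 23/30 by linarith)) (show 0 ≤ P.qH by linarith),
            mul_nonneg (show 0 ≤ P.qH by linarith) (show 0 ≤ P.qH - q by linarith),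
            mul_nonneg (show 0 ≤ c - 96/100 by linarith) (show 0 ≤ P.qH by linarith)]
        have h9 : 0 < q*((P.qH - q)*((81/100*(P.qH - 2*q) + 9/10*c + 2*P.κ^2*q)*P.qH - (21/10 - u))
            + q*P.F P.qH u) :=
          mul_pos hq0 (add_pos_of_nonneg_of_pos (mul_nonneg (by linarith) hbr.le) (mul_pos hq0 h7))
        refine pos_of_mul_pos_left (b := P.qH) ?_ (by linarith)
        refine h9.trans_eq ?_
        have e : q*P.F q u*P.qH = q*(q * P.F P.qH u + (P.qH - q)*(u - 21/10 + 2*P.κ^2*P.qH*q)) := by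
          rw [← hid]; ring
        linear_combination -e) t ht
    linarith
  rcases Fl.hit_or_avoid P.isClosed_Upc (S'_not_Upc hx) (T+1) with ⟨t, h1, h2, h3, h4⟩ | h
  · obtain ⟨ho, hq, hp⟩ := main t h1 h4
    have h5 := hp t ⟨h1, le_rfl⟩
    have h6 := hq t ⟨h1.le, le_rfl⟩
    have := mul_nonneg (mul_nonneg (show (0:ℝ) ≤ 9/10 by norm_num) h6.1.le)
      (show 0 ≤ P.qH - (φ x t).2.1 by linarith [h6.2])
    linarith [h3.1]
  · obtain ⟨ho, hq, hp⟩ := main (T+1) (by linarith) (fun s hs => h s ⟨hs.1, hs.2.le⟩)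
    by_cases hall : ∀ t ∈ Icc 0 (T+1), P.qL ≤ (φ x t).2.1
    · have := (htr x.1 hθ _ _ _ 0 (T+1) (by linarith) ho (fun t ht => ⟨hall t ht, (hq t ht).2⟩)
        (Or.inr (by simp only [Fl.zero]; exact hx.2.1))).1
      linarith
    · push Not at hall
      obtain ⟨t, ht, hqt⟩ := hall
      have ht0 : 0 < t := by
        refine lt_of_le_of_ne ht.1 fun h => ?_
        rw [← h, Fl.zero, hx.2.1] at hqt
        linarith
      have h5 := hp t ⟨ht0, ht.2⟩
      have h6 := (hq t ht).1
      refine hC ⟨t, ht.1, h6, h5.trans ?_, fun s hs => h s ⟨hs.1, hs.2.trans ht.2⟩⟩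
      have : (φ x t).2.1*1 < (φ x t).2.1*(P.qH - (φ x t).2.1) :=
        mul_lt_mul_of_pos_left (by linarith) h6
      nlinarith

end Par

/-- The whole backward orbit of `w` stays in `R`. -/
def BackIn {X : Type*} (φ : X → ℝ → X) (R : Set X) (w : X) : Prop := ∀ t ≤ 0, φ w t ∈ R

/-- A function on `(-∞,0]` that is nonnegative at `0`, dissipated and controlled by `N`. -/
theorem exists_zero_of_dissipation {G G' N : ℝ → ℝ} {s K B : ℝ} (hs : 0 < s) (hK : 0 < K)
    (hG : ∀ t ≤ 0, HasDerivAt G (G' t) t) (hd : ∀ t ≤ 0, G' t ≤ -s * N t)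
    (hGN : ∀ t ≤ 0, |G t| ≤ K * N t) (hB : ∀ t ≤ 0, N t ≤ B) (h0 : 0 ≤ G 0) :
    ∃ t ≤ 0, N t ≤ 0 := by
  have hN : ∀ t ≤ 0, 0 ≤ N t := fun t ht => by
    have := (abs_nonneg _).trans (hGN t ht)
    exact nonneg_of_mul_nonneg_right this hK
  have hanti : ∀ a b, a ≤ b → b ≤ 0 → G b ≤ G a := by
    intro a b hab hb
    have := ge_of_deriv_le (C := 0) hab (fun t ht => hG t (ht.2.trans hb)) (fun t ht => by
      have := hd t (ht.2.trans hb)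
      have := hN t (ht.2.trans hb)
      nlinarith)
    linarith
  have hle : ∀ t ≤ 0, G t ≤ 0 := by
    intro t₀ ht₀
    by_contra hcon
    push Not at hcon
    have key : ∀ t ≤ t₀, G t₀ + s * (G t₀ / K) * (t₀ - t) ≤ K * B := by
      intro t ht
      have h1 := ge_of_deriv_le (C := -(s * (G t₀ / K))) ht (fun r hr => hG r (hr.2.trans ht₀))
        (fun r hr => by
          have h2 := hd r (hr.2.trans ht₀)
          have h3 := hGN r (hr.2.trans ht₀)
          have h4 := hanti r t₀ hr.2 ht₀
          have h5 : G t₀ / K ≤ N r := by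
            rw [div_le_iff₀ hK]
            linarith [le_abs_self (G r)]
          nlinarith)
      have h2 := hGN t (ht.trans ht₀)
      have h3 := mul_le_mul_of_nonneg_left (hB t (ht.trans ht₀)) hK.le
      have := le_abs_self (G t)
      linarith
    have hp : 0 < s * (G t₀ / K) := by positivity
    have h1 := key (t₀ - (|K * B| + 1)/(s * (G t₀ / K))) (by
      have : 0 ≤ (|K * B| + 1)/(s * (G t₀ / K)) := by positivity
      linarith)
    have h2 : s * (G t₀ / K) * ((|K * B| + 1)/(s * (G t₀ / K))) = |K*B| + 1 := by field_simp
    have := le_abs_self (K * B)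
    rw [show t₀ - (t₀ - (|K * B| + 1)/(s * (G t₀ / K))) = (|K * B| + 1)/(s * (G t₀ / K)) by ring, h2]
      at h1
    linarith
  have hz : ∀ t ≤ 0, G t = 0 := fun t ht =>
    le_antisymm (hle t ht) (h0.trans (hanti t 0 ht le_rfl))
  obtain ⟨c, hc, hc'⟩ := exists_hasDerivAt_eq_slope G G' (show (-1:ℝ) < 0 by norm_num)
    (fun t ht => (hG t ht.2).continuousAt.continuousWithinAt) (fun t ht => hG t ht.2.le)
  rw [hz 0 le_rfl, hz (-1) (by norm_num)] at hc'
  refine ⟨c, hc.2.le, ?_⟩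
  have := hd c hc.2.le
  rw [hc'] at this
  simp only [sub_self, zero_div] at this
  nlinarith

theorem mul_mul_le_of_abs_le {X c : ℝ} (h : |X| ≤ c) (a b : ℝ) : X * (a * b) ≤ c/2 * (a^2 + b^2) := by
  rw [abs_le] at h
  nlinarith [mul_nonneg (show 0 ≤ c - X by linarith) (sq_nonneg (a + b)),
    mul_nonneg (show 0 ≤ c + X by linarith) (sq_nonneg (a - b))]

namespace Par
open Set
variable (P : Par)

/-- Primitive of the denominator of the slow drift. -/
def Md (θ u : ℝ) : ℝ := (P.cb θ + P.a θ * P.ζ) * (u - P.ub) + P.a θ * (u - P.ub)^2/2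

/-- A Lyapunov function for the difference of two solutions. -/
def gap (ε θ cX k dq dp u v : ℝ) : ℝ :=
  cX*dq^2 - 2*dq*dp + k/ε*(P.Md θ u - P.Md θ v)^2

/-- The derivative of `gap` along two solutions. -/
def dgap (θ cX k q p u q' p' u' : ℝ) : ℝ :=
  2*cX*(q-q')*(p-p') - 2*(p-p')^2
    - 2*(q-q')*((P.c θ u * p - q * P.F q u) - (P.c θ u' * p' - q' * P.F q' u'))
    + 2*k*(P.Md θ u - P.Md θ u')*(gq q u - gq q' u')

variable {P} {ε θ : ℝ} {q p u q' p' u' : ℝ → ℝ} {I : Set ℝ}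

theorem Orb.dMd (hθ : θ ∈ Icc (0:ℝ) 1) (h : P.Orb ε θ q p u I) {t : ℝ} (ht : t ∈ I) (hm : P.um ≤ u t) :
    HasDerivAt (fun t => P.Md θ (u t)) (ε * gq (q t) (u t)) t := by
  have h1 := h.du t ht
  have h2 := P.le_den hθ (h.hu t ht).1
  have h3 : HasDerivAt (fun t => P.Md θ (u t)) (((P.cb θ + P.a θ * P.ζ) + P.a θ * (u t - P.ub)) *
      P.du ε θ (q t) (u t)) t := by
    have h4 := h1.sub_const P.ub
    have h5 := (h4.const_mul (P.cb θ + P.a θ * P.ζ)).add (((h4.pow 2).const_mul (P.a θ)).div_const 2)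
    refine h5.congr_deriv ?_
    simp only [show 2 - 1 = 1 from rfl, pow_one, Nat.cast_ofNat]; ring
  convert h3 using 1
  unfold Par.du
  rw [P.m_eq hm]
  have h6 : P.c θ (u t) + P.a θ * P.ζ = P.cb θ + P.a θ * P.ζ + P.a θ * (u t - P.ub) := by
    unfold c; ring
  rw [h6] at h2 ⊢
  field_simp

theorem Orb.dgap (hθ : θ ∈ Icc (0:ℝ) 1) (hε : 0 < ε) (h : P.Orb ε θ q p u I)
    (h' : P.Orb ε θ q' p' u' I) {t : ℝ} (ht : t ∈ I) (hm : P.um ≤ u t) (hm' : P.um ≤ u' t)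
    (cX k : ℝ) : HasDerivAt (fun t => P.gap ε θ cX k (q t - q' t) (p t - p' t) (u t) (u' t))
      (P.dgap θ cX k (q t) (p t) (u t) (q' t) (p' t) (u' t)) t := by
  have h1 := (h.dq t ht).sub (h'.dq t ht)
  have h2 := (h.dp t ht).sub (h'.dp t ht)
  have h3 := (h.dMd hθ ht hm).sub (h'.dMd hθ ht hm')
  have h4 := (((h1.pow 2).const_mul cX).sub ((h1.const_mul 2).mul h2)).add ((h3.pow 2).const_mul (k/ε))
  refine h4.congr_deriv ?_
  simp only [show 2 - 1 = 1 from rfl, pow_one, Nat.cast_ofNat, Pi.sub_apply]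
  unfold Par.dgap
  field_simp; ring

theorem Md_sub (θ u u' : ℝ) : P.Md θ u - P.Md θ u' =
    (P.c θ u + P.c θ u' + 2*P.a θ*P.ζ)/2 * (u - u') := by
  unfold Md c; ring

theorem dgap_eq (θ cX k q p u q' p' u' : ℝ) : P.dgap θ cX k q p u q' p' u' =
    -2*(p-p')^2 + 2*(cX - P.c θ u)*((q-q')*(p-p'))
    + 2*(u - 21/10 + 2*P.κ^2*(2*(q+q')-(q^2+q*q'+q'^2)))*(q-q')^2
    + 2*(q' - 2*(k*((P.c θ u + P.c θ u' + 2*P.a θ*P.ζ)/2))*(u'-1) - P.a θ*p')*((q-q')*(u-u'))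
    - 2*(k*((P.c θ u + P.c θ u' + 2*P.a θ*P.ζ)/2))*(1+2*q)*(u-u')^2 := by
  unfold dgap; rw [Md_sub]; unfold gq F c; ring

variable (P) in
/-- Two orbits in `R` over the same parameter separate dissipatively. -/
structure Dissip (R : Set (ℝ × ℝ × ℝ × ℝ)) (cX k : ℝ → ℝ) (s : ℝ) : Prop where
  s_pos : 0 < s
  cX_mem : ∀ θ ∈ Icc (0:ℝ) 1, cX θ ∈ Icc (0:ℝ) 2
  k_nonneg : ∀ θ ∈ Icc (0:ℝ) 1, 0 ≤ k θ
  fst_mem : ∀ z ∈ R, z.1 ∈ Icc (0:ℝ) 1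
  q_mem : ∀ z ∈ R, z.2.1 ∈ Icc (0:ℝ) 2
  p_mem : ∀ z ∈ R, z.2.2.1 ∈ Icc (-16:ℝ) 7
  u_mem : ∀ z ∈ R, z.2.2.2 ∈ Icc P.um 2
  dissip : ∀ z ∈ R, ∀ z' ∈ R, z.1 = z'.1 →
    P.dgap z.1 (cX z.1) (k z.1) z.2.1 z.2.2.1 z.2.2.2 z'.2.1 z'.2.2.1 z'.2.2.2 ≤
      -s * ((z.2.1-z'.2.1)^2 + (z.2.2.1-z'.2.2.1)^2 + (z.2.2.2-z'.2.2.2)^2)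

namespace Dissip
variable {R : Set (ℝ × ℝ × ℝ × ℝ)} {cX k : ℝ → ℝ} {s : ℝ} (D : P.Dissip R cX k s)
  {φ : ℝ × ℝ × ℝ × ℝ → ℝ → ℝ × ℝ × ℝ × ℝ} (Fl : IsFlow (P.field ε) φ)
include D

theorem abs_gap_le (hε : 0 < ε) {z z' : ℝ × ℝ × ℝ × ℝ} (hz : z ∈ R) (hz' : z' ∈ R) :
    |P.gap ε z.1 (cX z.1) (k z.1) (z.2.1-z'.2.1) (z.2.2.1-z'.2.2.1) z.2.2.2 z'.2.2.2| ≤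
      (3 + k z.1/ε*(2+2*P.ζ)^2) *
        ((z.2.1-z'.2.1)^2 + (z.2.2.1-z'.2.2.1)^2 + (z.2.2.2-z'.2.2.2)^2) := by
  have hθ := D.fst_mem z hz
  have hum := P.hum
  have hu := D.u_mem z hz
  have hu' := D.u_mem z' hz'
  have hc := D.cX_mem z.1 hθ
  have hk : 0 ≤ k z.1/ε := div_nonneg (D.k_nonneg z.1 hθ) hε.le
  have hζ := P.hζ
  have h1 := P.le_den hθ (show P.ulo ≤ z.2.2.2 by linarith [hu.1])
  have h2 := P.le_den hθ (show P.ulo ≤ z'.2.2.2 by linarith [hu'.1])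
  have h3 := P.c_le hθ hu.2
  have h4 := P.c_le hθ hu'.2
  have h5 := P.a_le hθ
  have h6 := P.a_pos hθ
  unfold gap
  rw [Md_sub]
  set m := (P.c z.1 z.2.2.2 + P.c z.1 z'.2.2.2 + 2*P.a z.1*P.ζ)/2 with hm
  have hm0 : 0 ≤ m := by rw [hm]; linarith
  have hm1 : m ≤ 2 + 2*P.ζ := by rw [hm]; nlinarith
  have hm2 : m^2 ≤ (2+2*P.ζ)^2 := by gcongr
  generalize z.2.1 - z'.2.1 = dq
  generalize z.2.2.1 - z'.2.2.1 = dp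
  generalize z.2.2.2 - z'.2.2.2 = du
  have h7 : k z.1/ε*(m*du)^2 ≤ k z.1/ε*(2+2*P.ζ)^2*du^2 := by
    rw [mul_pow, ← mul_assoc]; gcongr
  have h8 : 0 ≤ k z.1/ε*(m*du)^2 := by positivity
  have h9 : 0 ≤ k z.1/ε*(2+2*P.ζ)^2 := by positivity
  have h10 := mul_nonneg h9 (sq_nonneg dq)
  have h11 := mul_nonneg h9 (sq_nonneg dp)
  have h12 := mul_nonneg hc.1 (sq_nonneg dq)
  have h13 := mul_le_mul_of_nonneg_right hc.2 (sq_nonneg dq)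
  rw [abs_le]
  constructor <;> nlinarith [sq_nonneg (dq+dp), sq_nonneg (dq-dp), sq_nonneg du, sq_nonneg dq, sq_nonneg dp]

include Fl

theorem orb {z : ℝ × ℝ × ℝ × ℝ} (hz : z ∈ R) {I : Set ℝ} (h : ∀ t ∈ I, φ z t ∈ R) :
    P.Orb ε z.1 (fun t => (φ z t).2.1) (fun t => (φ z t).2.2.1) (fun t => (φ z t).2.2.2) I :=
  flow_orb Fl (D.fst_mem z hz) (fun t ht => D.q_mem _ (h t ht)) (fun t ht => D.p_mem _ (h t ht))
    (fun t ht => ⟨P.hum.le.trans (D.u_mem _ (h t ht)).1, (D.u_mem _ (h t ht)).2⟩)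

theorem hasDerivAt_gap (hε : 0 < ε) {z z' : ℝ × ℝ × ℝ × ℝ} (hzz : z.1 = z'.1) (hz : z ∈ R) (hz' : z' ∈ R)
    {t : ℝ} (h : φ z t ∈ R) (h' : φ z' t ∈ R) : HasDerivAt (fun t => P.gap ε z.1 (cX z.1) (k z.1)
      ((φ z t).2.1 - (φ z' t).2.1) ((φ z t).2.2.1 - (φ z' t).2.2.1) (φ z t).2.2.2 (φ z' t).2.2.2)
      (P.dgap z.1 (cX z.1) (k z.1) (φ z t).2.1 (φ z t).2.2.1 (φ z t).2.2.2
        (φ z' t).2.1 (φ z' t).2.2.1 (φ z' t).2.2.2) t := by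
  have h1 := D.orb Fl hz (I := {t}) (by simpa using h)
  have h2 := D.orb Fl hz' (I := {t}) (by simpa using h')
  rw [← hzz] at h2
  exact h1.dgap (D.fst_mem z hz) hε h2 (mem_singleton t) (D.u_mem _ h).1 (D.u_mem _ h').1 _ _

theorem dgap_le {z z' : ℝ × ℝ × ℝ × ℝ} (hzz : z.1 = z'.1)
    {t : ℝ} (h : φ z t ∈ R) (h' : φ z' t ∈ R) : P.dgap z.1 (cX z.1) (k z.1) (φ z t).2.1 (φ z t).2.2.1
      (φ z t).2.2.2 (φ z' t).2.1 (φ z' t).2.2.1 (φ z' t).2.2.2 ≤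
      -s * (((φ z t).2.1 - (φ z' t).2.1)^2 + ((φ z t).2.2.1 - (φ z' t).2.2.1)^2 +
        ((φ z t).2.2.2 - (φ z' t).2.2.2)^2) := by
  have := D.dissip _ h _ h' (by rw [flow_fst Fl, flow_fst Fl, hzz])
  rwa [flow_fst Fl] at this

theorem abs_gap_flow_le (hε : 0 < ε) {z z' : ℝ × ℝ × ℝ × ℝ}
    {t : ℝ} (h : φ z t ∈ R) (h' : φ z' t ∈ R) : |P.gap ε z.1 (cX z.1) (k z.1)
      ((φ z t).2.1 - (φ z' t).2.1) ((φ z t).2.2.1 - (φ z' t).2.2.1) (φ z t).2.2.2 (φ z' t).2.2.2| ≤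
      (3 + k z.1/ε*(2+2*P.ζ)^2) * (((φ z t).2.1 - (φ z' t).2.1)^2 + ((φ z t).2.2.1 - (φ z' t).2.2.1)^2 +
        ((φ z t).2.2.2 - (φ z' t).2.2.2)^2) := by
  have := D.abs_gap_le hε h h'
  rwa [flow_fst Fl] at this

omit Fl in
theorem dist_sq_le {z z' : ℝ × ℝ × ℝ × ℝ} (h : z ∈ R) (h' : z' ∈ R) :
    (z.2.1-z'.2.1)^2 + (z.2.2.1-z'.2.2.1)^2 + (z.2.2.2-z'.2.2.2)^2 ≤ 4 + 23^2 + 4 := by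
  have h1 := D.q_mem _ h; have h2 := D.q_mem _ h'
  have h3 := D.p_mem _ h; have h4 := D.p_mem _ h'
  have h5 := D.u_mem _ h; have h6 := D.u_mem _ h'
  have := P.hulo; have := P.hum
  have e1 : (z.2.1-z'.2.1)^2 ≤ 2^2 :=
    sq_le_sq' (by linarith [h1.1, h2.2]) (by linarith [h1.2, h2.1])
  have e2 : (z.2.2.1-z'.2.2.1)^2 ≤ 23^2 :=
    sq_le_sq' (by linarith [h3.1, h4.2]) (by linarith [h3.2, h4.1])
  have e3 : (z.2.2.2-z'.2.2.2)^2 ≤ 2^2 :=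
    sq_le_sq' (by linarith [h5.1, h6.2]) (by linarith [h5.2, h6.1])
  linarith

theorem unique (hε : 0 < ε) {w w' : ℝ × ℝ × ℝ × ℝ} (h1 : w.1 = w'.1) (h2 : w.2.1 = w'.2.1)
    (hw : BackIn φ R w) (hw' : BackIn φ R w') : w = w' := by
  have hwR : w ∈ R := by have := hw 0 le_rfl; rwa [Fl.zero] at this
  have hwR' : w' ∈ R := by have := hw' 0 le_rfl; rwa [Fl.zero] at this
  have hk := D.k_nonneg _ (D.fst_mem w hwR)
  have hζ := P.hζ
  obtain ⟨t, ht, h⟩ := exists_zero_of_dissipation D.s_pos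
    (show 0 < 3 + k w.1/ε*(2+2*P.ζ)^2 by positivity)
    (fun t ht => D.hasDerivAt_gap Fl hε h1 hwR hwR' (hw t ht) (hw' t ht))
    (fun t ht => D.dgap_le Fl h1 (hw t ht) (hw' t ht))
    (fun t ht => D.abs_gap_flow_le Fl hε (hw t ht) (hw' t ht))
    (fun t ht => D.dist_sq_le (hw t ht) (hw' t ht))
    (by
      simp only [Fl.zero, h2, gap]
      have : 0 ≤ k w.1/ε*(P.Md w.1 w.2.2.2 - P.Md w.1 w'.2.2.2)^2 := by positivity
      nlinarith)
  have e1 : (φ w t).2.1 = (φ w' t).2.1 := by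
    nlinarith [sq_nonneg ((φ w t).2.1 - (φ w' t).2.1),
      sq_nonneg ((φ w t).2.2.1 - (φ w' t).2.2.1), sq_nonneg ((φ w t).2.2.2 - (φ w' t).2.2.2)]
  have e2 : (φ w t).2.2.1 = (φ w' t).2.2.1 := by
    nlinarith [sq_nonneg ((φ w t).2.1 - (φ w' t).2.1),
      sq_nonneg ((φ w t).2.2.1 - (φ w' t).2.2.1), sq_nonneg ((φ w t).2.2.2 - (φ w' t).2.2.2)]
  have e3 : (φ w t).2.2.2 = (φ w' t).2.2.2 := by
    nlinarith [sq_nonneg ((φ w t).2.1 - (φ w' t).2.1),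
      sq_nonneg ((φ w t).2.2.1 - (φ w' t).2.2.1), sq_nonneg ((φ w t).2.2.2 - (φ w' t).2.2.2)]
  have e0 : (φ w t).1 = (φ w' t).1 := by rw [flow_fst Fl, flow_fst Fl, h1]
  have e : φ w t = φ w' t := Prod.ext e0 (Prod.ext e1 (Prod.ext e2 e3))
  have := congrArg (fun z => φ z (-t)) e
  simpa only [Fl.add, add_neg_cancel, Fl.zero] using this

/-- Backward orbits in `R` converge to the equilibrium. -/
theorem tendsto_atBot (hε : 0 < ε) {w e : ℝ × ℝ × ℝ × ℝ} (h1 : w.1 = e.1) (he : e ∈ R)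
    (hee : ∀ t, φ e t = e) (hw : BackIn φ R w) : Tendsto (φ w) atBot (𝓝 e) := by
  have hwR : w ∈ R := by have := hw 0 le_rfl; rwa [Fl.zero] at this
  have hs := D.s_pos
  have hneg : ∀ t : ℝ, 0 ≤ t → -t ≤ 0 := fun t ht => by linarith
  have ho := D.orb Fl hwR (I := Iic 0) hw
  have hw0 := tendsto_zero_of_lyapunov (t₀ := 0)
    (m := -((3 + k w.1/ε*(2+2*P.ζ)^2) * (4 + 23^2 + 4)))
    (C := s*(2*2*16 + 2*32*100 + 2*2*(40*ε)))
    (L := fun t => -P.gap ε w.1 (cX w.1) (k w.1) ((φ w (-t)).2.1 - (φ e (-t)).2.1)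
      ((φ w (-t)).2.2.1 - (φ e (-t)).2.2.1) (φ w (-t)).2.2.2 (φ e (-t)).2.2.2)
    (L' := fun t => P.dgap w.1 (cX w.1) (k w.1) (φ w (-t)).2.1 (φ w (-t)).2.2.1
      (φ w (-t)).2.2.2 (φ e (-t)).2.1 (φ e (-t)).2.2.1 (φ e (-t)).2.2.2)
    (w := fun t => s * (((φ w (-t)).2.1 - e.2.1)^2 + ((φ w (-t)).2.2.1 - e.2.2.1)^2 +
      ((φ w (-t)).2.2.2 - e.2.2.2)^2))
    (w' := fun t => s * (2*((φ w (-t)).2.1 - e.2.1) * (-(φ w (-t)).2.2.1) +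
      2*((φ w (-t)).2.2.1 - e.2.2.1) * (-(P.c w.1 (φ w (-t)).2.2.2 * (φ w (-t)).2.2.1 -
        (φ w (-t)).2.1 * P.F (φ w (-t)).2.1 (φ w (-t)).2.2.2)) +
      2*((φ w (-t)).2.2.2 - e.2.2.2) * (-P.du ε w.1 (φ w (-t)).2.1 (φ w (-t)).2.2.2)))
    (fun t ht => by
      have := ((D.hasDerivAt_gap Fl hε h1 hwR he (hw (-t) (hneg t ht))
        (by rw [hee]; exact he)).comp t (hasDerivAt_neg t)).neg
      refine this.congr_deriv ?_
      ring)
    (fun t ht => by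
      have h3 := D.abs_gap_flow_le Fl hε (hw (-t) (hneg t ht)) (z' := e) (by rw [hee]; exact he)
      have h4 := D.dist_sq_le (hw (-t) (hneg t ht)) he
      have hk := D.k_nonneg _ (D.fst_mem w hwR)
      have hζ := P.hζ
      simp only [hee] at h3 ⊢
      have h5 := mul_le_mul_of_nonneg_left h4 (show 0 ≤ 3 + k w.1/ε*(2+2*P.ζ)^2 by positivity)
      rw [abs_le] at h3
      linarith [h3.2])
    (fun t ht => by positivity)
    (fun t ht => by
      have := D.dgap_le Fl h1 (hw (-t) (hneg t ht)) (z' := e) (by rw [hee]; exact he)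
      simp only [hee] at this ⊢
      linarith)
    (fun t ht => by
      have d1 := ((ho.dq (-t) (hneg t ht)).comp t (hasDerivAt_neg t)).sub_const e.2.1
      have d2 := ((ho.dp (-t) (hneg t ht)).comp t (hasDerivAt_neg t)).sub_const e.2.2.1
      have d3 := ((ho.du (-t) (hneg t ht)).comp t (hasDerivAt_neg t)).sub_const e.2.2.2
      refine ((((d1.pow 2).add (d2.pow 2)).add (d3.pow 2)).const_mul s).congr_deriv ?_
      simp only [show 2 - 1 = 1 from rfl, pow_one, Nat.cast_ofNat, Function.comp]; ring)
    (fun t ht => by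
      have hz := hw (-t) (hneg t ht)
      have hθ := D.fst_mem w hwR
      have hq := D.q_mem _ hz; have hp := D.p_mem _ hz; have hu := ho.hu (-t) (hneg t ht)
      have hq' := D.q_mem _ he; have hp' := D.p_mem _ he; have hu' := D.u_mem _ he
      have hum := P.hum; have hulo := P.hulo; have hhu := D.u_mem _ hz
      have hF := P.F_mem hq hu
      have hdu := P.abs_du_le hθ hε.le hq hu
      have hc1 := P.le_c hθ hu.1
      have hc2 := P.c_le hθ hu.2
      have a1 : |(φ w (-t)).2.1 - e.2.1| ≤ 2 := by
        rw [abs_le]; constructor <;> linarith [hq.1, hq.2, hq'.1, hq'.2]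
      have a2 : |(φ w (-t)).2.2.1 - e.2.2.1| ≤ 32 := by
        rw [abs_le]; constructor <;> linarith [hp.1, hp.2, hp'.1, hp'.2]
      have a3 : |(φ w (-t)).2.2.2 - e.2.2.2| ≤ 2 := by
        rw [abs_le]; constructor <;> linarith [hhu.1, hhu.2, hu'.1, hu'.2]
      have b1 : |(φ w (-t)).2.2.1| ≤ 16 := by
        rw [abs_le]; constructor <;> linarith [hp.1, hp.2]
      have b2 : |P.c w.1 (φ w (-t)).2.2.2 * (φ w (-t)).2.2.1 -
          (φ w (-t)).2.1 * P.F (φ w (-t)).2.1 (φ w (-t)).2.2.2| ≤ 100 := by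
        have e1 : |P.c w.1 (φ w (-t)).2.2.2 * (φ w (-t)).2.2.1| ≤ 2*16 := by
          rw [abs_mul]; gcongr; rw [abs_le]; constructor <;> linarith
        have e2 : |(φ w (-t)).2.1 * P.F (φ w (-t)).2.1 (φ w (-t)).2.2.2| ≤ 2*1 := by
          rw [abs_mul]; gcongr
          · rw [abs_le]; constructor <;> linarith [hq.1, hq.2]
          · rw [abs_le]; constructor <;> linarith [hF.1, hF.2]
        have := abs_sub (P.c w.1 (φ w (-t)).2.2.2 * (φ w (-t)).2.2.1)
          ((φ w (-t)).2.1 * P.F (φ w (-t)).2.1 (φ w (-t)).2.2.2)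
        linarith
      rw [abs_mul, abs_of_pos hs]
      refine mul_le_mul_of_nonneg_left ?_ hs.le
      refine (abs_add_le _ _).trans (add_le_add ((abs_add_le _ _).trans (add_le_add ?_ ?_)) ?_)
      · rw [abs_mul, abs_mul, abs_neg, abs_two]; gcongr
      · rw [abs_mul, abs_mul, abs_neg, abs_two]; gcongr
      · rw [abs_mul, abs_mul, abs_neg, abs_two]; gcongr)
  have hsq : ∀ {f g : ℝ → ℝ} {c : ℝ}, Tendsto g atTop (𝓝 0) → (∀ t, s * (f t - c)^2 ≤ g t) →
      Tendsto f atTop (𝓝 c) := by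
    intro f g c hg hfg
    have h3 : Tendsto (fun t => (f t - c)^2) atTop (𝓝 0) := by
      refine squeeze_zero (fun t => sq_nonneg _) (g := fun t => g t / s) (fun t => ?_) ?_
      · rw [le_div_iff₀ hs]; linarith [hfg t]
      · simpa using hg.div_const s
    have h4 : Tendsto (fun t => f t - c) atTop (𝓝 0) := by
      rw [tendsto_zero_iff_abs_tendsto_zero]
      have := h3.sqrt
      simpa [Real.sqrt_sq_eq_abs, Function.comp_def] using this
    simpa using h4.add_const c
  have main : Tendsto (fun t => φ w (-t)) atTop (𝓝 e) := by
    have t0 : Tendsto (fun t => (φ w (-t)).1) atTop (𝓝 e.1) := by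
      simp only [flow_fst Fl, h1]; exact tendsto_const_nhds
    refine t0.prodMk_nhds (Tendsto.prodMk_nhds (mx := fun t => (φ w (-t)).2.1) (hsq hw0 fun t => ?_)
      (Tendsto.prodMk_nhds (mx := fun t => (φ w (-t)).2.2.1) (my := fun t => (φ w (-t)).2.2.2)
        (hsq hw0 fun t => ?_) (hsq hw0 fun t => ?_))) <;>
    · apply mul_le_mul_of_nonneg_left _ hs.le
      nlinarith [sq_nonneg ((φ w (-t)).2.1 - e.2.1), sq_nonneg ((φ w (-t)).2.2.1 - e.2.2.1),
        sq_nonneg ((φ w (-t)).2.2.2 - e.2.2.2)]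
  have := main.comp tendsto_neg_atBot_atTop
  simpa [Function.comp_def] using this

end Dissip
end Par

section limits
variable {X : Type*} [NormedAddCommGroup X] [NormedSpace ℝ X] {V : X → X} {φ : X → ℝ → X}
  {ι : Type*} {l : Filter ι} {w : ι → X} {R K : Set X}

theorem IsFlow.backIn_of_mapClusterPt (Fl : IsFlow V φ) (hR : IsClosed R)
    (hT : ∀ T, ∀ᶠ i in l, ∀ t ∈ Set.Icc (-T) 0, φ (w i) t ∈ R) {z : X} (hz : MapClusterPt z l w) :
    BackIn φ R z := by
  intro t ht
  have h1 : MapClusterPt (φ z t) l (fun i => φ (w i) t) :=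
    hz.continuousAt_comp (f := fun x => φ x t) (Fl.continuous_left t).continuousAt
  refine hR.mem_of_mapClusterPt h1 ?_
  filter_upwards [hT (-t)] with i hi
  exact hi t ⟨by simp, ht⟩

theorem IsFlow.tendsto_of_backIn (Fl : IsFlow V φ) (hR : IsClosed R) (hK : IsCompact K)
    (hwK : ∀ᶠ i in l, w i ∈ K) (hT : ∀ T, ∀ᶠ i in l, ∀ t ∈ Set.Icc (-T) 0, φ (w i) t ∈ R) {w₀ : X}
    (hu : ∀ z ∈ K, MapClusterPt z l w → BackIn φ R z → z = w₀) : Tendsto w l (𝓝 w₀) := by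
  refine hK.le_nhds_of_unique_clusterPt hwK fun z hz hc => ?_
  exact hu z hz hc (Fl.backIn_of_mapClusterPt hR hT hc)

/-- Orbits leaving an equilibrium through a prescribed target accumulate at a backward orbit. -/
theorem IsFlow.exists_backIn (Fl : IsFlow V φ) (hR : IsClosed R) (hK : IsCompact K) {Tg : Set X}
    (hTg : IsClosed Tg) {e : X} (he : ∀ t, φ e t = e) (heT : e ∉ Tg) {x : ℝ → X}
    (hx : Tendsto x (𝓝[>] 0) (𝓝 e)) (h : ∀ᶠ d in 𝓝[>] (0:ℝ), ∃ t, 0 ≤ t ∧ φ (x d) t ∈ Tg ∧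
      φ (x d) t ∈ K ∧ ∀ s ∈ Set.Icc 0 t, φ (x d) s ∈ R) : ∃ z ∈ K, BackIn φ R z := by
  have h' : ∀ d : ℝ, ∃ t, (∃ t, 0 ≤ t ∧ φ (x d) t ∈ Tg ∧ φ (x d) t ∈ K ∧
      ∀ s ∈ Set.Icc 0 t, φ (x d) s ∈ R) → 0 ≤ t ∧ φ (x d) t ∈ Tg ∧
      φ (x d) t ∈ K ∧ ∀ s ∈ Set.Icc 0 t, φ (x d) s ∈ R := fun d => by
    by_cases hd : ∃ t, 0 ≤ t ∧ φ (x d) t ∈ Tg ∧ φ (x d) t ∈ K ∧ ∀ s ∈ Set.Icc 0 t, φ (x d) s ∈ R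
    · obtain ⟨t, ht⟩ := hd
      exact ⟨t, fun _ => ht⟩
    · exact ⟨0, fun h => absurd h hd⟩
  choose t ht using h'
  have h1 : ∀ᶠ d in 𝓝[>] (0:ℝ), 0 ≤ t d ∧ φ (x d) (t d) ∈ Tg ∧
      φ (x d) (t d) ∈ K ∧ ∀ s ∈ Set.Icc 0 (t d), φ (x d) s ∈ R := by
    filter_upwards [h] with d hd using ht d hd
  have h2 : ∀ T, ∀ᶠ d in 𝓝[>] (0:ℝ), ∀ s ∈ Set.Icc (-T) 0, φ (φ (x d) (t d)) s ∈ R := by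
    intro T
    filter_upwards [h1, hx.eventually (Fl.eventually_avoid hTg (x := e) (a := 0) (b := T)
      (fun s _ => by rwa [he]))] with d hd hav s hs
    have hT : T < t d := by
      by_contra hcon
      exact hav (t d) ⟨hd.1, not_lt.mp hcon⟩ hd.2.1
    rw [Fl.add]
    exact hd.2.2.2 _ ⟨by linarith [hs.1], by linarith [hs.2]⟩
  obtain ⟨z, hz, hc⟩ := hK.exists_mapClusterPt (f := 𝓝[>] (0:ℝ)) (u := fun d => φ (x d) (t d))
    (tendsto_principal.mpr (by filter_upwards [h1] with d hd using hd.2.2.1))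
  exact ⟨z, hz, Fl.backIn_of_mapClusterPt hR h2 hc⟩

end limits

namespace Par
open Set
variable (P : Par)

/-- A neighbourhood of the laminar state. -/
def R1 : Set (ℝ × ℝ × ℝ × ℝ) := {z | z.1 ∈ Icc (0:ℝ) 1 ∧ z.2.1 ∈ Icc 0 P.qL ∧
  z.2.2.1 ∈ Icc (-3*z.2.1) (3*z.2.1) ∧ z.2.2.2 ∈ Icc (2-2*P.qL) 2}
/-- A neighbourhood of the turbulent state. -/
def R2 : Set (ℝ × ℝ × ℝ × ℝ) := {z | z.1 ∈ Icc (0:ℝ) 1 ∧ z.2.1 ∈ Icc (1+P.y-P.ρ) (1+P.y+P.ρ) ∧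
  z.2.2.1 ∈ Icc (-6*P.ρ) (6*P.ρ) ∧ z.2.2.2 ∈ Icc P.um (P.ub+P.ρ)}

theorem isClosed_Icc_le {f g h : ℝ × ℝ × ℝ × ℝ → ℝ} (hf : Continuous f) (hg : Continuous g)
    (hh : Continuous h) : IsClosed {z | f z ∈ Icc (g z) (h z)} := by
  simp only [mem_Icc, ofPred_and]
  exact (isClosed_le hg hf).inter (isClosed_le hf hh)

theorem isClosed_R1 : IsClosed P.R1 := by
  simp only [R1, ofPred_and]
  refine (isClosed_Icc_le ?_ ?_ ?_).inter ((isClosed_Icc_le ?_ ?_ ?_).inter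
    ((isClosed_Icc_le ?_ ?_ ?_).inter (isClosed_Icc_le ?_ ?_ ?_))) <;> fun_prop

theorem isClosed_R2 : IsClosed P.R2 := by
  simp only [R2, ofPred_and]
  refine (isClosed_Icc_le ?_ ?_ ?_).inter ((isClosed_Icc_le ?_ ?_ ?_).inter
    ((isClosed_Icc_le ?_ ?_ ?_).inter (isClosed_Icc_le ?_ ?_ ?_))) <;> fun_prop

/-- The laminar and turbulent equilibria. -/
def e1 (θ : ℝ) : ℝ × ℝ × ℝ × ℝ := (θ, 0, 0, 2)
def e2 (θ : ℝ) : ℝ × ℝ × ℝ × ℝ := (θ, 1+P.y, 0, P.ub)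

theorem ub_sub_ulo_lt : P.ub - P.ulo < 1 + P.y - P.qH := by
  have h1 := P.hFH; have h2 := P.hy; have h3 := P.hqH'; have h4 := P.hR'; have h5 := P.hy1; have h6 := P.hqH
  have h7 := P.hy0
  have e : P.ulo - 21/10 + 2*P.κ^2*P.qH*(2-P.qH) = P.ulo - P.ub +
      2*P.κ^2*((1+P.y-P.qH)*(P.y+P.qH-1)) := by linear_combination -h2
  have h8 : 0 ≤ (1+P.y-P.qH)*(P.y+P.qH-1) := mul_nonneg (by linarith) (by linarith)
  have h9 : (1+P.y-P.qH)*(P.y+P.qH-1) ≤ (1+P.y-P.qH)*1 := by gcongr; linarith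
  have : 2*P.κ^2*((1+P.y-P.qH)*(P.y+P.qH-1)) ≤ 1*((1+P.y-P.qH)*(P.y+P.qH-1)) := by
    gcongr; linarith
  linarith

theorem qH_gap : 1 + P.y - P.qH ≤ P.ρ/160 := by
  have := P.hρω; have := P.hy1; have := P.hρ; nlinarith

theorem rho_le : P.ρ ≤ 1/4000 := by have := P.hρy; have := P.hy1; linarith

variable {P} {ε θ : ℝ}

theorem e1_mem (hθ : θ ∈ Icc (0:ℝ) 1) : e1 θ ∈ P.R1 := by
  have := P.hqL
  refine ⟨hθ, ⟨le_rfl, this.le⟩, ?_, ?_⟩ <;> simp only [e1, mem_Icc] <;> constructor <;> linarith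

theorem e2_mem (hθ : θ ∈ Icc (0:ℝ) 1) : P.e2 θ ∈ P.R2 := by
  have := P.hρ; have := P.hum'
  refine ⟨hθ, ?_, ?_, ?_⟩ <;> simp only [e2, mem_Icc] <;> constructor <;> linarith

theorem flow_e1 {φ : ℝ × ℝ × ℝ × ℝ → ℝ → ℝ × ℝ × ℝ × ℝ} (Fl : IsFlow (P.field ε) φ)
    (θ t : ℝ) : φ (e1 θ) t = e1 θ := by
  refine (Fl.uniq (fun _ => e1 θ) (fun t => ?_) t).symm
  have : P.field ε (e1 θ) = 0 := by
    simp only [field, rawField, trunc, e1, clamp_zero, clamp_eq (l := 0) (h := 2) ⟨le_rfl, zero_le_two⟩,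
      clamp_high P.ulo_lt.le le_rfl, gq]
    simp
  rw [this]; exact hasDerivAt_const _ _

theorem flow_e2 {φ : ℝ × ℝ × ℝ × ℝ → ℝ → ℝ × ℝ × ℝ × ℝ} (Fl : IsFlow (P.field ε) φ)
    (θ t : ℝ) : φ (P.e2 θ) t = P.e2 θ := by
  refine (Fl.uniq (fun _ => P.e2 θ) (fun t => ?_) t).symm
  have h1 := P.hum; have h2 := P.hum'; have h3 := P.hub'; have h4 := P.hy0; have h5 := P.hy1
  have hq : (1 + P.y) ∈ Icc (0:ℝ) 2 := ⟨by linarith, by linarith⟩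
  have hu : P.ub ∈ Icc P.ulo 2 := ⟨by linarith, by linarith⟩
  have hg : gq (1+P.y) P.ub = 0 := by unfold gq; linarith [P.hyub]
  have : P.field ε (P.e2 θ) = 0 := by
    simp only [field, rawField, trunc, e2, clamp_zero, clamp_eq hq, clamp_eq hu, F_q2, hg]
    simp
  rw [this]; exact hasDerivAt_const _ _

theorem R1_dissip : P.Dissip P.R1 P.c2 (fun θ => 1/(40*(P.c2 θ + P.a θ*P.ζ))) (1/100) := by
  have hqL := P.hqL; have hqL' := P.hqL'; have hζ := P.hζ
  have hulo := P.ulo_lt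
  have hM : ∀ θ ∈ Icc (0:ℝ) 1, 1/10 ≤ P.c2 θ + P.a θ*P.ζ := fun θ hθ => by
    have := P.le_den hθ P.ulo_lt.le
    rwa [P.c_two] at this
  refine ⟨by norm_num, fun θ hθ => ⟨?_, P.adm_hi θ hθ⟩, fun θ hθ => ?_, fun z hz => hz.1,
    fun z hz => ⟨hz.2.1.1, by linarith [hz.2.1.2]⟩, fun z hz => ?_, fun z hz => ⟨?_, hz.2.2.2.2⟩, ?_⟩
  · have := P.le_c hθ P.ulo_lt.le
    rw [P.c_two] at this; linarith
  · have := hM θ hθ; positivity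
  · have := hz.2.2.1; have := hz.2.1
    simp only [mem_Icc] at *
    constructor <;> linarith
  · have := hz.2.2.2.1; have := P.hum'; have := P.hub'; linarith
  · rintro ⟨θ, q, p, u⟩ ⟨hθ, hq, hp, hu⟩ ⟨θ', q', p', u'⟩ ⟨-, hq', hp', hu'⟩ h
    simp only at h hθ hq hp hu hq' hp' hu' ⊢
    have ha := P.a_pos hθ; have ha2 := P.a_le hθ
    have hM1 := hM θ hθ
    rw [dgap_eq]
    set m := (P.c θ u + P.c θ u' + 2*P.a θ*P.ζ)/2 with hm
    have hc : ∀ v, P.c θ v = P.c2 θ - P.a θ*(2-v) := fun v => by rw [← P.c_two]; unfold c; ring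
    rw [hc u, hc u'] at hm
    have n1 : 1/(40*(P.c2 θ + P.a θ*P.ζ))*m ≤ 25/1000 := by
      rw [div_mul_eq_mul_div, div_le_iff₀ (by linarith)]
      have := mul_nonneg ha.le (show 0 ≤ 2-u by linarith [hu.2])
      have := mul_nonneg ha.le (show 0 ≤ 2-u' by linarith [hu'.2])
      linarith
    have n2 : 24/1000 ≤ 1/(40*(P.c2 θ + P.a θ*P.ζ))*m := by
      rw [div_mul_eq_mul_div, le_div_iff₀ (by linarith)]
      have := mul_le_mul_of_nonneg_left (show 2-u ≤ 2/1000 by linarith [hu.1]) ha.le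
      have := mul_le_mul_of_nonneg_left (show 2-u' ≤ 2/1000 by linarith [hu'.1]) ha.le
      have := mul_le_mul_of_nonneg_left hζ.le ha.le
      linarith
    set n := 1/(40*(P.c2 θ + P.a θ*P.ζ))*m with hn
    rw [hc u]
    have x1 : |q' - 2*n*(u'-1) - P.a θ*p'| ≤ 6/100 := by
      have e1 : 0 ≤ 2*n*(u'-1) := mul_nonneg (by linarith) (by linarith [hu'.1])
      have e2 : 2*n*(u'-1) ≤ 50/1000*1 := by gcongr <;> linarith [hu'.1, hu'.2]
      have e3 : |P.a θ*p'| ≤ 2*(3/1000) := by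
        rw [abs_mul, abs_of_pos ha]; gcongr
        rw [abs_le]; constructor <;> linarith [hp'.1, hp'.2, hq'.1, hq'.2]
      rw [abs_le] at e3 ⊢
      constructor <;> linarith [hq'.1, hq'.2, e3.1, e3.2]
    have x2 : |P.a θ*(2-u)| ≤ 4/1000 := by
      rw [abs_mul, abs_of_pos ha, abs_of_nonneg (by linarith [hu.2])]
      calc _ ≤ (2:ℝ)*(2/1000) := by gcongr <;> linarith [hu.1, hu.2]
        _ = _ := by norm_num
    have x3 : u - 21/10 + 2*P.κ^2*(2*(q+q')-(q^2+q*q'+q'^2)) ≤ -96/1000 := by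
      have := P.hR'
      have e1 : 2*(q+q')-(q^2+q*q'+q'^2) ≤ 4/1000 := by
        linarith [sq_nonneg q, sq_nonneg q', mul_nonneg hq.1 hq'.1, hq.1, hq.2, hq'.1, hq'.2]
      have e2 : 2*P.κ^2*(2*(q+q')-(q^2+q*q'+q'^2)) ≤ 2*P.κ^2*(4/1000) := by gcongr
      linarith [hu.2]
    have y1 := mul_mul_le_of_abs_le x1 (2*(q-q')) (u-u')
    have y2 := mul_mul_le_of_abs_le x2 (q-q') (p-p')
    have y3 := mul_le_mul_of_nonneg_right x3 (sq_nonneg (q-q'))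
    have y4 : 24/1000*(u-u')^2 ≤ n*(1+2*q)*(u-u')^2 := by
      have : 24/1000 ≤ n*(1+2*q) := by linarith [mul_nonneg (show 0 ≤ n by linarith) hq.1]
      gcongr
    linarith [sq_nonneg (p-p'), sq_nonneg (q-q'), sq_nonneg (u-u')]

theorem slope_R2 {q q' u : ℝ} (hq : q ∈ Icc (1+P.y-P.ρ) (1+P.y+P.ρ))
    (hq' : q' ∈ Icc (1+P.y-P.ρ) (1+P.y+P.ρ)) (hu : u ≤ P.ub+P.ρ) :
    u - 21/10 + 2*P.κ^2*(2*(q+q')-(q^2+q*q'+q'^2)) ≤ -14/10*P.y := by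
  have hρ := P.hρ; have hρ1 := P.rho_le; have hρy := P.hρy
  have hy0 := P.hy0; have hy1 := P.hy1
  have hR := P.hR; have hR' := P.hR'; have hy := P.hy
  have e1 : 2*(q+q')-(q^2+q*q'+q'^2) ≤ 1 - 2*P.y - 3*P.y^2 + 6*P.ρ := by
    have : 2*(q+q')-(q^2+q*q'+q'^2) = 1 - 2*P.y - 3*P.y^2
      - (1+3*P.y)*((q-1-P.y) + (q'-1-P.y)) - ((q-1-P.y)^2 + (q-1-P.y)*(q'-1-P.y) + (q'-1-P.y)^2) := by
      ring
    rw [this]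
    have h1 : -(2*P.ρ) ≤ (q-1-P.y) + (q'-1-P.y) := by linarith [hq.1, hq'.1]
    nlinarith [sq_nonneg ((q-1-P.y) + (q'-1-P.y)), sq_nonneg (q-1-P.y), sq_nonneg (q'-1-P.y)]
  have e2 : 2*P.κ^2*(2*(q+q')-(q^2+q*q'+q'^2)) ≤ 2*P.κ^2*(1 - 2*P.y - 3*P.y^2 + 6*P.ρ) := by
    gcongr
  have e3 : 23/30*P.y ≤ 2*P.κ^2*P.y := by gcongr
  have e4 : 2*P.κ^2*(6*P.ρ) ≤ 87/100*(6*P.ρ) := by gcongr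
  nlinarith [hu, mul_nonneg (show 0 ≤ 2*P.κ^2 by positivity) (sq_nonneg P.y)]

theorem coef_R2 {y ρ a p q r f : ℝ} (hy0 : 0 < y) (hy1 : y < 1/4) (hρ : 0 < ρ) (hρ1 : ρ ≤ 1/4000)
    (ha : 0 < a) (ha2 : a ≤ 2) (hq : q ∈ Icc (1+y-ρ) (1+y+ρ)) (hp : p ∈ Icc (-6*ρ) (6*ρ))
    (hr : |r - 1| ≤ 20*ρ) (hf : |f - 1| ≤ 7/2*ρ) : |q - (1+y)*r*f - a*p| ≤ 44*ρ := by
  have e3 : |a*p| ≤ 2*(6*ρ) := by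
    rw [abs_mul, abs_of_pos ha]; gcongr
    rw [abs_le]; constructor <;> linarith [hp.1, hp.2]
  have e4 : |r*f - 1| ≤ 24*ρ := by
    have : r*f - 1 = (r-1)*(f-1) + (r-1) + (f-1) := by ring
    rw [this]
    have h1 : |(r-1)*(f-1)| ≤ (20*ρ)*(7/2*ρ) := by rw [abs_mul]; gcongr
    have h2 := abs_add_le ((r-1)*(f-1) + (r-1)) (f-1)
    have h3 := abs_add_le ((r-1)*(f-1)) (r-1)
    have h4 : (20*ρ)*(7/2*ρ) ≤ 1/2*ρ := by nlinarith
    linarith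
  have e5 : |(1+y)*(r*f-1)| ≤ 5/4*(24*ρ) := by
    rw [abs_mul, abs_of_pos (by linarith : 0 < 1 + y)]; gcongr; linarith
  have e6 : q - (1+y)*r*f - a*p = (q-(1+y)) - (1+y)*(r*f-1) - a*p := by ring
  rw [e6]
  rw [abs_le] at e3 e5 ⊢
  constructor <;> linarith [hq.1, hq.2, e3.1, e3.2, e5.1, e5.2]

theorem ratio_R2 {y r w n : ℝ} (hy0 : 0 < y) (hr : 9/10 ≤ r) (hw0 : 0 < w) (hw : w ≤ 1/3)
    (h : n*w = (1+y)/2*r) : 1 ≤ n := by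
  have h1 : 2/5 ≤ (1+y)/2*r := by nlinarith
  rw [← h] at h1
  by_contra hc
  nlinarith

theorem quad_R2 {y ρ A B C X Y S N : ℝ} (hy0 : 0 < y) (hy1 : y < 1/4) (hρy : ρ ≤ y/1000)
    (hA : 0 ≤ A) (hB : 0 ≤ B) (hC : 0 ≤ C) (h1 : X ≤ 44*ρ/2*(A+C)) (h2 : Y ≤ 2*ρ/2*(A+B))
    (h3 : S ≤ -14/10*y*A) (h4 : 1*C ≤ N) : -2*B + 2*Y + 2*S + 2*X - 2*N ≤ -y*(A+B+C) := by
  have z1 := mul_le_mul_of_nonneg_right hρy hA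
  have z2 := mul_le_mul_of_nonneg_right hρy hB
  have z3 := mul_le_mul_of_nonneg_right hρy hC
  have z4 := mul_le_mul_of_nonneg_right hy1.le hB
  have z5 := mul_le_mul_of_nonneg_right hy1.le hC
  have z6 := mul_nonneg hy0.le hA
  have z7 := mul_nonneg hy0.le hB
  have z8 := mul_nonneg hy0.le hC
  linarith

set_option maxHeartbeats 800000 in
theorem R2_dissip : P.Dissip P.R2 P.cb
    (fun θ => (1+P.y)/(2*(P.cb θ + P.a θ*P.ζ)*(P.ub-1))) P.y := by
  have hζ := P.hζ
  have hulo := P.ulo_lt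
  have hρ := P.hρ; have hρ1 := P.rho_le; have hρy := P.hρy
  have hub := P.hub; have hub' := P.hub'; have hum := P.hum; have hum' := P.hum'
  have hy0 := P.hy0; have hy1 := P.hy1
  have hlo := P.ub_sub_ulo_lt; have hg := P.qH_gap
  have hM : ∀ θ ∈ Icc (0:ℝ) 1, 1/10 ≤ P.cb θ + P.a θ*P.ζ := fun θ hθ => by
    have := P.le_den hθ (show P.ulo ≤ P.ub by linarith)
    rwa [P.c_ub] at this
  refine ⟨hy0, fun θ hθ => ?_, fun θ hθ => ?_, fun z hz => hz.1, fun z hz => ?_, fun z hz => ?_,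
    fun z hz => ⟨hz.2.2.2.1, by linarith [hz.2.2.2.2]⟩, ?_⟩
  · have h1 := P.le_c hθ (show P.ulo ≤ P.ub by linarith)
    have h2 := P.c_le hθ (show P.ub ≤ 2 by linarith)
    rw [P.c_ub] at h1 h2; exact ⟨by linarith, h2⟩
  · have := hM θ hθ
    have : 0 < P.ub - 1 := by linarith
    positivity
  · have := hz.2.1
    simp only [mem_Icc] at *
    constructor <;> linarith
  · have := hz.2.2.1
    simp only [mem_Icc] at *
    constructor <;> linarith
  · rintro ⟨θ, q, p, u⟩ ⟨hθ, hq, hp, hu⟩ ⟨θ', q', p', u'⟩ ⟨-, hq', hp', hu'⟩ h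
    simp only at h hθ hq hp hu hq' hp' hu' ⊢
    have ha := P.a_pos hθ; have ha2 := P.a_le hθ
    have hM1 := hM θ hθ
    rw [dgap_eq]
    set m := (P.c θ u + P.c θ u' + 2*P.a θ*P.ζ)/2 with hm
    set M := P.cb θ + P.a θ*P.ζ with hMd
    have hc : ∀ v, P.c θ v = P.cb θ + P.a θ*(v-P.ub) := fun v => rfl
    have au : ∀ v ∈ Icc P.um (P.ub + P.ρ), |P.a θ*(v-P.ub)| ≤ 2*P.ρ := fun v hv => by
      rw [abs_mul, abs_of_pos ha]; gcongr
      rw [abs_le]; constructor <;> linarith [hv.1, hv.2]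
    have au1 := au u hu; have au2 := au u' hu'
    have au1' := abs_le.mp au1; have au2' := abs_le.mp au2
    have m1 : |m/M - 1| ≤ 20*P.ρ := by
      have e : m/M - 1 = (P.a θ*(u-P.ub) + P.a θ*(u'-P.ub))/2/M := by
        rw [div_sub_one (by linarith : M ≠ 0), hm, hc, hc, hMd]; congr 1; ring
      rw [e, abs_div, abs_of_pos (show 0 < M by linarith), div_le_iff₀ (by linarith)]
      have : |(P.a θ*(u-P.ub) + P.a θ*(u'-P.ub))/2| ≤ 2*P.ρ := by
        rw [abs_le]; constructor <;> linarith [au1'.1, au1'.2, au2'.1, au2'.2]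
      nlinarith
    set f := (u'-1)/(P.ub-1) with hf
    have f1 : |f - 1| ≤ 7/2*P.ρ := by
      rw [hf, div_sub_one (by linarith), abs_div, abs_of_pos (show 0 < P.ub - 1 by linarith),
        div_le_iff₀ (by linarith), abs_le]
      constructor <;> nlinarith [hu'.1, hu'.2]
    set r := m/M with hr
    have n0 : (1+P.y)/(2*M*(P.ub-1))*m*(P.ub-1) = (1+P.y)/2*r := by
      rw [hr]
      have : P.ub - 1 ≠ 0 := by linarith
      have : M ≠ 0 := by linarith
      field_simp
    have n1 : 2*((1+P.y)/(2*M*(P.ub-1))*m)*(u'-1) = (1+P.y)*r*f := by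
      rw [hr, hf]
      have : P.ub - 1 ≠ 0 := by linarith
      have : M ≠ 0 := by linarith
      field_simp
    have m1' := abs_le.mp m1; have f1' := abs_le.mp f1
    have n2 := ratio_R2 hy0 (by linarith [m1'.1]) (by linarith) (by linarith) n0
    set n := (1+P.y)/(2*M*(P.ub-1))*m with hn
    rw [n1]
    have x1 := coef_R2 (p := p') hy0 hy1 hρ hρ1 ha ha2 hq' hp' m1 f1
    have x2 : |P.cb θ - P.c θ u| ≤ 2*P.ρ := by
      rw [hc, abs_le]; constructor <;> linarith [au1'.1, au1'.2]
    have x3 := P.slope_R2 hq hq' hu.2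
    have y1 := mul_mul_le_of_abs_le x1 (q-q') (u-u')
    have y2 := mul_mul_le_of_abs_le x2 (q-q') (p-p')
    have y3 := mul_le_mul_of_nonneg_right x3 (sq_nonneg (q-q'))
    have y4 : 1*(u-u')^2 ≤ n*(1+2*q)*(u-u')^2 := by
      have : 1 ≤ n*(1+2*q) := by
        linarith [mul_nonneg (show 0 ≤ n by linarith) (show 0 ≤ q by linarith [hq.1])]
      gcongr
    have := quad_R2 hy0 hy1 hρy (sq_nonneg (q-q')) (sq_nonneg (p-p')) (sq_nonneg (u-u')) y1 y2 y3 y4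
    linarith

end Par

namespace Par
open Set

/-- A parabola through the origin and `(b, 0)` is crossed downwards near `u = 2`. -/
structure BlueAt (P : Par) (Θ : Set ℝ) (b ω : ℝ) : Prop where
  hb : P.qH < b
  hb' : b < 2
  hω : 0 < ω
  hω' : ω ≤ 1/4
  hqL : 4*P.qL ≤ ω
  hc : ∀ θ ∈ Θ, P.κ*b*(P.c2 θ - P.κ*b) + 1/10 + ω < 0
  hF : 0 < P.F b (2 - ω)

/-- A parabola through `(qL, 0)` and `(b, 0)` is crossed upwards near `u = ub`. -/
structure RedAt (P : Par) (Θ : Set ℝ) (b ω : ℝ) : Prop where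
  hb : 1 + P.y + P.ρ ≤ b
  hb' : b ≤ 13/10
  hω : 2*(1 + P.y - P.qH) ≤ ω
  hc : ∀ θ ∈ Θ, P.c θ (P.ub + ω) ≤ P.κ*(4 - 3*(b + P.qL))
  hF : P.F b (P.ub + ω) < 0

variable {P : Par} {ε θ : ℝ} {q p u : ℝ → ℝ} {a b : ℝ}

theorem κ_lt (P : Par) : P.κ < 33/50 := by have := P.hR'; have := P.hκ; nlinarith

theorem du_eq {q u : ℝ} (hu : P.um ≤ u) :
    P.du ε θ q u = ε * gq q u / (P.c θ u + P.a θ * P.ζ) := by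
  unfold Par.du; rw [P.m_eq hu, mul_one]

theorem Orb.u_ge_near_laminar (hθ : θ ∈ Icc (0:ℝ) 1) (hε : 0 < ε) (h : P.Orb ε θ q p u (Icc a b))
    (hq : ∀ t ∈ Icc a b, q t ≤ P.qL) (h0 : 2 - 2*P.qL ≤ u a) :
    ∀ t ∈ Icc a b, 2 - 2*P.qL ≤ u t := by
  have hqL := P.hqL; have hqL' := P.hqL'; have := P.hum'; have := P.hub'
  have := barrier_nonneg (h := fun t => u t - (2 - 2*P.qL)) (a := a) (b := b)
    (fun t ht => (h.du t ht).sub_const _) (by linarith) (by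
      intro t ht _ hz
      have hz' : u t = 2 - 2*P.qL := by linarith
      rw [du_eq (by linarith)]
      have h1 := P.le_den hθ (h.hu t ht).1
      refine div_pos (mul_pos hε ?_) (by linarith)
      have h2 := (h.hq t ht).1
      have h3 := hq t ht
      unfold gq; rw [hz']
      have : 2 - (2 - 2*P.qL) + 2*q t*(1 - (2 - 2*P.qL)) = 2*(P.qL - q t)*(1-2*P.qL) + 4*P.qL*P.qL := by
        ring
      rw [this]
      have := mul_nonneg (sub_nonneg.mpr h3) (show 0 ≤ 1-2*P.qL by linarith)
      have := mul_pos hqL hqL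
      linarith)
  intro t ht; linarith [this t ht]

theorem Orb.u_le_near_turbulent (hθ : θ ∈ Icc (0:ℝ) 1) (hε : 0 < ε) (h : P.Orb ε θ q p u (Icc a b))
    (hq : ∀ t ∈ Icc a b, P.qH ≤ q t) (h0 : u a ≤ P.ub + (1 + P.y - P.qH)) :
    ∀ t ∈ Icc a b, u t ≤ P.ub + (1 + P.y - P.qH) := by
  have hqH := P.hqH; have hqH' := P.hqH'; have := P.hum'; have := P.hub'; have hub := P.hub
  have := barrier_nonneg (h := fun t => P.ub + (1 + P.y - P.qH) - u t) (a := a) (b := b)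
    (fun t ht => (h.du t ht).const_sub _) (by linarith) (by
      intro t ht _ hz
      have hz' : u t = P.ub + (1 + P.y - P.qH) := by linarith
      rw [du_eq (by linarith)]
      have h1 := P.le_den hθ (h.hu t ht).1
      rw [neg_pos]
      refine div_neg_of_neg_of_pos (mul_neg_of_pos_of_neg hε ?_) (by linarith)
      have h3 := hq t ht
      unfold gq; rw [hz']
      have h4 := P.hyub
      have : 2 - (P.ub + (1 + P.y - P.qH)) + 2*q t*(1 - (P.ub + (1 + P.y - P.qH)))
          = -(1+P.y-P.qH)*(1+2*q t) + 2*(P.ub-1)*(1+P.y - q t) := by linear_combination -h4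
      rw [this]
      have := mul_le_mul_of_nonneg_left (show 1+P.y-q t ≤ 1+P.y-P.qH by linarith)
        (show 0 ≤ 2*(P.ub-1) by linarith)
      have := mul_pos (show 0 < 1+P.y-P.qH by linarith) (show 0 < 1+2*q t - 2*(P.ub-1) by linarith)
      linarith)
  intro t ht; linarith [this t ht]

theorem F_le_near_turbulent {q u : ℝ} (hq : P.qH ≤ q) (hu : u ≤ P.ub + (1+P.y-P.qH)) :
    P.F q u ≤ 2*(1+P.y-P.qH) := by
  have hqH := P.hqH; have hqH' := P.hqH'; have hR' := P.hR'; have hy := P.hy; have hy1 := P.hy1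
  have h1 := F_anti (P := P) (u := u) hqH.le hq
  refine h1.trans ?_
  have : P.F P.qH u = (u - P.ub) + 2*P.κ^2*((1+P.y-P.qH)*(P.y+P.qH-1)) := by
    unfold F; linear_combination -hy
  rw [this]
  have h2 : 0 ≤ (1+P.y-P.qH)*(P.y+P.qH-1) := mul_nonneg (by linarith) (by linarith [P.hy0])
  have h3 := mul_le_mul_of_nonneg_right (show 2*P.κ^2 ≤ 1 by linarith) h2
  have h4 := mul_le_mul_of_nonneg_left (show P.y+P.qH-1 ≤ 1 by linarith)
    (show 0 ≤ 1+P.y-P.qH by linarith)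
  linarith

theorem Orb.p_ge_near_turbulent (hθ : θ ∈ Icc (0:ℝ) 1) (h : P.Orb ε θ q p u (Icc a b))
    (hq : ∀ t ∈ Icc a b, q t ∈ Icc P.qH (1+P.y+P.ρ))
    (hu : ∀ t ∈ Icc a b, u t ≤ P.ub + (1 + P.y - P.qH)) (h0 : -3*(1+P.y+3/2*P.ρ-q a) ≤ p a) :
    ∀ t ∈ Icc a b, -6*P.ρ ≤ p t := by
  have hqH := P.hqH; have hqH' := P.hqH'; have hg := P.qH_gap; have hρ := P.hρ
  have hy1 := P.hy1; have hρ1 := P.rho_le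
  have := nonneg_of_deriv_ge (h := fun t => p t + 3*(1+P.y+3/2*P.ρ-q t)) (K := 0) (a := a) (b := b)
    (fun t ht => (h.dp t ht).add (((h.dq t ht).const_sub _).const_mul 3)) (by linarith) (by
      intro t ht hz
      have h1 := P.c_le hθ (h.hu t ht).2
      have h3 := F_le_near_turbulent (P := P) (hq t ht).1 (hu t ht)
      have h4 := (hq t ht).1
      have h5 := (hq t ht).2
      have h6 : q t * P.F (q t) (u t) ≤ 3/2*(2*(1+P.y-P.qH)) := by
        rcases le_total 0 (P.F (q t) (u t)) with hF | hF
        · exact mul_le_mul (by linarith) h3 hF (by norm_num)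
        · have := mul_nonneg_of_nonpos_of_nonpos (a := -q t) (by linarith) hF
          linarith
      have h7 := mul_nonneg (show 0 ≤ 2 - P.c θ (u t) by linarith) (show 0 ≤ -p t by linarith)
      linarith)
  intro t ht; linarith [this t ht, (hq t ht).1]

end Par

namespace Par
open Set
variable {P : Par} {ε θ : ℝ} {q p u : ℝ → ℝ} {a b : ℝ}

theorem Orb.le_blue {Θ : Set ℝ} {β ω : ℝ} (hB : P.BlueAt Θ β ω) (hΘ : θ ∈ Θ) (hθ : θ ∈ Icc (0:ℝ) 1)
    (h : P.Orb ε θ q p u (Icc a b)) (hq : ∀ t ∈ Icc a b, q t ∈ Ioc 0 β)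
    (hu : ∀ t ∈ Icc a b, 2 - ω ≤ u t) (h0 : p a ≤ P.κ*q a*(β-q a)) :
    ∀ t ∈ Icc a b, p t ≤ P.κ*q t*(β-q t) := by
  have hκ := P.hκ; have hb := hB.hb; have hb' := hB.hb'; have hω' := hB.hω'; have hqH := P.hqH
  have := barrier_nonneg (h := fun t => P.κ*q t*(β-q t) - p t) (a := a) (b := b)
    (fun t ht => ((((h.dq t ht).const_mul P.κ).mul ((h.dq t ht).const_sub β)).sub (h.dp t ht)))
    (by linarith) (by
      intro t ht _ hz
      have hp : p t = P.κ*q t*(β-q t) := by linarith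
      have h5 := P.c_mono hθ (h.hu t ht).2
      rw [P.c_two] at h5
      have h6 := hB.hc θ hΘ
      have h7 : P.κ*β*(P.c θ (u t) - P.κ*β) ≤ P.κ*β*(P.c2 θ - P.κ*β) :=
        mul_le_mul_of_nonneg_left (by simpa using h5) (mul_nonneg hκ.le (by linarith))
      have := P.cross_down (b := β) (c := P.c θ (u t)) (q := q t)
        (u := u t) (by linarith [hu t ht])
        (hB.hF.trans_le (F_mono_u (hu t ht))) (by linarith) (hq t ht)
      simp only [hp]
      linarith)
  intro t ht
  linarith [this t ht]

theorem Orb.ge_red {Θ : Set ℝ} {β ω : ℝ} (hB : P.RedAt Θ β ω) (hΘ : θ ∈ Θ) (hθ : θ ∈ Icc (0:ℝ) 1)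
    (hab : a ≤ b)
    (h : P.Orb ε θ q p u (Icc a b)) (hq : ∀ t ∈ Icc a b, q t ∈ Icc P.qL β)
    (hu : ∀ t ∈ Icc a b, u t ≤ P.ub + ω) (h0 : -(P.κ*(q a-P.qL)*(β-q a)) ≤ p a) :
    -(P.κ*(q b-P.qL)*(β-q b)) ≤ p b := by
  rcases hab.eq_or_lt with rfl | hlt
  · exact h0
  have hκ := P.hκ; have hb := hB.hb; have hy := P.hy0; have hρ := P.hρ; have hqL' := P.hqL'
  have := h.ge_parabola (k := -P.κ) (α := P.qL) (β := β) (by ring) (by linarith) P.hqL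
    (fun t ht => by
      have h1 := hB.hc θ hΘ
      have h2 := P.c_mono hθ (hu t ht)
      have h3 := mul_le_mul_of_nonneg_left (h2.trans h1) hκ.le
      nlinarith [mul_nonneg hκ.le hκ.le, mul_le_mul_of_nonneg_left h1 hκ.le])
    (fun t ht => P.F_qL_neg (h.hu t ht).2)
    (fun t ht => (F_mono_u (hu t ht)).trans_lt hB.hF) hq (by linarith) b ⟨hlt, le_rfl⟩
  linarith

variable {φ : ℝ × ℝ × ℝ × ℝ → ℝ → ℝ × ℝ × ℝ × ℝ} (Fl : IsFlow (P.field ε) φ)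
include Fl

theorem orb_of_q (hε : 0 < ε) {x : ℝ × ℝ × ℝ × ℝ} (hθ : x.1 ∈ Icc (0:ℝ) 1)
    (hu : x.2.2.2 ∈ Icc P.ulo 2) (h3 : x.2.2.1 ≤ 3*x.2.1) (h5 : -5*(3-x.2.1) ≤ x.2.2.1) {T : ℝ}
    (hq : ∀ t ∈ Icc 0 T, (φ x t).2.1 ∈ Icc (0:ℝ) 2) :
    P.Orb ε x.1 (fun t => (φ x t).2.1) (fun t => (φ x t).2.2.1) (fun t => (φ x t).2.2.2) (Icc 0 T) ∧
      ∀ t ∈ Icc 0 T, (φ x t).2.2.1 ≤ 3*(φ x t).2.1 := by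
  have h3 := p_le_of_q_mem Fl hq h3
  have h5 := le_p_of_q_mem Fl hq h5
  exact ⟨flow_orb Fl hθ hq (fun t ht => ⟨by linarith [h5 t ht, (hq t ht).1],
    by linarith [h3 t ht, (hq t ht).2]⟩) (fun t ht => flow_u_mem Fl hθ hu hε ht.1), h3⟩

/-- Until it leaves a slab, an orbit starting inside it stays inside; it either hits the boundary or
stays for the whole time. -/
theorem slab_hit {x : ℝ × ℝ × ℝ × ℝ} {l r : ℝ} (hl : l < x.2.1) (hr : x.2.1 < r) (T : ℝ) (hT : 0 < T) :
    ∃ t, 0 < t ∧ t ≤ T ∧ (∀ s ∈ Icc 0 t, (φ x s).2.1 ∈ Icc l r) ∧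
      ((φ x t).2.1 = l ∨ (φ x t).2.1 = r ∨ t = T) := by
  have hc : ∀ t, ContinuousAt (fun t => (φ x t).2.1) t := fun t => (flow_dq Fl x t).continuousAt
  have key : ∀ t, 0 < t → (∀ s ∈ Ico 0 t, (φ x s) ∉ ({z | z.2.1 ≤ l} ∪ {z | r ≤ z.2.1})) →
      ∀ s ∈ Icc 0 t, (φ x s).2.1 ∈ Icc l r := by
    intro t ht h s hs
    simp only [mem_union, mem_ofPred_eq, not_or, not_le] at h
    have h1 := nonneg_at_end (h := fun s => (φ x s).2.1 - l) ht ((hc t).sub continuousAt_const)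
      (fun s hs => sub_nonneg.mpr (h s hs).1.le) s hs
    have h2 := nonneg_at_end (h := fun s => r - (φ x s).2.1) ht (continuousAt_const.sub (hc t))
      (fun s hs => sub_nonneg.mpr (h s hs).2.le) s hs
    exact ⟨sub_nonneg.mp h1, sub_nonneg.mp h2⟩
  have hcl : IsClosed ({z : ℝ × ℝ × ℝ × ℝ | z.2.1 ≤ l} ∪ {z | r ≤ z.2.1}) :=
    (isClosed_le (by fun_prop) (by fun_prop)).union (isClosed_le (by fun_prop) (by fun_prop))
  have hx0 : x ∉ ({z : ℝ × ℝ × ℝ × ℝ | z.2.1 ≤ l} ∪ {z | r ≤ z.2.1}) := by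
    simp only [mem_union, mem_ofPred_eq, not_or, not_le]; exact ⟨hl, hr⟩
  rcases Fl.hit_or_avoid hcl hx0 T with ⟨t, h1, h2, h3, h4⟩ | h
  · have h5 := key t h1 h4
    have h6 := h5 t ⟨h1.le, le_rfl⟩
    refine ⟨t, h1, h2, h5, ?_⟩
    rcases h3 with h3 | h3
    · exact Or.inl (le_antisymm h3 h6.1)
    · exact Or.inr (Or.inl (le_antisymm h6.2 h3))
  · exact ⟨T, hT, le_rfl, key T hT (fun s hs => h s ⟨hs.1, hs.2.le⟩), Or.inr (Or.inr rfl)⟩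

theorem laminar_exit (hε : 0 < ε) (hθ : θ ∈ Icc (0:ℝ) 1) {d : ℝ} (hd : 0 < d) (hd' : d < P.qL) :
    ∃ t, 0 ≤ t ∧ (φ (θ, d, P.c2 θ*d, 2) t).2.1 = P.qL ∧
      P.Orb ε θ (fun s => (φ (θ, d, P.c2 θ*d, 2) s).2.1) (fun s => (φ (θ, d, P.c2 θ*d, 2) s).2.2.1)
        (fun s => (φ (θ, d, P.c2 θ*d, 2) s).2.2.2) (Icc 0 t) ∧
      ∀ s ∈ Icc 0 t, φ (θ, d, P.c2 θ*d, 2) s ∈ P.R1 ∧ 0 < (φ (θ, d, P.c2 θ*d, 2) s).2.1 ∧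
        (φ (θ, d, P.c2 θ*d, 2) s).2.1/20 ≤ (φ (θ, d, P.c2 θ*d, 2) s).2.2.1 := by
  set x : ℝ × ℝ × ℝ × ℝ := (θ, d, P.c2 θ*d, 2) with hx
  have hqL := P.hqL; have hqL' := P.hqL'; have hulo := P.ulo_lt; have hκ := P.hκ; have hR' := P.hR'
  have hc2 := P.adm_hi θ hθ
  have hc2' := P.le_c hθ P.ulo_lt.le
  rw [P.c_two] at hc2'
  change P.c2 θ ≤ 2 at hc2
  have hp1 : 1/10*d ≤ P.c2 θ*d := mul_le_mul_of_nonneg_right hc2' hd.le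
  have hp2 : P.c2 θ*d ≤ 2*d := mul_le_mul_of_nonneg_right hc2 hd.le
  obtain ⟨t, h1, h2, h3, h4⟩ := slab_hit Fl (x := x) (l := 0) (r := P.qL) hd hd' (20*P.qL/d)
    (by positivity)
  obtain ⟨ho, h5⟩ := orb_of_q Fl hε (x := x) hθ ⟨hulo.le, le_rfl⟩
    (by simp only [hx]; linarith) (by simp only [hx]; linarith) (T := t)
    (fun s hs => ⟨(h3 s hs).1, by linarith [(h3 s hs).2]⟩)
  have h6 := nonneg_of_deriv_ge (h := fun s => (φ x s).2.2.1 - 1/20*(φ x s).2.1) (K := 2) (a := 0) (b := t)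
    (fun s hs => (ho.dp s hs).sub ((ho.dq s hs).const_mul (1/20))) (by simp only [Fl.zero, hx]; linarith) (by
      intro s hs h
      have c1 := P.le_c hθ (ho.hu s hs).1
      have c2 := P.c_le hθ (ho.hu s hs).2
      obtain ⟨q0, q1⟩ := h3 s hs
      have hF : P.F (φ x s).2.1 (φ x s).2.2.2 ≤ -9/100 := by
        have := (ho.hu s hs).2
        have : 2*P.κ^2*(φ x s).2.1*(2-(φ x s).2.1) ≤ 1/100 := by
          have := mul_le_mul_of_nonneg_right hR'.le (mul_nonneg q0 (show 0 ≤ 2-(φ x s).2.1 by linarith))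
          have := mul_le_mul_of_nonneg_left (show 2-(φ x s).2.1 ≤ 2 by linarith) q0
          linarith
        unfold F; linarith
      have e1 := mul_le_mul_of_nonneg_left hF q0
      have e2 : P.c x.1 (φ x s).2.2.2 * (φ x s).2.2.1 ≥ 2*((φ x s).2.2.1 - 1/20*(φ x s).2.1) + 1/200*(φ x s).2.1 := by
        have e3 := mul_le_mul_of_nonneg_left (show (φ x s).2.2.1 - 1/20*(φ x s).2.1 ≤ 0 by linarith)
          (show 0 ≤ 2 - P.c x.1 (φ x s).2.2.2 by simpa using c2)
        have e4 := mul_le_mul_of_nonneg_right c1 (show 0 ≤ 1/20*(φ x s).2.1 by linarith)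
        simp only [hx] at e3 e4 ⊢
        linarith
      simp only [hx] at e2 ⊢
      linarith)
  have h7 : ∀ s ∈ Icc 0 t, d*1 ≤ (φ x s).2.1 := by
    intro s hs
    have := le_of_deriv_ge (h := fun s => (φ x s).2.1) (C := 0) hs.1
      (fun r hr => ho.dq r ⟨hr.1, hr.2.trans hs.2⟩) (fun r hr => by
        have hr' : r ∈ Icc 0 t := ⟨hr.1, hr.2.trans hs.2⟩
        linarith [h6 r hr', (h3 r hr').1])
    simp only [Fl.zero, hx] at this ⊢
    linarith
  have h8 : (φ x t).2.1 = P.qL := by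
    have htt : t ∈ Icc 0 t := ⟨h1.le, le_rfl⟩
    rcases h4 with h | h | h
    · linarith [h7 t htt]
    · exact h
    · have := le_of_deriv_ge (h := fun s => (φ x s).2.1) (C := d/20) h1.le ho.dq (fun r hr => by
        linarith [h6 r hr, h7 r hr])
      have e : d/20*(t-0) = P.qL := by rw [h]; field_simp; ring
      rw [e] at this
      simp only [Fl.zero, hx] at this
      linarith [(h3 t htt).2]
  have h9 := ho.u_ge_near_laminar hθ hε (fun s hs => (h3 s hs).2) (by simp only [Fl.zero, hx]; linarith)
  refine ⟨t, h1.le, h8, ho, fun s hs => ⟨⟨?_, h3 s hs, ⟨?_, h5 s hs⟩, ⟨h9 s hs, (ho.hu s hs).2⟩⟩, ?_, ?_⟩⟩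
  · rw [flow_fst Fl]; exact hθ
  · linarith [h6 s hs, (h3 s hs).1]
  · linarith [h7 s hs]
  · linarith [h6 s hs]

theorem exists_unstable1 (hε : 0 < ε) (hθ : θ ∈ Icc (0:ℝ) 1) {B : ℝ}
    (hB : B = 3*P.qL ∨ ∃ Θ β ω, P.BlueAt Θ β ω ∧ θ ∈ Θ ∧ B = P.κ*P.qL*(β-P.qL)) :
    ∃ z : ℝ × ℝ × ℝ × ℝ, z.1 = θ ∧ z.2.1 = P.qL ∧ P.qL/20 ≤ z.2.2.1 ∧ z.2.2.1 ≤ B ∧ BackIn φ P.R1 z := by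
  have hqL := P.hqL; have hqL' := P.hqL'; have hκ := P.hκ; have hqH := P.hqH
  have hK : IsCompact (({θ} : Set ℝ) ×ˢ ({P.qL} : Set ℝ) ×ˢ Icc (P.qL/20) B ×ˢ Icc (2-2*P.qL) 2) :=
    isCompact_singleton.prod (isCompact_singleton.prod (isCompact_Icc.prod isCompact_Icc))
  have hx : Tendsto (fun d : ℝ => ((θ, d, P.c2 θ*d, 2) : ℝ × ℝ × ℝ × ℝ)) (𝓝[>] 0) (𝓝 (e1 θ)) := by
    have : Continuous fun d : ℝ => ((θ, d, P.c2 θ*d, 2) : ℝ × ℝ × ℝ × ℝ) := by fun_prop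
    have h := (this.tendsto 0).mono_left (nhdsWithin_le_nhds (s := Ioi 0))
    simpa [e1] using h
  have hBd : ∀ᶠ d in 𝓝[>] (0:ℝ), B = 3*P.qL ∨
      ∃ Θ β ω, P.BlueAt Θ β ω ∧ θ ∈ Θ ∧ B = P.κ*P.qL*(β-P.qL) ∧ P.c2 θ*d ≤ P.κ*d*(β-d) := by
    rcases hB with h | ⟨Θ, β, ω, h1, h2, h3⟩
    · exact Eventually.of_forall fun d => Or.inl h
    · have h4 := h1.hc θ h2
      have h5 := h1.hω; have h6 := h1.hb
      have h7 : 0 < P.κ*β - P.c2 θ := by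
        by_contra hcon
        have := mul_nonneg (show 0 ≤ P.κ*β from mul_nonneg hκ.le (by linarith))
          (show 0 ≤ P.c2 θ - P.κ*β by linarith)
        linarith
      filter_upwards [Ioo_mem_nhdsGT (show 0 < (P.κ*β - P.c2 θ)/P.κ by positivity)] with d hd
      refine Or.inr ⟨Θ, β, ω, h1, h2, h3, ?_⟩
      have := (lt_div_iff₀ hκ).mp hd.2
      have := mul_le_mul_of_nonneg_left (show P.c2 θ ≤ P.κ*(β - d) by linarith) hd.1.le
      linarith
  obtain ⟨z, hz, hz'⟩ := Fl.exists_backIn P.isClosed_R1 hK (Tg := {z | P.qL ≤ z.2.1})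
    (isClosed_le (by fun_prop) (by fun_prop)) (flow_e1 Fl θ)
    (by simp only [e1, mem_ofPred_eq, not_le]; exact hqL) hx (by
      filter_upwards [hBd, Ioo_mem_nhdsGT hqL] with d hBd hd
      obtain ⟨t, h1, h2, ho, h3⟩ := laminar_exit Fl hε hθ hd.1 hd.2
      have ht : t ∈ Icc 0 t := ⟨h1, le_rfl⟩
      refine ⟨t, h1, h2.ge, ⟨flow_fst Fl _ _, h2, ⟨?_, ?_⟩, (h3 t ht).1.2.2.2⟩, fun s hs => (h3 s hs).1⟩
      · have := (h3 t ht).2.2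
        rwa [h2] at this
      · rcases hBd with rfl | ⟨Θ, β, ω, c1, c2, rfl, c3⟩
        · have := (h3 t ht).1.2.2.1.2
          rwa [h2] at this
        · have c4 := c1.hb; have c5 := c1.hqL
          have := ho.le_blue c1 c2 hθ (fun s hs => ⟨(h3 s hs).2.1, by linarith [(h3 s hs).1.2.1.2]⟩)
            (fun s hs => by linarith [(h3 s hs).1.2.2.2.1]) (by simp only [Fl.zero]; exact c3) t ht
          simp only [h2] at this
          exact this)
  exact ⟨z, hz.1, hz.2.1, hz.2.2.1.1, hz.2.2.1.2, hz'⟩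

end Par

namespace Par
open Set
variable {P : Par} {ε θ : ℝ} {q p u : ℝ → ℝ} {a b : ℝ}

theorem lt_κ (P : Par) : 3/5 < P.κ := by have := P.hR; have := P.hκ; nlinarith

variable {φ : ℝ × ℝ × ℝ × ℝ → ℝ → ℝ × ℝ × ℝ × ℝ} (Fl : IsFlow (P.field ε) φ)
include Fl

theorem turbulent_exit (hε : 0 < ε) (hθ : θ ∈ Icc (0:ℝ) 1) {d : ℝ} (hd : 0 < d)
    (hd' : d < 1 + P.y - P.qH) :
    ∃ t, 0 ≤ t ∧ (φ (θ, 1+P.y-d, -(P.cb θ*d), P.ub) t).2.1 = P.qH ∧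
      P.Orb ε θ (fun s => (φ (θ, 1+P.y-d, -(P.cb θ*d), P.ub) s).2.1)
        (fun s => (φ (θ, 1+P.y-d, -(P.cb θ*d), P.ub) s).2.2.1)
        (fun s => (φ (θ, 1+P.y-d, -(P.cb θ*d), P.ub) s).2.2.2) (Icc 0 t) ∧
      ∀ s ∈ Icc 0 t, φ (θ, 1+P.y-d, -(P.cb θ*d), P.ub) s ∈ P.R2 ∧
        (φ (θ, 1+P.y-d, -(P.cb θ*d), P.ub) s).2.1 ∈ Icc P.qH (1+P.y) ∧
        (φ (θ, 1+P.y-d, -(P.cb θ*d), P.ub) s).2.2.2 ∈ Icc P.ub (P.ub + (1+P.y-P.qH)) ∧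
        (φ (θ, 1+P.y-d, -(P.cb θ*d), P.ub) s).2.2.1 ≤
          -((1+P.y-(φ (θ, 1+P.y-d, -(P.cb θ*d), P.ub) s).2.1)/20) := by
  set x : ℝ × ℝ × ℝ × ℝ := (θ, 1+P.y-d, -(P.cb θ*d), P.ub) with hx
  have hum := P.hum; have hum' := P.hum'; have hub' := P.hub'; have hqH := P.hqH; have hqH' := P.hqH'
  have hg := P.qH_gap; have hρ := P.hρ; have hρ1 := P.rho_le; have hy1 := P.hy1
  have hulb : P.ub ∈ Icc P.ulo 2 := ⟨by linarith, by linarith⟩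
  have hc := P.c_le hθ hulb.2
  have hc' := P.le_c hθ hulb.1
  rw [P.c_ub] at hc' hc
  have hp1 : 1/10*d ≤ P.cb θ*d := mul_le_mul_of_nonneg_right hc' hd.le
  have hp2 : P.cb θ*d ≤ 2*d := mul_le_mul_of_nonneg_right hc hd.le
  obtain ⟨t, h1, h2, h3, h4⟩ := slab_hit Fl (x := x) (l := P.qH) (r := 1+P.y)
    (by simp only [hx]; linarith) (by simp only [hx]; linarith) (20*(1+P.y-P.qH)/d)
    (by have : 0 < 1+P.y-P.qH := by linarith
        positivity)
  obtain ⟨ho, h5⟩ := orb_of_q Fl hε (x := x) hθ hulb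
    (by simp only [hx]; linarith) (by simp only [hx]; linarith) (T := t)
    (fun s hs => ⟨by linarith [(h3 s hs).1], by linarith [(h3 s hs).2]⟩)
  have hu1 := nonneg_of_deriv_ge (h := fun s => (φ x s).2.2.2 - P.ub) (K := 0) (a := 0) (b := t)
    (fun s hs => (ho.du s hs).sub_const _) (by simp only [Fl.zero, hx]; linarith) (by
      intro s hs h
      rw [zero_mul]
      have hθ' : x.1 ∈ Icc (0:ℝ) 1 := hθ
      exact div_nonneg (mul_nonneg (mul_nonneg hε.le (P.m_nonneg _))
        (gq_nonneg (by linarith [(h3 s hs).1]) (h3 s hs).2 (by linarith)))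
        (by linarith [P.le_den hθ' (ho.hu s hs).1]))
  have hu2 := ho.u_le_near_turbulent hθ hε (fun s hs => (h3 s hs).1) (by simp only [Fl.zero, hx]; linarith)
  have hF : ∀ s ∈ Icc 0 t, 0 ≤ P.F (φ x s).2.1 (φ x s).2.2.2 := by
    intro s hs
    have e1 := F_anti (P := P) (u := (φ x s).2.2.2) (show 1 ≤ (φ x s).2.1 by linarith [(h3 s hs).1]) (h3 s hs).2
    rw [F_q2] at e1
    linarith [hu1 s hs]
  have h6 := nonneg_of_deriv_ge (h := fun s => -(φ x s).2.2.1 - 1/20*(1+P.y-(φ x s).2.1)) (K := 2) (a := 0) (b := t)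
    (fun s hs => (ho.dp s hs).neg.sub (((ho.dq s hs).const_sub _).const_mul (1/20))) (by simp only [Fl.zero, hx]; linarith) (by
      intro s hs h
      have c1 := P.le_c hθ (ho.hu s hs).1
      have c2 := P.c_le hθ (ho.hu s hs).2
      have e1 := mul_nonneg (show 0 ≤ (φ x s).2.1 by linarith [(h3 s hs).1]) (hF s hs)
      have e3 := mul_le_mul_of_nonneg_left h.le
        (show 0 ≤ 2 - (P.c θ (φ x s).2.2.2 - 1/20) by linarith)
      have e4 := mul_nonneg (show 0 ≤ P.c θ (φ x s).2.2.2 - 1/20 by linarith) (show 0 ≤ 1/20*(1+P.y-(φ x s).2.1) by linarith [(h3 s hs).2])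
      simp only [hx] at e1 e3 e4 ⊢
      linarith)
  have h7 : ∀ s ∈ Icc 0 t, (φ x s).2.1 ≤ 1+P.y-d := by
    intro s hs
    have := ge_of_deriv_le (h := fun s => (φ x s).2.1) (C := 0) hs.1
      (fun r hr => ho.dq r ⟨hr.1, hr.2.trans hs.2⟩) (fun r hr => by
        have hr' : r ∈ Icc 0 t := ⟨hr.1, hr.2.trans hs.2⟩
        linarith [h6 r hr', (h3 r hr').2])
    simp only [Fl.zero, hx] at this ⊢
    linarith
  have h8 : (φ x t).2.1 = P.qH := by
    have htt : t ∈ Icc 0 t := ⟨h1.le, le_rfl⟩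
    rcases h4 with h | h | h
    · exact h
    · linarith [h7 t htt]
    · have := ge_of_deriv_le (h := fun s => (φ x s).2.1) (C := -(d/20)) h1.le ho.dq (fun r hr => by
        linarith [h6 r hr, h7 r hr])
      have e : -(d/20)*(t-0) = -(1+P.y-P.qH) := by rw [h]; field_simp; ring
      rw [e] at this
      simp only [Fl.zero, hx] at this
      linarith [(h3 t htt).1]
  have h9 := ho.p_ge_near_turbulent hθ (fun s hs => ⟨(h3 s hs).1, by linarith [(h3 s hs).2]⟩) hu2
    (by simp only [Fl.zero, hx]; linarith)
  refine ⟨t, h1.le, h8, ho, fun s hs => ⟨⟨?_, ⟨?_, ?_⟩, ⟨h9 s hs, ?_⟩, ⟨?_, ?_⟩⟩, h3 s hs,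
    ⟨by linarith [hu1 s hs], hu2 s hs⟩, ?_⟩⟩
  · rw [flow_fst Fl]; exact hθ
  · linarith [(h3 s hs).1]
  · linarith [(h3 s hs).2]
  · linarith [h6 s hs, (h3 s hs).2]
  · linarith [hu1 s hs]
  · linarith [hu2 s hs]
  · linarith [h6 s hs]

theorem exists_unstable2 (hε : 0 < ε) (hθ : θ ∈ Icc (0:ℝ) 1) {B : ℝ}
    (hB : B = -6*P.ρ ∨ ∃ Θ β ω, P.RedAt Θ β ω ∧ θ ∈ Θ ∧ B = -(P.κ*(P.qH-P.qL)*(β-P.qH))) :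
    ∃ z : ℝ × ℝ × ℝ × ℝ, z.1 = θ ∧ z.2.1 = P.qH ∧ B ≤ z.2.2.1 ∧ z.2.2.1 < 0 ∧
      z.2.2.2 ∈ Icc P.ub (P.ub + (1+P.y-P.qH)) ∧ BackIn φ P.R2 z := by
  have hqL := P.hqL; have hqL' := P.hqL'; have hκ := P.lt_κ; have hqH := P.hqH; have hqH' := P.hqH'
  have hg := P.qH_gap; have hρ := P.hρ; have hρ1 := P.rho_le; have hy1 := P.hy1
  have hum := P.hum; have hum' := P.hum'; have hub' := P.hub'
  have hω : 0 < 1+P.y-P.qH := by linarith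
  have hulb : P.ub ∈ Icc P.ulo 2 := ⟨by linarith, by linarith⟩
  have hc := P.c_le hθ hulb.2
  rw [P.c_ub] at hc
  have hK : IsCompact (({θ} : Set ℝ) ×ˢ ({P.qH} : Set ℝ) ×ˢ Icc B (-((1+P.y-P.qH)/20)) ×ˢ
      Icc P.ub (P.ub + (1+P.y-P.qH))) :=
    isCompact_singleton.prod (isCompact_singleton.prod (isCompact_Icc.prod isCompact_Icc))
  have hx : Tendsto (fun d : ℝ => ((θ, 1+P.y-d, -(P.cb θ*d), P.ub) : ℝ × ℝ × ℝ × ℝ)) (𝓝[>] 0) (𝓝 (P.e2 θ)) := by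
    have : Continuous fun d : ℝ => ((θ, 1+P.y-d, -(P.cb θ*d), P.ub) : ℝ × ℝ × ℝ × ℝ) := by fun_prop
    have h := (this.tendsto 0).mono_left (nhdsWithin_le_nhds (s := Ioi 0))
    simpa [e2] using h
  obtain ⟨z, hz, hz'⟩ := Fl.exists_backIn P.isClosed_R2 hK (Tg := {z | z.2.1 ≤ P.qH})
    (isClosed_le (by fun_prop) (by fun_prop)) (flow_e2 Fl θ)
    (by simp only [e2, mem_ofPred_eq, not_le]; exact hqH') hx (by
      filter_upwards [Ioo_mem_nhdsGT hω] with d hd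
      obtain ⟨t, h1, h2, ho, h3⟩ := turbulent_exit Fl hε hθ hd.1 hd.2
      have ht : t ∈ Icc 0 t := ⟨h1, le_rfl⟩
      refine ⟨t, h1, h2.le, ⟨flow_fst Fl _ _, h2, ⟨?_, ?_⟩, (h3 t ht).2.2.1⟩, fun s hs => (h3 s hs).1⟩
      · rcases hB with rfl | ⟨Θ, β, ω, c1, c2, rfl⟩
        · exact (h3 t ht).1.2.2.1.1
        · have c4 := c1.hb; have c5 := c1.hω
          have := ho.ge_red c1 c2 hθ h1 (fun s hs => ⟨by linarith [(h3 s hs).2.1.1], by linarith [(h3 s hs).2.1.2]⟩)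
            (fun s hs => by linarith [(h3 s hs).2.2.1.2]) (by
              simp only [Fl.zero]
              have e1 := mul_le_mul_of_nonneg_right hc hd.1.le
              have e2 : 3/5*(9/10) ≤ P.κ*(1+P.y-d-P.qL) :=
                mul_le_mul hκ.le (by linarith [hd.2]) (by norm_num) (by linarith)
              have e3 : 3/5*(9/10)*P.ρ ≤ P.κ*(1+P.y-d-P.qL)*(β-(1+P.y-d)) :=
                mul_le_mul e2 (by linarith [hd.1]) hρ.le (by linarith)
              linarith [hd.2])
          simp only [h2] at this
          exact this
      · have := (h3 t ht).2.2.2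
        rwa [h2] at this)
  exact ⟨z, hz.1, hz.2.1, hz.2.2.1.1, by linarith [hz.2.2.1.2], hz.2.2.2, hz'⟩

end Par

theorem MapClusterPt.eq_of_tendsto {ι X : Type*} [TopologicalSpace X] [T2Space X] {l : Filter ι}
    {f : ι → X} {x y : X} (h : MapClusterPt x l f) (hf : Tendsto f l (𝓝 y)) : x = y := by
  have : ClusterPt x (𝓝 y) := ClusterPt.mono h hf
  exact eq_of_nhds_neBot this

namespace Par
open Set
variable {P : Par} {ε θ : ℝ} {q p u : ℝ → ℝ} {a b : ℝ}

theorem isCompact_R1 (P : Par) : IsCompact P.R1 := by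
  have hK : IsCompact (Icc (0:ℝ) 1 ×ˢ Icc 0 P.qL ×ˢ Icc (-3:ℝ) 3 ×ˢ Icc (2-2*P.qL) 2) :=
    isCompact_Icc.prod (isCompact_Icc.prod (isCompact_Icc.prod isCompact_Icc))
  refine hK.of_isClosed_subset P.isClosed_R1 fun z hz => ⟨hz.1, hz.2.1, ⟨?_, ?_⟩, hz.2.2.2⟩
  · linarith [hz.2.2.1.1, hz.2.1.2, P.hqL']
  · linarith [hz.2.2.1.2, hz.2.1.2, P.hqL']

theorem isCompact_R2 (P : Par) : IsCompact P.R2 := by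
  have hK : IsCompact (Icc (0:ℝ) 1 ×ˢ Icc (1+P.y-P.ρ) (1+P.y+P.ρ) ×ˢ Icc (-6*P.ρ) (6*P.ρ) ×ˢ
      Icc P.um (P.ub+P.ρ)) :=
    isCompact_Icc.prod (isCompact_Icc.prod (isCompact_Icc.prod isCompact_Icc))
  exact hK.of_isClosed_subset P.isClosed_R2 fun z hz => hz

variable {φ : ℝ × ℝ × ℝ × ℝ → ℝ → ℝ × ℝ × ℝ × ℝ} (Fl : IsFlow (P.field ε) φ)
include Fl

theorem tendsto_unstable {ι : Type*} {l : Filter ι} {R : Set (ℝ × ℝ × ℝ × ℝ)} {cX k : ℝ → ℝ} {s : ℝ}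
    (D : P.Dissip R cX k s) (hR : IsCompact R) (hε : 0 < ε) {w : ι → ℝ × ℝ × ℝ × ℝ}
    (hT : ∀ T, ∀ᶠ i in l, ∀ t ∈ Icc (-T) 0, φ (w i) t ∈ R) {w₀ : ℝ × ℝ × ℝ × ℝ}
    (h1 : Tendsto (fun i => (w i).1) l (𝓝 w₀.1)) (h2 : ∀ᶠ i in l, (w i).2.1 = w₀.2.1)
    (h : BackIn φ R w₀) : Tendsto w l (𝓝 w₀) := by
  refine Fl.tendsto_of_backIn hR.isClosed hR ?_ hT fun z _ hz hb => ?_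
  · filter_upwards [hT 0] with i hi
    have := hi 0 ⟨by simp, le_rfl⟩
    rwa [Fl.zero] at this
  · have e1 : z.1 = w₀.1 :=
      (hz.continuousAt_comp (f := fun x : ℝ × ℝ × ℝ × ℝ => x.1) (by fun_prop)).eq_of_tendsto h1
    have e2 : z.2.1 = w₀.2.1 :=
      (hz.continuousAt_comp (f := fun x : ℝ × ℝ × ℝ × ℝ => x.2.1) (by fun_prop)).eq_of_tendsto
        (tendsto_const_nhds.congr' (h2.mono fun i hi => hi.symm))
    exact D.unique Fl hε e1 e2 hb h

theorem exists_sigma1 (hε : 0 < ε) : ∃ σ : ℝ → ℝ × ℝ × ℝ × ℝ, ContinuousOn σ (Icc 0 1) ∧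
    ∀ θ ∈ Icc (0:ℝ) 1, (σ θ).1 = θ ∧ σ θ ∈ P.S ∧ 2 - 2*P.qL ≤ (σ θ).2.2.2 ∧ BackIn φ P.R1 (σ θ) ∧
      ∀ Θ β ω, P.BlueAt Θ β ω → θ ∈ Θ → (σ θ).2.2.1 ≤ P.κ*P.qL*(β-P.qL) := by
  have h : ∀ θ : ℝ, ∃ z : ℝ × ℝ × ℝ × ℝ, θ ∈ Icc (0:ℝ) 1 → z.1 = θ ∧ z.2.1 = P.qL ∧ P.qL/20 ≤ z.2.2.1 ∧
      z.2.2.1 ≤ 3*P.qL ∧ BackIn φ P.R1 z := fun θ => by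
    by_cases hθ : θ ∈ Icc (0:ℝ) 1
    · obtain ⟨z, hz⟩ := exists_unstable1 Fl hε hθ (Or.inl rfl)
      exact ⟨z, fun _ => hz⟩
    · exact ⟨0, fun h => absurd h hθ⟩
  choose σ hσ using h
  refine ⟨σ, fun θ hθ => ?_, fun θ hθ => ?_⟩
  · obtain ⟨h1, h2, h3, h4, h5⟩ := hσ θ hθ
    refine tendsto_unstable Fl P.R1_dissip P.isCompact_R1 hε (fun T => ?_) ?_ ?_ h5
    · filter_upwards [self_mem_nhdsWithin] with θ' hθ' t ht
      exact (hσ θ' hθ').2.2.2.2 t ht.2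
    · rw [h1]
      refine (tendsto_id.mono_left nhdsWithin_le_nhds).congr' ?_
      filter_upwards [self_mem_nhdsWithin] with θ' hθ' using (hσ θ' hθ').1.symm
    · filter_upwards [self_mem_nhdsWithin] with θ' hθ'
      rw [h2, (hσ θ' hθ').2.1]
  · obtain ⟨h1, h2, h3, h4, h5⟩ := hσ θ hθ
    have h0 := h5 0 le_rfl
    rw [Fl.zero] at h0
    have hqL := P.hqL; have hqL' := P.hqL'; have := P.hum; have := P.hum'; have := P.hub'
    have hu := h0.2.2.2
    refine ⟨h1, ⟨by rwa [h1], h2, ⟨by linarith, by linarith⟩, ⟨by linarith [hu.1], hu.2⟩⟩, hu.1, h5,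
      fun Θ β ω hB hΘ => ?_⟩
    obtain ⟨z, z1, z2, -, z4, z5⟩ := exists_unstable1 Fl hε hθ (Or.inr ⟨Θ, β, ω, hB, hΘ, rfl⟩)
    rwa [P.R1_dissip.unique Fl hε (h1.trans z1.symm) (h2.trans z2.symm) h5 z5]

theorem exists_sigma2 (hε : 0 < ε) : ∃ σ : ℝ → ℝ × ℝ × ℝ × ℝ, ContinuousOn σ (Icc 0 1) ∧
    ∀ θ ∈ Icc (0:ℝ) 1, (σ θ).1 = θ ∧ σ θ ∈ P.S' ∧ (σ θ).2.2.2 ∈ Icc P.ub (P.ub + (1+P.y-P.qH)) ∧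
      BackIn φ P.R2 (σ θ) ∧
      ∀ Θ β ω, P.RedAt Θ β ω → θ ∈ Θ → -(P.κ*(P.qH-P.qL)*(β-P.qH)) ≤ (σ θ).2.2.1 := by
  have h : ∀ θ : ℝ, ∃ z : ℝ × ℝ × ℝ × ℝ, θ ∈ Icc (0:ℝ) 1 → z.1 = θ ∧ z.2.1 = P.qH ∧ -6*P.ρ ≤ z.2.2.1 ∧
      z.2.2.1 < 0 ∧ z.2.2.2 ∈ Icc P.ub (P.ub + (1+P.y-P.qH)) ∧ BackIn φ P.R2 z := fun θ => by
    by_cases hθ : θ ∈ Icc (0:ℝ) 1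
    · obtain ⟨z, hz⟩ := exists_unstable2 Fl hε hθ (Or.inl rfl)
      exact ⟨z, fun _ => hz⟩
    · exact ⟨0, fun h => absurd h hθ⟩
  choose σ hσ using h
  refine ⟨σ, fun θ hθ => ?_, fun θ hθ => ?_⟩
  · obtain ⟨h1, h2, h3, h4, -, h5⟩ := hσ θ hθ
    refine tendsto_unstable Fl P.R2_dissip P.isCompact_R2 hε (fun T => ?_) ?_ ?_ h5
    · filter_upwards [self_mem_nhdsWithin] with θ' hθ' t ht
      exact (hσ θ' hθ').2.2.2.2.2 t ht.2
    · rw [h1]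
      refine (tendsto_id.mono_left nhdsWithin_le_nhds).congr' ?_
      filter_upwards [self_mem_nhdsWithin] with θ' hθ' using (hσ θ' hθ').1.symm
    · filter_upwards [self_mem_nhdsWithin] with θ' hθ'
      rw [h2, (hσ θ' hθ').2.1]
  · obtain ⟨h1, h2, h3, h4, hu, h5⟩ := hσ θ hθ
    have hqH' := P.hqH'; have := P.hum; have := P.hum'; have := P.hub'
    have hg := P.qH_gap; have hρ1 := P.rho_le; have hy1 := P.hy1
    refine ⟨h1, ⟨by rwa [h1], h2, ⟨by linarith, h4⟩, ⟨by linarith [hu.1], by linarith [hu.2]⟩⟩, hu, h5,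
      fun Θ β ω hB hΘ => ?_⟩
    obtain ⟨z, z1, z2, z3, -, -, z5⟩ := exists_unstable2 Fl hε hθ (Or.inr ⟨Θ, β, ω, hB, hΘ, rfl⟩)
    rwa [P.R2_dissip.unique Fl hε (h1.trans z1.symm) (h2.trans z2.symm) h5 z5]

end Par

namespace Par
open Set
variable {P : Par} {ε θ : ℝ} {q p u : ℝ → ℝ}

theorem tendsto_of_sq_sub_le {f w : ℝ → ℝ} {c : ℝ} (hw : Tendsto w atTop (𝓝 0))
    (h : ∀ t, (f t - c)^2 ≤ w t) : Tendsto f atTop (𝓝 c) := by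
  rw [tendsto_iff_norm_sub_tendsto_zero]
  have hs := hw.sqrt
  rw [Real.sqrt_zero] at hs
  exact squeeze_zero (fun _ => norm_nonneg _) (fun t => Real.abs_le_sqrt (h t)) hs

/-- A strict Lyapunov function forces convergence of a bounded orbit. -/
theorem Orb.tendsto_of_lyapunov (hθ : θ ∈ Icc (0:ℝ) 1) (hε : 0 ≤ ε) {t₀ q₀ u₀ s m : ℝ}
    (h : P.Orb ε θ q p u (Ici t₀)) (hq₀ : q₀ ∈ Icc (0:ℝ) 2) (hu₀ : u₀ ∈ Icc P.ulo 2)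
    {L L' : ℝ → ℝ} (hL : ∀ t, t₀ ≤ t → HasDerivAt L (L' t) t) (hm : ∀ t, t₀ ≤ t → m ≤ L t)
    (hs : 0 < s) (hL' : ∀ t, t₀ ≤ t → L' t ≤ -(s*((q t - q₀)^2 + (p t)^2 + (u t - u₀)^2))) :
    Tendsto q atTop (𝓝 q₀) ∧ Tendsto p atTop (𝓝 0) ∧ Tendsto u atTop (𝓝 u₀) := by
  have hlo := P.hulo
  have key := tendsto_zero_of_lyapunov (C := s*(64 + 2*16*40 + 2*2*(40*ε))) hL hm
    (w := fun t => s*((q t - q₀)^2 + (p t)^2 + (u t - u₀)^2))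
    (w' := fun t => s*(2*(q t - q₀)*p t + 2*p t*(P.c θ (u t) * p t - q t * P.F (q t) (u t))
      + 2*(u t - u₀)*P.du ε θ (q t) (u t)))
    (fun t _ => by positivity) hL'
    (fun t ht => by
      refine (((((h.dq t ht).sub_const q₀).pow 2).add ((h.dp t ht).pow 2)).add
        (((h.du t ht).sub_const u₀).pow 2) |>.const_mul s).congr_deriv ?_
      push_cast; ring)
    (fun t ht => by
      have hq := h.hq t ht; have hp := h.hp t ht; have hu := h.hu t ht
      have hF := P.F_mem hq hu
      have hc0 := P.le_c hθ hu.1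
      have hc1 := P.c_le hθ hu.2
      have hd := P.abs_du_le hθ hε hq hu
      have a1 : |q t - q₀| ≤ 2 := abs_le.mpr ⟨by linarith [hq.1, hq₀.2], by linarith [hq.2, hq₀.1]⟩
      have a2 : |p t| ≤ 16 := abs_le.mpr ⟨hp.1, by linarith [hp.2]⟩
      have a3 : |u t - u₀| ≤ 2 := abs_le.mpr ⟨by linarith [hu.1, hu₀.2], by linarith [hu.2, hu₀.1]⟩
      have a4 : |P.c θ (u t)| ≤ 2 := abs_le.mpr ⟨by linarith, hc1⟩
      have a5 : |q t| ≤ 2 := abs_le.mpr ⟨by linarith [hq.1], hq.2⟩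
      have a6 : |P.F (q t) (u t)| ≤ 1 := abs_le.mpr ⟨by linarith [hF.1], by linarith [hF.2]⟩
      have b1 : |P.c θ (u t) * p t - q t * P.F (q t) (u t)| ≤ 40 := by
        refine (abs_sub _ _).trans ?_
        rw [abs_mul, abs_mul]
        have := mul_le_mul a4 a2 (abs_nonneg _) (by norm_num)
        have := mul_le_mul a5 a6 (abs_nonneg _) (by norm_num)
        linarith
      rw [abs_mul, abs_of_pos hs]
      refine mul_le_mul_of_nonneg_left ?_ hs.le
      refine (abs_add_three _ _ _).trans ?_
      simp only [abs_mul, abs_two]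
      have e1 := mul_le_mul a1 a2 (abs_nonneg _) (by norm_num)
      have e2 := mul_le_mul a2 b1 (abs_nonneg _) (by norm_num)
      have e3 := mul_le_mul a3 hd (abs_nonneg _) (by norm_num)
      linarith)
  have k2 : Tendsto (fun t => (q t - q₀)^2 + (p t)^2 + (u t - u₀)^2) atTop (𝓝 0) := by
    have := key.const_mul s⁻¹
    simpa [inv_mul_cancel_left₀ hs.ne'] using this
  refine ⟨tendsto_of_sq_sub_le k2 fun t => ?_, tendsto_of_sq_sub_le k2 fun t => ?_,
    tendsto_of_sq_sub_le k2 fun t => ?_⟩ <;>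
  nlinarith [sq_nonneg (q t - q₀), sq_nonneg (p t), sq_nonneg (u t - u₀)]

theorem Orb.tendsto_laminar (hθ : θ ∈ Icc (0:ℝ) 1) (hε : ε ∈ Ioo 0 (1/1000)) {t₀ : ℝ}
    (h : P.Orb ε θ q p u (Ici t₀)) (hq : ∀ t, t₀ ≤ t → q t ≤ P.qL)
    (hu : ∀ t, t₀ ≤ t → P.um ≤ u t) :
    Tendsto q atTop (𝓝 0) ∧ Tendsto p atTop (𝓝 0) ∧ Tendsto u atTop (𝓝 2) := by
  have ha := P.a_pos hθ
  have hζ := P.hζ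
  have hlo := P.hulo
  have hR := P.hR'
  have hqL := P.hqL'
  have hc2 : P.c θ 2 = P.c2 θ := P.c_two θ
  refine h.tendsto_of_lyapunov hθ hε.1.le ⟨le_rfl, by norm_num⟩ ⟨P.ulo_lt.le, le_rfl⟩
    (L := fun t => P.c θ (u t) * (q t)^2 - 2*(q t*p t)
      + (1/100)/ε*((P.c2 θ + P.a θ*P.ζ)*(2 - u t)^2 - 2/3*P.a θ*(2 - u t)^3))
    (L' := fun t => P.a θ * P.du ε θ (q t) (u t) * (q t)^2 - 2*(p t)^2
      + 2*((q t)^2*P.F (q t) (u t)) - 2*(1/100)*((2 - u t)*gq (q t) (u t)))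
    (m := -32 * 4) (s := 1/100) (fun t ht => ?_) (fun t ht => ?_) (by norm_num) (fun t ht => ?_)
  · have hden := P.le_den hθ (h.hu t ht).1
    have hdu := h.du t ht
    have hcd : HasDerivAt (fun t => P.c θ (u t)) (P.a θ * P.du ε θ (q t) (u t)) t :=
      ((hdu.sub_const P.ub).const_mul (P.a θ)).const_add (P.cb θ)
    have e : P.du ε θ (q t) (u t) * (P.c θ (u t) + P.a θ * P.ζ) = ε * gq (q t) (u t) := by
      rw [du_eq (hu t ht)]; field_simp
    have e2 : P.c θ (u t) = P.c2 θ - P.a θ * (2 - u t) := by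
      rw [← hc2]; unfold c; ring
    refine (((hcd.mul ((h.dq t ht).pow 2)).sub (((h.dq t ht).mul (h.dp t ht)).const_mul 2)).add
      (((((hdu.const_sub 2).pow 2).const_mul (P.c2 θ + P.a θ*P.ζ)).sub
        (((hdu.const_sub 2).pow 3).const_mul (2/3*P.a θ))).const_mul ((1/100)/ε))).congr_deriv ?_
    have e3 : (1/100)/ε*((2 - u t)*(P.du ε θ (q t) (u t) * (P.c θ (u t) + P.a θ * P.ζ)))
        = (1/100)*((2 - u t)*gq (q t) (u t)) := by
      rw [e]; have := hε.1.ne'; field_simp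
    simp only [Pi.pow_apply]
    push_cast
    rw [e2] at e3 ⊢
    linear_combination -2*e3
  · have hq := h.hq t ht; have hp := h.hp t ht; have hu := h.hu t ht
    have hc := P.le_c hθ hu.1
    have hden := P.le_den hθ hu.1
    have e2 : P.c θ (u t) = P.c2 θ - P.a θ * (2 - u t) := by
      rw [← hc2]; unfold c; ring
    have h1 : 0 ≤ (1/100)/ε*((P.c2 θ + P.a θ*P.ζ)*(2 - u t)^2 - 2/3*P.a θ*(2 - u t)^3) := by
      refine mul_nonneg (div_nonneg (by norm_num) hε.1.le) ?_
      have : 0 ≤ (2 - u t)^2 * ((P.c2 θ + P.a θ*P.ζ) - 2/3*(P.a θ*(2 - u t))) := by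
        refine mul_nonneg (sq_nonneg _) ?_
        have := mul_nonneg ha.le (show 0 ≤ 2 - u t by linarith [hu.2])
        linarith
      linarith
    have h2 : 0 ≤ P.c θ (u t) * (q t)^2 := by positivity
    have h3 : q t * p t ≤ 2 * 7 := by
      have := mul_le_mul_of_nonneg_left hp.2 hq.1
      linarith [hq.2]
    linarith
  · have hq' := h.hq t ht; have hp := h.hp t ht; have hu := h.hu t ht
    have hd := (abs_le.mp (P.abs_du_le hθ hε.1.le hq' hu)).2
    have h1 : P.a θ * P.du ε θ (q t) (u t) * (q t)^2 ≤ 8/100 * (q t)^2 := by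
      refine mul_le_mul_of_nonneg_right ?_ (sq_nonneg _)
      have := mul_le_mul_of_nonneg_left hd ha.le
      have := mul_le_mul_of_nonneg_right (P.a_le hθ) (show 0 ≤ 40*ε by linarith [hε.1])
      linarith [hε.2]
    have h2 : P.F (q t) (u t) ≤ -(9/100) := by
      unfold F
      have h3 : 2*P.κ^2*q t*(2 - q t) ≤ 87/100*q t*2 := by
        have := mul_le_mul (mul_le_mul_of_nonneg_right hR.le hq'.1)
          (show 2 - q t ≤ 2 by linarith [hq'.1]) (by linarith [hq'.2]) (by linarith [hq'.1])
        linarith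
      linarith [hq t ht, hu.2]
    have h4 : (q t)^2*P.F (q t) (u t) ≤ (q t)^2*(-(9/100)) :=
      mul_le_mul_of_nonneg_left h2 (sq_nonneg _)
    have h5 : (2 - u t)*gq (q t) (u t) = (2 - u t)^2 - 2*q t*(2 - u t)*(u t - 1) := by
      unfold gq; ring
    have h6 : 0 ≤ q t * (2 - u t) := mul_nonneg hq'.1 (by linarith [hu.2])
    have h7 : q t * (2 - u t) * (u t - 1) ≤ q t * (2 - u t) * 1 :=
      mul_le_mul_of_nonneg_left (by linarith [hu.2]) h6
    rw [h5]
    linarith [sq_nonneg (p t), sq_nonneg (2 - u t - 2*q t), sq_nonneg (q t),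
      show (2 - u t - 2*q t)^2 = (u t - 2)^2 - 4*(q t * (2 - u t)) + 4*(q t)^2 by ring,
      show (2 - u t)^2 = (u t - 2)^2 by ring, show (q t - 0)^2 = (q t)^2 by ring]

theorem log_gap {q r : ℝ} (hq : 0 < q) (hr : 0 < r) :
    0 ≤ 2*(q - r) - 2*r*Real.log (q/r) ∧ 2*(q - r) - 2*r*Real.log (q/r) ≤ 2*(q-r)^2/q := by
  have h1 := Real.log_le_sub_one_of_pos (div_pos hq hr)
  have h2 := Real.one_sub_inv_le_log_of_pos (div_pos hq hr)
  have e1 : r * (q/r) = q := by field_simp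
  have e2 : r * (q/r)⁻¹ = r^2/q := by field_simp
  have e3 : 2*(q-r)^2/q = 2*q - 4*r + 2*(r^2/q) := by field_simp; ring
  have m1 := mul_le_mul_of_nonneg_left h1 hr.le
  have m2 := mul_le_mul_of_nonneg_left h2 hr.le
  rw [mul_sub] at m1 m2
  rw [e3]
  constructor <;> linarith

theorem Orb.tendsto_turbulent (hθ : θ ∈ Icc (0:ℝ) 1) (hε : 0 < ε) (hε' : 160*ε ≤ P.y/2) {t₀ : ℝ}
    (h : P.Orb ε θ q p u (Ici t₀)) (hq : ∀ t, t₀ ≤ t → P.qH ≤ q t)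
    (hu : ∀ t, t₀ ≤ t → P.um ≤ u t) :
    Tendsto q atTop (𝓝 (1+P.y)) ∧ Tendsto p atTop (𝓝 0) ∧ Tendsto u atTop (𝓝 P.ub) := by
  have ha := P.a_pos hθ
  have hζ := P.hζ
  have hlo := P.hulo
  have hum := P.hum; have hum' := P.hum'; have hub' := P.hub'; have hub := P.hub
  have hR := P.hR
  have hqH := P.hqH
  have hy0 := P.hy0
  have hy1 := P.hy1
  have hyub := P.hyub
  have hdenb := P.le_den hθ (show P.ulo ≤ P.ub by linarith)
  have hub0 : P.ub - 1 ≠ 0 := by linarith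
  have hF : ∀ t, P.F (q t) (u t) = (u t - P.ub) - 2*P.κ^2*(q t - (1+P.y))*(q t + (1+P.y) - 2) := by
    intro t
    have := P.hy
    unfold F; linear_combination -this
  refine h.tendsto_of_lyapunov hθ hε.le ⟨by linarith, by linarith⟩ ⟨by linarith, by linarith⟩
    (L := fun t => P.c θ (u t) * (2*(q t - (1+P.y)) - 2*(1+P.y)*Real.log (q t/(1+P.y)))
      - 2*((q t - (1+P.y))/q t*p t)
      + (1/(2*(P.ub-1)))/ε*((P.cb θ + P.a θ*P.ζ)*(u t - P.ub)^2 + 2/3*P.a θ*(u t - P.ub)^3))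
    (L' := fun t => P.a θ * P.du ε θ (q t) (u t) *
        (2*(q t - (1+P.y)) - 2*(1+P.y)*Real.log (q t/(1+P.y)))
      - 2*((1+P.y)/(q t)^2*(p t)^2)
      - 2*(2*P.κ^2)*((q t - (1+P.y))^2*(q t + (1+P.y) - 2))
      - (1/(P.ub-1))*((1+2*q t)*(u t - P.ub)^2))
    (m := -64) (s := P.y/2) (fun t ht => ?_) (fun t ht => ?_) (by linarith) (fun t ht => ?_)
  · have hq0 : 0 < q t := by linarith [hq t ht]
    have hden := P.le_den hθ (h.hu t ht).1
    have hdu := h.du t ht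
    have hdq := h.dq t ht
    have hcd : HasDerivAt (fun t => P.c θ (u t)) (P.a θ * P.du ε θ (q t) (u t)) t :=
      ((hdu.sub_const P.ub).const_mul (P.a θ)).const_add (P.cb θ)
    have e : P.du ε θ (q t) (u t) * (P.c θ (u t) + P.a θ * P.ζ) = ε * gq (q t) (u t) := by
      rw [du_eq (hu t ht)]; field_simp
    refine (((hcd.mul (((hdq.sub_const (1+P.y)).const_mul 2).sub
      (((hdq.div_const (1+P.y)).log (by positivity)).const_mul (2*(1+P.y))))).sub
      ((((hdq.sub_const (1+P.y)).div hdq hq0.ne').mul (h.dp t ht)).const_mul 2)).add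
      (((((hdu.sub_const P.ub).pow 2).const_mul (P.cb θ + P.a θ*P.ζ)).add
        (((hdu.sub_const P.ub).pow 3).const_mul (2/3*P.a θ))).const_mul
          ((1/(2*(P.ub-1)))/ε))).congr_deriv ?_
    have e3 : (1/(2*(P.ub-1)))/ε*((u t - P.ub)*(P.du ε θ (q t) (u t) *
        (P.cb θ + P.a θ * (u t - P.ub) + P.a θ * P.ζ)))
        = (1/(2*(P.ub-1)))*((u t - P.ub)*gq (q t) (u t)) := by
      change (1/(2*(P.ub-1)))/ε*((u t - P.ub)*(P.du ε θ (q t) (u t) *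
        (P.c θ (u t) + P.a θ * P.ζ))) = _
      rw [e]; have := hε.ne'; field_simp
    have e4 : (1/(2*(P.ub-1)))*((u t - P.ub)*gq (q t) (u t)) =
        -(1/(2*(P.ub-1)))*((1+2*q t)*(u t - P.ub)^2) - (u t - P.ub)*(q t - (1+P.y)) := by
      have : gq (q t) (u t) = -(u t - P.ub)*(1+2*q t) - 2*(P.ub-1)*(q t - (1+P.y)) := by
        unfold gq; linear_combination -hyub
      rw [this]; field_simp
    rw [e4] at e3
    have e5 : (1/(2*(P.ub-1))) = 1/2*(1/(P.ub-1)) := by field_simp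
    rw [e5] at e3 ⊢
    rw [hF]
    simp only [Pi.div_apply, Pi.sub_apply]
    push_cast
    have e6 : p t / (1 + P.y) / (q t / (1 + P.y)) = p t / q t := by field_simp
    rw [e6]
    have e7 : (p t * q t - (q t - (1 + P.y)) * p t) / (q t)^2 = (1+P.y)/(q t)^2*p t := by ring
    rw [e7]
    have e8 : P.c θ (u t) * (2*p t - 2*(1+P.y)*(p t/q t)) = 2*((q t - (1+P.y))/q t * (P.c θ (u t)*p t)) := by
      field_simp
    have e9 : (q t - (1+P.y))/q t * (q t * ((u t - P.ub) - 2*P.κ^2*(q t - (1+P.y))*(q t + (1+P.y) - 2)))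
      = (q t - (1+P.y)) * ((u t - P.ub) - 2*P.κ^2*(q t - (1+P.y))*(q t + (1+P.y) - 2)) := by
      field_simp
    linear_combination 2*e3 + e8 + 2*e9
  · have hq' := h.hq t ht; have hp := h.hp t ht; have hu' := h.hu t ht
    have hqt := hq t ht
    have hq0 : 0 < q t := by linarith
    have hc := P.le_c hθ hu'.1
    have hden := P.le_den hθ hu'.1
    have hB := (log_gap hq0 (show 0 < 1+P.y by linarith)).1
    have h1 : 0 ≤ (1/(2*(P.ub-1)))/ε*((P.cb θ + P.a θ*P.ζ)*(u t - P.ub)^2 + 2/3*P.a θ*(u t - P.ub)^3) := by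
      refine mul_nonneg (div_nonneg (one_div_nonneg.mpr (by linarith)) hε.le) ?_
      have : 0 ≤ (u t - P.ub)^2 * ((P.cb θ + P.a θ*P.ζ) + 2/3*(P.a θ*(u t - P.ub))) := by
        refine mul_nonneg (sq_nonneg _) ?_
        rw [c_ub] at hdenb
        unfold c at hden
        linarith
      linarith
    have h2 := mul_nonneg (show 0 ≤ P.c θ (u t) by linarith) hB
    have h3 : |(q t - (1+P.y))/q t*p t| ≤ 2*16 := by
      rw [abs_mul, abs_div, abs_of_pos hq0]
      refine mul_le_mul ?_ (abs_le.mpr ⟨hp.1, by linarith [hp.2]⟩) (abs_nonneg _) (by norm_num)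
      rw [div_le_iff₀ hq0, abs_le]
      constructor <;> linarith [hq'.2]
    have h4 := (abs_le.mp h3).2
    linarith
  · have hq' := h.hq t ht; have hp := h.hp t ht; have hu' := h.hu t ht
    have hqt := hq t ht
    have hq0 : 0 < q t := by linarith
    have hd := (abs_le.mp (P.abs_du_le hθ hε.le hq' hu')).2
    obtain ⟨hB, hB'⟩ := log_gap hq0 (show 0 < 1+P.y by linarith)
    set B := 2*(q t - (1+P.y)) - 2*(1+P.y)*Real.log (q t/(1+P.y)) with hBd
    have hB2 : B ≤ 2*(q t - (1+P.y))^2 := by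
      refine hB'.trans (div_le_self (by positivity) (by linarith))
    have h1 : P.a θ * P.du ε θ (q t) (u t) ≤ 80*ε := by
      have := mul_le_mul_of_nonneg_left hd ha.le
      have := mul_le_mul_of_nonneg_right (P.a_le hθ) (show 0 ≤ 40*ε by linarith)
      linarith
    have h2 : P.a θ * P.du ε θ (q t) (u t) * B ≤ 80*ε*(2*(q t - (1+P.y))^2) :=
      (mul_le_mul_of_nonneg_right h1 hB).trans (mul_le_mul_of_nonneg_left hB2 (by linarith))
    have h2' : 160*ε*(q t - (1+P.y))^2 ≤ P.y/2*(q t - (1+P.y))^2 :=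
      mul_le_mul_of_nonneg_right hε' (sq_nonneg _)
    have h3 : 1/4*(p t)^2 ≤ (1+P.y)/(q t)^2*(p t)^2 := by
      refine mul_le_mul_of_nonneg_right ?_ (sq_nonneg _)
      rw [le_div_iff₀ (by positivity)]
      have := pow_le_pow_left₀ hq0.le hq'.2 2
      linarith
    have h4 : P.y*(q t - (1+P.y))^2 ≤ 2*(2*P.κ^2)*((q t - (1+P.y))^2*(q t + (1+P.y) - 2)) := by
      have h5 : (q t - (1+P.y))^2*P.y ≤ (q t - (1+P.y))^2*(q t + (1+P.y) - 2) :=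
        mul_le_mul_of_nonneg_left (by linarith) (sq_nonneg _)
      have h6 : 0 ≤ (q t - (1+P.y))^2*P.y := mul_nonneg (sq_nonneg _) hy0.le
      have h7 := mul_le_mul (show (1:ℝ) ≤ 2*(2*P.κ^2) by linarith) h5 h6 (by linarith)
      linarith
    have h8 : (u t - P.ub)^2 ≤ (1/(P.ub-1))*((1+2*q t)*(u t - P.ub)^2) := by
      have h9 : (1:ℝ) ≤ 1/(P.ub-1) := by rw [le_div_iff₀ (by linarith)]; linarith
      have h10 : (u t - P.ub)^2 ≤ (1+2*q t)*(u t - P.ub)^2 :=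
        le_mul_of_one_le_left (sq_nonneg _) (by linarith)
      have := mul_le_mul h9 h10 (sq_nonneg _) (by linarith)
      linarith
    have h11 : P.y/2*(p t)^2 ≤ 1/8*(p t)^2 := mul_le_mul_of_nonneg_right (by linarith) (sq_nonneg _)
    have h12 : P.y/2*(u t - P.ub)^2 ≤ 1*(u t - P.ub)^2 := mul_le_mul_of_nonneg_right (by linarith) (sq_nonneg _)
    linarith [sq_nonneg (p t)]

/-- The region above `um` is forward invariant to the left of the turbulent state. -/
theorem Orb.um_le (hθ : θ ∈ Icc (0:ℝ) 1) (hε : 0 ≤ ε) {a b : ℝ} (h : P.Orb ε θ q p u (Icc a b))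
    (hq : ∀ t ∈ Icc a b, q t ≤ 1+P.y) (hu : P.um ≤ u a) : ∀ t ∈ Icc a b, P.um ≤ u t := by
  have hum' := P.hum'
  have := nonneg_of_deriv_ge (K := 0) (h := fun t => u t - P.um)
    (fun t ht => (h.du t ht).sub_const P.um) (by linarith) (fun t ht hlt => by
      have hg := gq_nonneg (h.hq t ht).1 (hq t ht) (show u t ≤ P.ub by linarith)
      have hden := P.le_den hθ (h.hu t ht).1
      rw [zero_mul]
      unfold Par.du
      exact div_nonneg (mul_nonneg (mul_nonneg hε (P.m_nonneg _)) hg) (by linarith))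
  exact fun t ht => by linarith [this t ht]

end Par

namespace Par
open Set
variable {P : Par}

theorem F_le_of_le_qL {q u : ℝ} (hq : 0 ≤ q) (hqL : q ≤ P.qL) (hu : u ≤ 2) :
    P.F q u ≤ -(9/100) := by
  have hR := P.hR'
  have hL := P.hqL'
  have h3 : 2*P.κ^2*q*(2 - q) ≤ 87/100*q*2 := by
    have := mul_le_mul (mul_le_mul_of_nonneg_right hR.le hq)
      (show 2 - q ≤ 2 by linarith) (by linarith) (by linarith)
    linarith
  unfold F
  linarith

/-- Orbits from `S'` which neither escape nor come back converge to the laminar state. -/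
theorem tends_laminar (P : Par) : ∀ᶠ ε in 𝓝[>] (0:ℝ), ∀ φ, IsFlow (P.field ε) φ →
    ∀ x ∈ P.S', P.um ≤ x.2.2.2 → x ∉ P.C φ → ¬ Enters φ P.Up x →
    P.Orb ε x.1 (fun t => (φ x t).2.1) (fun t => (φ x t).2.2.1) (fun t => (φ x t).2.2.2) (Ici 0) ∧
    (∀ t, 0 ≤ t → φ x t ∉ P.Upc) ∧
    (∀ t, 0 ≤ t → P.um ≤ (φ x t).2.2.2) ∧ Tendsto (φ x) atTop (𝓝 (e1 x.1)) ∧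
    ∃ T₀, 0 ≤ T₀ ∧ ∀ t, T₀ ≤ t → 0 < (φ x t).2.1 ∧ (φ x t).2.1 < P.qL ∧ (φ x t).2.2.1 < 0 := by
  obtain ⟨T, hT, htr⟩ := P.transit
  filter_upwards [htr, P.regular_S', Ioo_mem_nhdsGT (show (0:ℝ) < 1/1000 by norm_num)] with
    ε htr hR hε φ Fl x hx hxu hC hE
  have hav : ∀ t, 0 ≤ t → φ x t ∉ P.Upc := fun t ht =>
    Fl.avoid_of_not_enters P.isClosed_Upc P.Up_subset (S'_not_Upc hx) (hR φ Fl x hx) hE ht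
  have hθ : x.1 ∈ Icc (0:ℝ) 1 := hx.1
  have hxq : x.2.1 = P.qH := hx.2.1
  have hqH' := P.hqH'
  have horb : ∀ b : ℝ, 0 < b → _ := fun b hb => S'_orb Fl hε.1 hx hC hb fun t ht => hav t ht.1
  have ho : P.Orb ε x.1 (fun t => (φ x t).2.1) (fun t => (φ x t).2.2.1)
      (fun t => (φ x t).2.2.2) (Ici 0) := by
    have : ∀ t : ℝ, t ∈ Ici (0:ℝ) → t ∈ Icc 0 (t+1) := fun t ht => ⟨ht, by linarith⟩
    have hp : ∀ t : ℝ, t ∈ Ici (0:ℝ) → 0 < t + 1 := fun t ht => by linarith [mem_Ici.mp ht]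
    exact ⟨fun t ht => (horb _ (hp t ht)).1.dq t (this t ht), fun t ht => (horb _ (hp t ht)).1.dp t (this t ht),
      fun t ht => (horb _ (hp t ht)).1.du t (this t ht), fun t ht => (horb _ (hp t ht)).1.hq t (this t ht),
      fun t ht => (horb _ (hp t ht)).1.hp t (this t ht), fun t ht => (horb _ (hp t ht)).1.hu t (this t ht)⟩
  have hq0 : ∀ t, 0 ≤ t → 0 < (φ x t).2.1 := fun t ht => (horb (t+1) (by linarith)).2.1 t ⟨ht, by linarith⟩
  have hqH : ∀ t, 0 ≤ t → (φ x t).2.1 ≤ P.qH := fun t ht =>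
    (horb (t+1) (by linarith)).2.2.1 t ⟨ht, by linarith⟩
  have hum : ∀ t, 0 ≤ t → P.um ≤ (φ x t).2.2.2 := fun t ht =>
    Orb.um_le (a := 0) (b := t) hθ hε.1.le (ho.mono fun s hs => hs.1)
      (fun s hs => (hqH s hs.1).trans hqH'.le) (by simpa only [Fl.zero] using hxu) t ⟨ht, le_rfl⟩
  obtain ⟨t₀, ht₀, hqt₀⟩ : ∃ t₀, 0 ≤ t₀ ∧ (φ x t₀).2.1 < P.qL := by
    by_contra! hcon
    have := (htr x.1 hθ _ _ _ 0 (T+1) (by linarith) (ho.mono fun s hs => hs.1)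
      (fun t ht => ⟨hcon t ht.1, hqH t ht.1⟩) (Or.inr (by simp only [Fl.zero, hxq]))).1
    linarith
  have hqL : ∀ t, t₀ ≤ t → (φ x t).2.1 ≤ P.qL := fun t ht => by
    have := nonneg_of_deriv_ge (K := 0) (a := t₀) (b := t) (h := fun t => P.qL - (φ x t).2.1)
      (fun s hs => (ho.dq s (ht₀.trans hs.1)).const_sub P.qL) (by linarith) (fun s hs hlt => by
        by_contra! hcon
        exact hav s (ht₀.trans hs.1) ⟨by linarith, by linarith⟩) t ⟨ht, le_rfl⟩
    linarith
  obtain ⟨l1, l2, l3⟩ := (ho.mono (Ici_subset_Ici.mpr ht₀)).tendsto_laminar hθ hε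
    hqL (fun t ht => hum t (ht₀.trans ht))
  have hlim : Tendsto (φ x) atTop (𝓝 (e1 x.1)) := by
    have := (tendsto_const_nhds (x := x.1) (f := (atTop : Filter ℝ))).prodMk_nhds
      (l1.prodMk_nhds (l2.prodMk_nhds l3))
    refine this.congr fun t => ?_
    rw [← flow_fst Fl x t]
  refine ⟨ho, hav, hum, hlim, ?_⟩
  obtain ⟨T₁, hT₁⟩ := eventually_atTop.mp (l1.eventually_lt_const P.hqL)
  refine ⟨max T₁ 0, le_max_right _ _, fun t ht => ?_⟩
  have ht1 : T₁ ≤ t := (le_max_left _ _).trans ht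
  have ht0 : 0 ≤ t := (le_max_right _ _).trans ht
  refine ⟨hq0 t ht0, hT₁ t ht1, ?_⟩
  by_contra! hp
  have hge : ∀ b, t ≤ b → (φ x t).2.1 ≤ (φ x b).2.1 := fun b hb => by
    have hob : P.Orb ε x.1 (fun t => (φ x t).2.1) (fun t => (φ x t).2.2.1)
      (fun t => (φ x t).2.2.2) (Icc t b) := ho.mono fun s hs => ht0.trans hs.1
    have hpp := barrier_nonneg hob.dp hp (fun s hs _ h0 => by
      simp only [h0, mul_zero]
      have hF := F_le_of_le_qL (hq0 s (ht0.trans hs.1)).le (hT₁ s (ht1.trans hs.1)).le (hob.hu s hs).2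
      have := mul_pos (hq0 s (ht0.trans hs.1)) (show 0 < -P.F (φ x s).2.1 (φ x s).2.2.2 by linarith)
      linarith)
    have := le_of_deriv_ge (C := 0) hb hob.dq hpp
    linarith
  have := ge_of_tendsto l1 (eventually_atTop.mpr ⟨t, hge⟩)
  linarith [hq0 t ht0]

/-- Orbits from `S` which neither escape nor come back converge to the turbulent state. -/
theorem tends_turbulent (P : Par) : ∀ᶠ ε in 𝓝[>] (0:ℝ), ∀ φ, IsFlow (P.field ε) φ →
    ∀ x ∈ P.S, P.ub ≤ x.2.2.2 → x ∉ P.A φ → ¬ Enters φ P.Dn x →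
    P.Orb ε x.1 (fun t => (φ x t).2.1) (fun t => (φ x t).2.2.1) (fun t => (φ x t).2.2.2) (Ici 0) ∧
    (∀ t, 0 ≤ t → φ x t ∉ P.Dnc) ∧
    (∀ t, 0 ≤ t → P.um ≤ (φ x t).2.2.2) ∧ Tendsto (φ x) atTop (𝓝 (P.e2 x.1)) := by
  obtain ⟨T, hT, htr⟩ := P.transit
  filter_upwards [htr, P.regular_S, P.um_le,
    Ioo_mem_nhdsGT (show (0:ℝ) < P.y/320 by linarith [P.hy0])] with
    ε htr hR hum' hε φ Fl x hx hxu hA hE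
  have hav : ∀ t, 0 ≤ t → φ x t ∉ P.Dnc := fun t ht =>
    Fl.avoid_of_not_enters P.isClosed_Dnc P.Dn_subset (S_not_Dnc hx) (hR φ Fl x hx) hE ht
  have hθ : x.1 ∈ Icc (0:ℝ) 1 := hx.1
  have hxq : x.2.1 = P.qL := hx.2.1
  have horb : ∀ b : ℝ, 0 < b → _ := fun b hb => S_orb Fl hε.1 hx hA hb fun t ht => hav t ht.1
  have ho : P.Orb ε x.1 (fun t => (φ x t).2.1) (fun t => (φ x t).2.2.1)
      (fun t => (φ x t).2.2.2) (Ici 0) := by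
    have : ∀ t : ℝ, t ∈ Ici (0:ℝ) → t ∈ Icc 0 (t+1) := fun t ht => ⟨ht, by linarith⟩
    have hp : ∀ t : ℝ, t ∈ Ici (0:ℝ) → 0 < t + 1 := fun t ht => by linarith [mem_Ici.mp ht]
    exact ⟨fun t ht => (horb _ (hp t ht)).1.dq t (this t ht), fun t ht => (horb _ (hp t ht)).1.dp t (this t ht),
      fun t ht => (horb _ (hp t ht)).1.du t (this t ht), fun t ht => (horb _ (hp t ht)).1.hq t (this t ht),
      fun t ht => (horb _ (hp t ht)).1.hp t (this t ht), fun t ht => (horb _ (hp t ht)).1.hu t (this t ht)⟩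
  have hqL : ∀ t, 0 ≤ t → P.qL ≤ (φ x t).2.1 := fun t ht =>
    (horb (t+1) (by linarith)).2.1 t ⟨ht, by linarith⟩
  have hum : ∀ t, 0 ≤ t → P.um ≤ (φ x t).2.2.2 := fun t ht =>
    hum' φ Fl x hx hA hxu (t+1) (by linarith) (fun s hs => hav s hs.1) t ⟨ht, by linarith⟩
  obtain ⟨t₀, ht₀, hqt₀⟩ : ∃ t₀, 0 ≤ t₀ ∧ P.qH < (φ x t₀).2.1 := by
    by_contra! hcon
    have := (htr x.1 hθ _ _ _ 0 (T+1) (by linarith) (ho.mono fun s hs => hs.1)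
      (fun t ht => ⟨hqL t ht.1, hcon t ht.1⟩) (Or.inl (by simp only [Fl.zero, hxq]))).1
    linarith
  have hqH : ∀ t, t₀ ≤ t → P.qH ≤ (φ x t).2.1 := fun t ht => by
    have := nonneg_of_deriv_ge (K := 0) (a := t₀) (b := t) (h := fun t => (φ x t).2.1 - P.qH)
      (fun s hs => (ho.dq s (ht₀.trans hs.1)).sub_const P.qH) (by linarith) (fun s hs hlt => by
        by_contra! hcon
        exact hav s (ht₀.trans hs.1) ⟨by linarith, by linarith⟩) t ⟨ht, le_rfl⟩
    linarith
  obtain ⟨l1, l2, l3⟩ := (ho.mono (Ici_subset_Ici.mpr ht₀)).tendsto_turbulent hθ hε.1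
    (by linarith [hε.2]) hqH (fun t ht => hum t (ht₀.trans ht))
  refine ⟨ho, hav, hum, ?_⟩
  have := (tendsto_const_nhds (x := x.1) (f := (atTop : Filter ℝ))).prodMk_nhds
    (l1.prodMk_nhds (l2.prodMk_nhds l3))
  refine this.congr fun t => ?_
  rw [← flow_fst Fl x t]

end Par

namespace Par
open Set
variable {P : Par}

/-- Orbits starting near one that converges to the laminar state leave along its unstable manifold. -/
theorem window_laminar (P : Par) : ∀ᶠ ε in 𝓝[>] (0:ℝ), ∀ φ, IsFlow (P.field ε) φ →
    ∀ x ∈ P.S', P.um ≤ x.2.2.2 → x ∉ P.C φ → ¬ Enters φ P.Up x →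
    ∃ T, 0 ≤ T ∧ ∀ᶠ y in 𝓝[P.S'] x, Enters φ P.Up y → T < entry φ P.Up y ∧
      hit φ P.Up y ∈ P.S ∧ 2 - 2*P.qL ≤ (hit φ P.Up y).2.2.2 ∧
      (∀ Θ β ω, P.BlueAt Θ β ω → y.1 ∈ Θ → (hit φ P.Up y).2.2.1 ≤ P.κ*P.qL*(β - P.qL)) ∧
      ∀ t ∈ Icc T (entry φ P.Up y), φ y t ∈ P.R1 := by
  filter_upwards [P.tends_laminar, P.regular_S', self_mem_nhdsWithin] with
    ε htl hR hε φ Fl x hx hxu hC hE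
  obtain ⟨ho, hav, hum, hlim, T₀, hT₀, hT⟩ := htl φ Fl x hx hxu hC hE
  have hqL := P.hqL
  have hu2 : ∀ᶠ t in atTop, 2 - 2*P.qL < (φ x t).2.2.2 :=
    ((continuous_snd.comp (continuous_snd.comp continuous_snd)).tendsto (e1 x.1) |>.comp hlim).eventually_const_lt
      (show 2 - 2*P.qL < 2 by linarith)
  obtain ⟨T, hTu, hT0⟩ := (hu2.and (eventually_ge_atTop T₀)).exists
  obtain ⟨h1, h2, h3⟩ := hT T hT0
  have hcont := (Fl.continuous_left T).tendsto x
  have c1 : Continuous fun z : ℝ × ℝ × ℝ × ℝ => z.2.1 := by fun_prop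
  have c2 : Continuous fun z : ℝ × ℝ × ℝ × ℝ => z.2.2.1 := by fun_prop
  have c3 : Continuous fun z : ℝ × ℝ × ℝ × ℝ => z.2.2.2 := by fun_prop
  refine ⟨T, hT₀.trans hT0, ?_⟩
  filter_upwards [self_mem_nhdsWithin,
    nhdsWithin_le_nhds (Fl.eventually_entry_ge P.isClosed_Upc P.Up_subset hav (T+1)),
    nhdsWithin_le_nhds (((c1.tendsto _).comp hcont).eventually_lt_const h2),
    nhdsWithin_le_nhds (((c2.tendsto _).comp hcont).eventually_lt_const h3),
    nhdsWithin_le_nhds (((c3.tendsto _).comp hcont).eventually_const_lt hTu)] with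
    y hy hge hq1 hp1 hu1 hEy
  simp only [Function.comp_apply] at hq1 hp1 hu1
  replace hge := hge hEy
  obtain ⟨hE0, -, havy, hCy, hhit⟩ := hit_Up Fl hε (hR φ Fl) hy hEy
  set E := entry φ P.Up y with hEd
  have hTE : T ∈ Icc 0 E := ⟨by linarith, by linarith⟩
  have hS : hit φ P.Up y ∈ P.S := by
    rcases hhit with h | ⟨-, h⟩
    · exact h
    · linarith [h T hTE]
  obtain ⟨hoy, hqy0, hqyH, hpy1, hpy2⟩ := S'_orb Fl hε hy hCy hE0 havy
  have hθ : y.1 ∈ Icc (0:ℝ) 1 := hy.1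
  have hsub : ∀ {t}, t ∈ Icc T E → t ∈ Icc 0 E := fun ht => ⟨hTE.1.trans ht.1, ht.2⟩
  have hoT := hoy.mono (J := Icc T E) fun t ht => hsub ht
  have hhitq : (φ y E).2.1 = P.qL := hS.2.1
  have hqT : ∀ t ∈ Icc T E, (φ y t).2.1 ≤ P.qL := fun t ht => by
    have := nonneg_of_deriv_ge (K := 0) (h := fun t => P.qL - (φ y t).2.1)
      (fun s hs => (hoT.dq s hs).const_sub P.qL) (by linarith) (fun s hs hlt => by
        rcases hs.2.eq_or_lt with he | hl
        · rw [he, hhitq] at hlt; linarith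
        · by_contra! hcon
          exact havy s ⟨(hsub hs).1, hl⟩ ⟨by linarith, by linarith⟩) t ht
    linarith
  have huT := hoT.u_ge_near_laminar hθ hε hqT hu1.le
  have hEE : E ∈ Icc T E := ⟨hTE.2, le_rfl⟩
  refine ⟨by linarith, hS, huT E hEE, fun Θ β ω hB hΘ => ?_, fun t ht => ?_⟩
  · have hb := hB.hb; have := P.qL_lt_qH; have := hB.hqL
    have hκ := P.hκ
    have := hoT.le_blue hB hΘ hθ (fun t ht => ⟨hqy0 t (hsub ht), (hqT t ht).trans (by linarith)⟩)
      (fun t ht => by linarith [huT t ht]) (by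
        have h4 : 0 ≤ P.κ * (φ y T).2.1 * (β - (φ y T).2.1) :=
          mul_nonneg (mul_nonneg hκ.le (hqy0 T hTE).le) (by linarith)
        linarith) E hEE
    simp only [hhitq] at this
    exact this
  · have := hqy0 t (hsub ht); have := hpy2 t (hsub ht)
    refine ⟨by rw [flow_fst Fl]; exact hθ, ⟨by linarith, hqT t ht⟩, ⟨?_, hpy1 t (hsub ht)⟩,
      huT t ht, (hoT.hu t ht).2⟩
    linarith

/-- Orbits starting near one that converges to the turbulent state leave along its unstable
manifold. -/
theorem window_turbulent (P : Par) : ∀ᶠ ε in 𝓝[>] (0:ℝ), ∀ φ, IsFlow (P.field ε) φ →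
    (∀ x ∈ P.S, x.2.2.2 ≤ 8/5 → x ∈ P.A φ) →
    ∀ x ∈ P.S, x ∉ P.A φ → ¬ Enters φ P.Dn x →
    ∃ T, 0 ≤ T ∧ ∀ᶠ y in 𝓝[P.S] x, Enters φ P.Dn y → T < entry φ P.Dn y ∧
      hit φ P.Dn y ∈ P.S' ∧ (hit φ P.Dn y).2.2.2 ≤ P.ub + (1 + P.y - P.qH) ∧
      (∀ Θ β ω, P.RedAt Θ β ω → y.1 ∈ Θ →
        -(P.κ*(P.qH - P.qL)*(β - P.qH)) ≤ (hit φ P.Dn y).2.2.1) ∧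
      ∀ t ∈ Icc T (entry φ P.Dn y), φ y t ∈ P.R2 := by
  have hρ := P.hρ
  have hy0 := P.hy0
  have hy1 := P.hy1
  have hgap := P.qH_gap
  have hqH := P.hqH
  have hqH' := P.hqH'
  have hub' := P.hub'
  have hR := P.hR
  have hFneg : P.F (1+P.y+P.ρ) (P.ub + (1 + P.y - P.qH)) < 0 := by
    have e : P.F (1+P.y+P.ρ) (P.ub + (1 + P.y - P.qH)) =
        (1 + P.y - P.qH) - 2*P.κ^2*(P.ρ*(2*P.y + P.ρ)) := by
      have := P.hy
      unfold F; linear_combination -this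
    have h1 := P.hρω
    have h2 : 0 < P.ρ*(2*P.y + P.ρ) := by positivity
    have h3 : 23/30*(P.ρ*(2*P.y + P.ρ)) ≤ 2*P.κ^2*(P.ρ*(2*P.y + P.ρ)) :=
      mul_le_mul_of_nonneg_right hR.le h2.le
    have h4 : 0 < P.ρ*P.y := by positivity
    have h5 : 0 < P.ρ*P.ρ := by positivity
    rw [e]
    linarith
  filter_upwards [P.tends_turbulent, P.regular_S, P.um_le,
    P.mem_A_of_trap (b := 1+P.y+P.ρ) (v := P.ub + (1 + P.y - P.qH))
      (ν := -P.F (1+P.y+P.ρ) (P.ub + (1 + P.y - P.qH))/2) (by linarith) (by linarith) (by linarith),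
    self_mem_nhdsWithin] with
    ε htl hR hum' htrap hε φ Fl hFA x hx hA hE
  have hub : ∀ z ∈ P.S, z ∉ P.A φ → P.ub ≤ z.2.2.2 := fun z hz hzA => by
    by_contra! hlt
    exact hzA (hFA z hz (by linarith))
  obtain ⟨ho, hav, hum, hlim⟩ := htl φ Fl x hx (hub x hx hA) hA hE
  have hqL := P.hqL
  have hqL' := P.hqL'
  have c1 : Continuous fun z : ℝ × ℝ × ℝ × ℝ => z.2.1 := by fun_prop
  have c2 : Continuous fun z : ℝ × ℝ × ℝ × ℝ => z.2.2.1 := by fun_prop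
  have c3 : Continuous fun z : ℝ × ℝ × ℝ × ℝ => z.2.2.2 := by fun_prop
  obtain ⟨T, hq1, hq2, hp1, hp2, hu1, hT0⟩ := (((c1.tendsto _).comp hlim).eventually_const_lt
      (show P.qH < 1+P.y by linarith) |>.and
    ((((c1.tendsto _).comp hlim).eventually_lt_const (show 1+P.y < 1+P.y+P.ρ/2 by linarith)).and
    ((((c2.tendsto _).comp hlim).eventually_const_lt (show -(P.ρ/4) < 0 by linarith)).and
    ((((c2.tendsto _).comp hlim).eventually_lt_const (show 0 < P.ρ by linarith)).and
    ((((c3.tendsto _).comp hlim).eventually_lt_const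
      (show P.ub < P.ub + (1+P.y-P.qH) by linarith)).and (eventually_ge_atTop 0)))))).exists
  have hcont := (Fl.continuous_left T).tendsto x
  refine ⟨T, hT0, ?_⟩
  filter_upwards [self_mem_nhdsWithin,
    nhdsWithin_le_nhds (Fl.eventually_entry_ge P.isClosed_Dnc P.Dn_subset hav (T+1)),
    nhdsWithin_le_nhds (((c1.tendsto _).comp hcont).eventually_const_lt hq1),
    nhdsWithin_le_nhds (((c1.tendsto _).comp hcont).eventually_lt_const hq2),
    nhdsWithin_le_nhds (((c2.tendsto _).comp hcont).eventually_const_lt hp1),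
    nhdsWithin_le_nhds (((c2.tendsto _).comp hcont).eventually_lt_const hp2),
    nhdsWithin_le_nhds (((c3.tendsto _).comp hcont).eventually_lt_const hu1)] with
    y hy hge hq1 hq2 hp1 hp2 hu1 hEy
  simp only [Function.comp_apply] at hq1 hq2 hp1 hp2 hu1
  replace hge := hge hEy
  obtain ⟨hE0, -, havy, hAy, hhit⟩ := hit_Dn Fl hε (hR φ Fl) hy hEy
  set E := entry φ P.Dn y with hEd
  have hTE : T ∈ Icc 0 E := ⟨by linarith, by linarith⟩
  have hS : hit φ P.Dn y ∈ P.S' := by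
    rcases hhit with h | ⟨-, h⟩
    · exact h
    · linarith [h T hTE]
  have humy := hum' φ Fl y hy hAy (hub y hy hAy) E hE0 havy
  obtain ⟨hoy, -, -, -⟩ := S_orb Fl hε hy hAy hE0 havy
  have hθ : y.1 ∈ Icc (0:ℝ) 1 := hy.1
  have hsub : ∀ {t}, t ∈ Icc T E → t ∈ Icc 0 E := fun ht => ⟨hTE.1.trans ht.1, ht.2⟩
  have hoT := hoy.mono (J := Icc T E) fun t ht => hsub ht
  have hhitq : (φ y E).2.1 = P.qH := hS.2.1
  have hhitp : (φ y E).2.2.1 < 0 := hS.2.2.1.2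
  have hqT : ∀ t ∈ Icc T E, P.qH ≤ (φ y t).2.1 := fun t ht => by
    have := nonneg_of_deriv_ge (K := 0) (h := fun t => (φ y t).2.1 - P.qH)
      (fun s hs => (hoT.dq s hs).sub_const P.qH) (by linarith) (fun s hs hlt => by
        rcases hs.2.eq_or_lt with he | hl
        · rw [he, hhitq] at hlt; linarith
        · by_contra! hcon
          exact havy s ⟨(hsub hs).1, hl⟩ ⟨by linarith, by linarith⟩) t ht
    linarith
  have huT := hoT.u_le_near_turbulent hθ hε hqT hu1.le
  have hEE : E ∈ Icc T E := ⟨hTE.2, le_rfl⟩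
  have hqT' : ∀ t ∈ Icc T E, (φ y t).2.1 < 1 + P.y + P.ρ := fun t ht => by
    by_contra! hcon
    obtain ⟨s, hs, hs0, hs1⟩ := exists_first_zero (f := fun s => 1 + P.y + P.ρ - (φ y s).2.1) ht.1
      (fun s hs => ((hoT.dq s ⟨hs.1, hs.2.trans ht.2⟩).const_sub _).continuousAt.continuousWithinAt)
      (by linarith) (by linarith)
    have hsE : s ∈ Icc T E := ⟨hs.1.le, hs.2.trans ht.2⟩
    have hsp := deriv_nonpos_of_first ((hoT.dq s hsE).const_sub (1 + P.y + P.ρ)) hs.1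
      (fun r hr => (hs1 r hr).le) hs0.le
    exact hAy (htrap φ Fl y hy s (hsub hsE).1 (fun r hr => havy r ⟨hr.1, hr.2.trans_le hsE.2⟩)
      (by linarith) (by linarith) (huT s hsE))
  have hpT : ∀ t ∈ Icc T E, (φ y t).2.2.1 ≤ P.ρ := fun t ht => by
    by_contra! hcon
    have := barrier_nonneg (h := fun t => (φ y t).2.2.1 - P.ρ) (a := t) (b := E)
      (fun s hs => (hoT.dp s ⟨ht.1.trans hs.1, hs.2⟩).sub_const _) (by linarith)
      (fun s hs _ h0 => by
        have hsT : s ∈ Icc T E := ⟨ht.1.trans hs.1, hs.2⟩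
        have hp : (φ y s).2.2.1 = P.ρ := by linarith
        have hF := F_le_near_turbulent (P := P) (hqT s hsT) (huT s hsT)
        have hc := P.le_c hθ (hoT.hu s hsT).1
        have h1 := mul_le_mul_of_nonneg_right hc hρ.le
        have h2 := mul_le_mul_of_nonneg_left hF (hoT.hq s hsT).1
        have h3 := mul_le_mul_of_nonneg_right (hoT.hq s hsT).2
          (show 0 ≤ 2*(1 + P.y - P.qH) by linarith)
        simp only [hp]
        linarith) E ⟨ht.2, le_rfl⟩
    linarith
  have hpT' := hoT.p_ge_near_turbulent hθ (fun t ht => ⟨hqT t ht, (hqT' t ht).le⟩) huT (by linarith)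
  refine ⟨by linarith, hS, huT E hEE, fun Θ β ω hB hΘ => ?_, fun t ht => ?_⟩
  · have hb := hB.hb; have := P.qL_lt_qH; have := hB.hω
    have hκ := P.lt_κ
    have := hoT.ge_red hB hΘ hθ hTE.2
      (fun t ht => ⟨by linarith [hqT t ht], (hqT' t ht).le.trans hb⟩)
      (fun t ht => by linarith [huT t ht]) (by
        have h4 : 3/5*(1/1) ≤ P.κ * ((φ y T).2.1 - P.qL + 1/100) :=
          mul_le_mul hκ.le (by linarith) (by norm_num) (by linarith)
        have h4' : 1/2 ≤ P.κ * ((φ y T).2.1 - P.qL) := by linarith [P.κ_lt]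
        have h5 : 1/2*(P.ρ/2) ≤ P.κ * ((φ y T).2.1 - P.qL) * (β - (φ y T).2.1) :=
          mul_le_mul h4' (by linarith) (by linarith) (by linarith)
        linarith)
    simp only [hhitq] at this
    exact this
  · refine ⟨by rw [flow_fst Fl]; exact hθ, ⟨?_, (hqT' t ht).le⟩, ⟨hpT' t ht, ?_⟩,
      humy t (hsub ht), ?_⟩
    · linarith [hqT t ht]
    · linarith [hpT t ht]
    · linarith [huT t ht]

end Par

namespace Par
open Set
variable {P : Par} {ε : ℝ} {φ : ℝ × ℝ × ℝ × ℝ → ℝ → ℝ × ℝ × ℝ × ℝ}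

/-- The part of `S'` where the slow drift is not cut off. -/
def St (P : Par) : Set (ℝ × ℝ × ℝ × ℝ) := P.S' ∩ {z | P.um ≤ z.2.2.2}

theorem St_le (P : Par) (x : ℝ × ℝ × ℝ × ℝ) : 𝓝[P.St] x ≤ 𝓝[P.S'] x :=
  nhdsWithin_mono _ inter_subset_left

/-- Exit points of orbits passing near a rest point converge to its unstable manifold. -/
theorem tendsto_hit_unstable (Fl : IsFlow (P.field ε) φ) (hε : 0 < ε)
    {Sx O C R : Set (ℝ × ℝ × ℝ × ℝ)} {cX k : ℝ → ℝ} {s T : ℝ}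
    (D : P.Dissip R cX k s) (hR : IsCompact R) (hC : IsClosed C) (hOC : O ⊆ C)
    {x w₀ : ℝ × ℝ × ℝ × ℝ} (hav : ∀ t, 0 ≤ t → φ x t ∉ C)
    (hw : ∀ᶠ y in 𝓝[Sx] x, Enters φ O y → (hit φ O y).2.1 = w₀.2.1 ∧
      ∀ t ∈ Icc T (entry φ O y), φ y t ∈ R) (h1 : w₀.1 = x.1) (h : BackIn φ R w₀) :
    Tendsto (hit φ O) (𝓝[Sx ∩ {y | Enters φ O y}] x) (𝓝 w₀) := by
  have hw' : ∀ᶠ y in 𝓝[Sx ∩ {y | Enters φ O y}] x, Enters φ O y ∧ (hit φ O y).2.1 = w₀.2.1 ∧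
      ∀ t ∈ Icc T (entry φ O y), φ y t ∈ R := by
    filter_upwards [hw.filter_mono (nhdsWithin_mono _ inter_subset_left), self_mem_nhdsWithin] with y h1 h2
    exact ⟨h2.2, h1 h2.2⟩
  refine tendsto_unstable Fl D hR hε (fun T' => ?_) ?_ (hw'.mono fun y hy => hy.2.1) h
  · filter_upwards [hw', (Fl.eventually_entry_ge hC hOC hav (T+T')).filter_mono nhdsWithin_le_nhds]
      with y hy hy' t ht
    have := hy' hy.1
    unfold hit
    rw [Fl.add]
    exact hy.2.2 _ ⟨by linarith [ht.1], by linarith [ht.2]⟩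
  · have : (fun y => (hit φ O y).1) = fun y => y.1 := by
      funext y; exact flow_fst Fl y _
    rw [this, h1]
    exact (continuous_fst.tendsto x).mono_left nhdsWithin_le_nhds

/-- Low points of `S` escape. -/
def LowEscapes (P : Par) : Prop := ∀ᶠ ε in 𝓝[>] (0:ℝ), ∀ φ, IsFlow (P.field ε) φ →
  ∀ x ∈ P.S, x.2.2.2 ≤ 8/5 → x ∈ P.A φ

theorem um_le_hit (P : Par) (hL : P.LowEscapes) : ∀ᶠ ε in 𝓝[>] (0:ℝ), ∀ φ, IsFlow (P.field ε) φ →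
    ∀ x ∈ P.S, Enters φ P.Dn x → P.um ≤ (hit φ P.Dn x).2.2.2 := by
  filter_upwards [hL, P.um_le, P.regular_S, self_mem_nhdsWithin] with ε hL hu hR hε φ Fl x hx h
  obtain ⟨h1, -, h3, h4, -⟩ := hit_Dn Fl hε (hR φ Fl) hx h
  refine hu φ Fl x hx h4 ?_ _ h1 h3 _ ⟨h1.le, le_rfl⟩
  by_contra h5
  have := P.hub'
  exact h4 (hL φ Fl x hx (by linarith [not_le.mp h5]))

theorem halfMap_St (Fl : IsFlow (P.field ε) φ) (hε : 0 < ε)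
    (hR : ∀ x ∈ P.S, RegularEntry φ P.Dn P.Dnc x)
    (hu : ∀ x ∈ P.S, Enters φ P.Dn x → P.um ≤ (hit φ P.Dn x).2.2.2) :
    HalfMap (P.field ε) φ P.S P.St P.Dn P.Dnc (P.A φ) :=
  { halfMap_S Fl hε hR with
    good_open := fun x hx he hh => by
      filter_upwards [(halfMap_S Fl hε hR).good_open x hx he hh.1,
        (halfMap_S Fl hε hR).eventually_enters he, self_mem_nhdsWithin] with y h1 h2 h3
      exact ⟨h1, hu y h3 h2⟩ }

theorem halfMap_St' (Fl : IsFlow (P.field ε) φ) (hε : 0 < ε)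
    (hR : ∀ x ∈ P.S', RegularEntry φ P.Up P.Upc x) :
    HalfMap (P.field ε) φ P.St P.S P.Up P.Upc (P.C φ) :=
  have H := halfMap_S' Fl hε hR
  { flow := H.flow, isOpen := H.isOpen, isClosed := H.isClosed, subset := H.subset
    disj := fun x hx => H.disj x hx.1
    regular := fun x hx => H.regular x hx.1
    esc_not_enters := fun x hx => H.esc_not_enters x hx.1
    esc_open := fun x hx h => (H.esc_open x hx.1 h).filter_mono (P.St_le x)
    good_open := fun x hx h h' => (H.good_open x hx.1 h h').filter_mono (P.St_le x) }

/-- Shooting from the laminar state to the turbulent state. -/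
theorem front_pair (P : Par) (hL : P.LowEscapes) {b₁ ω₁ b₂ ω₂ : ℝ} (hB : P.BlueAt {0} b₁ ω₁)
    (hr : P.RedAt (Icc 0 1) b₂ ω₂)
    (hone : ∀ᶠ ε in 𝓝[>] (0:ℝ), ∀ φ, IsFlow (P.field ε) φ → ∀ x ∈ P.S, x.1 ∈ ({1} : Set ℝ) →
      x.2.2.2 ∈ Ici (2 - 2*P.qL) → x ∈ P.A φ) :
    ∀ᶠ ε in 𝓝[>] (0:ℝ), ∀ φ, IsFlow (P.field ε) φ → ∃ σ : ℝ → ℝ × ℝ × ℝ × ℝ,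
      (∀ θ ∈ Icc (0:ℝ) 1, (σ θ).1 = θ ∧ BackIn φ P.R1 (σ θ)) ∧
      HalfPair (P.field ε) φ P.S P.St P.Dn P.Dnc (P.A φ) P.Up P.Upc (P.C φ) (fun x => x.1) σ := by
  have hqH' := P.hqH'
  have hρ := P.hρ
  filter_upwards [hL, P.um_le_hit hL, P.regular_S, P.regular_S', P.edge_fst, P.edge_snd,
    P.window_laminar, P.window_turbulent, hone,
    P.turn_above (by linarith [hr.hb]) hr.hb' (by linarith [hr.hω]) hr.hc hr.hF,
    P.turn_below hB.hb hB.hb' hB.hω hB.hω' hB.hc hB.hF, self_mem_nhdsWithin]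
    with ε hL hum hR hR' hef hes hwl hwt hone hta htb hε φ Fl
  obtain ⟨σ, hσc, hσ⟩ := exists_sigma1 Fl hε
  have H := halfMap_St Fl hε (hR φ Fl) (hum φ Fl)
  have H' := halfMap_St' Fl hε (hR' φ Fl)
  have h0 : (0:ℝ) ∈ Icc (0:ℝ) 1 := ⟨le_rfl, zero_le_one⟩
  have h1 : (1:ℝ) ∈ Icc (0:ℝ) 1 := ⟨zero_le_one, le_rfl⟩
  refine ⟨σ, fun θ hθ => ⟨(hσ θ hθ).1, (hσ θ hθ).2.2.2.1⟩, ?_⟩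
  refine ⟨H, H', fun x t => flow_fst Fl x t, fun t ht => (hσ t ht).2.1, hσc,
    fun t ht => (hσ t ht).1, ?_, ?_, ?_, ?_, ?_, ?_, ?_⟩
  · intro x hx he hh
    filter_upwards [hef φ Fl (hL φ Fl) x hx he fun h => hh ⟨h, hum φ Fl x hx he⟩] with y hy hy'
    exact hy hy'.1
  · exact fun x hx he hh => (hes φ Fl (hL φ Fl) x hx.1 he hh).filter_mono (P.St_le x)
  · intro x hx hxA he
    obtain ⟨T, -, hT⟩ := hwt φ Fl (hL φ Fl) x hx hxA he
    filter_upwards [hT, self_mem_nhdsWithin] with y hy hyS hye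
    obtain ⟨-, i2, i3, i4, -⟩ := hy hye
    have hθ := hyS.1
    have hfst : (hit φ P.Dn y).1 ∈ Icc (0:ℝ) 1 := i2.1
    obtain ⟨-, j2, j3⟩ := hta φ Fl _ i2 hfst (by linarith [hr.hω]) (i4 _ _ _ hr hθ)
    exact ⟨⟨i2, hum φ Fl y hyS hye⟩, j2, fun h => absurd h j3⟩
  · intro x hx hxC he
    obtain ⟨T, -, hT⟩ := hwl φ Fl x hx.1 hx.2 hxC he
    filter_upwards [hT.filter_mono (P.St_le x)] with y hy hye
    exact (hy hye).2.1
  · intro x hx hxC he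
    obtain ⟨T, -, hT⟩ := hwl φ Fl x hx.1 hx.2 hxC he
    obtain ⟨i1, i2, -, i4, -⟩ := hσ x.1 hx.1.1
    refine tendsto_hit_unstable Fl hε P.R1_dissip P.isCompact_R1 P.isClosed_Upc P.Up_subset
      (fun t ht => Fl.avoid_of_not_enters P.isClosed_Upc P.Up_subset (S'_not_Upc hx.1)
        (hR' φ Fl x hx.1) he ht) (T := T) ?_ i1 i4
    filter_upwards [hT.filter_mono (P.St_le x)] with y hy hye
    exact ⟨(hy hye).2.1.2.1.trans i2.2.1.symm, (hy hye).2.2.2.2⟩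
  · obtain ⟨i1, i2, i3, -, i5⟩ := hσ 0 h0
    obtain ⟨j1, j2, j3⟩ := htb φ Fl _ i2 i1 (by linarith [hB.hqL]) (i5 _ _ _ hB rfl)
    exact ⟨j1, j2, fun h => j3 h.1⟩
  · obtain ⟨i1, i2, i3, -⟩ := hσ 1 h1
    exact hone φ Fl _ i2 i1 i3

/-- Shooting from the turbulent state to the laminar state. -/
theorem back_pair (P : Par) (hL : P.LowEscapes) {b₁ ω₁ b₂ ω₂ : ℝ} (hB : P.BlueAt (Icc 0 1) b₁ ω₁)
    (hr : P.RedAt {0} b₂ ω₂) (hulo : 128/100 ≤ P.ulo) (hLH : P.qL < P.qH - 1)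
    (hone : ∀ θ ∈ ({1} : Set ℝ), 96/100 ≤ P.c θ P.ulo) :
    ∀ᶠ ε in 𝓝[>] (0:ℝ), ∀ φ, IsFlow (P.field ε) φ → ∃ σ : ℝ → ℝ × ℝ × ℝ × ℝ,
      (∀ θ ∈ Icc (0:ℝ) 1, (σ θ).1 = θ ∧ BackIn φ P.R2 (σ θ)) ∧
      HalfPair (P.field ε) φ P.St P.S P.Up P.Upc (P.C φ) P.Dn P.Dnc (P.A φ) (fun x => x.1) σ := by
  have hqH' := P.hqH'
  have hρ := P.hρ
  filter_upwards [hL, P.um_le_hit hL, P.regular_S, P.regular_S', P.edge_fst, P.edge_snd,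
    P.window_laminar, P.window_turbulent, P.mem_C_of_speed hulo hLH hone,
    P.turn_above (by linarith [hr.hb]) hr.hb' (by linarith [hr.hω]) hr.hc hr.hF,
    P.turn_below hB.hb hB.hb' hB.hω hB.hω' hB.hc hB.hF, self_mem_nhdsWithin]
    with ε hL hum hR hR' hef hes hwl hwt hone hta htb hε φ Fl
  obtain ⟨σ, hσc, hσ⟩ := exists_sigma2 Fl hε
  have H := halfMap_St Fl hε (hR φ Fl) (hum φ Fl)
  have H' := halfMap_St' Fl hε (hR' φ Fl)
  have h0 : (0:ℝ) ∈ Icc (0:ℝ) 1 := ⟨le_rfl, zero_le_one⟩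
  have h1 : (1:ℝ) ∈ Icc (0:ℝ) 1 := ⟨zero_le_one, le_rfl⟩
  refine ⟨σ, fun θ hθ => ⟨(hσ θ hθ).1, (hσ θ hθ).2.2.2.1⟩, ?_⟩
  refine ⟨H', H, fun x t => flow_fst Fl x t,
    fun t ht => ⟨(hσ t ht).2.1, P.hum'.le.trans (hσ t ht).2.2.1.1⟩, hσc,
    fun t ht => (hσ t ht).1, ?_, ?_, ?_, ?_, ?_, ?_, ?_⟩
  · exact fun x hx he hh => (hes φ Fl (hL φ Fl) x hx.1 he hh).filter_mono (P.St_le x)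
  · intro x hx he hh
    filter_upwards [hef φ Fl (hL φ Fl) x hx he fun h => hh ⟨h, hum φ Fl x hx he⟩] with y hy hy'
    exact hy hy'.1
  · intro x hx hxC he
    obtain ⟨T, -, hT⟩ := hwl φ Fl x hx.1 hx.2 hxC he
    filter_upwards [hT.filter_mono (P.St_le x), self_mem_nhdsWithin] with y hy hyS hye
    obtain ⟨-, i2, i3, i4, -⟩ := hy hye
    have hfst : (hit φ P.Up y).1 ∈ Icc (0:ℝ) 1 := i2.1
    obtain ⟨-, j2, j3⟩ := htb φ Fl _ i2 hfst (by linarith [hB.hqL]) (i4 _ _ _ hB hyS.1.1)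
    exact ⟨i2, j2, fun h => j3 h.1⟩
  · intro x hx hxA he
    obtain ⟨T, -, hT⟩ := hwt φ Fl (hL φ Fl) x hx hxA he
    filter_upwards [hT, self_mem_nhdsWithin] with y hy hyS hye
    exact ⟨(hy hye).2.1, hum φ Fl y hyS hye⟩
  · intro x hx hxA he
    obtain ⟨T, -, hT⟩ := hwt φ Fl (hL φ Fl) x hx hxA he
    obtain ⟨i1, i2, -, i4, -⟩ := hσ x.1 hx.1
    refine tendsto_hit_unstable Fl hε P.R2_dissip P.isCompact_R2 P.isClosed_Dnc P.Dn_subset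
      (fun t ht => Fl.avoid_of_not_enters P.isClosed_Dnc P.Dn_subset (S_not_Dnc hx)
        (hR φ Fl x hx) he ht) (T := T) ?_ i1 i4
    filter_upwards [hT] with y hy hye
    exact ⟨(hy hye).2.1.2.1.trans i2.2.1.symm, (hy hye).2.2.2.2⟩
  · obtain ⟨i1, i2, i3, -, i5⟩ := hσ 0 h0
    obtain ⟨j1, j2, j3⟩ := hta φ Fl _ i2 i1 (by linarith [hr.hω, i3.2]) (i5 _ _ _ hr rfl)
    exact ⟨j1, j2, fun h => absurd h j3⟩
  · obtain ⟨i1, i2, -⟩ := hσ 1 h1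
    exact hone φ Fl _ i2 i1

end Par

namespace Par
open Set
variable {P : Par} {ε θ : ℝ} {φ : ℝ × ℝ × ℝ × ℝ → ℝ → ℝ × ℝ × ℝ × ℝ}

/-- The region in which the truncated field agrees with the original one. -/
def Bx (P : Par) : Set (ℝ × ℝ × ℝ × ℝ) :=
  {z | z.2.1 ∈ Icc (0:ℝ) 2 ∧ z.2.2.1 ∈ Icc (-16:ℝ) 7 ∧ z.2.2.2 ∈ Icc P.um 2}

theorem R1_sub (P : Par) : P.R1 ⊆ P.Bx := fun z hz => by
  have := P.hqL; have := P.hqL'; have := P.hum'; have := P.hub'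
  obtain ⟨-, h1, h2, h3⟩ := hz
  exact ⟨⟨h1.1, by linarith [h1.2]⟩, ⟨by linarith [h2.1, h1.2], by linarith [h2.2, h1.2]⟩,
    ⟨by linarith [h3.1], h3.2⟩⟩

theorem R2_sub (P : Par) : P.R2 ⊆ P.Bx := fun z hz => by
  have := P.rho_le; have := P.hρ; have := P.hy0; have := P.hy1; have := P.hub'
  obtain ⟨-, h1, h2, h3⟩ := hz
  exact ⟨⟨by linarith [h1.1], by linarith [h1.2]⟩, ⟨by linarith [h2.1], by linarith [h2.2]⟩,
    ⟨h3.1, by linarith [h3.2]⟩⟩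

/-- The orbit in the original variables. -/
def wave (a : ℝ) (z : ℝ × ℝ × ℝ × ℝ) : ℝ × ℝ × ℝ := (z.2.1, a*z.2.2.1, z.2.2.2)

theorem isTWSol {r : ℝ} (hθ : θ ∈ Icc (0:ℝ) 1) (hr : r = 2*P.κ^2 - 1/10) (Fl : IsFlow (P.field ε) φ)
    {w : ℝ × ℝ × ℝ × ℝ} (hw : w.1 = θ) (h : ∀ t, φ w t ∈ P.Bx) :
    IsTWSol (1/(P.a θ)^2) (P.cb θ/P.a θ - P.ub) (-P.ζ - (P.cb θ/P.a θ - P.ub)) ε r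
      (fun ξ => (φ w (P.a θ*ξ)).2.1) (fun ξ => P.a θ*(φ w (P.a θ*ξ)).2.2.1)
      (fun ξ => (φ w (P.a θ*ξ)).2.2.2) := by
  subst hw
  have ha := P.a_pos hθ
  have hum := P.hum
  have ho := flow_orb Fl (I := univ) hθ (fun t _ => (h t).1) (fun t _ => (h t).2.1)
    (fun t _ => ⟨by linarith [(h t).2.2.1], (h t).2.2.2⟩)
  have hlin : ∀ ξ : ℝ, HasDerivAt (fun ξ => P.a w.1*ξ) (P.a w.1) ξ := fun ξ => by
    simpa using (hasDerivAt_id ξ).const_mul (P.a w.1)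
  have hden : ∀ ξ, (φ w (P.a w.1*ξ)).2.2.2 - (-P.ζ - (P.cb w.1/P.a w.1 - P.ub)) =
      (P.c w.1 (φ w (P.a w.1*ξ)).2.2.2 + P.a w.1*P.ζ)/P.a w.1 := fun ξ => by
    unfold c; field_simp; ring
  have hpos : ∀ ξ, 0 < P.c w.1 (φ w (P.a w.1*ξ)).2.2.2 + P.a w.1*P.ζ := fun ξ => by
    have := P.le_den hθ (show P.ulo ≤ (φ w (P.a w.1*ξ)).2.2.2 by linarith [(h (P.a w.1*ξ)).2.2.1])
    linarith
  refine ⟨fun ξ h0 => ?_, fun ξ => ?_, fun ξ => ?_, fun ξ => ?_⟩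
  · exact (div_pos (hpos ξ) ha).ne' ((hden ξ).symm.trans (sub_eq_zero.mpr h0))
  · have := (ho.dq (P.a w.1*ξ) trivial).comp ξ (hlin ξ)
    exact this.congr_deriv (mul_comm _ _)
  · have := ((ho.dp (P.a w.1*ξ) trivial).comp ξ (hlin ξ)).const_mul (P.a w.1)
    refine this.congr_deriv ?_
    unfold c F fq
    rw [hr]
    field_simp
    ring
  · have := (ho.du (P.a w.1*ξ) trivial).comp ξ (hlin ξ)
    refine this.congr_deriv ?_
    have h1 := (hpos ξ).ne'
    simp only
    rw [hden ξ, du_eq (h (P.a w.1*ξ)).2.2.1]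
    field_simp

theorem seg_S (P : Par) (hL : P.LowEscapes) : ∀ᶠ ε in 𝓝[>] (0:ℝ), ∀ φ, IsFlow (P.field ε) φ →
    ∀ x ∈ P.S, x ∉ P.A φ → P.ub ≤ x.2.2.2 ∧
      ∀ T, 0 < T → (∀ s ∈ Ico 0 T, φ x s ∉ P.Dnc) → ∀ s ∈ Icc 0 T, φ x s ∈ P.Bx := by
  filter_upwards [hL, P.um_le, self_mem_nhdsWithin] with ε hL hu hε φ Fl x hx hA
  have hxu : P.ub ≤ x.2.2.2 := by
    by_contra h5
    have := P.hub'
    exact hA (hL φ Fl x hx (by linarith [not_le.mp h5]))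
  refine ⟨hxu, fun T hT hD s hs => ?_⟩
  have ho := (S_orb Fl hε hx hA hT hD).1
  exact ⟨ho.hq s hs, ho.hp s hs, hu φ Fl x hx hA hxu T hT hD s hs, (ho.hu s hs).2⟩

theorem seg_St (Fl : IsFlow (P.field ε) φ) (hε : 0 < ε) {x : ℝ × ℝ × ℝ × ℝ} (hx : x ∈ P.St)
    (hC : x ∉ P.C φ) {T : ℝ} (hT : 0 < T) (hD : ∀ s ∈ Ico 0 T, φ x s ∉ P.Upc) :
    ∀ s ∈ Icc 0 T, φ x s ∈ P.Bx := fun s hs => by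
  obtain ⟨ho, -, h2, -⟩ := S'_orb Fl hε hx.1 hC hT hD
  have hqH := P.hqH'
  exact ⟨ho.hq s hs, ho.hp s hs, ho.um_le hx.1.1 hε.le (fun t ht => by linarith [h2 t ht])
    (by simp only [Fl.zero]; exact hx.2) s hs, (ho.hu s hs).2⟩

/-- The points of the two sections which do not escape are close to the rest states. -/
def CloseTo (P : Par) (δ : ℝ) : Prop := ∀ᶠ ε in 𝓝[>] (0:ℝ), ∀ φ, IsFlow (P.field ε) φ →
  (∀ x ∈ P.S, x ∉ P.A φ → dist3 (wave (P.a x.1) x) (0, 0, 2) ≤ δ) ∧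
  ∀ x ∈ P.S', x ∉ P.C φ → dist3 (wave (P.a x.1) x) (1+P.y, 0, P.ub) ≤ δ

theorem tendsto_wave {α : Type*} {l : Filter α} {f : α → ℝ × ℝ × ℝ × ℝ} {z : ℝ × ℝ × ℝ × ℝ} {a : ℝ}
    (h : Tendsto f l (𝓝 z)) : Tendsto (fun x => ((f x).2.1, a*(f x).2.2.1, (f x).2.2.2)) l (𝓝 (wave a z)) := by
  have : Continuous (wave a) := by unfold wave; fun_prop
  exact (this.tendsto z).comp h

theorem front_wave (P : Par) {r δ : ℝ} (hr : r = 2*P.κ^2 - 1/10) (hL : P.LowEscapes) (hδ : P.CloseTo δ)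
    {b₁ ω₁ b₂ ω₂ : ℝ} (hB : P.BlueAt {0} b₁ ω₁) (hRd : P.RedAt (Icc 0 1) b₂ ω₂)
    (hone : ∀ᶠ ε in 𝓝[>] (0:ℝ), ∀ φ, IsFlow (P.field ε) φ → ∀ x ∈ P.S, x.1 ∈ ({1} : Set ℝ) →
      x.2.2.2 ∈ Ici (2 - 2*P.qL) → x ∈ P.A φ) :
    ∀ᶠ ε in 𝓝[>] (0:ℝ), ∀ k : ℕ, ∃ D : ℝ, 0 < D ∧ ∃ μ : ℝ, ∃ Q R U : ℝ → ℝ,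
      IsTWSol D μ (-P.ζ - μ) ε r Q R U ∧
      Tendsto (fun ξ => (Q ξ, R ξ, U ξ)) atBot (𝓝 (0, 0, 2)) ∧
      Tendsto (fun ξ => (Q ξ, R ξ, U ξ)) atTop (𝓝 (1+P.y, 0, P.ub)) ∧
      ∃ zs xs : Fin k → ℝ, (∀ i, zs i < xs i) ∧ (∀ i j, i < j → xs i < zs j) ∧
        (∀ i, dist3 (Q (zs i), R (zs i), U (zs i)) (1+P.y, 0, P.ub) ≤ δ) ∧
        (∀ i, dist3 (Q (xs i), R (xs i), U (xs i)) (0, 0, 2) ≤ δ) := by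
  filter_upwards [P.front_pair hL hB hRd hone, P.seg_S hL, P.tends_turbulent, hδ, self_mem_nhdsWithin]
    with ε hp hs ht hδ hε k
  obtain ⟨φ, Fl⟩ := P.exists_flow ε
  obtain ⟨σ, hσ, H⟩ := hp φ Fl
  have hend : ∀ x ∈ P.S, x ∉ P.A φ → ¬ Enters φ P.Dn x →
      (∀ s, 0 ≤ s → φ x s ∈ P.Bx) ∧ Tendsto (φ x) atTop (𝓝 (P.e2 x.1)) := fun x hx hA he => by
    obtain ⟨i1, -, i3, i4⟩ := ht φ Fl x hx (hs φ Fl x hx hA).1 hA he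
    exact ⟨fun s hs => ⟨i1.hq s hs, i1.hp s hs, i3 s hs, (i1.hu s hs).2⟩, i4⟩
  obtain ⟨θ, hθ, τ, η, h1, h2, h3, h4, h5⟩ := H.exists_orbit_mem (B := P.Bx)
    (fun x hx hA => (hs φ Fl x hx hA).2) (fun x hx hC T hT => seg_St Fl hε hx hC hT)
    (fun x hx hA he => (hend x hx hA he).1) k
  obtain ⟨g1, g2⟩ := hσ θ hθ
  have ha := P.a_pos hθ
  have hth : ∀ t, (φ (σ θ) t).1 = θ := fun t => (flow_fst Fl _ t).trans g1
  have hmem : ∀ t, φ (σ θ) t ∈ P.Bx := fun t => by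
    rcases le_total t 0 with h | h
    exacts [P.R1_sub (g2 t h), h5 t h]
  have hmul : ∀ t, P.a θ*(t/P.a θ) = t := fun t => mul_div_cancel₀ _ ha.ne'
  have hτ : ∀ i j, i < j → j < k → τ (i+1) < η j := fun i j hij hj => by
    refine lt_of_le_of_lt ?_ (h1 j hj).1
    induction j, hij using Nat.le_induction with
    | base => exact le_rfl
    | succ j hj' ih => linarith [ih (by omega), h1 j (by omega)]
  refine ⟨1/(P.a θ)^2, by positivity, P.cb θ/P.a θ - P.ub, _, _, _, isTWSol hθ hr Fl g1 hmem, ?_, ?_,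
    fun i => η i/P.a θ, fun i => τ (i+1)/P.a θ, fun i => ?_, fun i j hij => ?_, fun i => ?_, fun i => ?_⟩
  · have h6 := R1_dissip (P := P) |>.tendsto_atBot Fl hε (e := e1 θ) g1 (P.e1_mem hθ) (flow_e1 Fl θ) g2
    have := tendsto_wave (a := P.a θ) (h6.comp (tendsto_id.const_mul_atBot ha))
    simpa [wave, e1] using this
  · obtain ⟨i1, i2⟩ := h2 k le_rfl
    have h6 := (hend _ i1 i2 h4).2
    rw [hth] at h6
    have h7 : Tendsto (φ (σ θ)) atTop (𝓝 (P.e2 θ)) := by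
      have := h6.comp (tendsto_atTop_add_const_right atTop (-τ k) tendsto_id)
      refine this.congr fun t => ?_
      simp only [Function.comp_apply, id]
      rw [Fl.add]; congr 1; ring
    have := tendsto_wave (a := P.a θ) (h7.comp (tendsto_id.const_mul_atTop ha))
    simpa [wave, e2] using this
  · exact div_lt_div_of_pos_right (h1 i i.2).2 ha
  · exact div_lt_div_of_pos_right (hτ i j hij j.2) ha
  · have := (hδ φ Fl).2 _ (h3 i i.2).1.1 (h3 i i.2).2
    rw [hth] at this
    simpa only [hmul, wave] using this
  · have := (hδ φ Fl).1 _ (h2 (i+1) i.2).1 (h2 (i+1) i.2).2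
    rw [hth] at this
    simpa only [hmul, wave] using this

theorem back_wave (P : Par) {r δ : ℝ} (hr : r = 2*P.κ^2 - 1/10) (hL : P.LowEscapes) (hδ : P.CloseTo δ)
    {b₁ ω₁ b₂ ω₂ : ℝ} (hB : P.BlueAt (Icc 0 1) b₁ ω₁) (hRd : P.RedAt {0} b₂ ω₂)
    (hulo : 128/100 ≤ P.ulo) (hLH : P.qL < P.qH - 1) (hone : ∀ θ ∈ ({1} : Set ℝ), 96/100 ≤ P.c θ P.ulo) :
    ∀ᶠ ε in 𝓝[>] (0:ℝ), ∀ k : ℕ, ∃ D : ℝ, 0 < D ∧ ∃ μ : ℝ, ∃ Q R U : ℝ → ℝ,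
      IsTWSol D μ (-P.ζ - μ) ε r Q R U ∧
      Tendsto (fun ξ => (Q ξ, R ξ, U ξ)) atBot (𝓝 (1+P.y, 0, P.ub)) ∧
      Tendsto (fun ξ => (Q ξ, R ξ, U ξ)) atTop (𝓝 (0, 0, 2)) ∧
      ∃ xs : Fin (k+1) → ℝ, ∃ zs : Fin k → ℝ, (∀ i : Fin k, xs i.castSucc < zs i ∧ zs i < xs i.succ) ∧
        (∀ i, dist3 (Q (xs i), R (xs i), U (xs i)) (0, 0, 2) ≤ δ) ∧
        (∀ i, dist3 (Q (zs i), R (zs i), U (zs i)) (1+P.y, 0, P.ub) ≤ δ) := by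
  filter_upwards [P.back_pair hL hB hRd hulo hLH hone, P.seg_S hL, P.tends_laminar, hδ,
    self_mem_nhdsWithin] with ε hp hs ht hδ hε k
  obtain ⟨φ, Fl⟩ := P.exists_flow ε
  obtain ⟨σ, hσ, H⟩ := hp φ Fl
  have hend : ∀ x ∈ P.St, x ∉ P.C φ → ¬ Enters φ P.Up x →
      (∀ s, 0 ≤ s → φ x s ∈ P.Bx) ∧ Tendsto (φ x) atTop (𝓝 (e1 x.1)) := fun x hx hC he => by
    obtain ⟨i1, -, i3, i4, -⟩ := ht φ Fl x hx.1 hx.2 hC he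
    exact ⟨fun s hs => ⟨i1.hq s hs, i1.hp s hs, i3 s hs, (i1.hu s hs).2⟩, i4⟩
  obtain ⟨θ, hθ, τ, η, h1, h2, h3, h4, h5⟩ := H.exists_orbit_mem (B := P.Bx)
    (fun x hx hC T hT => seg_St Fl hε hx hC hT) (fun x hx hA => (hs φ Fl x hx hA).2)
    (fun x hx hA he => (hend x hx hA he).1) (k+1)
  obtain ⟨g1, g2⟩ := hσ θ hθ
  have ha := P.a_pos hθ
  have hth : ∀ t, (φ (σ θ) t).1 = θ := fun t => (flow_fst Fl _ t).trans g1
  have hmem : ∀ t, φ (σ θ) t ∈ P.Bx := fun t => by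
    rcases le_total t 0 with h | h
    exacts [P.R2_sub (g2 t h), h5 t h]
  have hmul : ∀ t, P.a θ*(t/P.a θ) = t := fun t => mul_div_cancel₀ _ ha.ne'
  refine ⟨1/(P.a θ)^2, by positivity, P.cb θ/P.a θ - P.ub, _, _, _, isTWSol hθ hr Fl g1 hmem, ?_, ?_,
    fun i => η i/P.a θ, fun i => τ (i+1)/P.a θ, fun i => ⟨?_, ?_⟩, fun i => ?_, fun i => ?_⟩
  · have h6 := R2_dissip (P := P) |>.tendsto_atBot Fl hε (e := P.e2 θ) g1 (P.e2_mem hθ) (flow_e2 Fl θ) g2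
    have := tendsto_wave (a := P.a θ) (h6.comp (tendsto_id.const_mul_atBot ha))
    simpa [wave, e2] using this
  · obtain ⟨i1, i2⟩ := h2 (k+1) le_rfl
    have h6 := (hend _ i1 i2 h4).2
    rw [hth] at h6
    have h7 : Tendsto (φ (σ θ)) atTop (𝓝 (e1 θ)) := by
      have := h6.comp (tendsto_atTop_add_const_right atTop (-τ (k+1)) tendsto_id)
      refine this.congr fun t => ?_
      simp only [Function.comp_apply, id]
      rw [Fl.add]; congr 1; ring
    have := tendsto_wave (a := P.a θ) (h7.comp (tendsto_id.const_mul_atTop ha))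
    simpa [wave, e1] using this
  · exact div_lt_div_of_pos_right (h1 i (by omega)).2 ha
  · exact div_lt_div_of_pos_right (h1 (i+1) (by omega)).1 ha
  · have := (hδ φ Fl).1 _ (h3 i i.2).1 (h3 i i.2).2
    rw [hth] at this
    simpa only [hmul, wave] using this
  · have := (hδ φ Fl).2 _ (h2 (i+1) (by omega)).1.1 (h2 (i+1) (by omega)).2
    rw [hth] at this
    simpa only [hmul, wave] using this

end Par

theorem hasDerivAt_phi (χ : ℝ) : HasDerivAt phi (phi χ*(1 - phi χ)/Real.sqrt 2) χ := by
  have h2 : Real.sqrt 2 ≠ 0 := by positivity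
  have h1 : HasDerivAt (fun χ : ℝ => Real.exp (-χ/Real.sqrt 2)) (Real.exp (-χ/Real.sqrt 2)*(-1/Real.sqrt 2)) χ :=
    ((hasDerivAt_id χ).neg.div_const _).exp
  have h := (h1.const_add 1).inv (by positivity)
  have he : phi = (fun χ : ℝ => 1 + Real.exp (-χ/Real.sqrt 2))⁻¹ := by
    funext χ; simp [phi]
  rw [he]
  refine h.congr_deriv ?_
  simp only [Pi.inv_apply]
  have h3 : 1 + Real.exp (-χ/Real.sqrt 2) ≠ 0 := by positivity
  field_simp
  ring

theorem phi_bounds (χ : ℝ) : 0 < phi χ ∧ phi χ < 1 ∧ phi χ ≤ Real.exp (χ/Real.sqrt 2) ∧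
    1 - phi χ ≤ Real.exp (-χ/Real.sqrt 2) := by
  have h := Real.exp_pos (-χ/Real.sqrt 2)
  have h' : Real.exp (χ/Real.sqrt 2)*Real.exp (-χ/Real.sqrt 2) = 1 := by
    rw [← Real.exp_add, ← add_div]; simp
  have h'' := Real.exp_pos (χ/Real.sqrt 2)
  unfold phi
  refine ⟨by positivity, ?_, ?_, ?_⟩
  · rw [div_lt_one (by positivity)]; linarith
  · rw [div_le_iff₀ (by positivity)]; nlinarith
  · rw [sub_le_iff_le_add, ← sub_le_iff_le_add', le_div_iff₀ (by positivity)]; nlinarith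

theorem exp_phi_le {a : ℝ} (ha : 0 ≤ a) (ha' : a ≤ 1/Real.sqrt 2) (χ : ℝ) :
    0 ≤ Real.exp (-a*χ)*((phi χ)^2*(1 - phi χ)) ∧
    Real.exp (-a*χ)*((phi χ)^2*(1 - phi χ)) ≤ Real.exp (-(1/Real.sqrt 2)*|χ|) := by
  obtain ⟨h1, h2, h3, h4⟩ := phi_bounds χ
  have h5 : 0 < 1 - phi χ := by linarith
  have hs : 0 < 1/Real.sqrt 2 := by positivity
  refine ⟨by positivity, ?_⟩
  rcases le_total 0 χ with h | h
  · rw [abs_of_nonneg h]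
    calc _ ≤ 1*(1^2*Real.exp (-χ/Real.sqrt 2)) := by
          gcongr
          exact Real.exp_le_one_iff.mpr (by nlinarith)
      _ = _ := by rw [one_mul, one_pow, one_mul]; congr 1; ring
  · rw [abs_of_nonpos h]
    calc _ ≤ Real.exp (-a*χ)*((Real.exp (χ/Real.sqrt 2))^2*1) := by
          gcongr; linarith
      _ = Real.exp (-a*χ + (χ/Real.sqrt 2 + χ/Real.sqrt 2)) := by
          rw [Real.exp_add, Real.exp_add, mul_one, sq]
      _ ≤ _ := by
          apply Real.exp_le_exp.mpr
          have e : χ/Real.sqrt 2 = 1/Real.sqrt 2*χ := by ring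
          rw [e]; nlinarith

theorem integrable_exp_abs {c : ℝ} (hc : 0 < c) : Integrable fun χ : ℝ => Real.exp (-c*|χ|) := by
  refine integrableOn_univ.mp ?_
  rw [← Set.Iic_union_Ioi (a := (0:ℝ))]
  refine IntegrableOn.union ?_ ?_
  · refine (integrableOn_exp_mul_Iic hc 0).congr_fun (fun χ hχ => ?_) measurableSet_Iic
    simp [abs_of_nonpos (Set.mem_Iic.mp hχ)]
  · refine (exp_neg_integrableOn_Ioi 0 hc).congr_fun (fun χ hχ => ?_) measurableSet_Ioi
    simp [abs_of_pos (Set.mem_Ioi.mp hχ)]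

theorem Jn_one_eq {a : ℝ} (ha : 0 ≤ a) (ha' : a ≤ 1/Real.sqrt 2) :
    (1 + Real.sqrt 2*a)*Jn a 1 = 3*Real.sqrt 2*Jsq a ∧ 0 ≤ Jsq a := by
  have hs2 : Real.sqrt 2*Real.sqrt 2 = 2 := Real.mul_self_sqrt (by norm_num)
  have hs : 0 < Real.sqrt 2 := by positivity
  have hd : deriv phi = fun χ => phi χ*(1 - phi χ)/Real.sqrt 2 := funext fun χ => (hasDerivAt_phi χ).deriv
  have hc : Continuous phi := continuous_iff_continuousAt.mpr fun χ => (hasDerivAt_phi χ).continuousAt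
  have hbase := integrable_exp_abs (show 0 < 1/Real.sqrt 2 by positivity)
  have hi : ∀ f : ℝ → ℝ, Continuous f → (∀ χ, |f χ| ≤ 1) →
      Integrable fun χ => Real.exp (-a*χ)*((phi χ)^2*(1 - phi χ))*f χ := fun f hf hf' => by
    refine hbase.mono' (Continuous.aestronglyMeasurable (by fun_prop)) (.of_forall fun χ => ?_)
    obtain ⟨h1, h2⟩ := exp_phi_le ha ha' χ
    rw [Real.norm_eq_abs, abs_mul, abs_of_nonneg h1]
    nlinarith [hf' χ, abs_nonneg (f χ)]
  have i1 := (hi (fun _ => 1) (by fun_prop) (by simp)).const_mul (1/Real.sqrt 2)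
  have i2 := (hi (fun χ => 1 - phi χ) (by fun_prop) (fun χ => by
    obtain ⟨h1, h2, -⟩ := phi_bounds χ
    rw [abs_of_pos (by linarith)]; linarith)).const_mul (1/2)
  have e1 : Jn a 1 = ∫ χ, 1/Real.sqrt 2*(Real.exp (-a*χ)*((phi χ)^2*(1 - phi χ))*1) := by
    unfold Jn; rw [hd]; congr 1; funext χ; simp only; ring
  have e2 : Jsq a = ∫ χ, 1/2*(Real.exp (-a*χ)*((phi χ)^2*(1 - phi χ))*(1 - phi χ)) := by
    unfold Jsq; rw [hd]; congr 1; funext χ; simp only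
    rw [div_pow, sq (Real.sqrt 2), hs2]; ring
  refine ⟨?_, integral_nonneg fun χ => by positivity⟩
  have hH : ∀ χ, HasDerivAt (fun χ => Real.exp (-a*χ)*((phi χ)^2*(1 - phi χ)))
      (3*Real.sqrt 2*(1/2*(Real.exp (-a*χ)*((phi χ)^2*(1 - phi χ))*(1 - phi χ))) -
        (1 + Real.sqrt 2*a)*(1/Real.sqrt 2*(Real.exp (-a*χ)*((phi χ)^2*(1 - phi χ))*1))) χ := fun χ => by
    have h1 : HasDerivAt (fun χ : ℝ => Real.exp (-a*χ)) (Real.exp (-a*χ)*(-a)) χ := by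
      have := ((hasDerivAt_id χ).const_mul (-a)).exp
      simpa using this
    have h2 := hasDerivAt_phi χ
    have h3 := h1.mul ((h2.pow 2).mul (h2.const_sub 1))
    refine h3.congr_deriv ?_
    simp only [Pi.mul_apply, Pi.pow_apply]
    have : Real.sqrt 2^2 = 2 := by rw [sq, hs2]
    push_cast
    field_simp
    rw [this]
    ring
  have hlim : ∀ l : Filter ℝ, Tendsto (fun χ : ℝ => |χ|) l atTop →
      Tendsto (fun χ => Real.exp (-a*χ)*((phi χ)^2*(1 - phi χ))) l (𝓝 0) := fun l hl => by
    refine squeeze_zero (fun χ => (exp_phi_le ha ha' χ).1) (fun χ => (exp_phi_le ha ha' χ).2) ?_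
    exact Real.tendsto_exp_atBot.comp (hl.const_mul_atTop_of_neg (by simp))
  have h := integral_of_hasDerivAt_of_tendsto hH ((i2.const_mul _).sub (i1.const_mul _))
    (hlim _ tendsto_abs_atBot_atTop) (hlim _ tendsto_abs_atTop_atTop)
  rw [integral_sub (i2.const_mul _) (i1.const_mul _), integral_const_mul (3*Real.sqrt 2),
    integral_const_mul (1 + Real.sqrt 2*a), ← e1, ← e2] at h
  linarith

/-- The static relations satisfied by the equilibria of the singular fast system. -/
structure Stat (ub y x κ : ℝ) : Prop where
  hκ : 61/100 < κ
  hκ' : κ < 65/100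
  hR : 23/30 < 2*κ^2
  hR' : 2*κ^2 < 84/100
  hub : 9/7 < ub
  hub' : ub < 4/3
  hx0 : 93/100 < x
  hx1 : x < 94/100
  hx : 2*κ^2*x^2 = 2*κ^2 - 1/10
  hy0 : 0 < y
  hy1 : y < 185/1000
  hy : 2*κ^2*y^2 = 2*κ^2 + ub - 21/10
  hyub : 2*(1+y)*(ub-1) = 2 - ub
  hM : 3*(x+y)^2 < 4*x

set_option maxHeartbeats 400000 in
theorem stat_of {r ubr : ℝ} (hr : 2/3 < r) (hub : ubr ∈ Set.Ioo (6/5 : ℝ) (4/3))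
    (hK : Kc ubr r = 0) (hMt : 0 < Mtf r ubr) : ∃ y x κ, Stat ubr y x κ ∧ r = 2*κ^2 - 1/10 ∧
      qbp r ubr = 1 + y := by
  obtain ⟨h1, h2⟩ := hub
  have hR : 0 < r + 1/10 := by linarith
  obtain ⟨y, hy⟩ : ∃ y, y = (2-ubr)/(2*(ubr-1)) - 1 := ⟨_, rfl⟩
  have hu1 : 0 < ubr - 1 := by linarith
  have hyub : 2*(1+y)*(ubr-1) = 2 - ubr := by
    rw [hy]; field_simp; ring
  have hy0 : 0 < y := by
    by_contra h; nlinarith [not_lt.mp h]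
  have hyy : (r+1/10)*y^2 = r + ubr - 2 := by
    have e : 4*(ubr-1)^2*((r+1/10)*y^2 - (r + ubr - 2)) = 0 := by
      have e1 : 2*(ubr-1)*y = 4 - 3*ubr := by linarith
      have : 4*(ubr-1)^2*((r+1/10)*y^2) = (r+1/10)*(2*(ubr-1)*y)^2 := by ring
      unfold Kc at hK
      rw [mul_sub, this, e1]; linarith
    rcases mul_eq_zero.mp e with h | h
    · nlinarith
    · linarith
  obtain ⟨x, hx⟩ : ∃ x, x = Real.sqrt (r/(r+1/10)) := ⟨_, rfl⟩
  have hxp : 0 < x := by rw [hx]; positivity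
  have hxx : (r+1/10)*x^2 = r := by
    rw [hx, Real.sq_sqrt (by positivity)]; field_simp
  have hsy : Real.sqrt ((r+ubr-2)/(r+1/10)) = y := by
    rw [← hyy, mul_div_cancel_left₀ _ hR.ne', Real.sqrt_sq hy0.le]
  obtain ⟨κ, hκ⟩ : ∃ κ, κ = Real.sqrt ((r+1/10)/2) := ⟨_, rfl⟩
  have hκ0 : 0 < κ := by rw [hκ]; positivity
  have hκκ : 2*κ^2 = r + 1/10 := by
    rw [hκ, Real.sq_sqrt (by positivity)]; ring
  have hx0 : 932/1000 < x := by
    by_contra h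
    have h3 : x^2 ≤ 932/1000*(932/1000) := by rw [sq]; gcongr <;> exact not_lt.mp h
    nlinarith [mul_le_mul_of_nonneg_left h3 hR.le]
  have hx1 : x < 1 := by
    by_contra h
    nlinarith [mul_le_mul_of_nonneg_left (one_le_pow₀ (not_lt.mp h) : 1 ≤ x^2) hR.le]
  have hM : 3*(x+y)^2 < 4*x := by
    by_contra! hc
    have hS : 0 < 3*(x+y) - 2 := by linarith
    have hs2 : Real.sqrt 2*Real.sqrt 2 = 2 := Real.mul_self_sqrt (by norm_num)
    have hs : 0 < Real.sqrt 2 := by positivity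
    have eaf : Real.sqrt 2*af r = (3*x-1)/(1+x) := by
      unfold af qfm qfp
      rw [← hx, ← mul_assoc, hs2]; field_simp; ring
    have eaf' : af r = (3*x-1)/(1+x)*(1/Real.sqrt 2) := by
      rw [← eaf]; field_simp
    have ha : 0 ≤ af r := by
      rw [eaf']; exact mul_nonneg (div_nonneg (by linarith) (by linarith)) (by positivity)
    have ha' : af r ≤ 1/Real.sqrt 2 := by
      rw [eaf']
      refine mul_le_of_le_one_left (by positivity) ?_
      rw [div_le_one (by linarith)]; linarith
    obtain ⟨hJ, hJ0⟩ := Jn_one_eq ha ha'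
    rw [eaf] at hJ
    have hJ' : 4*x*Jn (af r) 1 = 3*Real.sqrt 2*Jsq (af r)*(1+x) := by
      rw [← hJ]; field_simp; ring
    have hD : Real.sqrt ((r+1/10)/D0 r ubr) = (r+1/10)*(3*(x+y)-2)/(Real.sqrt 2*(2-ubr)) := by
      rw [Real.sqrt_eq_iff_mul_self_eq (by unfold D0; positivity)
        (div_nonneg (by positivity) (mul_nonneg hs.le (by linarith)))]
      unfold D0 qbm qbp qfm qfp
      rw [← hx, hsy, show (2*(1-y)-(1+y)+2*(1-x)-(1+x))^2 = (3*(x+y)-2)^2 by ring]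
      have h3 : 2 - ubr ≠ 0 := by linarith
      have h4 : Real.sqrt 2^2 = 2 := by rw [sq, hs2]
      field_simp
      rw [h4]
    unfold Mtf at hMt
    rw [hD, show qfp r = 1 + x by rw [hx]; rfl] at hMt
    have h5 : 0 < Real.sqrt 2*(2-ubr) := mul_pos hs (by linarith)
    have h6 := mul_pos hMt (mul_pos (mul_pos four_pos hxp) h5)
    have h7 : (-(1+x)*((r+1/10)*(3*(x+y)-2)/(Real.sqrt 2*(2-ubr)))*Jsq (af r) + Jn (af r) 1)*
        (4*x*(Real.sqrt 2*(2-ubr))) =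
        Jsq (af r)*(1+x)*(2*(3*(2-ubr) - 2*x*(r+1/10)*(3*(x+y)-2))) := by
      have hA := div_mul_cancel₀ ((r+1/10)*(3*(x+y)-2)) h5.ne'
      linear_combination -(1+x)*Jsq (af r)*4*x*hA + Real.sqrt 2*(2-ubr)*hJ' +
        3*Jsq (af r)*(1+x)*(2-ubr)*hs2
    rw [h7] at h6
    have e : 2*x*(r+1/10)*(3*(x+y)-2) - 3*(2-ubr) = (r+1/10)*(3*(x+y)^2-4*x) := by
      linear_combination 3*hxx - 3*hyy
    have h8 : 0 ≤ (r+1/10)*(3*(x+y)^2-4*x) := mul_nonneg hR.le (by linarith)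
    have h9 : 0 ≤ Jsq (af r)*(1+x) := mul_nonneg hJ0 (by linarith)
    rw [show 3*(2-ubr) - 2*x*(r+1/10)*(3*(x+y)-2) = -((r+1/10)*(3*(x+y)^2-4*x)) by linarith] at h6
    linarith [mul_nonneg h9 h8]
  have hy1 : y < 185/1000 := by
    by_contra h; nlinarith [not_lt.mp h]
  have hubr : 1295/1000 < ubr := by nlinarith
  have hrr : r + 1/10 < 84/100 := by
    have h3 : y^2 ≤ 185/1000*(185/1000) := by rw [sq]; gcongr
    linarith [mul_le_mul_of_nonneg_left h3 hR.le]
  refine ⟨y, x, κ, ⟨?_, ?_, ?_, ?_, ?_, h2, ?_, ?_, ?_, hy0, hy1, ?_, hyub, hM⟩, by linarith,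
    by unfold qbp; rw [hsy]⟩
  · nlinarith
  · nlinarith
  · linarith
  · linarith
  · linarith
  · linarith
  · by_contra h
    have h3 : 94/100*(94/100) ≤ x^2 := by rw [sq]; gcongr <;> exact not_lt.mp h
    linarith [mul_le_mul_of_nonneg_left h3 hR.le]
  · rw [hκκ]; linarith
  · rw [hκκ]; linarith

namespace Par
open Set

/-- A concrete choice of the auxiliary small constants. -/
structure Std (P : Par) : Prop where
  hs : Stat P.ub P.y P.x P.κ
  eqL : P.qL = P.y/20000
  eρ : P.ρ = P.y/4000
  eqH : P.qH = 1 + P.y - P.y^2/160000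
  eulo : P.ulo = P.ub - P.y^3/320000
  hcb : ∀ θ ∈ Icc (0:ℝ) 1, P.κ*(1-3*P.y) - P.y/1000 ≤ P.cb θ ∧ P.cb θ ≤ 1
  hc2 : ∀ θ ∈ Icc (0:ℝ) 1, P.κ*(3*P.x-1) - P.y/1000 ≤ P.c2 θ ∧ P.c2 θ ≤ P.κ*(3*P.x-1) + P.y/1000

theorem exists_std {ζ ub y x κ cb0 cb1 c20 c21 : ℝ} (hζ : 2/5 < ζ) (H : Stat ub y x κ)
    (hcb : ∀ θ ∈ Icc (0:ℝ) 1, κ*(1-3*y) - y/1000 ≤ cb0 + cb1*θ ∧ cb0 + cb1*θ ≤ 1)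
    (hc2 : ∀ θ ∈ Icc (0:ℝ) 1, κ*(3*x-1) - y/1000 ≤ c20 + c21*θ ∧ c20 + c21*θ ≤ κ*(3*x-1) + y/1000) :
    ∃ P : Par, P.Std ∧ P.ζ = ζ ∧ P.ub = ub ∧ P.y = y ∧ P.x = x ∧ P.κ = κ ∧
      (∀ θ, P.cb θ = cb0 + cb1*θ) ∧ ∀ θ, P.c2 θ = c20 + c21*θ := by
  obtain ⟨h1, h2, h3, h4, h5, h6, h7, h8, h9, h10, h11, h12, h13, h14⟩ := id H
  have y2 : y^2 ≤ y*(185/1000) := by rw [sq]; gcongr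
  have y2' : 0 < y^2 := by positivity
  have y3 : y^3 ≤ y^2*(185/1000) := by rw [pow_succ]; gcongr
  have y3' : 0 < y^3 := by positivity
  have y4 : y^4 ≤ y^3*(185/1000) := by rw [pow_succ]; gcongr
  have y4' : 0 < y^4 := by positivity
  have k1 : κ*(1-3*y) ≤ 65/100*1 := mul_le_mul h2.le (by linarith) (by linarith) (by norm_num)
  have k2 : 61/100*(44/100) ≤ κ*(1-3*y) := mul_le_mul h1.le (by linarith) (by norm_num) (by linarith)
  have k3 : κ*(3*x-1) ≤ 65/100*(182/100) := mul_le_mul h2.le (by linarith) (by linarith) (by norm_num)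
  have k4 : 61/100*(179/100) ≤ κ*(3*x-1) := mul_le_mul h1.le (by linarith) (by norm_num) (by linarith)
  have ha : ∀ θ ∈ Icc (0:ℝ) 1, 0 < ((c20 + c21*θ) - (cb0 + cb1*θ))/(2-ub) ∧
      ((c20 + c21*θ) - (cb0 + cb1*θ))/(2-ub) ≤ 2 := fun θ hθ => by
    obtain ⟨l1, l2⟩ := hcb θ hθ
    obtain ⟨m1, m2⟩ := hc2 θ hθ
    have : 0 < 2 - ub := by linarith
    refine ⟨div_pos (by linarith) this, ?_⟩
    rw [div_le_iff₀ this]; linarith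
  refine ⟨{
    ζ := ζ, ub := ub, y := y, x := x, κ := κ, cb0 := cb0, cb1 := cb1, c20 := c20, c21 := c21
    qL := y/20000, qH := 1 + y - y^2/160000, ulo := ub - y^3/320000, um := ub - y^3/640000
    ρ := y/4000, hζ := hζ, hub := h5, hub' := h6, hκ := by linarith, hR := h3
    hR' := by linarith, hx0 := by linarith, hx := h9, hy0 := h10, hy1 := by linarith
    hy := h12, hyub := h13, hqL := by positivity, hqL' := by linarith
    hqH := by linarith, hqH' := by linarith, hulo := by linarith, hum := by linarith
    hum' := by linarith
    hFH := ?_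
    hρ := by positivity, hρy := by linarith, hρω := by nlinarith
    adm_a := ha
    adm_lo := fun θ hθ => ?_
    adm_hi := fun θ hθ => by linarith [(hc2 θ hθ).2] },
    ⟨H, rfl, rfl, rfl, rfl, hcb, hc2⟩, rfl, rfl, rfl, rfl, rfl, fun _ => rfl, fun _ => rfl⟩
  · have e : ub - y^3/320000 - 21/10 + 2*κ^2*(1+y-y^2/160000)*(2-(1+y-y^2/160000)) =
        2*κ^2*(y^3/80000 - y^4/160000^2) - y^3/320000 := by linear_combination -h12
    rw [e]
    have : 23/30*(y^3/80000 - y^4/160000^2) ≤ 2*κ^2*(y^3/80000 - y^4/160000^2) := by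
      gcongr
      linarith
    linarith
  · have l1 := (hcb θ hθ).1
    have := mul_le_mul_of_nonneg_right (ha θ hθ).2 y3'.le
    rw [show ub - y^3/320000 - ub = -(y^3/320000) by ring]
    linarith

variable {P : Par}

theorem c_add_le {θ : ℝ} (hθ : θ ∈ Icc (0:ℝ) 1) (ω : ℝ) (hω : 0 ≤ ω) (h : P.cb θ = P.κ*(1-3*P.y) - P.y/1000) :
    P.c θ (P.ub + ω) ≤ P.κ*(1-3*P.y) - P.y/1000 + 2*ω := by
  have := mul_le_mul_of_nonneg_right (P.a_le hθ) hω
  unfold c; rw [h]; linarith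

variable (H : P.Std)
include H

theorem Std.redAt {Θ : Set ℝ} (hΘ : Θ ⊆ Icc 0 1) (h : ∀ θ ∈ Θ, P.cb θ = P.κ*(1-3*P.y) - P.y/1000) :
    P.RedAt Θ (1 + P.y + P.y/4000) (P.y^2/80000) := by
  obtain ⟨h1, h2, h3, h4, h5, h6, h7, h8, h9, h10, h11, h12, h13, h14⟩ := id H.hs
  have y2 : P.y^2 ≤ P.y*(185/1000) := by rw [sq]; gcongr
  have y2' : 0 < P.y^2 := by have := P.hy0; positivity
  refine ⟨by rw [H.eρ], by linarith, by rw [H.eqH]; linarith, fun θ hθ => ?_, ?_⟩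
  · have l1 := c_add_le (hΘ hθ) (P.y^2/80000) (by positivity) (h θ hθ)
    have l2 := mul_lt_mul_of_pos_right h2 h10
    rw [H.eqL]; linarith
  · have e : P.F (1 + P.y + P.y/4000) (P.ub + P.y^2/80000) =
        P.y^2/80000 - 2*P.κ^2*(P.y^2/2000 + P.y^2/4000^2) := by
      unfold F; linear_combination -h12
    rw [e]
    have : 23/30*(P.y^2/2000 + P.y^2/4000^2) ≤ 2*P.κ^2*(P.y^2/2000 + P.y^2/4000^2) := by
      gcongr
    linarith

theorem Std.blueAt {Θ : Set ℝ} (h : ∀ θ ∈ Θ, P.c2 θ = P.κ*(3*P.x-1) - P.y/1000) :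
    P.BlueAt Θ (1 + P.x - P.y/2000) (P.y/4000) := by
  obtain ⟨h1, h2, h3, h4, h5, h6, h7, h8, h9, h10, h11, h12, h13, h14⟩ := id H.hs
  have y2 : P.y^2 ≤ P.y*(185/1000) := by rw [sq]; gcongr
  have y2' : 0 < P.y^2 := by have := P.hy0; positivity
  refine ⟨by rw [H.eqH]; linarith, by linarith, by positivity, by linarith,
    by rw [H.eqL]; linarith, fun θ hθ => ?_, ?_⟩
  · have e : P.κ*(1 + P.x - P.y/2000)*(P.c2 θ - P.κ*(1 + P.x - P.y/2000)) + 1/10 + P.y/4000 =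
        P.y/4000 - P.κ*(1 + P.x - P.y/2000)*(P.y/1000) + 2*P.κ^2*(3 - P.x - P.y/2000)*(P.y/4000) := by
      rw [h θ hθ]; linear_combination h9
    rw [e]
    have l1 : 61/100*(192/100)*(P.y/1000) ≤ P.κ*(1 + P.x - P.y/2000)*(P.y/1000) := by
      gcongr <;> linarith
    have l2 : 2*P.κ^2*(3 - P.x - P.y/2000)*(P.y/4000) ≤ 84/100*(207/100)*(P.y/4000) := by
      gcongr <;> linarith
    linarith
  · have e : P.F (1 + P.x - P.y/2000) (2 - P.y/4000) =
        2*P.κ^2*((2*P.x - P.y/2000)*(P.y/2000)) - P.y/4000 := by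
      unfold F; linear_combination -h9
    rw [e]
    have l2 : 23/30*(18/10*(P.y/2000)) ≤ 2*P.κ^2*((2*P.x - P.y/2000)*(P.y/2000)) := by
      gcongr; linarith
    linarith

end Par

namespace Par
open Set

variable {P : Par} (H : P.Std)
include H

theorem Std.top_escapes (h : P.c2 1 = P.κ*(3*P.x-1) + P.y/1000) :
    ∀ᶠ ε in 𝓝[>] (0:ℝ), ∀ φ, IsFlow (P.field ε) φ → ∀ x ∈ P.S, x.1 ∈ ({1} : Set ℝ) →
      x.2.2.2 ∈ Ici (2 - 2*P.qL) → x ∈ P.A φ := by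
  obtain ⟨h1, h2, h3, h4, h5, h6, h7, h8, h9, h10, h11, h12, h13, h14⟩ := id H.hs
  have hq := P.hqL
  have hq' := P.hqL'
  have hx := P.hx0
  refine mem_A_of_over P (ω := P.qL) (μ := 2*P.κ^2*(P.x*P.qL)) hq (by positivity)
    fun θ hθ v hv => ⟨1 + P.x + P.qL, ⟨by linarith, by linarith⟩, fun u hu huv => ?_⟩
  obtain rfl : θ = 1 := hθ
  have hv : 2 - 2*P.qL ≤ v := hv
  have huv := abs_le.mp huv
  constructor
  · have e : P.c 1 u = P.c2 1 - P.a 1*(2-u) := by rw [← P.c_two]; unfold c; ring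
    have l1 : P.a 1*(2-u) ≤ 2*(3*P.qL) :=
      mul_le_mul (P.a_le ⟨zero_le_one, le_rfl⟩) (by linarith) (by linarith [hu.2]) (by norm_num)
    have l2 := mul_lt_mul_of_pos_right h2 hq
    have e2 := H.eqL
    rw [e, h]; linarith
  · have e : P.F (1 + P.x + P.qL) u = u - 2 - 2*P.κ^2*(2*(P.x*P.qL) + P.qL^2) := by
      unfold F; linear_combination -h9
    rw [e]
    have : 2*P.κ^2*(P.x*P.qL) ≤ 2*P.κ^2*(2*(P.x*P.qL) + P.qL^2) := by
      gcongr; nlinarith [mul_pos hx hq, sq_nonneg P.qL]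
    linarith [hu.2]

set_option maxHeartbeats 400000 in
theorem Std.lowEscapes : P.LowEscapes := by
  obtain ⟨h1, h2, h3, h4, h5, h6, h7, h8, h9, h10, h11, h12, h13, h14⟩ := id H.hs
  have key := mem_A_of_over P (Θ := Icc 0 1) (V := Icc P.ulo (8/5)) (ω := 1/200) (μ := 1/100)
    (by norm_num) (by norm_num) fun θ hθ v hv => by
    obtain ⟨L, hL⟩ : ∃ L, L = P.x + P.y - 2/3 := ⟨_, rfl⟩
    obtain ⟨t, ht⟩ : ∃ t, t = (v - P.ub)/(2 - P.ub) := ⟨_, rfl⟩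
    have hu2 : 0 < 2 - P.ub := by linarith
    have ht' : v = P.ub + t*(2 - P.ub) := by rw [ht]; field_simp; ring
    have hy3 : P.y^3 ≤ 1 := pow_le_one₀ h10.le (by linarith)
    have t1 : -(1/1000) ≤ t := by
      rw [ht, le_div_iff₀ hu2]; linarith [hv.1, H.eulo]
    have t2 : t ≤ 45/100 := by
      rw [ht, div_le_iff₀ hu2]; linarith [hv.2]
    have L0 : 0 < L := by linarith
    have L1 : L < 1/2 := by linarith
    have tL1 : t*L ≤ 45/100*(1/2) := mul_le_mul t2 L1.le L0.le (by norm_num)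
    have tL2 : -(1/1000)*L ≤ t*L := mul_le_mul_of_nonneg_right t1 L0.le
    refine ⟨1 + (2/3 - P.y + t*L) - 1/100, ⟨by linarith, by linarith⟩, fun u hu huv => ?_⟩
    have huv := abs_le.mp huv
    constructor
    · have e : P.c θ u = (1-t)*P.cb θ + t*P.c2 θ + P.a θ*(u - v) := by
        have : P.a θ*(2-P.ub) = P.c2 θ - P.cb θ := div_mul_cancel₀ _ hu2.ne'
        unfold c; linear_combination P.a θ*ht' + t*this
      have l0 := P.a_pos hθ
      have l1 : -(1/100) ≤ P.a θ*(u-v) := by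
        have := mul_nonneg l0.le (show 0 ≤ u - v + 1/200 by linarith)
        linarith [P.a_le hθ]
      have l2 := mul_le_mul_of_nonneg_left (H.hcb θ hθ).1 (show 0 ≤ 1 - t by linarith)
      have l3 : t*(P.κ*(3*P.x-1)) - P.y/1000 ≤ t*P.c2 θ := by
        have h5 := H.hc2 θ hθ
        have h6 : |t*(P.c2 θ - P.κ*(3*P.x-1))| ≤ 1*(P.y/1000) := by
          rw [abs_mul]
          exact mul_le_mul (abs_le.mpr ⟨by linarith, by linarith⟩)
            (abs_le.mpr ⟨by linarith, by linarith⟩) (abs_nonneg _) zero_le_one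
        linarith [(abs_le.mp h6).1]
      have l4 : P.κ*(3*P.y/20000) ≤ 65/100*(3*P.y/20000) := by gcongr
      have l5 := mul_nonneg (show 0 ≤ t + 1/1000 by linarith) h10.le
      rw [e, H.eqL]
      have e2 : P.κ*(3*(1 + (2/3 - P.y + t*L) - 1/100 + P.y/20000) - 4) =
          (1-t)*(P.κ*(1-3*P.y)) + t*(P.κ*(3*P.x-1)) - P.κ*(3/100) + P.κ*(3*P.y/20000) := by
        rw [hL]; ring
      linarith
    · obtain ⟨Y, hY⟩ : ∃ Y, Y = 2/3 - P.y + t*L := ⟨_, rfl⟩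
      have e : P.F (1 + Y - 1/100) u = u - v - 2*P.κ^2*((1-t)*((4/9-4*P.y/3) - L^2*t)
          - Y*(2/100) + (1/100)^2) := by
        unfold F
        rw [hY, hL]
        linear_combination (1-t)*h12*(-1) - t*h9 + ht'
      have hm : L^2 ≤ 4/9 - 4*P.y/3 := by rw [hL]; linarith
      have m1 : 55/100*(55/100)*(197/1000) ≤ (1-t)*((4/9-4*P.y/3) - L^2*t) := by
        rcases le_total t 0 with h0 | h0
        · have : L^2*t ≤ 0 := mul_nonpos_of_nonneg_of_nonpos (sq_nonneg L) h0
          have h1 := mul_nonneg (show 0 ≤ -t by linarith) (show 0 ≤ 4/9-4*P.y/3 - L^2*t by linarith)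
          linarith
        · have e3 : L^2*t ≤ (4/9-4*P.y/3)*t := mul_le_mul_of_nonneg_right hm h0
          calc (55/100*(55/100)*(197/1000) : ℝ) ≤ (1-t)*(1-t)*(4/9-4*P.y/3) := by
                gcongr <;> first | linarith | exact mul_self_nonneg _
            _ = (1-t)*((1-t)*(4/9-4*P.y/3)) := by ring
            _ ≤ _ := mul_le_mul_of_nonneg_left (by linarith) (by linarith)
      rw [← hY, e]
      have : 23/30*(3/100) ≤ 2*P.κ^2*((1-t)*((4/9-4*P.y/3) - L^2*t) - Y*(2/100) + (1/100)^2) := by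
        gcongr
        linarith
      linarith
  filter_upwards [key] with ε h φ Fl x hx hx'
  exact h φ Fl x hx hx.1 ⟨hx.2.2.2.1, hx'⟩

end Par

theorem dist3_le_div {a b c d : ℝ × ℝ × ℝ}
    (h : 9*((a.1 - b.1)^2 + (a.2.1 - b.2.1)^2 + (a.2.2 - b.2.2)^2) ≤
      (c.1 - d.1)^2 + (c.2.1 - d.2.1)^2 + (c.2.2 - d.2.2)^2) : dist3 a b ≤ dist3 c d/3 := by
  unfold dist3
  rw [le_div_iff₀ three_pos, mul_comm, ← Real.sqrt_sq (show (0:ℝ) ≤ 3 by norm_num),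
    ← Real.sqrt_mul (by norm_num)]
  exact Real.sqrt_le_sqrt (by linarith)

theorem energy_poly {y : ℝ} (h0 : 0 ≤ y) (h1 : y ≤ 185/1000) :
    (975/1000*(82/100 + 301/100*y))^2*(1+y)^2*(14/100*((1+y)*(1-3*y)) + 3/10000) + 1/100000 ≤
      ((1+y)^2 + 4/9)/9 := by
  have l1 : (1+y)^2*(14/100*((1+y)*(1-3*y)) + 3/10000) ≤ 14/100*(1-6*y^2) + 5/10000 := by
    have : 0 ≤ y^3 := by positivity
    have : 0 ≤ y^4 := by positivity
    nlinarith
  have l2 := mul_le_mul_of_nonneg_left l1 (sq_nonneg (975/1000*(82/100 + 301/100*y)))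
  nlinarith [mul_nonneg h0 (sq_nonneg (y - 188/1000)), sq_nonneg (y^2 - 353/10000),
    sq_nonneg (y - 2/10)]

namespace Par
open Set

variable {P : Par} {ε : ℝ} {φ : ℝ × ℝ × ℝ × ℝ → ℝ → ℝ × ℝ × ℝ × ℝ} (H : P.Std)
include H

theorem Std.a_bound {θ : ℝ} (hθ : θ ∈ Icc (0:ℝ) 1) : P.a θ ≤ 975/1000*(82/100 + 301/100*P.y) := by
  obtain ⟨h1, h2, h3, h4, h5, h6, h7, h8, h9, h10, h11, h12, h13, h14⟩ := id H.hs
  have l1 := (H.hcb θ hθ).1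
  have l2 := (H.hc2 θ hθ).2
  have l3 : P.κ*(3*P.x + 3*P.y - 2) ≤ 65/100*(82/100 + 3*P.y) := by
    gcongr <;> linarith
  unfold a
  rw [div_le_iff₀ (by linarith)]
  have l4 := mul_le_mul_of_nonneg_left (show 2/3 ≤ 2 - P.ub by linarith)
    (show 0 ≤ 975/1000*(82/100 + 301/100*P.y) by linarith)
  linarith

theorem Std.energy_bound {p u : ℝ} (h : P.Rt P.qH p u < 1/10000) :
    p^2 ≤ (1+P.y)^2*(14/100*((1+P.y)*(1-3*P.y)) + 3/10000 - (u - P.ub)) ∧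
    0 ≤ 14/100*((1+P.y)*(1-3*P.y)) + 3/10000 - (u - P.ub) := by
  obtain ⟨h1, h2, h3, h4, h5, h6, h7, h8, h9, h10, h11, h12, h13, h14⟩ := id H.hs
  have hq := P.hqH
  have hq' := P.hqH'
  obtain ⟨h, hh⟩ : ∃ h, h = 1 + P.y - P.qH := ⟨_, rfl⟩
  have hh0 : 0 < h := by linarith
  have hh1 : h ≤ 1/100000 := by
    rw [hh, H.eqH]; nlinarith
  have e : (p/P.qH)^2 = 2*P.Rt P.qH p u + (2*P.κ^2*((1+P.y)*(1-3*P.y)/6 + h*(1/3 - P.y) + h^2/2)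
      - (u - P.ub)) := by
    unfold Rt; rw [hh]; linear_combination h12
  have l1 : 2*P.κ^2*((1+P.y)*(1-3*P.y)/6 + h*(1/3 - P.y) + h^2/2) ≤
      84/100*((1+P.y)*(1-3*P.y)/6 + h*(1/3) + h*1/2) := by
    have : 0 ≤ (1+P.y)*(1-3*P.y) := mul_nonneg (by linarith) (by linarith)
    have : 0 ≤ h*(1/3 - P.y) := mul_nonneg hh0.le (by linarith)
    gcongr
    · linarith
    · rw [sq]; gcongr; linarith
  have l2 : (p/P.qH)^2 ≤ 14/100*((1+P.y)*(1-3*P.y)) + 3/10000 - (u - P.ub) := by linarith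
  refine ⟨?_, (sq_nonneg _).trans l2⟩
  calc p^2 = P.qH^2*(p/P.qH)^2 := by field_simp
    _ ≤ _ := by gcongr

theorem Std.dist_le_of_not_mem_C (Fl : IsFlow (P.field ε) φ) (hε : 0 < ε) (hε' : ε < 1/40000000000)
    {x : ℝ × ℝ × ℝ × ℝ} (hx : x ∈ P.S') (hC : x ∉ P.C φ) :
    dist3 (wave (P.a x.1) x) (1+P.y, 0, P.ub) ≤ dist3 (0, 0, 2) (1+P.y, 0, P.ub)/3 := by
  obtain ⟨h1, h2, h3, h4, h5, h6, h7, h8, h9, h10, h11, h12, h13, h14⟩ := id H.hs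
  have hu2 : 4/9 ≤ (2-P.ub)^2 := by nlinarith
  refine dist3_le_div ?_
  have hE := not_le.mp fun hc => hC (mem_C_of_energy Fl hε (η := 1/10000) (by norm_num)
    (by linarith) hx hc)
  rw [hx.2.1] at hE
  obtain ⟨l1, l2⟩ := H.energy_bound hE
  obtain ⟨hx1, hx2, -, hx5, -⟩ := hx
  obtain ⟨w, hw⟩ : ∃ w, w = x.2.2.2 - P.ub := ⟨_, rfl⟩
  rw [← hw] at l1 l2
  obtain ⟨W, hW⟩ : ∃ W, W = 14/100*((1+P.y)*(1-3*P.y)) + 3/10000 := ⟨_, rfl⟩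
  rw [← hW] at l1 l2
  have hy3 : P.y^3 ≤ (2/10)^3 := pow_le_pow_left₀ h10.le (by linarith) 3
  have hw0 : -(1/10000000) ≤ w := by rw [hw]; linarith [hx5, H.eulo]
  have a0 := P.a_pos hx1
  have a1 := pow_le_pow_left₀ a0.le (H.a_bound hx1) 2
  obtain ⟨G, hG⟩ : ∃ G, G = (975/1000*(82/100 + 301/100*P.y))^2*(1+P.y)^2 := ⟨_, rfl⟩
  have hG0 : 6/10 ≤ G := by
    rw [hG]
    calc (6/10:ℝ) ≤ (975/1000*(82/100))^2*1^2 := by norm_num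
      _ ≤ _ := by gcongr <;> linarith
  have hG1 : G ≤ 3 := by
    rw [hG]
    calc _ ≤ (975/1000*(82/100 + 301/100*(185/1000)))^2*(1+185/1000)^2 := by gcongr
      _ ≤ (3:ℝ) := by norm_num
  have hW1 : W ≤ 2/10 := by rw [hW]; linarith [sq_nonneg P.y]
  have l3 : (P.a x.1*x.2.2.1)^2 ≤ G*(W - w) := by
    rw [mul_pow, hG, mul_assoc]; gcongr
  have l4 : G*(W - w) + w^2 ≤ G*W + 1/1000000 := by
    rcases le_total 0 w with h0 | h0
    · linarith [mul_nonneg h0 (show 0 ≤ G - w by linarith)]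
    · linarith [mul_nonneg (show 0 ≤ -w by linarith) (show 0 ≤ 3 - G by linarith),
        mul_nonneg (show 0 ≤ -w by linarith) (show 0 ≤ w + 1/10000000 by linarith)]
  have l5 : G*W + 1/100000 ≤ ((1+P.y)^2 + 4/9)/9 := by
    rw [hG, hW]
    exact energy_poly h10.le h11.le
  have l6 : (P.qH - (1+P.y))^2 ≤ 1/10000000 := by
    rw [H.eqH, show 1 + P.y - P.y^2/160000 - (1+P.y) = -(P.y^2/160000) by ring, neg_sq, div_pow, ← pow_mul]
    have := pow_le_one₀ (n := 2*2) h10.le (by linarith)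
    norm_num at this ⊢
    linarith
  simp only [wave, hx2, ← hw]
  linarith

theorem Std.closeTo : P.CloseTo (dist3 (0, 0, 2) (1+P.y, 0, P.ub)/3) := by
  obtain ⟨h1, h2, h3, h4, h5, h6, h7, h8, h9, h10, h11, h12, h13, h14⟩ := id H.hs
  have hu2 : 4/9 ≤ (2-P.ub)^2 := by nlinarith
  filter_upwards [H.lowEscapes, Ioo_mem_nhdsGT (show (0:ℝ) < 1/40000000000 by norm_num)]
    with ε hL hε φ Fl
  refine ⟨fun x hx hA => dist3_le_div ?_, fun x hx hC => H.dist_le_of_not_mem_C Fl hε.1 hε.2 hx hC⟩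
  have hu : 8/5 < x.2.2.2 := by
    by_contra hc; exact hA (hL φ Fl x hx (not_lt.mp hc))
  obtain ⟨hx1, hx2, ⟨hx3, hx4⟩, -, hx5⟩ := hx
  have a0 := P.a_pos hx1
  have l1 : P.a x.1*x.2.2.1 ≤ 2*(3*P.qL) := mul_le_mul (P.a_le hx1) hx4 hx3.le (by norm_num)
  have l2 : (P.a x.1*x.2.2.1)^2 ≤ (2*(3*P.qL))^2 := pow_le_pow_left₀ (by positivity) l1 2
  have l3 : (x.2.2.2 - 2)^2 ≤ (4/10)^2 := by nlinarith
  have e := H.eqL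
  have l4 : P.qL^2 ≤ (1/100000)^2 := pow_le_pow_left₀ P.hqL.le (by linarith) 2
  simp only [wave, hx2]
  linarith [sq_nonneg P.y]

end Par

theorem stmt19 (ζ r ubr : ℝ) (hζ : 2/5 < ζ) (hr : 2/3 < r)
    (hub : ubr ∈ Set.Ioo (6/5 : ℝ) (4/3)) (hK : Kc ubr r = 0)
    (hM : Mhat r ubr ≠ 0) (hMt : 0 < Mtf r ubr) :
    ∃ ε₀ > 0, ∀ ε ∈ Set.Ioo (0:ℝ) ε₀, ∀ k : ℕ, 1 ≤ k →
      let X1 : ℝ × ℝ × ℝ := (0, 0, 2)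
      let X2 : ℝ × ℝ × ℝ := (qbp r ubr, 0, ubr)
      let δ : ℝ := dist3 X1 X2 / 3
      -- (i) a k-front
      (∃ D : ℝ, 0 < D ∧ ∃ μ : ℝ, ∃ Q P U : ℝ → ℝ,
        IsTWSol D μ (-ζ - μ) ε r Q P U ∧
        Tendsto (fun ξ => (Q ξ, P ξ, U ξ)) atBot (nhds X1) ∧
        Tendsto (fun ξ => (Q ξ, P ξ, U ξ)) atTop (nhds X2) ∧
        (∃ zs xs : Fin k → ℝ,
          (∀ i : Fin k, zs i < xs i) ∧
          (∀ i j : Fin k, i < j → xs i < zs j) ∧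
          (∀ i : Fin k, dist3 (Q (zs i), P (zs i), U (zs i)) X2 ≤ δ) ∧
          (∀ i : Fin k, dist3 (Q (xs i), P (xs i), U (xs i)) X1 ≤ δ))) ∧
      -- (ii) a k-back
      (∃ D : ℝ, 0 < D ∧ ∃ μ : ℝ, ∃ Q P U : ℝ → ℝ,
        IsTWSol D μ (-ζ - μ) ε r Q P U ∧
        Tendsto (fun ξ => (Q ξ, P ξ, U ξ)) atBot (nhds X2) ∧
        Tendsto (fun ξ => (Q ξ, P ξ, U ξ)) atTop (nhds X1) ∧
        (∃ xs : Fin (k+1) → ℝ, ∃ zs : Fin k → ℝ,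
          (∀ i : Fin k, xs i.castSucc < zs i ∧ zs i < xs i.succ) ∧
          (∀ i : Fin (k+1), dist3 (Q (xs i), P (xs i), U (xs i)) X1 ≤ δ) ∧
          (∀ i : Fin k, dist3 (Q (zs i), P (zs i), U (zs i)) X2 ≤ δ))) := by
  obtain ⟨y, x, κ, H, hrκ, hq⟩ := stat_of hr hub hK hMt
  have hy0 := H.hy0
  have hy1 := H.hy1
  have hx0 := H.hx0
  have k1 : κ*(1-3*y) ≤ 65/100*1 :=
    mul_le_mul H.hκ'.le (by linarith) (by linarith) (by norm_num)
  have front : ∃ P : Par, P.Std ∧ P.ζ = ζ ∧ P.ub = ubr ∧ P.y = y ∧ P.x = x ∧ P.κ = κ ∧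
      (∀ θ, P.cb θ = (κ*(1-3*y) - y/1000) + 0*θ) ∧
      ∀ θ, P.c2 θ = (κ*(3*x-1) - y/1000) + y/500*θ :=
    Par.exists_std hζ H (fun θ _ => ⟨by linarith, by linarith⟩) fun θ hθ =>
      ⟨by linarith [mul_nonneg hy0.le hθ.1], by linarith [mul_le_mul_of_nonneg_left hθ.2 hy0.le]⟩
  have back : ∃ P : Par, P.Std ∧ P.ζ = ζ ∧ P.ub = ubr ∧ P.y = y ∧ P.x = x ∧ P.κ = κ ∧
      (∀ θ, P.cb θ = (κ*(1-3*y) - y/1000) + (1 - (κ*(1-3*y) - y/1000))*θ) ∧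
      ∀ θ, P.c2 θ = (κ*(3*x-1) - y/1000) + 0*θ :=
    Par.exists_std hζ H (fun θ hθ => by
      have h : 0 ≤ 1 - (κ*(1-3*y) - y/1000) := by linarith
      exact ⟨by linarith [mul_nonneg h hθ.1], by linarith [mul_le_mul_of_nonneg_left hθ.2 h]⟩)
      fun θ _ => ⟨by linarith, by linarith⟩
  obtain ⟨P, hP, eζ, eu, ey, ex, eκ, ecb, ec2⟩ := front
  obtain ⟨P', hP', eζ', eu', ey', ex', eκ', ecb', ec2'⟩ := back
  have F := P.front_wave (r := r) (by rw [eκ]; exact hrκ) hP.lowEscapes hP.closeTo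
    (hP.blueAt fun θ hθ => by rw [ec2, eκ, ex, ey, Set.mem_singleton_iff.mp hθ]; ring)
    (hP.redAt subset_rfl fun θ _ => by rw [ecb, eκ, ey]; ring)
    (hP.top_escapes (by rw [ec2, eκ, ex, ey]; ring))
  have y3 : 0 < P'.y^3 := by have := P'.hy0; positivity
  have y3' : P'.y^3 ≤ 1 := pow_le_one₀ P'.hy0.le (by linarith [P'.hy1])
  have hlo := hP'.eulo
  have B := P'.back_wave (r := r) (by rw [eκ']; exact hrκ) hP'.lowEscapes hP'.closeTo
    (hP'.blueAt fun θ _ => by rw [ec2', eκ', ex', ey']; ring)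
    (hP'.redAt (Set.singleton_subset_iff.mpr ⟨le_rfl, zero_le_one⟩) fun θ hθ => by
      rw [ecb', eκ', ey', Set.mem_singleton_iff.mp hθ]; ring)
    (by linarith [P'.hub]) (by
      rw [hP'.eqL, hP'.eqH]
      have := P'.hy0
      nlinarith [P'.hy1])
    (fun θ hθ => by
      obtain rfl : θ = 1 := hθ
      have h1 := P'.a_le (θ := 1) ⟨zero_le_one, le_rfl⟩
      have h2 := mul_le_mul_of_nonneg_right h1 y3.le
      unfold Par.c
      rw [ecb', hlo, show P'.ub - P'.y^3/320000 - P'.ub = -(P'.y^3/320000) by ring]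
      linarith)
  rw [eζ, ey, eu] at F
  rw [eζ', ey', eu'] at B
  obtain ⟨ε₀, hε₀, h⟩ := mem_nhdsGT_iff_exists_Ioo_subset.mp (F.and B)
  refine ⟨ε₀, hε₀, fun ε hε k _ => ?_⟩
  simp only [hq]
  exact ⟨(h hε).1 k, (h hε).2 k⟩
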